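/- (Exactness of the SOS relaxation under an SOS certificate at the optimum.) Let h₀, h₁, …, h_l ∈ ℝ[x₁,…,x_n] be polynomials of degree at most d, let h = (h₁,…,h_l), h̄ = (h₀, h), and let h* := inf{h₀(x) : x ∈ V(h)}, assumed > −∞ (with the convention that the infimum over the empty set is +∞). Suppose there exists q ∈ Σ²_w[x] with 2w ≥ d such that h₀ − h* − q vanishes identically on V(h) (this hypothesis is vacuous when V(h) = ∅). Set r := (1/2)·b(n, 2w, l+1) + d. Then ρ_r(h̄) = h*, i.e., sup{ξ ∈ ℝ : h₀ − ξ ∈ Σ²_r[x] + I_r(h)[x]} = h*. -/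

import Mathlib

open MvPolynomial

/-- `bit(d)`: the number of binary digits of `d`, with `bit(0) = 1`. -/
def bitNum (d : ℕ) : ℕ := if d = 0 then 1 else Nat.log2 d + 1

/-- The bound `b(n,d,s) = 2^(2^(2^(max{2,d}^(4^n)) + s^(2^n)·max{2,d}^(16^n·bit(d))))`. -/
def bFun (n d s : ℕ) : ℕ :=
  2 ^ 2 ^ (2 ^ (max 2 d) ^ 4 ^ n + s ^ 2 ^ n * (max 2 d) ^ (16 ^ n * bitNum d))

/-- `σ ∈ Σ²_w`: a finite sum of squares of polynomials of degree at most `w`. -/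
def IsSOS {σv : Type*} (w : ℕ) (p : MvPolynomial σv ℝ) : Prop :=
  ∃ (k : ℕ) (q : Fin k → MvPolynomial σv ℝ),
    (∀ i, (q i).totalDegree ≤ w) ∧ p = ∑ i, q i ^ 2

section
open MvPolynomial
open scoped Polynomial

namespace ENS

/-! ## Graded families of additive subgroups -/

structure IsGr {A : Type*} [CommRing A] (B : ℕ → AddSubgroup A) : Prop where
  mono : Monotone B
  one : (1 : A) ∈ B 0
  mul : ∀ {r s a b}, a ∈ B r → b ∈ B s → a * b ∈ B (r + s)

namespace IsGr
variable {A : Type*} [CommRing A] {B : ℕ → AddSubgroup A}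

theorem le (h : IsGr B) {r s : ℕ} {a : A} (hrs : r ≤ s) (ha : a ∈ B r) : a ∈ B s := h.mono hrs ha

theorem one' (h : IsGr B) (r : ℕ) : (1 : A) ∈ B r := h.le (Nat.zero_le _) h.one

theorem pow (h : IsGr B) {r : ℕ} {a : A} (ha : a ∈ B r) (n : ℕ) : a ^ n ∈ B (n * r) := by
  induction n with
  | zero => simpa using h.one' _
  | succ k ih => rw [pow_succ, Nat.succ_mul]; exact h.mul ih ha

theorem prod (h : IsGr B) {ι : Type*} (s : Finset ι) (f : ι → A) (e : ι → ℕ)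
    (hf : ∀ i ∈ s, f i ∈ B (e i)) : ∏ i ∈ s, f i ∈ B (∑ i ∈ s, e i) := by
  classical
  induction s using Finset.induction_on with
  | empty => simpa using h.one
  | insert a s ha ih =>
    rw [Finset.prod_insert ha, Finset.sum_insert ha]
    exact h.mul (hf _ (Finset.mem_insert_self _ _)) (ih fun i hi => hf i (Finset.mem_insert_of_mem hi))

theorem det (h : IsGr B) {n : Type*} [Fintype n] [DecidableEq n] (M : Matrix n n A) (δ : ℕ)
    (hM : ∀ i j, M i j ∈ B δ) : M.det ∈ B (Fintype.card n * δ) := by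
  rw [Matrix.det_apply]
  refine AddSubgroup.sum_mem _ fun σ _ => ?_
  have : ∏ i, M (σ i) i ∈ B (Fintype.card n * δ) := by
    have := h.prod Finset.univ (fun i => M (σ i) i) (fun _ => δ) (fun i _ => hM _ _)
    simpa using this
  rcases Int.units_eq_one_or (Equiv.Perm.sign σ) with h1 | h1 <;> rw [h1] <;> simpa using this

end IsGr

/-- the piece of weight `r - jω` -/
def Bz {A : Type*} [CommRing A] (B : ℕ → AddSubgroup A) (ω r j : ℕ) : AddSubgroup A :=
  if j * ω ≤ r then B (r - j * ω) else ⊥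

/-- weighted polynomials -/
def WP {A : Type*} [CommRing A] (B : ℕ → AddSubgroup A) (ω r : ℕ) : AddSubgroup A[X] where
  carrier := {f | ∀ j, f.coeff j ∈ Bz B ω r j}
  zero_mem' := fun j => by simp [(Bz B ω r j).zero_mem]
  add_mem' := fun {a b} ha hb j => by
    simpa using (Bz B ω r j).add_mem (ha j) (hb j)
  neg_mem' := fun {a} ha j => by simpa using ha j

section WP
variable {A : Type*} [CommRing A] {B : ℕ → AddSubgroup A} {ω : ℕ}

theorem mem_WP {r : ℕ} {f : A[X]} : f ∈ WP B ω r ↔ ∀ j, f.coeff j ∈ Bz B ω r j := Iff.rfl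

theorem Bz_of_le {r s j : ℕ} (h : IsGr B) {a : A} (hs : s + j * ω ≤ r) (ha : a ∈ B s) :
    a ∈ Bz B ω r j := by
  rw [Bz, if_pos (by omega)]; exact h.le (by omega) ha

theorem Bz_elim {r j : ℕ} {a : A} (ha : a ∈ Bz B ω r j) :
    a = 0 ∨ ∃ s, s + j * ω = r ∧ a ∈ B s := by
  rw [Bz] at ha
  split_ifs at ha with h
  · exact Or.inr ⟨_, by omega, ha⟩
  · exact Or.inl (by simpa using ha)

theorem Bz_le_B (h : IsGr B) {r j : ℕ} {a : A} (ha : a ∈ Bz B ω r j) : a ∈ B r := by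
  rcases Bz_elim ha with h0 | ⟨s, hs, h0⟩
  · rw [h0]; exact zero_mem _
  · exact h.le (by omega) h0

theorem Bz_mul (h : IsGr B) {r s i j : ℕ} {a b : A} (ha : a ∈ Bz B ω r i) (hb : b ∈ Bz B ω s j) :
    a * b ∈ Bz B ω (r + s) (i + j) := by
  rcases Bz_elim ha with h0 | ⟨r', hr, h0⟩
  · rw [h0, zero_mul]; exact zero_mem _
  rcases Bz_elim hb with h1 | ⟨s', hs, h1⟩
  · rw [h1, mul_zero]; exact zero_mem _
  refine Bz_of_le h (s := r' + s') ?_ (h.mul h0 h1)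
  rw [← hr, ← hs]; apply le_of_eq; ring

theorem Bz_mono (h : IsGr B) {r s j : ℕ} (hrs : r ≤ s) {a : A} (ha : a ∈ Bz B ω r j) :
    a ∈ Bz B ω s j := by
  rcases Bz_elim ha with h0 | ⟨r', hr, h0⟩
  · rw [h0]; exact zero_mem _
  · exact Bz_of_le h (by omega) h0

theorem WP_gr (h : IsGr B) : IsGr (WP B ω) where
  mono := fun r s hrs f hf j => Bz_mono h hrs (hf j)
  one := fun j => by
    rw [Polynomial.coeff_one]
    split_ifs with hj
    · exact Bz_of_le h (s := 0) (by simp [hj]) h.one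
    · exact zero_mem _
  mul := fun {r s a b} ha hb j => by
    rw [Polynomial.coeff_mul]
    refine AddSubgroup.sum_mem _ fun p hp => ?_
    have := Bz_mul h (ha p.1) (hb p.2)
    rwa [Finset.HasAntidiagonal.mem_antidiagonal.1 hp] at this

theorem WP_monomial (h : IsGr B) {r s j : ℕ} {a : A} (hs : s + j * ω ≤ r) (ha : a ∈ B s) :
    Polynomial.monomial j a ∈ WP B ω r := fun i => by
  rw [Polynomial.coeff_monomial]
  split_ifs with hj
  · subst hj; exact Bz_of_le h hs ha
  · exact zero_mem _

theorem WP_C (h : IsGr B) {r : ℕ} {a : A} (ha : a ∈ B r) : Polynomial.C a ∈ WP B ω r := by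
  rw [← Polynomial.monomial_zero_left]; exact WP_monomial h (by simp) ha

theorem WP_X (h : IsGr B) : (Polynomial.X : A[X]) ∈ WP B ω ω :=
  WP_monomial h (s := 0) (by simp) h.one

/-- weights of coefficients of the characteristic polynomial -/
theorem charpoly_gr (h : IsGr B) {n : Type*} [Fintype n] [DecidableEq n] (M : Matrix n n A) (δ : ℕ)
    (hM : ∀ i j, M i j ∈ B δ) (j : ℕ) : M.charpoly.coeff j ∈ Bz B δ (Fintype.card n * δ) j := by
  have : M.charpoly ∈ WP B δ (Fintype.card n * δ) := by
    rw [Matrix.charpoly]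
    refine (WP_gr h).det _ δ fun i j => ?_
    rw [Matrix.charmatrix_apply]
    refine sub_mem ?_ (WP_C h (hM i j))
    rw [Matrix.diagonal_apply]
    split_ifs
    · exact WP_X h
    · exact zero_mem _
  exact this j

theorem WP_natDegree {r : ℕ} (_ : 1 ≤ ω) {f : A[X]} (hf : f ∈ WP B ω r) : f.natDegree * ω ≤ r := by
  by_cases h0 : f = 0
  · simp [h0]
  rcases Bz_elim (hf f.natDegree) with h1 | ⟨s, hs, -⟩
  · exact absurd (Polynomial.leadingCoeff_eq_zero.1 h1) h0
  · omega

theorem WP_eval₂ {A' : Type*} [CommRing A'] {B' : ℕ → AddSubgroup A'} (h' : IsGr B')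
    (φ : A →+* A') (hφ : ∀ r a, a ∈ B r → φ a ∈ B' r) {z : A'} (hz : z ∈ B' ω) {r : ℕ} {f : A[X]}
    (hf : f ∈ WP B ω r) : f.eval₂ φ z ∈ B' r := by
  rw [Polynomial.eval₂_eq_sum_range]
  refine AddSubgroup.sum_mem _ fun j _ => ?_
  rcases Bz_elim (hf j) with h1 | ⟨s, hs, h1⟩
  · rw [h1]; simp [zero_mem]
  · rw [← hs]; exact h'.mul (hφ _ _ h1) (h'.pow hz j)

theorem WP_eval (h : IsGr B) {z : A} (hz : z ∈ B ω) {r : ℕ} {f : A[X]}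
    (hf : f ∈ WP B ω r) : f.eval z ∈ B r :=
  WP_eval₂ h (RingHom.id A) (fun _ _ h => h) hz hf

theorem WP_map {A' : Type*} [CommRing A'] {B' : ℕ → AddSubgroup A'} (h' : IsGr B')
    (φ : A →+* A') (hφ : ∀ r a, a ∈ B r → φ a ∈ B' r) {r : ℕ} {f : A[X]}
    (hf : f ∈ WP B ω r) : f.map φ ∈ WP B' ω r := fun j => by
  rw [Polynomial.coeff_map]
  rcases Bz_elim (hf j) with h1 | ⟨s, hs, h1⟩
  · rw [h1]; simp [zero_mem]
  · exact Bz_of_le h' hs.le (hφ _ _ h1)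

theorem WP_quot_mul (h : IsGr B) {q Q : A[X]} {k r : ℕ} (hq : q ∈ WP B ω (k * ω)) (hk : q.natDegree ≤ k)
    (hQ : Q * Polynomial.X ^ k ∈ WP B ω r) : q * Q ∈ WP B ω r := fun j => by
  rw [Polynomial.coeff_mul]
  refine AddSubgroup.sum_mem _ fun p hp => ?_
  have hp := Finset.HasAntidiagonal.mem_antidiagonal.1 hp
  have h1 := hQ (p.2 + k)
  rw [Polynomial.coeff_mul_X_pow] at h1
  by_cases hpk : k < p.1
  · rw [Polynomial.coeff_eq_zero_of_natDegree_lt (by omega), zero_mul]; exact zero_mem _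
  rcases Bz_elim (hq p.1) with h2 | ⟨s, hs, h2⟩
  · rw [h2, zero_mul]; exact zero_mem _
  rcases Bz_elim h1 with h3 | ⟨t, ht, h3⟩
  · rw [h3, mul_zero]; exact zero_mem _
  refine Bz_of_le h (s := s + t) ?_ (h.mul h2 h3)
  have e1 : (p.2 + k) * ω = p.2 * ω + k * ω := by ring
  have e2 : j * ω = p.1 * ω + p.2 * ω := by rw [← hp]; ring
  omega

theorem WP_divMod (h : IsGr B) {q : A[X]} (hm : q.Monic)
    (hq : q ∈ WP B ω (q.natDegree * ω)) (r : ℕ) (f : A[X]) (hf : f ∈ WP B ω r) :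
    f %ₘ q ∈ WP B ω r ∧ (f /ₘ q) * Polynomial.X ^ q.natDegree ∈ WP B ω r := by
  nontriviality A
  have key : ∀ n : ℕ, ∀ f : A[X], f.natDegree < n → f ∈ WP B ω r →
      ∃ Q S, f = q * Q + S ∧ S.degree < q.degree ∧ S ∈ WP B ω r ∧
        Q * Polynomial.X ^ q.natDegree ∈ WP B ω r := by
    intro n
    induction n with
    | zero => intro f hf; omega
    | succ n ih =>
      intro f hfn hf
      by_cases hd : f.degree < q.degree
      · exact ⟨0, f, by simp, hd, hf, by simp [zero_mem]⟩
      have hd' : q.degree ≤ f.degree := not_lt.1 hd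
      have hnd : q.natDegree ≤ f.natDegree := Polynomial.natDegree_le_natDegree hd'
      have hf0 : f ≠ 0 := by
        rintro rfl
        simp at hd'
        exact hm.ne_zero hd'
      set T : A[X] := Polynomial.C f.leadingCoeff * Polynomial.X ^ (f.natDegree - q.natDegree) with hT
      have hTX : T * Polynomial.X ^ q.natDegree ∈ WP B ω r := by
        rw [hT, mul_assoc, ← pow_add, Nat.sub_add_cancel hnd, Polynomial.C_mul_X_pow_eq_monomial]
        rcases Bz_elim (hf f.natDegree) with h1 | ⟨s, hs, h1⟩
        · exact absurd (Polynomial.leadingCoeff_eq_zero.1 h1) hf0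
        · exact WP_monomial h hs.le h1
      have hqT := WP_quot_mul h hq le_rfl hTX
      by_cases hq0 : q.natDegree = 0
      · have : q = 1 := (Polynomial.Monic.natDegree_eq_zero hm).1 hq0
        subst this
        exact ⟨f, 0, by simp, by simp, zero_mem _, by simpa using hf⟩
      have hlt : (f - q * T).natDegree < n ∨ f - q * T = 0 := by
        by_cases hz : f - q * T = 0
        · exact Or.inr hz
        left
        have := Polynomial.div_wf_lemma ⟨hd', hf0⟩ hm
        have h2 := Polynomial.natDegree_lt_natDegree hz this
        omega
      rcases hlt with hlt | hz
      · obtain ⟨Q, S, h1, h2, h3, h4⟩ := ih _ hlt (sub_mem hf hqT)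
        refine ⟨Q + T, S, ?_, h2, h3, ?_⟩
        · rw [mul_add]; linear_combination h1
        · rw [add_mul]; exact add_mem h4 hTX
      · refine ⟨T, 0, by linear_combination hz, ?_, zero_mem _, hTX⟩
        rw [Polynomial.degree_zero]; exact bot_lt_iff_ne_bot.2 (by simpa using hm.ne_zero)
  obtain ⟨Q, S, h1, h2, h3, h4⟩ := key _ f (Nat.lt_succ_self _) hf
  have := Polynomial.div_modByMonic_unique (f := f) Q S hm ⟨by rw [h1]; ring, h2⟩
  rw [this.1, this.2]; exact ⟨h3, h4⟩

end WP

/-! ## Filtered cones -/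

structure Filt (K : Type*) [CommRing K] where
  B : ℕ → AddSubgroup K
  C : ℕ → AddSubmonoid K
  gr : IsGr B
  C_mono : Monotone C
  mul_C : ∀ {r s a b}, a ∈ C r → b ∈ C s → a * b ∈ C (r + s)
  C_le : ∀ {r a}, a ∈ C r → a ∈ B r
  sq_C : ∀ {r a}, a ∈ B r → a ^ 2 ∈ C (2 * r)

namespace Filt
variable {K : Type*} [CommRing K] (F : Filt K)

def Cons (R : ℕ) : Prop := ∀ b ∈ F.B R, -(b ^ 2) ∈ F.C (2 * R) → b = 0

theorem C_of_le {r s : ℕ} {a : K} (hrs : r ≤ s) (ha : a ∈ F.C r) : a ∈ F.C s := F.C_mono hrs ha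
theorem B_of_le {r s : ℕ} {a : K} (hrs : r ≤ s) (ha : a ∈ F.B r) : a ∈ F.B s := F.gr.le hrs ha

theorem one_C (r : ℕ) : (1 : K) ∈ F.C r := by
  have := F.sq_C F.gr.one
  exact F.C_of_le (Nat.zero_le _) (by simpa using this)

variable {F}

theorem Cons.mono {R S : ℕ} (h : F.Cons S) (hRS : R ≤ S) : F.Cons R := fun b hb hc =>
  h b (F.B_of_le hRS hb) (F.C_of_le (by omega) hc)

theorem Cons.zero {R : ℕ} (h : F.Cons R) {x : K} {r s : ℕ} (hx : x ∈ F.C r) (hx' : -x ∈ F.C s)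
    (hr : r ≤ R) (hs : s ≤ R) : x = 0 := by
  refine h x (F.B_of_le hr (F.C_le hx)) ?_
  have := F.mul_C hx hx'
  rw [show x * -x = -(x^2) by ring] at this
  exact F.C_of_le (by omega) this

theorem Cons.add_zero {R : ℕ} (h : F.Cons R) {x y : K} {r s : ℕ} (hx : x ∈ F.C r) (hy : y ∈ F.C s)
    (hr : r ≤ R) (hs : s ≤ R) (hxy : x + y = 0) : x = 0 :=
  h.zero hx (by rw [show -x = y by linear_combination -hxy]; exact hy) hr hs

/-- filtered homomorphisms -/
structure Le {K' : Type*} [CommRing K'] (F : Filt K) (F' : Filt K') (φ : K →+* K') : Prop where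
  B : ∀ {r a}, a ∈ F.B r → φ a ∈ F'.B r
  C : ∀ {r a}, a ∈ F.C r → φ a ∈ F'.C r

theorem Le.refl (F : Filt K) : Le F F (RingHom.id K) := ⟨fun h => h, fun h => h⟩

theorem Le.trans {K' K'' : Type*} [CommRing K'] [CommRing K''] {F : Filt K} {F' : Filt K'}
    {F'' : Filt K''} {φ : K →+* K'} {ψ : K' →+* K''} (h : Le F F' φ) (h' : Le F' F'' ψ) :
    Le F F'' (ψ.comp φ) := ⟨fun ha => h'.B (h.B ha), fun ha => h'.C (h.C ha)⟩

theorem Cons.of_le {K' : Type*} [CommRing K'] {F' : Filt K'} {φ : K →+* K'} (h : Le F F' φ)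
    (hφ : Function.Injective φ) {R : ℕ} (h' : F'.Cons R) : F.Cons R := fun b hb hc => by
  apply hφ
  rw [map_zero]
  exact h' _ (h.B hb) (by simpa using h.C hc)

/-- image filtration -/
def map {K' : Type*} [CommRing K'] (F : Filt K) (φ : K →+* K') : Filt K' where
  B := fun r => (F.B r).map φ.toAddMonoidHom
  C := fun r => (F.C r).map φ.toAddMonoidHom
  gr := 
    { mono := fun r s h => AddSubgroup.map_mono (F.gr.mono h)
      one := ⟨1, F.gr.one, by simp⟩
      mul := by
        rintro r s _ _ ⟨a, ha, rfl⟩ ⟨b, hb, rfl⟩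
        exact ⟨a * b, F.gr.mul ha hb, by simp⟩ }
  C_mono := by
    rintro r s h _ ⟨a, ha, rfl⟩
    exact ⟨a, F.C_mono h ha, rfl⟩
  mul_C := by
    rintro r s _ _ ⟨a, ha, rfl⟩ ⟨b, hb, rfl⟩
    exact ⟨a * b, F.mul_C ha hb, by simp⟩
  C_le := by
    rintro r _ ⟨a, ha, rfl⟩
    exact ⟨a, F.C_le ha, rfl⟩
  sq_C := by
    rintro r _ ⟨a, ha, rfl⟩
    exact ⟨a ^ 2, F.sq_C ha, by simp⟩

theorem le_map {K' : Type*} [CommRing K'] (F : Filt K) (φ : K →+* K') : Le F (F.map φ) φ :=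
  ⟨fun h => ⟨_, h, rfl⟩, fun h => ⟨_, h, rfl⟩⟩

theorem Cons.map {K' : Type*} [CommRing K'] {φ : K →+* K'} (hφ : Function.Injective φ) {R : ℕ}
    (h : F.Cons R) : (F.map φ).Cons R := by
  rintro _ ⟨b, hb, rfl⟩ ⟨c, hc, hcb⟩
  have : c = -(b ^ 2) := hφ (by simpa using hcb)
  subst this
  simp [h b hb hc]

/-! ### Sign decisions -/

/-- adjoin the sign condition `u ≥ 0` with weight `δ` -/
def adjSign (F : Filt K) (u : K) (δ : ℕ) (hu : u ∈ F.B δ) : Filt K where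
  B := F.B
  C := fun r =>
    { carrier := {x | ∃ α ∈ F.C r, ∃ β, (β = 0 ∨ ∃ s, s + δ ≤ r ∧ β ∈ F.C s) ∧ x = α + u * β}
      zero_mem' := ⟨0, zero_mem _, 0, Or.inl rfl, by simp⟩
      add_mem' := by
        rintro _ _ ⟨α, hα, β, hβ, rfl⟩ ⟨α', hα', β', hβ', rfl⟩
        refine ⟨α + α', add_mem hα hα', β + β', ?_, by ring⟩
        rcases hβ with rfl | ⟨s, hs, hβ⟩
        · simpa using hβ'
        rcases hβ' with rfl | ⟨s', hs', hβ'⟩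
        · exact Or.inr ⟨s, hs, by simpa using hβ⟩
        · exact Or.inr ⟨max s s', by omega, add_mem (F.C_of_le (le_max_left _ _) hβ)
            (F.C_of_le (le_max_right _ _) hβ')⟩ }
  gr := F.gr
  C_mono := by
    rintro r s h _ ⟨α, hα, β, hβ, rfl⟩
    refine ⟨α, F.C_of_le h hα, β, ?_, rfl⟩
    rcases hβ with rfl | ⟨s, hs, hβ⟩
    · exact Or.inl rfl
    · exact Or.inr ⟨s, by omega, hβ⟩
  mul_C := by
    rintro r s _ _ ⟨α, hα, β, hβ, rfl⟩ ⟨α', hα', β', hβ', rfl⟩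
    refine ⟨α * α' + u ^ 2 * (β * β'), ?_, α * β' + α' * β, ?_, by ring⟩
    · refine add_mem (F.mul_C hα hα') ?_
      rcases hβ with rfl | ⟨t, ht, hβ⟩
      · simp [zero_mem]
      rcases hβ' with rfl | ⟨t', ht', hβ'⟩
      · simp [zero_mem]
      exact F.C_of_le (by omega) (F.mul_C (F.sq_C hu) (F.mul_C hβ hβ'))
    · rcases hβ with rfl | ⟨t, ht, hβ⟩
      · rcases hβ' with rfl | ⟨t', ht', hβ'⟩
        · left; ring
        · exact Or.inr ⟨r + t', by omega, by simpa using F.mul_C hα hβ'⟩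
      rcases hβ' with rfl | ⟨t', ht', hβ'⟩
      · exact Or.inr ⟨s + t, by omega, by simpa using F.mul_C hα' hβ⟩
      · refine Or.inr ⟨r + s - δ, by omega, add_mem ?_ ?_⟩
        · exact F.C_of_le (by omega) (F.mul_C hα hβ')
        · exact F.C_of_le (by omega) (F.mul_C hα' hβ)
  C_le := by
    rintro r _ ⟨α, hα, β, hβ, rfl⟩
    refine add_mem (F.C_le hα) ?_
    rcases hβ with rfl | ⟨t, ht, hβ⟩
    · simp [zero_mem]
    · exact F.B_of_le (by omega) (F.gr.mul hu (F.C_le hβ))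
  sq_C := fun {r a} ha => ⟨a ^ 2, F.sq_C ha, 0, Or.inl rfl, by simp⟩

theorem le_adjSign (F : Filt K) (u : K) (δ : ℕ) (hu : u ∈ F.B δ) :
    Le F (F.adjSign u δ hu) (RingHom.id K) :=
  ⟨fun h => h, fun {r a} h => ⟨a, h, 0, Or.inl rfl, by simp⟩⟩

theorem mem_adjSign (F : Filt K) (u : K) (δ : ℕ) (hu : u ∈ F.B δ) : u ∈ (F.adjSign u δ hu).C δ :=
  ⟨0, zero_mem _, 1, Or.inr ⟨0, by simp, F.one_C 0⟩, by simp⟩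

theorem adjSign_cons [IsDomain K] {R : ℕ} (h : F.Cons (2 * R)) (u : K) (δ : ℕ) (hu : u ∈ F.B δ) :
    (F.adjSign u δ hu).Cons R ∨ (F.adjSign (-u) δ (neg_mem hu)).Cons R := by
  by_contra hcon
  simp only [Cons, not_or, not_forall] at hcon
  obtain ⟨⟨b, hb, ⟨α, hα, β, hβ, e⟩, hb0⟩, ⟨b', hb', ⟨α', hα', β', hβ', e'⟩, hb0'⟩⟩ := hcon
  change b ∈ F.B R at hb
  change b' ∈ F.B R at hb'
  have : b * b' = 0 := by
    apply h
    · exact F.B_of_le (by omega) (F.gr.mul hb hb')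
    · have : -((b * b') ^ 2) = b ^ 2 * α' + α * b' ^ 2 + α * α' + u ^ 2 * (β * β') := by
        linear_combination (α' + b' ^ 2) * e + (-u * β) * e'
      rw [this]
      refine add_mem (add_mem (add_mem ?_ ?_) ?_) ?_
      · exact F.C_of_le (by omega) (F.mul_C (F.sq_C hb) hα')
      · exact F.C_of_le (by omega) (F.mul_C hα (F.sq_C hb'))
      · exact F.C_of_le (by omega) (F.mul_C hα hα')
      · rcases hβ with rfl | ⟨t, ht, hβ⟩
        · simp [zero_mem]
        rcases hβ' with rfl | ⟨t', ht', hβ'⟩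
        · simp [zero_mem]
        exact F.C_of_le (by omega) (F.mul_C (F.sq_C hu) (F.mul_C hβ hβ'))
  rcases mul_eq_zero.1 this with h | h
  · exact hb0 h
  · exact hb0' h

/-- decided elements -/
def Dec (F : Filt K) (δ : ℕ) (x : K) : Prop := x ∈ F.C δ ∨ -x ∈ F.C δ

theorem Dec.le {K' : Type*} [CommRing K'] {F' : Filt K'} {φ : K →+* K'} (h : Le F F' φ) {δ : ℕ} {x : K}
    (hx : F.Dec δ x) : F'.Dec δ (φ x) := by
  rcases hx with hx | hx
  · exact Or.inl (h.C hx)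
  · exact Or.inr (by simpa using h.C hx)

theorem Dec.mono {δ δ' : ℕ} (hd : δ ≤ δ') {x : K} (hx : F.Dec δ x) : F.Dec δ' x :=
  hx.imp (F.C_of_le hd) (F.C_of_le hd)

theorem exists_dec [IsDomain K] {F : Filt K} (E : Finset K) {δ R : ℕ} (hE : ∀ x ∈ E, x ∈ F.B δ)
    (h : F.Cons (2 ^ E.card * R)) :
    ∃ F' : Filt K, Le F F' (RingHom.id K) ∧ F'.Cons R ∧ ∀ x ∈ E, F'.Dec δ x := by
  classical
  induction E using Finset.induction_on generalizing F with
  | empty => exact ⟨F, Le.refl F, by simpa using h, by simp⟩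
  | insert u E hu ih =>
    have hu' : u ∈ F.B δ := hE u (Finset.mem_insert_self _ _)
    rw [Finset.card_insert_of_notMem hu, pow_succ, mul_comm (2 ^ _) 2, mul_assoc] at h
    rcases adjSign_cons h u δ hu' with h1 | h1
    · obtain ⟨F', hle, hc, hd⟩ := ih (F := F.adjSign u δ hu')
        (fun x hx => hE x (Finset.mem_insert_of_mem hx)) h1
      refine ⟨F', (le_adjSign F u δ hu').trans hle, hc, ?_⟩
      intro x hx
      rcases Finset.mem_insert.1 hx with rfl | hx
      · exact Or.inl (hle.C (mem_adjSign F x δ hu'))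
      · exact hd x hx
    · obtain ⟨F', hle, hc, hd⟩ := ih (F := F.adjSign (-u) δ (neg_mem hu'))
        (fun x hx => hE x (Finset.mem_insert_of_mem hx)) h1
      refine ⟨F', (le_adjSign F (-u) δ _).trans hle, hc, ?_⟩
      intro x hx
      rcases Finset.mem_insert.1 hx with rfl | hx
      · exact Or.inr (hle.C (mem_adjSign F (-x) δ (neg_mem hu')))
      · exact hd x hx

/-! ### Adjoining an element -/

/-- weighted cone in the polynomial ring -/
noncomputable def CP (F : Filt K) (ω r : ℕ) : AddSubmonoid K[X] :=
  AddSubmonoid.closure {f | ∃ a b c s, c ∈ F.C a ∧ s ∈ WP F.B ω b ∧ a + 2 * b ≤ r ∧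
    f = Polynomial.C c * s ^ 2}

theorem CP_gen {ω r a b : ℕ} {c : K} {s : K[X]} (hc : c ∈ F.C a) (hs : s ∈ WP F.B ω b)
    (h : a + 2 * b ≤ r) : Polynomial.C c * s ^ 2 ∈ F.CP ω r :=
  AddSubmonoid.subset_closure ⟨a, b, c, s, hc, hs, h, rfl⟩

theorem CP_mono {ω r s : ℕ} (h : r ≤ s) : F.CP ω r ≤ F.CP ω s := by
  apply AddSubmonoid.closure_mono
  rintro f ⟨a, b, c, s, hc, hs, hab, rfl⟩
  exact ⟨a, b, c, s, hc, hs, by omega, rfl⟩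

theorem CP_mul {ω r s : ℕ} {f g : K[X]} (hf : f ∈ F.CP ω r) (hg : g ∈ F.CP ω s) :
    f * g ∈ F.CP ω (r + s) := by
  induction hf using AddSubmonoid.closure_induction with
  | zero => simp [zero_mem]
  | add x y _ _ hx hy => rw [add_mul]; exact add_mem hx hy
  | mem x hx =>
    obtain ⟨a, b, c, t, hc, ht, hab, rfl⟩ := hx
    induction hg using AddSubmonoid.closure_induction with
    | zero => simp [zero_mem]
    | add x y _ _ hx hy => rw [mul_add]; exact add_mem hx hy
    | mem x hx =>
      obtain ⟨a', b', c', t', hc', ht', hab', rfl⟩ := hx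
      have := CP_gen (F := F) (ω := ω) (r := r + s) (F.mul_C hc hc') ((WP_gr F.gr).mul ht ht')
        (by omega)
      convert this using 1
      rw [Polynomial.C_mul]; ring

theorem CP_le {ω r : ℕ} {f : K[X]} (hf : f ∈ F.CP ω r) : f ∈ WP F.B ω r := by
  induction hf using AddSubmonoid.closure_induction with
  | zero => simp [zero_mem]
  | add x y _ _ hx hy => exact add_mem hx hy
  | mem x hx =>
    obtain ⟨a, b, c, t, hc, ht, hab, rfl⟩ := hx
    have := (WP_gr F.gr).mul (WP_C (ω := ω) F.gr (F.C_le hc)) ((WP_gr F.gr).pow ht 2)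
    exact (WP_gr F.gr).le hab this

theorem CP_C {ω r : ℕ} {c : K} (hc : c ∈ F.C r) : Polynomial.C c ∈ F.CP ω r := by
  have := CP_gen (F := F) (ω := ω) (r := r) hc ((WP_gr F.gr).one' 0) (by omega)
  simpa using this

theorem CP_sq {ω r : ℕ} {s : K[X]} (hs : s ∈ WP F.B ω r) : s ^ 2 ∈ F.CP ω (2 * r) := by
  have := CP_gen (F := F) (ω := ω) (r := 2 * r) (F.one_C 0) hs (by omega)
  simpa using this

theorem CP_eval₂ {K' : Type*} [CommRing K'] {F' : Filt K'} {φ : K →+* K'} (h : Le F F' φ) {ω r : ℕ}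
    {z : K'} (hz : z ∈ F'.B ω) {f : K[X]} (hf : f ∈ F.CP ω r) : f.eval₂ φ z ∈ F'.C r := by
  induction hf using AddSubmonoid.closure_induction with
  | zero => simp [zero_mem]
  | add x y _ _ hx hy => rw [Polynomial.eval₂_add]; exact add_mem hx hy
  | mem x hx =>
    obtain ⟨a, b, c, t, hc, ht, hab, rfl⟩ := hx
    rw [Polynomial.eval₂_mul, Polynomial.eval₂_pow, Polynomial.eval₂_C]
    exact F'.C_of_le hab (F'.mul_C (h.C hc) (F'.sq_C (WP_eval₂ F'.gr φ (fun _ _ => h.B) hz ht)))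

/-- adjoin `z` with weight `ω` -/
noncomputable def adj {K' : Type*} [CommRing K'] (F : Filt K) (φ : K →+* K') (z : K') (ω : ℕ) : Filt K' where
  B := fun r => (WP F.B ω r).map (Polynomial.eval₂RingHom φ z).toAddMonoidHom
  C := fun r => (F.CP ω r).map (Polynomial.eval₂RingHom φ z).toAddMonoidHom
  gr :=
    { mono := fun r s h => AddSubgroup.map_mono ((WP_gr F.gr).mono h)
      one := ⟨1, (WP_gr F.gr).one, by simp⟩
      mul := by
        rintro r s _ _ ⟨a, ha, rfl⟩ ⟨b, hb, rfl⟩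
        exact ⟨a * b, (WP_gr F.gr).mul ha hb, by simp [Polynomial.eval₂_mul]⟩ }
  C_mono := by
    rintro r s h _ ⟨a, ha, rfl⟩
    exact ⟨a, CP_mono h ha, rfl⟩
  mul_C := by
    rintro r s _ _ ⟨a, ha, rfl⟩ ⟨b, hb, rfl⟩
    exact ⟨a * b, CP_mul ha hb, by simp [Polynomial.eval₂_mul]⟩
  C_le := by
    rintro r _ ⟨a, ha, rfl⟩
    exact ⟨a, CP_le ha, rfl⟩
  sq_C := by
    rintro r _ ⟨a, ha, rfl⟩
    exact ⟨a ^ 2, CP_sq ha, by simp [Polynomial.eval₂_pow]⟩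

theorem le_adj {K' : Type*} [CommRing K'] (F : Filt K) (φ : K →+* K') (z : K') (ω : ℕ) :
    Le F (F.adj φ z ω) φ :=
  ⟨fun {r a} h => ⟨Polynomial.C a, WP_C F.gr h, by simp⟩,
   fun {r a} h => ⟨Polynomial.C a, CP_C h, by simp⟩⟩

theorem mem_adj {K' : Type*} [CommRing K'] (F : Filt K) (φ : K →+* K') (z : K') (ω : ℕ) :
    z ∈ (F.adj φ z ω).B ω := ⟨Polynomial.X, WP_X F.gr, by simp⟩

end Filt

theorem pow_mul_eval_inv {K : Type*} [Field K] {B : ℕ → AddSubgroup K} (hB : IsGr B) {a : K} (ha0 : a ≠ 0)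
    {δ : ℕ} (_ : 1 ≤ δ) (ha : a ∈ B δ) {b N : ℕ} {f : K[X]} (hf : f ∈ WP B δ b) (hN : f.natDegree ≤ N) :
    a ^ N * f.eval a⁻¹ ∈ B (b + N * δ) := by
  rw [Polynomial.eval_eq_sum_range, Finset.mul_sum]
  refine AddSubgroup.sum_mem _ fun j hj => ?_
  have hj' : j ≤ N := by have := Finset.mem_range.1 hj; omega
  have e : a ^ N * (f.coeff j * a⁻¹ ^ j) = f.coeff j * a ^ (N - j) := by
    have : a ^ N = a ^ (N - j) * a ^ j := by rw [← pow_add, Nat.sub_add_cancel hj']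
    rw [this, inv_pow]; field_simp
  rw [e]
  refine hB.le ?_ (hB.mul (Bz_le_B hB (hf j)) (hB.pow ha _))
  have := Nat.mul_le_mul_right δ (Nat.sub_le N j)
  omega

namespace Filt

theorem inv_cons {K : Type*} [Field K] {F : Filt K} {R : ℕ} (h : F.Cons (2 * R)) {a : K} (ha0 : a ≠ 0)
    {δ : ℕ} (hδ : 1 ≤ δ) (ha : a ∈ F.B δ) : (F.adj (RingHom.id K) a⁻¹ δ).Cons R := by
  rintro _ ⟨f, hf, rfl⟩ ⟨κ, hκ, hfκ⟩
  replace hfκ : κ.eval a⁻¹ = -((f.eval a⁻¹) ^ 2) := hfκ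
  change f.eval a⁻¹ = 0
  set N := R / δ with hN
  have hNR : N * δ ≤ R := Nat.div_mul_le_self _ _
  have hdeg : ∀ {b : ℕ} {g : K[X]}, g ∈ WP F.B δ b → b ≤ R → g.natDegree ≤ N := by
    intro b g hg hb
    rw [hN, Nat.le_div_iff_mul_le (by omega)]
    exact (WP_natDegree hδ hg).trans hb
  have h1 : a ^ N * f.eval a⁻¹ = 0 := by
    apply h
    · exact F.B_of_le (by omega) (pow_mul_eval_inv F.gr ha0 hδ ha hf (hdeg hf le_rfl))
    · have e : -((a ^ N * f.eval a⁻¹) ^ 2) = (a ^ N) ^ 2 * κ.eval a⁻¹ := by rw [hfκ]; ring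
      rw [e]
      clear hfκ e
      induction hκ using AddSubmonoid.closure_induction with
      | zero => simp [zero_mem]
      | add x y _ _ hx hy => rw [Polynomial.eval_add, mul_add]; exact add_mem hx hy
      | mem x hx =>
        obtain ⟨a', b, c, s, hc, hs, hab, rfl⟩ := hx
        have e : (a ^ N) ^ 2 * Polynomial.eval a⁻¹ (Polynomial.C c * s ^ 2) =
            c * (a ^ N * s.eval a⁻¹) ^ 2 := by simp; ring
        rw [e]
        refine F.C_of_le ?_ (F.mul_C hc (F.sq_C
          (pow_mul_eval_inv F.gr ha0 hδ ha hs (hdeg hs (by omega)))))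
        omega
  exact (mul_eq_zero.1 h1).resolve_left (pow_ne_zero _ ha0)

end Filt
end ENS
end

section
open MvPolynomial
open scoped Polynomial

namespace ENS

theorem WP_comp {A : Type*} [CommRing A] {B : ℕ → AddSubgroup A} (h : IsGr B) {ω R ρ : ℕ} {k f : A[X]}
    (hk : k ∈ WP B R ρ) (hf : f ∈ WP B ω R) : k.comp f ∈ WP B ω ρ :=
  WP_eval₂ (WP_gr h) Polynomial.C (fun _ _ ha => WP_C h ha) hf hk

theorem exists_annihilator {A : Type*} [CommRing A] {B : ℕ → AddSubgroup A} (h : IsGr B) {ω R : ℕ}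
    {G f : A[X]} (hm : G.Monic) (hG : G ∈ WP B ω (G.natDegree * ω)) (hf : f ∈ WP B ω R) :
    ∃ χ : A[X], χ.Monic ∧ χ ∈ WP B (R + G.natDegree * ω) (G.natDegree * (R + G.natDegree * ω)) ∧
      G ∣ χ.comp f := by
  classical
  set pb := AdjoinRoot.powerBasis' hm
  have hdim : pb.dim = G.natDegree := rfl
  set M := Algebra.leftMulMatrix pb.basis (AdjoinRoot.mk G f) with hM
  refine ⟨M.charpoly, Matrix.charpoly_monic _, ?_, ?_⟩
  · have := charpoly_gr h M (R + G.natDegree * ω) ?_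
    · intro j; simpa [hdim] using this j
    · intro i j
      rw [hM, Algebra.leftMulMatrix_eq_repr_mul]
      have e : pb.basis j = AdjoinRoot.mk G (Polynomial.X ^ (j : ℕ)) := by
        rw [pb.basis_eq_pow]; simp [pb]
      rw [e, ← map_mul]
      change (AdjoinRoot.modByMonicHom hm (AdjoinRoot.mk G _)).coeff (i : ℕ) ∈ _
      rw [AdjoinRoot.modByMonicHom_mk]
      have h1 := (WP_gr h).mul hf ((WP_gr h).pow (WP_X (B := B) (ω := ω) h) (j : ℕ))
      have h2 := (WP_divMod h hm hG _ _ h1).1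
      refine h.le ?_ (Bz_le_B h (h2 i))
      have : (j : ℕ) ≤ G.natDegree := j.2.le
      gcongr
  · rw [← AdjoinRoot.mk_eq_zero]
    have h1 : Polynomial.aeval (AdjoinRoot.mk G f) M.charpoly = 0 := by
      apply Algebra.leftMulMatrix_injective pb.basis
      rw [map_zero, ← Polynomial.aeval_algHom_apply]
      exact Matrix.aeval_self_charpoly M
    rw [← h1, Polynomial.comp, Polynomial.hom_eval₂]
    rfl

namespace Filt
variable {K : Type*} [Field K] {F : Filt K}

/-- consistency of adjoining a root of `G`, tested on constants only -/
def PC (F : Filt K) (G : K[X]) (ω R : ℕ) : Prop :=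
  ∀ b ∈ F.B R, ∀ κ ∈ F.CP ω (2 * R), G ∣ Polynomial.C (b ^ 2) + κ → b = 0

theorem factor_aux {ω R : ℕ} {G G1 f κ : K[X]} (hm : G.Monic) (hg : 1 ≤ G.natDegree)
    (hG : G ∈ WP F.B ω (G.natDegree * ω)) (hp : Prime G1) (hd : G1 ∣ G)
    (hf : f ∈ WP F.B ω R) (hκ : κ ∈ F.CP ω (2 * R)) (hfG : ¬ G1 ∣ f) (hfκ : G1 ∣ f ^ 2 + κ) :
    ∃ b, b ≠ 0 ∧ b ∈ F.B (G.natDegree * (R + G.natDegree * ω)) ∧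
      ∃ κ' ∈ F.CP ω (2 * (G.natDegree * (R + G.natDegree * ω))), G1 ∣ Polynomial.C (b ^ 2) + κ' := by
  obtain ⟨χ, hχm, hχ, hχd⟩ := exists_annihilator F.gr hm hG hf
  set g := G.natDegree
  set R1 := R + g * ω with hR1
  obtain ⟨χ', e, hχ'⟩ := Polynomial.exists_eq_pow_rootMultiplicity_mul_and_not_dvd χ hχm.ne_zero 0
  set m := Polynomial.rootMultiplicity 0 χ
  rw [Polynomial.C_0, sub_zero] at e hχ'
  have hco : ∀ j, χ'.coeff j = χ.coeff (j + m) := fun j => by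
    rw [e, mul_comm, Polynomial.coeff_mul_X_pow]
  rw [Polynomial.X_dvd_iff] at hχ'
  set b := χ'.coeff 0 with hb
  have hbB : b ∈ F.B (g * R1) := by
    rw [hb, hco]; exact Bz_le_B F.gr (hχ _)
  have hk : χ'.divX ∈ WP F.B R1 ((g - 1) * R1) := fun j => by
    rw [Polynomial.coeff_divX, hco]
    rcases Bz_elim (hχ (j + 1 + m)) with h0 | ⟨s, hs, h0⟩
    · rw [h0]; exact zero_mem _
    · refine Bz_of_le F.gr (s := s) ?_ h0
      obtain ⟨g', hg'⟩ : ∃ g', g = g' + 1 := ⟨g - 1, by omega⟩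
      rw [hg'] at hs ⊢
      simp only [Nat.add_sub_cancel]
      have : (j + 1 + m) * R1 = j * R1 + R1 + m * R1 := by ring
      have : (g' + 1) * R1 = g' * R1 + R1 := by ring
      omega
  have hf1 : f ∈ WP F.B ω R1 := (WP_gr F.gr).le (by omega) hf
  have hkf := WP_comp F.gr hk hf1
  set k := χ'.divX.comp f
  have hχf : G1 ∣ Polynomial.C b + f * k := by
    have h1 : G1 ∣ χ.comp f := hd.trans hχd
    rw [e, Polynomial.mul_comp, Polynomial.pow_comp, Polynomial.X_comp] at h1
    rcases hp.dvd_or_dvd h1 with h2 | h2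
    · exact absurd (hp.dvd_of_dvd_pow h2) hfG
    · have e2 : χ'.comp f = f * k + Polynomial.C b := by
        have e3 := congrArg (fun p : K[X] => p.comp f) (Polynomial.X_mul_divX_add χ')
        simp only [Polynomial.add_comp, Polynomial.mul_comp, Polynomial.X_comp, Polynomial.C_comp] at e3
        exact e3.symm
      rw [e2, add_comm] at h2; exact h2
  refine ⟨b, hχ', hbB, κ * k ^ 2, ?_, ?_⟩
  · refine CP_mono ?_ (CP_mul hκ (CP_sq hkf))
    obtain ⟨g', hg'⟩ : ∃ g', g = g' + 1 := ⟨g - 1, by omega⟩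
    rw [hg']
    simp only [Nat.add_sub_cancel]
    have : (g' + 1) * R1 = g' * R1 + R1 := by ring
    omega
  · have e3 : Polynomial.C (b ^ 2) + κ * k ^ 2 =
        (Polynomial.C b + f * k) * (Polynomial.C b - f * k) + (f ^ 2 + κ) * k ^ 2 := by
      rw [Polynomial.C_pow]; ring
    rw [e3]
    exact dvd_add (hχf.mul_right _) (hfκ.mul_right _)

theorem prod_dvd {ω ρ : ℕ} (s : Multiset K[X]) (hs : ∀ p ∈ s, ∃ b, b ≠ 0 ∧ b ∈ F.B ρ ∧
      ∃ κ' ∈ F.CP ω (2 * ρ), p ∣ Polynomial.C (b ^ 2) + κ') :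
    ∃ b, b ≠ 0 ∧ b ∈ F.B (s.card * ρ) ∧
      ∃ κ' ∈ F.CP ω (2 * (s.card * ρ)), s.prod ∣ Polynomial.C (b ^ 2) + κ' := by
  induction s using Multiset.induction_on with
  | empty => exact ⟨1, one_ne_zero, F.gr.one' _, 0, zero_mem _, by simp⟩
  | cons p s ih =>
    obtain ⟨b, hb0, hb, κ, hκ, hd⟩ := ih fun p hp => hs p (Multiset.mem_cons_of_mem hp)
    obtain ⟨b', hb0', hb', κ', hκ', hd'⟩ := hs p (Multiset.mem_cons_self _ _)
    rw [Multiset.card_cons, Multiset.prod_cons]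
    refine ⟨b' * b, mul_ne_zero hb0' hb0, F.B_of_le (by ring_nf; rfl) (F.gr.mul hb' hb),
      Polynomial.C (b' ^ 2) * κ + κ' * Polynomial.C (b ^ 2) + κ' * κ, ?_, ?_⟩
    · have h1 := CP_C (ω := ω) (F.sq_C hb)
      have h2 := CP_C (ω := ω) (F.sq_C hb')
      refine add_mem (add_mem ?_ ?_) ?_
      · exact CP_mono (by ring_nf; rfl) (CP_mul h2 hκ)
      · exact CP_mono (by ring_nf; rfl) (CP_mul hκ' h1)
      · exact CP_mono (by ring_nf; rfl) (CP_mul hκ' hκ)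
    · convert mul_dvd_mul hd' hd using 1
      rw [mul_pow, Polynomial.C_mul]; ring

theorem factor {ω R : ℕ} {G : K[X]} (hm : G.Monic) (hg : 1 ≤ G.natDegree)
    (hG : G ∈ WP F.B ω (G.natDegree * ω))
    (h : F.PC G ω (G.natDegree * (G.natDegree * (R + G.natDegree * ω)))) :
    ∃ G1 : K[X], Irreducible G1 ∧ G1 ∣ G ∧
      (F.adj (AdjoinRoot.of G1) (AdjoinRoot.root G1) ω).Cons R := by
  classical
  by_contra hcon
  push Not at hcon
  have hG0 : G ≠ 0 := hm.ne_zero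
  have hs : ∀ p ∈ UniqueFactorizationMonoid.normalizedFactors G, ∃ b, b ≠ 0 ∧
      b ∈ F.B (G.natDegree * (R + G.natDegree * ω)) ∧
      ∃ κ' ∈ F.CP ω (2 * (G.natDegree * (R + G.natDegree * ω))), p ∣ Polynomial.C (b ^ 2) + κ' := by
    intro p hp
    have hirr := UniqueFactorizationMonoid.irreducible_of_normalized_factor p hp
    have hdvd := UniqueFactorizationMonoid.dvd_of_mem_normalizedFactors hp
    have h1 := hcon p hirr hdvd
    rw [Cons] at h1
    push Not at h1
    obtain ⟨_, ⟨f, hf, rfl⟩, ⟨κ, hκ, e⟩, h0⟩ := h1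
    have hmk : ∀ q : K[X], (Polynomial.eval₂RingHom (AdjoinRoot.of p) (AdjoinRoot.root p)).toAddMonoidHom q
        = AdjoinRoot.mk p q := fun q => by
      change Polynomial.eval₂ _ _ q = _
      rw [← AdjoinRoot.algebraMap_eq, ← Polynomial.aeval_def, AdjoinRoot.aeval_eq]
    rw [hmk, hmk] at e
    rw [hmk, Ne, AdjoinRoot.mk_eq_zero] at h0
    refine factor_aux hm hg hG hirr.prime hdvd hf hκ h0 ?_
    rw [← AdjoinRoot.mk_eq_zero, map_add, e, map_pow]; ring
  obtain ⟨b, hb0, hb, κ, hκ, hd⟩ := prod_dvd _ hs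
  have hcard : (UniqueFactorizationMonoid.normalizedFactors G).card ≤ G.natDegree := by
    have h1 := UniqueFactorizationMonoid.prod_normalizedFactors hG0
    rw [← Polynomial.natDegree_eq_of_degree_eq (Polynomial.degree_eq_degree_of_associated h1),
      Polynomial.natDegree_multiset_prod _ (UniqueFactorizationMonoid.zero_notMem_normalizedFactors _)]
    have := Multiset.card_nsmul_le_sum (s := (UniqueFactorizationMonoid.normalizedFactors G).map
      Polynomial.natDegree) (a := 1) ?_
    · simpa using this
    · intro x hx
      obtain ⟨p, hp, rfl⟩ := Multiset.mem_map.1 hx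
      exact (UniqueFactorizationMonoid.irreducible_of_normalized_factor p hp).natDegree_pos
  refine hb0 (h b (F.B_of_le (by gcongr) hb) κ (CP_mono (by gcongr) hκ) ?_)
  exact (UniqueFactorizationMonoid.prod_normalizedFactors hG0).symm.dvd.trans hd

end Filt
end ENS
end

section
open MvPolynomial
open scoped Polynomial

namespace ENS
namespace Filt
variable {K : Type*} [Field K]

/-- as `CP`, but the squared polynomials have degree `< g` -/
noncomputable def CPd (F : Filt K) (ω r g : ℕ) : AddSubmonoid K[X] :=
  AddSubmonoid.closure {f | ∃ a b c s, c ∈ F.C a ∧ s ∈ WP F.B ω b ∧ a + 2 * b ≤ r ∧ s.natDegree < g ∧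
    f = Polynomial.C c * s ^ 2}

variable {F : Filt K}

theorem CPd_le {ω r g : ℕ} : F.CPd ω r g ≤ F.CP ω r := by
  apply AddSubmonoid.closure_mono
  rintro f ⟨a, b, c, s, hc, hs, hab, hd, rfl⟩
  exact ⟨a, b, c, s, hc, hs, hab, rfl⟩

theorem CPd_natDegree {ω r g : ℕ} {f : K[X]} (hf : f ∈ F.CPd ω r g) : f.natDegree ≤ 2 * (g - 1) := by
  induction hf using AddSubmonoid.closure_induction with
  | zero => simp
  | add x y _ _ hx hy => exact (Polynomial.natDegree_add_le _ _).trans (max_le hx hy)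
  | mem x hx =>
    obtain ⟨a, b, c, s, hc, hs, hab, hd, rfl⟩ := hx
    refine (Polynomial.natDegree_C_mul_le _ _).trans ?_
    refine (Polynomial.natDegree_pow_le).trans ?_
    gcongr; omega

theorem CPd_lc {ω r g R : ℕ} (h : F.Cons R) (hr : r ≤ R) {f : K[X]} (hf : f ∈ F.CPd ω r g) :
    f = 0 ∨ (Even f.natDegree ∧ f.leadingCoeff ∈ F.C r) := by
  induction hf using AddSubmonoid.closure_induction with
  | zero => simp
  | add x y _ _ hx hy =>
    rcases hx with rfl | ⟨hx1, hx2⟩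
    · simpa using hy
    rcases hy with rfl | ⟨hy1, hy2⟩
    · right; simpa using ⟨hx1, hx2⟩
    rcases lt_trichotomy x.natDegree y.natDegree with hlt | heq | hgt
    · right
      rw [Polynomial.natDegree_add_eq_right_of_natDegree_lt hlt,
        Polynomial.leadingCoeff_add_of_degree_lt (Polynomial.degree_lt_degree hlt)]
      exact ⟨hy1, hy2⟩
    · by_cases hx0 : x.leadingCoeff = 0
      · rw [Polynomial.leadingCoeff_eq_zero] at hx0
        subst hx0
        right; simpa using ⟨hy1, hy2⟩
      have hne : x.leadingCoeff + y.leadingCoeff ≠ 0 := fun h0 =>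
        hx0 (h.add_zero hx2 hy2 hr hr h0)
      have hco : (x + y).coeff x.natDegree = x.leadingCoeff + y.leadingCoeff := by
        rw [Polynomial.coeff_add, Polynomial.leadingCoeff, Polynomial.leadingCoeff, ← heq]
      have hnd : (x + y).natDegree = x.natDegree := by
        apply le_antisymm
        · exact (Polynomial.natDegree_add_le _ _).trans (max_le le_rfl heq.ge)
        · exact Polynomial.le_natDegree_of_ne_zero (by rw [hco]; exact hne)
      right
      rw [Polynomial.leadingCoeff, hnd, hco]
      exact ⟨hx1, add_mem hx2 hy2⟩
    · right
      rw [Polynomial.natDegree_add_eq_left_of_natDegree_lt hgt,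
        Polynomial.leadingCoeff_add_of_degree_lt' (Polynomial.degree_lt_degree hgt)]
      exact ⟨hx1, hx2⟩
  | mem x hx =>
    obtain ⟨a, b, c, s, hc, hs, hab, hd, rfl⟩ := hx
    by_cases hc0 : c = 0
    · left; simp [hc0]
    right
    rw [Polynomial.natDegree_C_mul hc0, Polynomial.natDegree_pow, Polynomial.leadingCoeff_mul,
      Polynomial.leadingCoeff_pow, Polynomial.leadingCoeff_C]
    exact ⟨even_two_mul _, F.C_of_le hab (F.mul_C hc (F.sq_C (Bz_le_B F.gr (hs _))))⟩

theorem CPd_reduce {ω r : ℕ} {G : K[X]} (hm : G.Monic) (hg : 1 ≤ G.natDegree)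
    (hG : G ∈ WP F.B ω (G.natDegree * ω)) {f : K[X]} (hf : f ∈ F.CP ω r) :
    ∃ f' ∈ F.CPd ω r G.natDegree, G ∣ f - f' := by
  induction hf using AddSubmonoid.closure_induction with
  | zero => exact ⟨0, zero_mem _, by simp⟩
  | add x y _ _ hx hy =>
    obtain ⟨x', hx', hx⟩ := hx
    obtain ⟨y', hy', hy⟩ := hy
    exact ⟨x' + y', add_mem hx' hy', by rw [add_sub_add_comm]; exact dvd_add hx hy⟩
  | mem x hx =>
    obtain ⟨a, b, c, s, hc, hs, hab, rfl⟩ := hx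
    refine ⟨Polynomial.C c * (s %ₘ G) ^ 2, AddSubmonoid.subset_closure
      ⟨a, b, c, _, hc, (WP_divMod F.gr hm hG _ _ hs).1, hab, ?_, rfl⟩, ?_⟩
    · exact Polynomial.natDegree_modByMonic_lt _ hm (by rintro rfl; simp at hg)
    · have e := Polynomial.modByMonic_add_div s G
      have e2 : Polynomial.C c * s ^ 2 - Polynomial.C c * (s %ₘ G) ^ 2 =
          Polynomial.C c * (s - s %ₘ G) * (s + s %ₘ G) := by ring
      rw [e2]
      refine Dvd.dvd.mul_right (Dvd.dvd.mul_left ⟨s /ₘ G, ?_⟩ _) _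
      linear_combination -e

theorem CPd_change {F' : Filt K} (hle : Le F F' (RingHom.id K)) {ω r g ω' r' : ℕ} (hω : ω ≤ ω')
    (hr : r + 2 * (g * ω') ≤ r') {f : K[X]} (hf : f ∈ F.CPd ω r g) : f ∈ F'.CP ω' r' := by
  induction hf using AddSubmonoid.closure_induction with
  | zero => exact zero_mem _
  | add x y _ _ hx hy => exact add_mem hx hy
  | mem x hx =>
    obtain ⟨a, b, c, s, hc, hs, hab, hd, rfl⟩ := hx
    refine CP_gen (F := F') (a := a) (b := b + g * ω') (hle.C hc) (fun j => ?_) (by omega)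
    by_cases hj : g ≤ j
    · rw [Polynomial.coeff_eq_zero_of_natDegree_lt (by omega)]; exact zero_mem _
    rcases Bz_elim (hs j) with h0 | ⟨t, ht, h0⟩
    · rw [h0]; exact zero_mem _
    · refine Bz_of_le F'.gr (s := t) ?_ (hle.B h0)
      have : j * ω' ≤ g * ω' := by gcongr; omega
      omega

theorem ivt (g : ℕ) : ∀ (F : Filt K) (ω R δ : ℕ) (G : K[X]) (a u v : K), G.Monic → G.natDegree = g →
    1 ≤ g → G ∈ WP F.B ω (g * ω) → a ∈ F.B ω → u ∈ F.C δ → v ∈ F.C δ → v ≠ 0 →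
    u * G.eval a = -v → ω ≤ R → δ ≤ R → 1 ≤ R → F.Cons ((20 * g) ^ g * R) → F.PC G ω R := by
  induction g using Nat.strong_induction_on with
  | _ g ih =>
  intro F ω R δ G a u v hm hdeg hg hG ha hu hv hv0 huv hωR hδR hR hC b hb κ hκ hdvd
  by_contra hb0
  have hu0 : u ≠ 0 := by rintro rfl; rw [zero_mul] at huv; exact hv0 (by simpa using huv.symm)
  have h20 : 20 * R ≤ (20 * g) ^ g * R := by
    gcongr
    calc 20 ≤ 20 * g := by omega
      _ ≤ (20 * g) ^ g := Nat.le_self_pow (by omega) _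
  have hC20 : F.Cons (20 * R) := hC.mono h20
  obtain ⟨κ', hκ', hκd⟩ := CPd_reduce hm (by omega) (by rw [hdeg]; exact hG) hκ
  rw [hdeg] at hκ'
  set W := Polynomial.C (b ^ 2) + κ' with hW
  have hWd : W ∈ F.CPd ω (2 * R) g := by
    refine add_mem (AddSubmonoid.subset_closure ⟨2 * R, 0, b ^ 2, 1, F.sq_C hb, (WP_gr F.gr).one, by simp,
      by simp; omega, by simp⟩) hκ'
  have hWdvd : G ∣ W := by
    have : W = (Polynomial.C (b ^ 2) + κ) - (κ - κ') := by rw [hW]; ring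
    rw [this]; exact dvd_sub hdvd hκd
  have hWa : W.eval a ∈ F.C (2 * R) := CP_eval₂ (Le.refl F) ha (CPd_le hWd)
  have hWa0 : W.eval a ≠ 0 := by
    intro h0
    rw [hW, Polynomial.eval_add, Polynomial.eval_C] at h0
    have := hC20.add_zero (F.sq_C hb) (CP_eval₂ (Le.refl F) ha (CPd_le hκ')) (by omega) (by omega) h0
    exact hb0 (pow_eq_zero_iff (two_ne_zero) |>.1 this)
  have hW0 : W ≠ 0 := by intro h0; rw [h0] at hWa0; simp at hWa0
  have hWlc := ((CPd_lc hC20 (by omega) hWd).resolve_left hW0).2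
  obtain ⟨H, hH⟩ := hWdvd
  have hH0 : H ≠ 0 := by rintro rfl; rw [mul_zero] at hH; exact hW0 hH
  have hHlc : H.leadingCoeff = W.leadingCoeff := by rw [hH, Polynomial.leadingCoeff_mul, Polynomial.Monic.leadingCoeff hm, one_mul]
  set l := H.leadingCoeff with hl
  have hl0 : l ≠ 0 := Polynomial.leadingCoeff_ne_zero.2 hH0
  have hlC : l ∈ F.C (2 * R) := by rw [hHlc]; exact hWlc
  have hdegW : W.natDegree = g + H.natDegree := by rw [hH, hm.natDegree_mul' hH0, hdeg]
  have hdegW' := CPd_natDegree hWd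
  have hWe : W.eval a = G.eval a * H.eval a := by rw [hH, Polynomial.eval_mul]
  by_cases hh0 : H.natDegree = 0
  · have hHl : H.eval a = l := by
      rw [Polynomial.eq_C_of_natDegree_eq_zero hh0] at hl ⊢
      simp [hl]
    have e : v * l + u * W.eval a = 0 := by
      rw [hWe, hHl]; linear_combination l * huv
    have := hC20.add_zero (F.mul_C hv hlC) (F.mul_C hu hWa) (by omega) (by omega) e
    rcases mul_eq_zero.1 this with h | h
    · exact hv0 h
    · exact hl0 h
  set h := H.natDegree with hhdef
  have hhg : h + 2 ≤ g := by omega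
  set F1 := F.adj (RingHom.id K) l⁻¹ (2 * R) with hF1
  have hle : Le F F1 (RingHom.id K) := le_adj _ _ _ _
  have hli : l⁻¹ ∈ F1.B (2 * R) := mem_adj _ _ _ _
  have hpow : 2 * ((20 * h) ^ h * (10 * g * R)) ≤ (20 * g) ^ g * R := by
    have : (20 * h) ^ h ≤ (20 * g) ^ (g - 1) :=
      (Nat.pow_le_pow_left (by omega) _).trans (Nat.pow_le_pow_right (by omega) (by omega))
    calc 2 * ((20 * h) ^ h * (10 * g * R)) = (20 * h) ^ h * (20 * g) * R := by ring
      _ ≤ (20 * g) ^ (g - 1) * (20 * g) * R := by gcongr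
      _ = (20 * g) ^ g * R := by rw [← pow_succ, Nat.sub_add_cancel hg]
  have hC1 : F1.Cons ((20 * h) ^ h * (10 * g * R)) :=
    inv_cons (hC.mono hpow) hl0 (by omega) (F.C_le hlC)
  have hgR : R ≤ g * R := Nat.le_mul_of_pos_left _ (by omega)
  have h10 : 10 * g * R = 10 * (g * R) := by ring
  have hliC : l⁻¹ ∈ F1.C (6 * R) := by
    have : l⁻¹ = l * l⁻¹ ^ 2 := by field_simp
    rw [this]
    exact F1.C_of_le (by omega) (F1.mul_C (hle.C hlC) (F1.sq_C hli))
  have hHB : ∀ j, H.coeff j ∈ F.B (2 * R) := by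
    intro j
    have h1 := (WP_divMod F.gr hm (by rw [hdeg]; exact hG) _ _ (CP_le (CPd_le hWd))).2
    rw [hH, Polynomial.mul_divByMonic_cancel_left _ hm] at h1
    have h2 := h1 (j + G.natDegree)
    rw [Polynomial.coeff_mul_X_pow] at h2
    exact Bz_le_B F.gr h2
  have hHm : (Polynomial.C l⁻¹ * H).Monic := by
    rw [Polynomial.Monic, Polynomial.leadingCoeff_mul, Polynomial.leadingCoeff_C, ← hl]
    exact inv_mul_cancel₀ hl0
  have hHdeg : (Polynomial.C l⁻¹ * H).natDegree = h := Polynomial.natDegree_C_mul (inv_ne_zero hl0)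
  have := ih h (by omega) F1 (4 * R) (10 * g * R) (δ + 8 * R) (Polynomial.C l⁻¹ * H) a v
    (u * l⁻¹ * W.eval a) hHm hHdeg (by omega) ?_ (hle.B (F.B_of_le (by omega) ha))
    (F1.C_of_le (by omega) (hle.C hv)) 
    (F1.C_of_le (by omega) (F1.mul_C (F1.mul_C (hle.C hu) hliC) (hle.C hWa)))
    (mul_ne_zero (mul_ne_zero hu0 (inv_ne_zero hl0)) hWa0) ?_ (by omega) (by omega)
    (by omega) hC1 b (hle.B (F.B_of_le (by omega) hb)) κ' 
    (CPd_change hle (g := g) (ω := ω) (r := 2 * R) (by omega) ?_ hκ') ?_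
  · exact hb0 this
  · intro j
    rcases lt_trichotomy j h with hj | hj | hj
    · rw [Polynomial.coeff_C_mul]
      refine Bz_of_le F1.gr (s := 4 * R) ?_ ?_
      · have : (j + 1) * (4 * R) ≤ h * (4 * R) := by gcongr; omega
        linarith
      · exact F1.B_of_le (by omega) (F1.gr.mul hli (hle.B (hHB j)))
    · have e : (Polynomial.C l⁻¹ * H).coeff j = 1 := by
        rw [hj, ← hHdeg]; exact hHm
      rw [e, hj]
      exact Bz_of_le F1.gr (s := 0) (by simp) F1.gr.one
    · rw [Polynomial.coeff_eq_zero_of_natDegree_lt (by omega)]; exact zero_mem _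
  · rw [Polynomial.eval_mul, Polynomial.eval_C, hWe]
    linear_combination (l⁻¹ * H.eval a) * huv
  · have : g * (4 * R) = 4 * (g * R) := by ring
    omega
  · refine ⟨Polynomial.C l * G, ?_⟩
    rw [← hW, hH]
    have : Polynomial.C l⁻¹ * Polynomial.C l = 1 := by
      rw [← Polynomial.C_mul, inv_mul_cancel₀ hl0, Polynomial.C_1]
    linear_combination (-G * H) * this

/-- adjoining a root by the intermediate value theorem -/
theorem exists_root {K : Type} [Field K] {F : Filt K} {ω R : ℕ} {G : K[X]} {a u v : K} (hm : G.Monic)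
    (hg : 1 ≤ G.natDegree) (hG : G ∈ WP F.B ω (G.natDegree * ω)) (ha : a ∈ F.B ω) (hu : u ∈ F.C R)
    (hv : v ∈ F.C R) (hv0 : v ≠ 0) (huv : u * G.eval a = -v) (hωR : ω ≤ R) (hR : 1 ≤ R)
    (hC : F.Cons ((20 * G.natDegree) ^ (G.natDegree + 3) * R)) :
    ∃ (K' : Type) (_ : Field K') (F' : Filt K') (φ : K →+* K') (z : K'), Le F F' φ ∧ z ∈ F'.B ω ∧
      (G.map φ).eval z = 0 ∧ F'.Cons R := by
  set g := G.natDegree with hgdef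
  set R' := g * (g * (R + g * ω)) with hR'
  have hRR' : R ≤ R' := by
    calc R ≤ R + g * ω := by omega
      _ ≤ g * (R + g * ω) := Nat.le_mul_of_pos_left _ (by omega)
      _ ≤ _ := Nat.le_mul_of_pos_left _ (by omega)
  have hpow : (20 * g) ^ g * R' ≤ (20 * g) ^ (g + 3) * R := by
    have h1 : R + g * ω ≤ 20 * g * R := by
      have : g * ω ≤ g * R := by gcongr
      have : R ≤ g * R := Nat.le_mul_of_pos_left _ (by omega)
      have : 20 * g * R = 20 * (g * R) := by ring
      omega
    calc (20 * g) ^ g * R' ≤ (20 * g) ^ g * ((20 * g) * ((20 * g) * (20 * g * R))) := by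
          rw [hR']; gcongr <;> omega
      _ = _ := by ring
  have hpc : F.PC G ω R' := ivt g F ω R' R G a u v hm rfl hg hG ha hu hv hv0 huv (hωR.trans hRR') hRR'
    (hR.trans hRR') (hC.mono hpow)
  obtain ⟨G1, hirr, hdvd, hcons⟩ := factor hm hg hG hpc
  have : Fact (Irreducible G1) := ⟨hirr⟩
  refine ⟨AdjoinRoot G1, inferInstance, _, AdjoinRoot.of G1, AdjoinRoot.root G1, le_adj _ _ _ _,
    mem_adj _ _ _ _, ?_, hcons⟩
  obtain ⟨Q, rfl⟩ := hdvd
  rw [Polynomial.map_mul, Polynomial.eval_mul, Polynomial.eval_map, AdjoinRoot.eval₂_root, zero_mul]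

end Filt
end ENS
end

section
open MvPolynomial
open scoped Polynomial

namespace ENS
namespace Filt

/-- partial factorisation of a family of monic polynomials -/
structure Pre {K : Type} [Field K] (F : Filt K) (ω : ℕ) {ι : Type} (f : ι → K[X]) (N : ℕ) (ξ : Fin N → K)
    (m : ι → Fin N → ℕ) (Q : ι → K[X]) : Prop where
  inj : Function.Injective ξ
  mem : ∀ a, ξ a ∈ F.B ω
  monic : ∀ i, (Q i).Monic
  wp : ∀ i, Q i ∈ WP F.B ω ((Q i).natDegree * ω)
  eq : ∀ i, f i = (∏ a, (Polynomial.X - Polynomial.C (ξ a)) ^ m i a) * Q i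

section
variable {K : Type} [Field K] {F : Filt K} {ω : ℕ} {ι : Type} {f : ι → K[X]} {N : ℕ} {ξ : Fin N → K}
    {m : ι → Fin N → ℕ} {Q : ι → K[X]}

theorem Pre.map {K' : Type} [Field K'] {F' : Filt K'} {φ : K →+* K'} (h : Pre F ω f N ξ m Q)
    (hle : Le F F' φ) : Pre F' ω (fun i => (f i).map φ) N (fun a => φ (ξ a)) m (fun i => (Q i).map φ) where
  inj := φ.injective.comp h.inj
  mem := fun a => hle.B (h.mem a)
  monic := fun i => (h.monic i).map φ
  wp := fun i => by
    rw [(h.monic i).natDegree_map]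
    exact WP_map F'.gr φ (fun _ _ => hle.B) (h.wp i)
  eq := fun i => by
    rw [h.eq i]
    simp [Polynomial.map_mul, Polynomial.map_prod]

theorem wp_root {z : K} (hz : z ∈ F.B ω) {q : K[X]} (hm : q.Monic) (hq : q ∈ WP F.B ω (q.natDegree * ω))
    (h0 : q.eval z = 0) : ∃ q' : K[X], q = (Polynomial.X - Polynomial.C z) * q' ∧ q'.Monic ∧
      q' ∈ WP F.B ω (q'.natDegree * ω) ∧ q.natDegree = q'.natDegree + 1 := by
  have hX : (Polynomial.X - Polynomial.C z).Monic := Polynomial.monic_X_sub_C z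
  have hXw : Polynomial.X - Polynomial.C z ∈ WP F.B ω ((Polynomial.X - Polynomial.C z).natDegree * ω) := by
    rw [Polynomial.natDegree_X_sub_C, one_mul]
    exact sub_mem (WP_X F.gr) (WP_C F.gr hz)
  have e := Polynomial.mul_divByMonic_eq_iff_isRoot.2 h0
  set q' := q /ₘ (Polynomial.X - Polynomial.C z)
  have hq'm : q'.Monic := by
    rw [← e] at hm
    exact hX.of_mul_monic_left hm
  have hd : q.natDegree = q'.natDegree + 1 := by
    conv_lhs => rw [← e]
    rw [hX.natDegree_mul hq'm, Polynomial.natDegree_X_sub_C, add_comm]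
  refine ⟨q', e.symm, hq'm, fun j => ?_, hd⟩
  have h2 := (WP_divMod F.gr hX hXw _ _ hq).2 (j + 1)
  rw [Polynomial.natDegree_X_sub_C, Polynomial.coeff_mul_X_pow] at h2
  rcases Bz_elim h2 with h3 | ⟨s, hs, h3⟩
  · change q'.coeff j = 0 at h3
    rw [h3]; exact zero_mem _
  · refine Bz_of_le F.gr (s := s) ?_ h3
    rw [hd] at hs
    have : (j + 1) * ω = j * ω + ω := by ring
    have : (q'.natDegree + 1) * ω = q'.natDegree * ω + ω := by ring
    omega

theorem Pre.root [DecidableEq ι] (h : Pre F ω f N ξ m Q) (i : ι) (a : Fin N) (h0 : (Q i).eval (ξ a) = 0) :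
    ∃ m' Q', Pre F ω f N ξ m' Q' ∧ (∀ j ≠ i, Q' j = Q j) ∧ (Q i).natDegree = (Q' i).natDegree + 1 := by
  obtain ⟨q', e, hm, hw, hd⟩ := wp_root (h.mem a) (h.monic i) (h.wp i) h0
  refine ⟨Function.update m i (Function.update (m i) a (m i a + 1)), Function.update Q i q',
    ⟨h.inj, h.mem, ?_, ?_, ?_⟩, fun j hj => Function.update_of_ne hj _ _, by simpa using hd⟩
  · intro j
    by_cases hj : j = i
    · subst hj; simpa using hm
    · simpa [hj] using h.monic j
  · intro j
    by_cases hj : j = i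
    · subst hj; simpa using hw
    · simpa [hj] using h.wp j
  · intro j
    by_cases hj : j = i
    · subst hj
      simp only [Function.update_self]
      rw [h.eq j, e, ← Finset.mul_prod_erase _ _ (Finset.mem_univ a),
        ← Finset.mul_prod_erase _ (fun b => _ ^ (Function.update (m j) a (m j a + 1) b)) (Finset.mem_univ a)]
      have : ∏ x ∈ Finset.univ.erase a, (Polynomial.X - Polynomial.C (ξ x)) ^ m j x =
        ∏ x ∈ Finset.univ.erase a, (Polynomial.X - Polynomial.C (ξ x)) ^
          (Function.update (m j) a (m j a + 1) x) := by
        refine Finset.prod_congr rfl fun x hx => ?_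
        rw [Function.update_of_ne (Finset.ne_of_mem_erase hx)]
      rw [this, Function.update_self, pow_succ]; ring
    · simpa [hj] using h.eq j

theorem Pre.cons (h : Pre F ω f N ξ m Q) {z : K} (hz : z ∈ F.B ω) (hne : ∀ a, ξ a ≠ z) :
    Pre F ω f (N + 1) (Fin.cons z ξ) (fun i => Fin.cons 0 (m i)) Q where
  inj := by
    rw [Fin.cons_injective_iff]
    exact ⟨fun ⟨a, ha⟩ => hne a ha, h.inj⟩
  mem := fun a => by
    refine Fin.cases ?_ (fun b => ?_) a
    · simpa using hz
    · simpa using h.mem b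
  monic := h.monic
  wp := h.wp
  eq := fun i => by
    rw [Fin.prod_univ_succ]; simpa using h.eq i

end

/-- a complete factorisation -/
structure Comp {K : Type} [Field K] (F : Filt K) (Δ : ℕ) {ι : Type} (f : ι → K[X]) (N : ℕ) (ξ : Fin N → K)
    (m : ι → Fin N → ℕ) (Q : ι → K[X]) : Prop where
  lt : ∀ a b, a < b → ξ b - ξ a ∈ F.C Δ
  inj : Function.Injective ξ
  monic : ∀ i, (Q i).Monic
  even : ∀ i, Even (Q i).natDegree
  eq : ∀ i, f i = (∏ a, (Polynomial.X - Polynomial.C (ξ a)) ^ m i a) * Q i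
  pos : ∀ i a, (Q i).eval (ξ a) ∈ F.C Δ
  ne : ∀ i a, (Q i).eval (ξ a) ≠ 0

/-- the cost of one round -/
def cst (T : ℕ) : ℕ := 2 ^ (2 * T ^ 2) * (20 * T) ^ (T + 3)

theorem exists_sort {K : Type} [Field K] {F : Filt K} {N Δ R : ℕ} (ξ : Fin N → K) (hinj : Function.Injective ξ)
    (hd : ∀ a b, F.Dec Δ (ξ a - ξ b)) (hC : F.Cons R) (hR : Δ ≤ R) :
    ∃ σ : Equiv.Perm (Fin N), ∀ a b, a < b → ξ (σ b) - ξ (σ a) ∈ F.C Δ := by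
  classical
  let rk : Fin N → ℕ := fun a => (Finset.univ.filter fun b => b ≠ a ∧ ξ a - ξ b ∈ F.C Δ).card
  have key : ∀ a b, a ≠ b → ξ b - ξ a ∈ F.C Δ → rk a < rk b := by
    intro a b hab hlt
    apply Finset.card_lt_card
    rw [Finset.ssubset_iff_of_subset]
    · refine ⟨a, by simp [hab, hlt], by simp⟩
    · intro c hc
      simp only [Finset.mem_filter, Finset.mem_univ, true_and] at hc ⊢
      have hcb : c ≠ b := by
        rintro rfl
        have : ξ c - ξ a = 0 := hC.zero hlt (by rw [neg_sub]; exact hc.2) hR hR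
        exact hab (hinj (sub_eq_zero.1 this)).symm
      refine ⟨hcb, ?_⟩
      rw [show ξ b - ξ c = (ξ b - ξ a) + (ξ a - ξ c) by ring]
      exact add_mem hlt hc.2
  refine ⟨Tuple.sort rk, fun a b hab => ?_⟩
  have hmono := Tuple.monotone_sort rk hab.le
  have hne : Tuple.sort rk a ≠ Tuple.sort rk b := fun h => hab.ne ((Tuple.sort rk).injective h)
  rcases hd (Tuple.sort rk b) (Tuple.sort rk a) with h | h
  · exact h
  · rw [neg_sub] at h
    exact absurd (key _ _ hne.symm h) (not_lt.2 hmono)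

theorem completion_aux {ι : Type} [Fintype ι] (T ω : ℕ) (hι : Fintype.card ι ≤ T) {R : ℕ} (hTR : T * ω ≤ R)
    (hT : 1 ≤ T) (hR : 1 ≤ R) (hωR : ω ≤ R)
    (μ : ℕ) : ∀ {K : Type} [Field K] (F : Filt K) (f : ι → K[X]) (y : K) (N : ℕ) (ξ : Fin N → K)
    (m : ι → Fin N → ℕ) (Q : ι → K[X]) (_ : Pre F ω f N ξ m Q) (_ : ∑ i, (Q i).natDegree = μ)
    (_ : N + μ ≤ T) (_ : ∃ a, ξ a = y) (_ : F.Cons (cst T ^ (μ + 1) * R)),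
    ∃ (K' : Type) (_ : Field K') (F' : Filt K') (φ : K →+* K') (N' : ℕ) (ξ' : Fin N' → K')
      (m' : ι → Fin N' → ℕ) (Q' : ι → K'[X]), Le F F' φ ∧ F'.Cons R ∧
        Comp F' (T * ω) (fun i => (f i).map φ) N' ξ' m' Q' ∧ ∃ a, ξ' a = φ y := by
  classical
  have hωT : ω ≤ T * ω := Nat.le_mul_of_pos_left _ hT
  have h20 : 1 ≤ (20 * T) ^ (T + 3) := Nat.one_le_pow _ _ (by omega)
  have hcst : 1 ≤ cst T := Nat.mul_pos (by positivity) (by omega)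
  induction μ using Nat.strong_induction_on with
  | _ μ ih =>
  intro K _ F f y N ξ m Q hP hμ hNT hy hC
  -- decide all signs
  let E : Finset K := (Finset.univ.image fun p : ι × Fin N => (Q p.1).eval (ξ p.2)) ∪
    (Finset.univ.image fun p : Fin N × Fin N => ξ p.1 - ξ p.2)
  have hQT : ∀ i, (Q i).natDegree ≤ μ := fun i => by
    rw [← hμ]; exact Finset.single_le_sum (f := fun i => (Q i).natDegree) (fun _ _ => Nat.zero_le _)
      (Finset.mem_univ i)
  have hEc : E.card ≤ 2 * T ^ 2 := by
    refine (Finset.card_union_le _ _).trans ?_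
    have h1 := Finset.card_image_le (s := (Finset.univ : Finset (ι × Fin N)))
      (f := fun p : ι × Fin N => (Q p.1).eval (ξ p.2))
    have h2 := Finset.card_image_le (s := (Finset.univ : Finset (Fin N × Fin N)))
      (f := fun p : Fin N × Fin N => ξ p.1 - ξ p.2)
    simp only [Finset.card_univ, Fintype.card_prod, Fintype.card_fin] at h1 h2
    have h3 : Fintype.card ι * N ≤ T * T := by gcongr; omega
    have h4 : N * N ≤ T * T := by gcongr <;> omega
    have h5 : T ^ 2 = T * T := sq T
    omega
  have hEB : ∀ x ∈ E, x ∈ F.B (T * ω) := by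
    intro x hx
    rcases Finset.mem_union.1 hx with hx | hx
    · obtain ⟨p, -, rfl⟩ := Finset.mem_image.1 hx
      refine F.B_of_le ?_ (WP_eval F.gr (hP.mem p.2) (hP.wp p.1))
      gcongr
      have := hQT p.1
      omega
    · obtain ⟨p, -, rfl⟩ := Finset.mem_image.1 hx
      exact F.B_of_le hωT (sub_mem (hP.mem _) (hP.mem _))
  have hC1 : F.Cons (2 ^ E.card * ((20 * T) ^ (T + 3) * (cst T ^ μ * R))) := by
    refine hC.mono ?_
    calc 2 ^ E.card * ((20 * T) ^ (T + 3) * (cst T ^ μ * R))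
        ≤ 2 ^ (2 * T ^ 2) * ((20 * T) ^ (T + 3) * (cst T ^ μ * R)) := by gcongr; omega
      _ = cst T ^ (μ + 1) * R := by rw [pow_succ, cst]; ring
  obtain ⟨F1, hle, hC1, hdec⟩ := exists_dec E hEB hC1
  have hP1 : Pre F1 ω f N ξ m Q := by simpa using hP.map hle
  have hQdec : ∀ i a, F1.Dec (T * ω) ((Q i).eval (ξ a)) := fun i a =>
    hdec _ (Finset.mem_union_left _ (Finset.mem_image.2 ⟨(i, a), Finset.mem_univ _, rfl⟩))
  have hddec : ∀ a b, F1.Dec (T * ω) (ξ a - ξ b) := fun a b =>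
    hdec _ (Finset.mem_union_right _ (Finset.mem_image.2 ⟨(a, b), Finset.mem_univ _, rfl⟩))
  have hRμ : R ≤ cst T ^ μ * R := Nat.le_mul_of_pos_left _ (by positivity)
  have hμ1 : cst T ^ μ * R ≤ (20 * T) ^ (T + 3) * (cst T ^ μ * R) := Nat.le_mul_of_pos_left _ h20
  have hC1' : F1.Cons (cst T ^ μ * R) := hC1.mono hμ1
  have hC1R : F1.Cons R := hC1'.mono hRμ
  have hsum : ∀ {K' : Type} [Field K'] (Q' : ι → K'[X]) (i : ι), (∀ j ≠ i, (Q' j).natDegree = (Q j).natDegree) →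
      (Q i).natDegree = (Q' i).natDegree + 1 → ∑ i, (Q' i).natDegree + 1 = μ := by
    intro K' _ Q' i h1 h2
    rw [← hμ, ← Finset.add_sum_erase _ _ (Finset.mem_univ i),
      ← Finset.add_sum_erase _ (fun i => (Q i).natDegree) (Finset.mem_univ i), h2,
      Finset.sum_congr rfl fun j hj => h1 j (Finset.ne_of_mem_erase hj)]
    ring
  by_cases hz : ∃ i a, (Q i).eval (ξ a) = 0
  · obtain ⟨i, a, h0⟩ := hz
    obtain ⟨m', Q', hP', hj, hd⟩ := hP1.root i a h0
    have hs := hsum Q' i (fun j hj' => by rw [hj j hj']) hd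
    obtain ⟨K', _, F', φ, N', ξ', m'', Q'', hle', hc', hcomp, hy'⟩ :=
      ih (∑ i, (Q' i).natDegree) (by omega) F1 f y N ξ m' Q' hP' rfl (by omega) hy (by rwa [hs])
    exact ⟨K', _, F', φ, N', ξ', m'', Q'', by simpa using hle.trans hle', hc', hcomp, hy'⟩
  push Not at hz
  -- adjoining a new root
  have adjoin : ∀ (i : ι) (K' : Type) [Field K'] (F' : Filt K') (φ : K →+* K') (z : K'), Le F1 F' φ →
      z ∈ F'.B ω → ((Q i).map φ).eval z = 0 → F'.Cons (cst T ^ μ * R) →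
      ∃ (K' : Type) (_ : Field K') (F' : Filt K') (φ : K →+* K') (N' : ℕ) (ξ' : Fin N' → K')
      (m' : ι → Fin N' → ℕ) (Q' : ι → K'[X]), Le F F' φ ∧ F'.Cons R ∧
        Comp F' (T * ω) (fun i => (f i).map φ) N' ξ' m' Q' ∧ ∃ a, ξ' a = φ y := by
    intro i K' _ F' φ z hle1 hzB hz0 hC'
    have hP2 := (hP1.map hle1).cons hzB (fun a ha => by
      rw [← ha, Polynomial.eval_map, Polynomial.eval₂_at_apply] at hz0
      exact hz i a (φ.injective (by rw [hz0, map_zero])))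
    obtain ⟨m', Q', hP', hj, hd⟩ := hP2.root i 0 (by simpa using hz0)
    have hs := hsum Q' i (fun j hj' => by rw [hj j hj', (hP.monic j).natDegree_map])
      (by rw [← hd, (hP.monic i).natDegree_map])
    obtain ⟨b, hb⟩ := hy
    obtain ⟨K'', _, F'', φ', N', ξ', m'', Q'', hle', hc', hcomp, hy'⟩ :=
      ih (∑ i, (Q' i).natDegree) (by omega) F' _ (φ y) _ _ m' Q' hP' rfl (by omega)
        ⟨b.succ, by simp [hb]⟩ (by rwa [hs])
    refine ⟨K'', _, F'', φ'.comp φ, N', ξ', m'', Q'', by simpa using (hle.trans hle1).trans hle', hc', ?_, ?_⟩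
    · simpa only [Polynomial.map_map] using hcomp
    · simpa using hy'
  have hcost : ∀ g, 1 ≤ g → g ≤ T → F1.Cons ((20 * g) ^ (g + 3) * (cst T ^ μ * R)) := by
    intro g h1 hg
    refine hC1.mono ?_
    gcongr ?_ * _
    exact (Nat.pow_le_pow_left (by omega) _).trans (Nat.pow_le_pow_right (by omega) (by omega))
  by_cases hneg : ∃ i a, -(Q i).eval (ξ a) ∈ F1.C (T * ω)
  · obtain ⟨i, a, hn⟩ := hneg
    have hg : 1 ≤ (Q i).natDegree := by
      by_contra hg
      have h1 : Q i = 1 := (Polynomial.Monic.natDegree_eq_zero (hP.monic i)).1 (by omega)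
      refine hz i a (hC1R.zero (r := 0) ?_ hn (by omega) hTR)
      rw [h1, Polynomial.eval_one]; exact F1.one_C 0
    obtain ⟨K', _, F', φ, z, h1, h2, h3, h4⟩ := exists_root (F := F1) (R := cst T ^ μ * R) (u := 1)
      (v := -(Q i).eval (ξ a)) (hP.monic i) hg (hP1.wp i) (hP1.mem a) (F1.one_C _)
      (F1.C_of_le (hTR.trans hRμ) hn) (neg_ne_zero.2 (hz i a)) (by ring) (hωR.trans hRμ) (hR.trans hRμ)
      (hcost _ hg (by have := hQT i; omega))
    exact adjoin i K' F' φ z h1 h2 h3 h4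
  push Not at hneg
  have hpos : ∀ i a, (Q i).eval (ξ a) ∈ F1.C (T * ω) := fun i a => (hQdec i a).resolve_right (hneg i a)
  by_cases hodd : ∃ i, ¬ Even (Q i).natDegree
  · obtain ⟨i, ho⟩ := hodd
    rw [Nat.not_even_iff_odd] at ho
    obtain ⟨a, ha⟩ := hy
    have hX0 : (-Polynomial.X : K[X]).natDegree = 1 := by rw [Polynomial.natDegree_neg, Polynomial.natDegree_X]
    set G := -((Q i).comp (-Polynomial.X)) with hG
    have hGd : G.natDegree = (Q i).natDegree := by
      rw [hG, Polynomial.natDegree_neg, Polynomial.natDegree_comp, hX0, mul_one]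
    have hGm : G.Monic := by
      rw [Polynomial.Monic, hG, Polynomial.leadingCoeff_neg, Polynomial.leadingCoeff_comp (by omega),
        (hP.monic i).leadingCoeff, Polynomial.leadingCoeff_neg, Polynomial.leadingCoeff_X, ho.neg_one_pow]
      simp
    have hGw : G ∈ WP F1.B ω (G.natDegree * ω) := by
      rw [hGd]
      exact neg_mem (WP_comp F1.gr (hP1.wp i) (neg_mem (WP_X F1.gr)))
    have hGe : G.eval (-ξ a) = -(Q i).eval (ξ a) := by
      rw [hG, Polynomial.eval_neg, Polynomial.eval_comp]; simp
    have hg : 1 ≤ G.natDegree := by rw [hGd]; exact ho.pos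
    obtain ⟨K', _, F', φ, z, h1, h2, h3, h4⟩ := exists_root (F := F1) (R := cst T ^ μ * R) (u := 1)
      (v := (Q i).eval (ξ a)) hGm hg hGw (neg_mem (hP1.mem a)) (F1.one_C _)
      (F1.C_of_le (hTR.trans hRμ) (hpos i a)) (hz i a) (by rw [hGe]; ring) (hωR.trans hRμ) (hR.trans hRμ)
      (hcost _ hg (by have := hQT i; omega))
    refine adjoin i K' F' φ (-z) h1 (neg_mem h2) ?_ h4
    rw [hG, Polynomial.map_neg, Polynomial.map_comp, Polynomial.eval_neg, neg_eq_zero, Polynomial.eval_comp] at h3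
    simpa using h3
  push Not at hodd
  obtain ⟨σ, hσ⟩ := exists_sort ξ hP.inj hddec hC1R hTR
  obtain ⟨a, ha⟩ := hy
  refine ⟨K, _, F1, RingHom.id K, N, ξ ∘ σ, fun i => m i ∘ σ, Q, hle, hC1R,
    ⟨hσ, hP.inj.comp σ.injective, hP.monic, hodd, fun i => ?_, fun i a => hpos _ _, fun i a => hz _ _⟩,
    σ.symm a, by simp [ha]⟩
  rw [Polynomial.map_id, hP.eq i]
  congr 1
  exact (Equiv.prod_comp σ fun a => (Polynomial.X - Polynomial.C (ξ a)) ^ m i a).symm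

/-- completion of a finite family of monic polynomials -/
theorem completion {ι : Type} [Fintype ι] {K : Type} [Field K] (F : Filt K) (f : ι → K[X]) (y : K)
    (T ω R : ℕ) (hι : Fintype.card ι ≤ T) (hTR : T * ω ≤ R) (hR : 1 ≤ R)
    (hm : ∀ i, (f i).Monic) (hf : ∀ i, f i ∈ WP F.B ω ((f i).natDegree * ω)) (hy : y ∈ F.B ω)
    (hT : 1 + ∑ i, (f i).natDegree ≤ T) (hC : F.Cons (cst T ^ T * R)) :
    ∃ (K' : Type) (_ : Field K') (F' : Filt K') (φ : K →+* K') (N' : ℕ) (ξ' : Fin N' → K')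
      (m' : ι → Fin N' → ℕ) (Q' : ι → K'[X]), Le F F' φ ∧ F'.Cons R ∧
        Comp F' (T * ω) (fun i => (f i).map φ) N' ξ' m' Q' ∧ ∃ a, ξ' a = φ y := by
  have hcst : 1 ≤ cst T := Nat.mul_pos (by positivity) (Nat.one_le_pow _ _ (by omega))
  refine completion_aux T ω hι hTR (by omega) hR ((Nat.le_mul_of_pos_left _ (by omega)).trans hTR)
    (∑ i, (f i).natDegree) F f y 1 (fun _ => y) (fun _ _ => 0) f
    ⟨Function.injective_of_subsingleton _, fun _ => hy, hm, hf, fun i => by simp⟩ rfl hT ⟨0, rfl⟩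
    (hC.mono ?_)
  gcongr
  omega

end Filt
end ENS
end

section
open MvPolynomial
open scoped Polynomial

namespace ENS
namespace Filt
variable {K : Type} [Field K]

/-- `x` is nonzero of sign `s` (with weight `w`) -/
def Sg (F : Filt K) (w : ℕ) (x : K) (s : ℤˣ) : Prop := x ≠ 0 ∧ (((s : ℤˣ) : ℤ) : K) * x ∈ F.C w

variable {F : Filt K}

theorem Sg.mono {w w' : ℕ} {x : K} {s : ℤˣ} (h : F.Sg w x s) (hw : w ≤ w') : F.Sg w' x s :=
  ⟨h.1, F.C_of_le hw h.2⟩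

theorem Sg.mul {w w' : ℕ} {x y : K} {s t : ℤˣ} (h : F.Sg w x s) (h' : F.Sg w' y t) :
    F.Sg (w + w') (x * y) (s * t) := by
  refine ⟨mul_ne_zero h.1 h'.1, ?_⟩
  have := F.mul_C h.2 h'.2
  convert this using 1
  push_cast; ring

theorem Sg.of_C {w : ℕ} {x : K} (h : x ∈ F.C w) (h0 : x ≠ 0) : F.Sg w x 1 := ⟨h0, by simpa using h⟩

theorem Sg.one_C {w : ℕ} {x : K} (h : F.Sg w x 1) : x ∈ F.C w := by simpa using h.2

theorem Sg.neg {w : ℕ} {x : K} {s : ℤˣ} (h : F.Sg w x s) : F.Sg w (-x) (-s) :=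
  ⟨neg_ne_zero.2 h.1, by simpa using h.2⟩

theorem Sg.one (w : ℕ) : F.Sg w (1 : K) 1 := Sg.of_C (F.one_C _) one_ne_zero

theorem Sg.pow {w : ℕ} {x : K} {s : ℤˣ} (h : F.Sg w x s) (n : ℕ) : F.Sg (n * w) (x ^ n) (s ^ n) := by
  induction n with
  | zero => simpa using Sg.one (F := F) 0
  | succ n ih => rw [pow_succ, pow_succ, Nat.succ_mul]; exact ih.mul h

theorem Sg.prod {α : Type*} (A : Finset α) (w : α → ℕ) (x : α → K) (s : α → ℤˣ)
    (h : ∀ a ∈ A, F.Sg (w a) (x a) (s a)) : F.Sg (∑ a ∈ A, w a) (∏ a ∈ A, x a) (∏ a ∈ A, s a) := by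
  classical
  induction A using Finset.induction_on with
  | empty => simpa using Sg.one (F := F) 0
  | insert a A ha ih =>
    rw [Finset.sum_insert ha, Finset.prod_insert ha, Finset.prod_insert ha]
    exact (h a (Finset.mem_insert_self _ _)).mul (ih fun b hb => h b (Finset.mem_insert_of_mem hb))

theorem Sg.add_zero {R w w' : ℕ} {x y : K} {s t : ℤˣ} (hC : F.Cons R) (h : F.Sg w x s) (h' : F.Sg w' y t)
    (hw : w ≤ R) (hw' : w' ≤ R) (hxy : x + y = 0) : t = -s := by
  have hs : (((s : ℤˣ) : ℤ) : K) ≠ 0 := by rcases Int.units_eq_one_or s with h | h <;> simp [h]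
  rcases Int.units_eq_one_or t with ht | ht <;> rcases Int.units_eq_one_or s with hs' | hs' <;>
    simp only [ht, hs', neg_neg]
  · subst ht hs'
    exact absurd (hC.add_zero h.one_C h'.one_C hw hw' hxy) h.1
  · subst ht hs'
    have h1 := h.2
    have h2 := h'.2
    simp only [Units.val_neg, Units.val_one, Int.cast_neg, Int.cast_one, neg_mul, one_mul] at h1 h2
    exact absurd (neg_eq_zero.1 (hC.add_zero h1 h2 hw hw' (by linear_combination -hxy))) h.1

theorem Sg.unique {R w w' : ℕ} {x : K} {s t : ℤˣ} (hC : F.Cons R) (h : F.Sg w x s) (h' : F.Sg w' x t)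
    (hw : w ≤ R) (hw' : w' ≤ R) : s = t := by
  have := Sg.add_zero hC h h'.neg hw hw' (by ring)
  rw [neg_inj] at this; exact this.symm

theorem natCast_C (F : Filt K) (n w : ℕ) : (n : K) ∈ F.C w := by
  induction n with
  | zero => simp [zero_mem]
  | succ n ih => push_cast; exact add_mem ih (F.one_C _)

theorem Sg.natCast {R : ℕ} (hC : F.Cons R) {n : ℕ} (hn : n ≠ 0) : F.Sg 0 (n : K) 1 := by
  refine Sg.of_C (natCast_C F n 0) ?_
  obtain ⟨n, rfl⟩ := Nat.exists_eq_succ_of_ne_zero hn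
  intro h
  push_cast at h
  rw [add_comm] at h
  exact one_ne_zero (hC.add_zero (F.one_C 0) (natCast_C F n 0) (Nat.zero_le _) (Nat.zero_le _) h)

/-- local data of a polynomial at a point -/
def Loc (F : Filt K) (w : ℕ) (x : K) (p : K[X]) (k : ℕ) (s : ℤˣ) : Prop :=
  ∃ g : K[X], p = (Polynomial.X - Polynomial.C x) ^ k * g ∧ F.Sg w (g.eval x) s

theorem Loc.mono {w w' : ℕ} {x : K} {p : K[X]} {k : ℕ} {s : ℤˣ} (h : F.Loc w x p k s) (hw : w ≤ w') :
    F.Loc w' x p k s := by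
  obtain ⟨g, h1, h2⟩ := h
  exact ⟨g, h1, h2.mono hw⟩

theorem Loc.mul {w w' : ℕ} {x : K} {p p' : K[X]} {k k' : ℕ} {s s' : ℤˣ} (h : F.Loc w x p k s)
    (h' : F.Loc w' x p' k' s') : F.Loc (w + w') x (p * p') (k + k') (s * s') := by
  obtain ⟨g, rfl, h2⟩ := h
  obtain ⟨g', rfl, h2'⟩ := h'
  refine ⟨g * g', by rw [pow_add]; ring, ?_⟩
  rw [Polynomial.eval_mul]; exact h2.mul h2'

theorem Loc.of_eval {w : ℕ} {x : K} {p : K[X]} {s : ℤˣ} (h : F.Sg w (p.eval x) s) : F.Loc w x p 0 s :=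
  ⟨p, by simp, h⟩

theorem Loc.C {w : ℕ} {x c : K} {s : ℤˣ} (h : F.Sg w c s) : F.Loc w x (Polynomial.C c) 0 s :=
  Loc.of_eval (by simpa using h)

theorem Loc.C_mul {w w' : ℕ} {x c : K} {p : K[X]} {k : ℕ} {s t : ℤˣ} (h : F.Loc w x p k s)
    (hc : F.Sg w' c t) : F.Loc (w' + w) x (Polynomial.C c * p) k (t * s) := by
  have := (Loc.C (x := x) hc).mul h
  rwa [zero_add] at this

theorem Loc.le_of_dvd {w : ℕ} {x : K} {p : K[X]} {k : ℕ} {s : ℤˣ} (h : F.Loc w x p k s) {j : ℕ}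
    (hd : (Polynomial.X - Polynomial.C x) ^ j ∣ p) : j ≤ k := by
  by_contra hlt
  obtain ⟨g, rfl, h2⟩ := h
  have h3 : (Polynomial.X - Polynomial.C x) ^ (k + 1) ∣ (Polynomial.X - Polynomial.C x) ^ k * g :=
    (pow_dvd_pow _ (by omega)).trans hd
  rw [pow_succ] at h3
  have h4 := (mul_dvd_mul_iff_left (pow_ne_zero _ (Polynomial.X_sub_C_ne_zero x))).1 h3
  exact h2.1 (Polynomial.dvd_iff_isRoot.1 h4)

theorem Loc.dvd {w : ℕ} {x : K} {p : K[X]} {k : ℕ} {s : ℤˣ} (h : F.Loc w x p k s) {j : ℕ} (hj : j ≤ k) :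
    (Polynomial.X - Polynomial.C x) ^ j ∣ p := by
  obtain ⟨g, rfl, h2⟩ := h
  exact (pow_dvd_pow _ hj).mul_right _

/-- if `p + q` vanishes to higher order than `p`, then `q` has the opposite local sign -/
theorem Loc.opp {R w w' : ℕ} {x : K} {p q : K[X]} {k k' : ℕ} {s t : ℤˣ} (hC : F.Cons R)
    (h : F.Loc w x p k s) (h' : F.Loc w' x q k' t) (hw : w ≤ R) (hw' : w' ≤ R)
    (hd : (Polynomial.X - Polynomial.C x) ^ (k + 1) ∣ p + q) : k' = k ∧ t = -s := by
  have hk1 : k ≤ k' := h'.le_of_dvd (by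
    have := dvd_sub ((pow_dvd_pow _ (Nat.le_succ k)).trans hd) (h.dvd le_rfl)
    simpa using this)
  have hk2 : k' ≤ k := by
    by_contra hlt
    have := dvd_sub hd (h'.dvd (j := k + 1) (by omega))
    have := h.le_of_dvd (j := k + 1) (by simpa using this)
    omega
  obtain rfl : k' = k := le_antisymm hk2 hk1
  refine ⟨rfl, ?_⟩
  obtain ⟨g, rfl, h2⟩ := h
  obtain ⟨g', rfl, h2'⟩ := h'
  rw [← mul_add, pow_succ] at hd
  have h4 := (mul_dvd_mul_iff_left (pow_ne_zero _ (Polynomial.X_sub_C_ne_zero x))).1 hd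
  have h5 : (g + g').eval x = 0 := Polynomial.dvd_iff_isRoot.1 h4
  rw [Polynomial.eval_add] at h5
  exact Sg.add_zero hC h2 h2' hw hw' h5

theorem Loc.unique {R w w' : ℕ} {x : K} {p : K[X]} {k k' : ℕ} {s t : ℤˣ} (hC : F.Cons R)
    (h : F.Loc w x p k s) (h' : F.Loc w' x p k' t) (hw : w ≤ R) (hw' : w' ≤ R) : k = k' ∧ s = t := by
  have h1 : F.Loc w' x (-p) k' (-t) := by
    obtain ⟨g, rfl, h2⟩ := h'
    exact ⟨-g, by ring, by rw [Polynomial.eval_neg]; exact h2.neg⟩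
  have := Loc.opp hC h h1 hw hw' (by simp)
  exact ⟨this.1.symm, by have := this.2; rw [neg_inj] at this; exact this.symm⟩

theorem Loc.derivative {R w : ℕ} {x : K} {p : K[X]} {k : ℕ} {s : ℤˣ} (hC : F.Cons R)
    (h : F.Loc w x p (k + 1) s) : F.Loc w x (Polynomial.derivative p) k s := by
  obtain ⟨g, rfl, h2⟩ := h
  refine ⟨Polynomial.C ((k + 1 : ℕ) : K) * g + (Polynomial.X - Polynomial.C x) * Polynomial.derivative g, ?_, ?_⟩
  · rw [Polynomial.derivative_mul, Polynomial.derivative_X_sub_C_pow, pow_succ]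
    simp only [Nat.add_sub_cancel]
    rw [Polynomial.C_eq_natCast]
    push_cast
    ring
  · have := (Sg.natCast hC (n := k + 1) (by omega)).mul h2
    simpa using this

theorem neg_one_pow_double (k : ℕ) : ((-1 : ℤ)) ^ (k + k) = 1 := Even.neg_one_pow ⟨k, rfl⟩

theorem sturm_comb (M : ℕ) (v : ℕ → ℕ) (s w : ℕ → ℤ) (μ : ℕ) (h0 : v M = μ)
    (h2 : ∀ i < M, v i = μ ∨ v (i + 1) = μ)
    (h3 : ∀ i, i + 1 < M → v (i + 1) ≠ μ → w (i + 1) * s (i + 2) = -(w i * s i)) :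
    ∑ i ∈ Finset.range M, w i * s i * s (i + 1) * (1 - (-1) ^ (v i + v (i + 1))) =
      if M = 0 then 0 else w 0 * s 0 * s 1 * (1 - (-1) ^ (v 0 + μ)) := by
  have hD : ∀ i ∈ Finset.range M, w i * s i * s (i + 1) * (1 - (-1) ^ (v i + v (i + 1))) =
      w i * s i * s (i + 1) * (1 - (-1) ^ (v i + μ)) + w i * s i * s (i + 1) * (1 - (-1) ^ (v (i + 1) + μ)) := by
    intro i hi
    rcases h2 i (Finset.mem_range.1 hi) with h | h
    · rw [h, neg_one_pow_double, add_comm μ]; ring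
    · rw [h, neg_one_pow_double]; ring
  rw [Finset.sum_congr rfl hD, Finset.sum_add_distrib]
  cases M with
  | zero => simp
  | succ M =>
    rw [Finset.sum_range_succ', Finset.sum_range_succ (fun i => w i * s i * s (i + 1) * (1 - (-1) ^ (v (i + 1) + μ))),
      h0, neg_one_pow_double]
    have : ∑ k ∈ Finset.range M, w (k + 1) * s (k + 1) * s (k + 1 + 1) * (1 - (-1) ^ (v (k + 1) + μ)) =
        - ∑ k ∈ Finset.range M, w k * s k * s (k + 1) * (1 - (-1) ^ (v (k + 1) + μ)) := by
      rw [← Finset.sum_neg_distrib]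
      refine Finset.sum_congr rfl fun i hi => ?_
      by_cases hv : v (i + 1) = μ
      · rw [hv, neg_one_pow_double]; ring
      · have := h3 i (by have := Finset.mem_range.1 hi; omega) hv
        linear_combination (s (i + 1) * (1 - (-1) ^ (v (i + 1) + μ))) * this
    rw [this]; simp

/-- multiplicities of roots with index at least `k` -/
def tail {N : ℕ} (m : Fin N → ℕ) (k : ℕ) : ℕ := ∑ b : Fin N, if k ≤ b then m b else 0

theorem tail_succ {N : ℕ} (m : Fin N → ℕ) (a : Fin N) : tail m a = m a + tail m (a + 1) := by
  classical
  rw [tail, tail, ← Finset.add_sum_erase _ _ (Finset.mem_univ a), ← Finset.add_sum_erase (a := a)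
    (f := fun b : Fin N => if (a : ℕ) + 1 ≤ b then m b else 0) _ (Finset.mem_univ a)]
  simp only [le_refl, if_true, Nat.not_succ_le_self, if_false, zero_add]
  congr 1
  refine Finset.sum_congr rfl fun b hb => ?_
  have : (b : ℕ) ≠ a := fun h => Finset.ne_of_mem_erase hb (Fin.ext h)
  have : ((a : ℕ) ≤ b) ↔ ((a : ℕ) + 1 ≤ b) := by omega
  simp [this]

theorem tail_zero {N : ℕ} (m : Fin N → ℕ) : tail m 0 = ∑ b, m b := by simp [tail]

theorem tail_top {N : ℕ} (m : Fin N → ℕ) : tail m N = 0 := by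
  rw [tail]
  refine Finset.sum_eq_zero fun b _ => ?_
  rw [if_neg (by omega)]

/-- a model: family of polynomials with known signs of leading coefficients, completely factored -/
structure Mdl (F : Filt K) (W R : ℕ) {ι : Type} (f : ι → K[X]) (κ : ι → ℤˣ) (N : ℕ) (ξ : Fin N → K)
    (m : ι → Fin N → ℕ) : Prop where
  cons : F.Cons R
  hWR : 4 * W ≤ R
  deg : ∀ i, ((-1 : ℤˣ)) ^ (f i).natDegree = (-1) ^ (tail (m i) 0)
  loc : ∀ i a, F.Loc W (ξ a) (f i) (m i a) (κ i * (-1) ^ tail (m i) (a + 1))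

theorem sum_tele {N : ℕ} (E : ℕ → ℤ) : ∑ a : Fin N, (E (a + 1) - E a) = E N - E 0 := by
  rw [Fin.sum_univ_eq_sum_range (fun a => E (a + 1) - E a), Finset.sum_range_sub]

/-- the Sturm-Tarski count -/
theorem sturm {W R : ℕ} {ι : Type} {f : ι → K[X]} {κ : ι → ℤˣ} {N : ℕ} {ξ : Fin N → K}
    {m : ι → Fin N → ℕ} (h : Mdl F W R f κ N ξ m) (M : ℕ) (S : ℕ → ι) (Q T : K[X])
    (a c : ℕ → K) (sa sc : ℕ → ℤˣ) (ha : ∀ i < M, F.Sg W (a i) (sa i)) (hc : ∀ i < M, F.Sg W (c i) (sc i))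
    (hT : T = Polynomial.derivative (f (S 0)) * Q)
    (h0 : 0 < M → f (S 0) ∣ Polynomial.C (a 0) * T + Polynomial.C (c 0) * f (S 1))
    (hrel : ∀ i, i + 1 < M → f (S (i + 1)) ∣ Polynomial.C (a (i + 1)) * f (S i) +
      Polynomial.C (c (i + 1)) * f (S (i + 2)))
    (hlast : ∀ i, i + 1 = M → f (S M) ∣ f (S i)) (hlast0 : M = 0 → f (S 0) ∣ T)
    (WQ : ℕ) (hWQ : 2 * W + WQ ≤ R)
    (τ : Fin N → ℤ) (hτ : ∀ b, (τ b = 0 ∧ Q.eval (ξ b) = 0) ∨ ∃ t : ℤˣ, τ b = (t : ℤˣ) ∧ F.Sg WQ (Q.eval (ξ b)) t) :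
    ∑ i ∈ Finset.range M, ((-∏ j ∈ Finset.range (i + 1), (sa j * sc j) : ℤˣ) : ℤ) * (κ (S i) : ℤˣ) * (κ (S (i + 1)) : ℤˣ) *
      (1 - (-1) ^ ((f (S i)).natDegree + (f (S (i + 1))).natDegree)) =
    2 * ∑ b, if m (S 0) b = 0 then 0 else τ b := by
  have hC := h.cons
  have hWR := h.hWR
  set w : ℕ → ℤ := fun i => ((-∏ j ∈ Finset.range (i + 1), (sa j * sc j) : ℤˣ) : ℤ) with hw
  let σ : ℕ → ℕ → ℤ := fun i k => ((κ (S i) * (-1) ^ tail (m (S i)) k : ℤˣ) : ℤ)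
  let E : ℕ → ℤ := fun k => ∑ i ∈ Finset.range M, w i * σ i k * σ (i + 1) k
  have hE : E N - E 0 = ∑ i ∈ Finset.range M, w i * (κ (S i) : ℤˣ) * (κ (S (i + 1)) : ℤˣ) *
      (1 - (-1) ^ ((f (S i)).natDegree + (f (S (i + 1))).natDegree)) := by
    simp only [E]
    rw [← Finset.sum_sub_distrib]
    refine Finset.sum_congr rfl fun i _ => ?_
    have hd : ∀ i, ((-1 : ℤ)) ^ (f i).natDegree = (-1) ^ (tail (m i) 0) := fun i => by
      have := congrArg (fun u : ℤˣ => (u : ℤ)) (h.deg i)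
      simpa using this
    rw [pow_add, hd, hd]
    simp only [σ, tail_top]
    push_cast
    ring
  rw [← hE, ← sum_tele, Finset.mul_sum]
  refine Finset.sum_congr rfl fun b _ => ?_
  -- local analysis at `ξ b`
  set x := ξ b
  set v : ℕ → ℕ := fun i => m (S i) b with hv
  set s : ℕ → ℤˣ := fun i => κ (S i) * (-1) ^ tail (m (S i)) (b + 1) with hs
  have hloc : ∀ i, F.Loc W x (f (S i)) (v i) (s i) := fun i => h.loc (S i) b
  have hEE : E (b + 1) - E b = ∑ i ∈ Finset.range M, w i * (s i : ℤˣ) * (s (i + 1) : ℤˣ) * (1 - (-1) ^ (v i + v (i + 1))) := by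
    simp only [E]
    rw [← Finset.sum_sub_distrib]
    refine Finset.sum_congr rfl fun i _ => ?_
    simp only [σ, tail_succ, hs, hv]
    push_cast
    rw [pow_add, pow_add, pow_add]
    ring
  have hCa : ∀ i < M, IsUnit (Polynomial.C (a i)) := fun i hi =>
    Polynomial.isUnit_C.2 (isUnit_iff_ne_zero.2 (ha i hi).1)
  have hCc : ∀ i < M, IsUnit (Polynomial.C (c i)) := fun i hi =>
    Polynomial.isUnit_C.2 (isUnit_iff_ne_zero.2 (hc i hi).1)
  -- divisibility propagates upwards
  have hup : ∀ j, ∀ k, k < M → (Polynomial.X - Polynomial.C x) ^ j ∣ f (S k) →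
      (Polynomial.X - Polynomial.C x) ^ j ∣ f (S (k + 1)) → (Polynomial.X - Polynomial.C x) ^ j ∣ f (S M) := by
    intro j k hk
    induction hn : M - k generalizing k with
    | zero => omega
    | succ n ih =>
      intro h1 h2
      by_cases hkM : k + 1 = M
      · rw [← hkM]; exact h2
      refine ih (k + 1) (by omega) (by omega) h2 ?_
      have h3 := h2.trans (hrel k (by omega))
      have h4 := (dvd_sub h3 (h1.mul_left (Polynomial.C (a (k + 1)))))
      rw [add_sub_cancel_left] at h4
      exact (hCc (k + 1) (by omega)).dvd_mul_left.1 h4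
  -- and downwards
  have hdown : ∀ n, ∀ k, k + n = M → f (S M) ∣ f (S k) ∧ (k < M → f (S M) ∣ f (S (k + 1))) := by
    intro n
    induction n with
    | zero => intro k hk; exact ⟨by rw [← hk, add_zero], fun h => by omega⟩
    | succ n ih =>
      intro k hk
      have h1 := ih (k + 1) (by omega)
      refine ⟨?_, fun _ => h1.1⟩
      by_cases hkM : k + 1 = M
      · exact hlast k hkM
      have h3 := h1.1.trans (hrel k (by omega))
      have h4 := (dvd_sub h3 ((h1.2 (by omega)).mul_left (Polynomial.C (c (k + 1)))))
      rw [add_sub_cancel_right] at h4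
      exact (hCa (k + 1) (by omega)).dvd_mul_left.1 h4
  have hge : ∀ k ≤ M, v M ≤ v k := fun k hk =>
    (hloc k).le_of_dvd (((hloc M).dvd le_rfl).trans (hdown (M - k) k (by omega)).1)
  have hmin : ∀ k < M, ∀ j, j ≤ v k → j ≤ v (k + 1) → j ≤ v M := fun k hk j h1 h2 =>
    (hloc M).le_of_dvd (hup j k hk ((hloc k).dvd h1) ((hloc (k + 1)).dvd h2))
  have h2' : ∀ i < M, v i = v M ∨ v (i + 1) = v M := by
    intro i hi
    have h1 := hge i (by omega)
    have h2 := hge (i + 1) (by omega)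
    have h3 := hmin i hi (min (v i) (v (i + 1))) (min_le_left _ _) (min_le_right _ _)
    rcases le_total (v i) (v (i + 1)) with h4 | h4
    · rw [min_eq_left h4] at h3; left; omega
    · rw [min_eq_right h4] at h3; right; omega
  rw [hEE, sturm_comb M v (fun i => ((s i : ℤˣ) : ℤ)) w (v M) rfl h2' ?_]
  · -- evaluation of the index
    change _ = 2 * if v 0 = 0 then 0 else τ b
    by_cases hv0 : v 0 = 0
    · have := hge 0 (Nat.zero_le _)
      rw [if_pos hv0]
      split_ifs
      · simp
      · rw [hv0, show v M = 0 by omega]; simp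
    rw [if_neg hv0]
    obtain ⟨k, hk⟩ := Nat.exists_eq_succ_of_ne_zero hv0
    rw [Nat.succ_eq_add_one] at hk
    have hl0 := hloc 0
    rw [hk] at hl0
    have hder := hl0.derivative hC
    rcases hτ b with ⟨hτ0, hQ0⟩ | ⟨t, hτt, hQt⟩
    · rw [hτ0]
      split_ifs with hM
      · simp
      · have hTd : (Polynomial.X - Polynomial.C x) ^ (v 0) ∣ T := by
          rw [hT, hk, pow_succ]
          exact mul_dvd_mul (hder.dvd le_rfl) (Polynomial.dvd_iff_isRoot.2 hQ0)
        have h3 := ((hloc 0).dvd le_rfl).trans (h0 (by omega))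
        have h4 := (dvd_sub h3 (hTd.mul_left (Polynomial.C (a 0))))
        rw [add_sub_cancel_left] at h4
        have h5 := hmin 0 (by omega) (v 0) le_rfl
          ((hloc 1).le_of_dvd ((hCc 0 (by omega)).dvd_mul_left.1 h4))
        have h6 := hge 0 (by omega)
        rw [show v M = v 0 by omega, neg_one_pow_double]; simp
    · have hTl : F.Loc (W + WQ) x T k (s 0 * t) := by
        rw [hT]
        have := hder.mul (Loc.of_eval hQt)
        rwa [add_zero] at this
      split_ifs with hM
      · have := hTl.le_of_dvd (((hloc 0).dvd le_rfl).trans (hlast0 hM))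
        omega
      · have h3 := ((hloc 0).dvd le_rfl).trans (h0 (by omega))
        rw [hk] at h3
        have h4 := Loc.opp hC (hTl.C_mul (ha 0 (by omega))) ((hloc 1).C_mul (hc 0 (by omega)))
          (by omega) (by omega) h3
        have hvM : v M = k := by
          rcases h2' 0 (by omega) with h5 | h5
          · have := hge 1 (by omega)
            omega
          · rw [zero_add] at h5; omega
        rw [hτt, hvM, hk, show k + 1 + k = (k + k) + 1 by ring, pow_succ, neg_one_pow_double]
        have h5 : w 0 * ((s 0 : ℤˣ) : ℤ) * ((s 1 : ℤˣ) : ℤ) = ((t : ℤˣ) : ℤ) := by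
          have h6 : -(sa 0 * sc 0) * s 0 * s 1 = t := by
            have h7 : s 1 = sc 0 * -(sa 0 * (s 0 * t)) := by
              rw [← h4.2, ← mul_assoc, Int.units_mul_self, one_mul]
            rw [h7]
            have e1 := Int.units_mul_self (sc 0)
            have e2 := Int.units_mul_self (sa 0)
            have e3 := Int.units_mul_self (s 0)
            calc -(sa 0 * sc 0) * s 0 * (sc 0 * -(sa 0 * (s 0 * t)))
                = (sc 0 * sc 0) * (sa 0 * sa 0) * (s 0 * s 0) * t := by
                  rw [mul_neg, neg_mul, mul_neg, neg_mul, neg_neg]; ac_rfl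
              _ = t := by rw [e1, e2, e3]; simp
          rw [← h6, hw]
          simp
        rw [h5]; ring
  · intro i hi hvi
    rcases h2' i (by omega) with h5 | h5
    swap
    · exact absurd h5 hvi
    rcases h2' (i + 1) hi with h6 | h6
    · exact absurd h6 hvi
    have h7 : v M + 1 ≤ v (i + 1) := by have := hge (i + 1) (by omega); omega
    have h8 := Loc.opp hC ((hloc i).C_mul (ha (i + 1) hi)) ((hloc (i + 2)).C_mul (hc (i + 1) hi))
      (by omega) (by omega) (((hloc (i + 1)).dvd (by omega)).trans (hrel i hi))
    have h9 : s (i + 2) = sc (i + 1) * -(sa (i + 1) * s i) := by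
      rw [← h8.2, ← mul_assoc, Int.units_mul_self, one_mul]
    have h10 : (-∏ j ∈ Finset.range (i + 1 + 1), (sa j * sc j)) * s (i + 2) =
        - ((-∏ j ∈ Finset.range (i + 1), (sa j * sc j)) * s i) := by
      rw [Finset.prod_range_succ, h9]
      have e1 := Int.units_mul_self (sc (i + 1))
      have e2 := Int.units_mul_self (sa (i + 1))
      calc _ = (∏ j ∈ Finset.range (i + 1), (sa j * sc j)) * ((sa (i + 1) * sa (i + 1)) *
            (sc (i + 1) * sc (i + 1))) * s i := by
            rw [mul_neg, neg_mul, mul_neg, neg_neg]; ac_rfl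
        _ = _ := by rw [e1, e2]; simp
    have := congrArg (fun u : ℤˣ => (u : ℤ)) h10
    simpa [hw] using this

end Filt
end ENS
end

section
open MvPolynomial
open scoped Polynomial

namespace ENS

set_option linter.unusedSectionVars false

section Kernel
variable {A : Type*} [CommRing A] [IsDomain A] {B : ℕ → AddSubgroup A}

theorem pow_gr (h : IsGr B) {n : Type*} [Fintype n] [DecidableEq n] (M : Matrix n n A) (δ : ℕ)
    (hM : ∀ i j, M i j ∈ B δ) (k : ℕ) : ∀ i j, (M ^ k) i j ∈ B (k * δ) := by
  induction k with
  | zero =>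
    intro i j
    rw [pow_zero, Matrix.one_apply]
    split_ifs
    · exact h.one' _
    · exact zero_mem _
  | succ k ih =>
    intro i j
    rw [pow_succ, Matrix.mul_apply]
    refine AddSubgroup.sum_mem _ fun l _ => ?_
    rw [Nat.succ_mul]
    exact h.mul (ih i l) (hM l j)

/-- bounded kernel vectors of singular square matrices -/
theorem kernel_sq (h : IsGr B) {n : Type*} [Fintype n] [DecidableEq n] (M : Matrix n n A) (δ : ℕ)
    (hM : ∀ i j, M i j ∈ B δ) (hdet : M.det = 0) :
    ∃ x : n → A, x ≠ 0 ∧ (∀ i, x i ∈ B (Fintype.card n * δ)) ∧ M.mulVec x = 0 := by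
  classical
  have hχ : M.charpoly ≠ 0 := (Matrix.charpoly_monic M).ne_zero
  obtain ⟨χ, hχ1, hχ0⟩ := Polynomial.exists_eq_pow_rootMultiplicity_mul_and_not_dvd M.charpoly hχ 0
  set κ := M.charpoly.rootMultiplicity 0
  rw [Polynomial.C_0, sub_zero] at hχ1 hχ0
  have hc0 : χ.coeff 0 ≠ 0 := fun h0 => hχ0 (Polynomial.X_dvd_iff.2 h0)
  have hN : Polynomial.aeval M χ ≠ 0 := by
    intro h0
    obtain ⟨q, hq⟩ := Polynomial.X_dvd_sub_C (p := χ)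
    have h1 : M * Polynomial.aeval M q = -(algebraMap A (Matrix n n A) (χ.coeff 0)) := by
      have := congrArg (Polynomial.aeval M) hq
      rw [map_sub, h0, Polynomial.aeval_C, map_mul, Polynomial.aeval_X, zero_sub] at this
      exact this.symm
    have h2 := congrArg Matrix.det h1
    rw [Matrix.det_mul, hdet, zero_mul, Matrix.det_neg, Matrix.algebraMap_eq_diagonal, Matrix.det_diagonal] at h2
    simp [hc0] at h2
  have hex : ∃ j, M ^ j * Polynomial.aeval M χ = 0 := by
    refine ⟨κ, ?_⟩
    have := Matrix.aeval_self_charpoly M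
    rw [hχ1] at this
    simpa using this
  have hκ : Nat.find hex ≤ κ := Nat.find_min' hex (by
    have := Matrix.aeval_self_charpoly M
    rw [hχ1] at this
    simpa using this)
  have hpos : Nat.find hex ≠ 0 := by
    intro h0
    have := Nat.find_spec hex
    rw [h0, pow_zero, one_mul] at this
    exact hN this
  obtain ⟨j, hj⟩ := Nat.exists_eq_succ_of_ne_zero hpos
  have hj0 : M ^ j * Polynomial.aeval M χ ≠ 0 := Nat.find_min hex (by omega)
  have hj1 : M * (M ^ j * Polynomial.aeval M χ) = 0 := by
    have := Nat.find_spec hex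
    rw [hj, pow_succ', mul_assoc] at this
    exact this
  set Z := M ^ j * Polynomial.aeval M χ with hZ
  have hZB : ∀ i k, Z i k ∈ B (Fintype.card n * δ) := by
    intro i k
    rw [hZ, Polynomial.aeval_eq_sum_range, Finset.mul_sum, Matrix.sum_apply]
    refine AddSubgroup.sum_mem _ fun l _ => ?_
    rw [mul_smul_comm, ← pow_add, Matrix.smul_apply, smul_eq_mul]
    have h1 : χ.coeff l ∈ Bz B δ (Fintype.card n * δ) (l + κ) := by
      have := charpoly_gr h M δ hM (l + κ)
      rw [hχ1, Polynomial.coeff_X_pow_mul] at this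
      exact this
    rcases Bz_elim h1 with h2 | ⟨s, hs, h2⟩
    · rw [h2, zero_mul]; exact zero_mem _
    · refine h.le ?_ (h.mul h2 (pow_gr h M δ hM (j + l) i k))
      rw [← hs]
      have : (j + l) * δ ≤ (l + κ) * δ := Nat.mul_le_mul_right _ (by omega)
      omega
  obtain ⟨k, hk⟩ : ∃ k, Z.col k ≠ 0 := by
    by_contra hcon
    push Not at hcon
    exact hj0 (by ext i k; exact congrFun (hcon k) i)
  refine ⟨Z.col k, hk, fun i => hZB i k, ?_⟩
  ext i
  have := congrFun (congrFun hj1 i) k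
  simpa [Matrix.mul_apply, Matrix.mulVec, dotProduct] using this

/-- bounded kernel vectors -/
theorem kernel (h : IsGr B) {m n : Type*} [Fintype m] [Fintype n] (M : Matrix m n A) (δ : ℕ)
    (hM : ∀ i j, M i j ∈ B δ) (hcard : Fintype.card m < Fintype.card n) :
    ∃ x : n → A, x ≠ 0 ∧ (∀ i, x i ∈ B (Fintype.card n * δ)) ∧ M.mulVec x = 0 := by
  classical
  obtain ⟨e⟩ := Function.Embedding.nonempty_of_card_le hcard.le
  obtain ⟨i0, hi0⟩ : ∃ i0, i0 ∉ Set.range e := by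
    by_contra hcon
    push Not at hcon
    have := Fintype.card_le_of_surjective e hcon
    omega
  let N : Matrix n n A := Function.extend e M 0
  have hNe : ∀ i, N (e i) = M i := fun i => e.injective.extend_apply _ _ _
  have hN0 : ∀ i, i ∉ Set.range e → N i = 0 := fun i hi => Function.extend_apply' _ _ _ (by simpa using hi)
  obtain ⟨x, hx0, hxB, hx⟩ := kernel_sq h N δ (fun i j => by
    by_cases hi : i ∈ Set.range e
    · obtain ⟨i', rfl⟩ := hi
      rw [hNe]; exact hM _ _
    · rw [hN0 i hi]; exact zero_mem _) (Matrix.det_eq_zero_of_row_eq_zero i0 fun j => by rw [hN0 i0 hi0]; rfl)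
  refine ⟨x, hx0, hxB, ?_⟩
  ext i
  have := congrFun hx (e i)
  simp only [Matrix.mulVec] at this ⊢
  rw [hNe] at this
  exact this

theorem WP0 {r : ℕ} {f : A[X]} : f ∈ WP B 0 r ↔ ∀ j, f.coeff j ∈ B r := by
  rw [mem_WP]; simp [Bz]

/-- pseudo-division -/
theorem prem (h : IsGr B) (H : A[X]) {δH : ℕ} (hH : H ∈ WP B 0 δH) (hH0 : H ≠ 0) (e : ℕ) : ∀ (G : A[X]) (δG : ℕ), G ∈ WP B 0 δG →
    G.degree < ((H.natDegree + e : ℕ) : WithBot ℕ) →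
    ∃ R : A[X], R ∈ WP B 0 (δG + e * δH) ∧ R.degree < H.degree ∧ H ∣ Polynomial.C (H.leadingCoeff ^ e) * G - R := by
  induction e with
  | zero =>
    intro G δG hG hd
    refine ⟨G, by simpa using hG, ?_, by simp⟩
    rwa [Polynomial.degree_eq_natDegree hH0]
  | succ e ih =>
    intro G δG hG hd
    set G1 := Polynomial.C H.leadingCoeff * G - Polynomial.monomial e (G.coeff (H.natDegree + e)) * H with hG1
    have hlc : H.leadingCoeff ∈ B δH := WP0.1 hH _
    obtain ⟨R, hR, hRd, hRe⟩ := ih G1 (δG + δH) (by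
      refine sub_mem ?_ ?_
      · rw [add_comm]; exact (WP_gr h).mul (WP_C h hlc) hG
      · exact (WP_gr h).mul (WP_monomial h (s := δG) (by simp) (WP0.1 hG _)) hH) (by
      rw [Polynomial.degree_lt_iff_coeff_zero]
      intro k hk
      rw [hG1, Polynomial.coeff_sub, Polynomial.coeff_C_mul]
      obtain ⟨k', rfl⟩ := Nat.exists_eq_add_of_le hk
      rw [show H.natDegree + e + k' = (H.natDegree + k') + e by ring, Polynomial.coeff_monomial_mul]
      rcases Nat.eq_zero_or_pos k' with h0 | h0
      · subst h0; rw [add_zero, Polynomial.coeff_natDegree]; ring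
      · rw [Polynomial.coeff_eq_zero_of_natDegree_lt (p := H) (by omega), mul_zero, sub_zero]
        rw [(Polynomial.degree_lt_iff_coeff_zero G _).1 hd _ (by omega), mul_zero])
    refine ⟨R, (WP_gr h).le (by rw [Nat.succ_mul]; omega) hR, hRd, ?_⟩
    have : Polynomial.C (H.leadingCoeff ^ (e + 1)) * G - R = (Polynomial.C (H.leadingCoeff ^ e) * G1 - R) +
      (Polynomial.C (H.leadingCoeff ^ e) * Polynomial.monomial e (G.coeff (H.natDegree + e))) * H := by
      rw [hG1, pow_succ, map_mul]; ring
    rw [this]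
    exact dvd_add hRe (Dvd.intro_left _ rfl)

theorem sum_monomial_coeff {u : ℕ} (x : Fin (u + 1) → A) (P : A[X]) (k : ℕ) :
    ((∑ j : Fin (u + 1), Polynomial.monomial (j : ℕ) (x j)) * P).coeff k =
      ∑ j : Fin (u + 1), (Polynomial.X ^ (j : ℕ) * P).coeff k * x j := by
  rw [Finset.sum_mul, Polynomial.finsetSum_coeff]
  refine Finset.sum_congr rfl fun j _ => ?_
  rw [← Polynomial.C_mul_X_pow_eq_monomial, mul_assoc, Polynomial.coeff_C_mul, mul_comm]

theorem sum_monomial_deg {u : ℕ} (x : Fin (u + 1) → A) :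
    (∑ j : Fin (u + 1), Polynomial.monomial (j : ℕ) (x j)).natDegree ≤ u :=
  Polynomial.natDegree_sum_le_of_forall_le _ _ fun j _ =>
    (Polynomial.natDegree_monomial_le _).trans (by omega)

theorem sum_monomial_coeff' {u : ℕ} (x : Fin (u + 1) → A) (i : Fin (u + 1)) :
    (∑ j : Fin (u + 1), Polynomial.monomial (j : ℕ) (x j)).coeff i = x i := by
  rw [Polynomial.finsetSum_coeff, Finset.sum_eq_single i]
  · simp
  · intro j _ hj
    rw [Polynomial.coeff_monomial, if_neg (by omega)]
  · simp

theorem bez (h : IsGr B) {P S : A[X]} {δ k u v : ℕ} (hP : P ∈ WP B 0 δ) (hS : S ∈ WP B 0 δ)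
    (hPd : P.natDegree ≤ k + v) (hSd : S.natDegree ≤ k + u) :
    ∃ U V : A[X], (U ≠ 0 ∨ V ≠ 0) ∧ V.natDegree ≤ v ∧ U * P + V * S ∈ WP B 0 ((u + v + 3) * δ) ∧
      (U * P + V * S).degree < (k : WithBot ℕ) := by
  classical
  have hcf : ∀ {P : A[X]}, P ∈ WP B 0 δ → ∀ j i, (Polynomial.X ^ j * P).coeff i ∈ B δ := by
    intro P hP j i
    rw [Polynomial.coeff_X_pow_mul']
    split_ifs
    · exact WP0.1 hP _
    · exact zero_mem _
  let N : Matrix (Fin (u + v + 1)) (Fin (u + 1) ⊕ Fin (v + 1)) A := fun i => Sum.elim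
    (fun j => (Polynomial.X ^ (j : ℕ) * P).coeff (k + i)) (fun j => (Polynomial.X ^ (j : ℕ) * S).coeff (k + i))
  obtain ⟨x, hx0, hxB, hx⟩ := kernel h N δ (fun i j => by
    cases j
    · exact hcf hP _ _
    · exact hcf hS _ _) (by simp; omega)
  have hcard : Fintype.card (Fin (u + 1) ⊕ Fin (v + 1)) = u + v + 2 := by simp; omega
  rw [hcard] at hxB
  set U := ∑ j : Fin (u + 1), Polynomial.monomial (j : ℕ) (x (Sum.inl j)) with hU
  set V := ∑ j : Fin (v + 1), Polynomial.monomial (j : ℕ) (x (Sum.inr j)) with hV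
  have hUd : U.natDegree ≤ u := sum_monomial_deg _
  have hVd : V.natDegree ≤ v := sum_monomial_deg _
  refine ⟨U, V, ?_, hVd, ?_, ?_⟩
  · by_contra hcon
    push Not at hcon
    apply hx0
    ext i
    cases i with
    | inl i => rw [← sum_monomial_coeff' (fun j => x (Sum.inl j)) i, ← hU, hcon.1]; simp
    | inr i => rw [← sum_monomial_coeff' (fun j => x (Sum.inr j)) i, ← hV, hcon.2]; simp
  · have e : (u + v + 3) * δ = (u + v + 2) * δ + δ := by ring
    rw [e]
    refine add_mem ((WP_gr h).mul ?_ hP) ((WP_gr h).mul ?_ hS)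
    · exact AddSubgroup.sum_mem _ fun j _ => WP_monomial h (by simp) (hxB _)
    · exact AddSubgroup.sum_mem _ fun j _ => WP_monomial h (by simp) (hxB _)
  · rw [Polynomial.degree_lt_iff_coeff_zero]
    intro i hi
    obtain ⟨i', rfl⟩ := Nat.exists_eq_add_of_le hi
    by_cases hi' : i' < u + v + 1
    · have := congrFun hx ⟨i', hi'⟩
      simp only [Matrix.mulVec, dotProduct, Fintype.sum_sum_type, N, Sum.elim_inl, Sum.elim_inr] at this
      rw [Polynomial.coeff_add, hU, hV, sum_monomial_coeff, sum_monomial_coeff]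
      exact this
    · refine Polynomial.coeff_eq_zero_of_natDegree_lt ?_
      refine lt_of_le_of_lt ((Polynomial.natDegree_add_le_of_degree_le (n := k + u + v) ?_ ?_)) (by omega)
      · exact Polynomial.natDegree_mul_le.trans (by omega)
      · exact Polynomial.natDegree_mul_le.trans (by omega)

end Kernel

/-- uniqueness of bounded Bezout combinations -/
theorem bez_unique {k : Type*} [Field k] {P S U1 V1 U2 V2 U' V' : k[X]} {ε : k} (hε : ε ≠ 0)
    (hdet : U' * V2 - U2 * V' = Polynomial.C ε) (hV2 : V2 ≠ 0) {η : ℕ}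
    (hP : V2.natDegree + η = P.natDegree) (hP0 : P ≠ 0)
    (hV1 : V1.natDegree ≤ V2.natDegree) (h1 : (U1 * P + V1 * S).degree < (η : WithBot ℕ))
    (h2 : (U2 * P + V2 * S).degree < (η : WithBot ℕ)) (hne : U1 ≠ 0 ∨ V1 ≠ 0) :
    ∃ β : k, β ≠ 0 ∧ U1 = Polynomial.C β * U2 ∧ V1 = Polynomial.C β * V2 := by
  have hα : U1 * V2 - U2 * V1 = 0 := by
    by_contra hα
    have e : (U1 * P + V1 * S) * V2 - (U2 * P + V2 * S) * V1 = (U1 * V2 - U2 * V1) * P := by ring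
    have hd : ((U1 * P + V1 * S) * V2 - (U2 * P + V2 * S) * V1).degree < (P.natDegree : WithBot ℕ) := by
      have aux : ∀ f V : k[X], f.degree < (η : WithBot ℕ) → V.natDegree ≤ V2.natDegree →
          (f * V).degree < (P.natDegree : WithBot ℕ) := by
        intro f V hf hV
        by_cases hf0 : f = 0
        · subst hf0; rw [zero_mul, Polynomial.degree_zero]; exact WithBot.bot_lt_coe _
        · refine lt_of_le_of_lt Polynomial.degree_le_natDegree ?_
          rw [Nat.cast_lt]
          have := (Polynomial.natDegree_lt_iff_degree_lt hf0).2 hf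
          have := Polynomial.natDegree_mul_le (p := f) (q := V)
          omega
      exact lt_of_le_of_lt (Polynomial.degree_sub_le _ _) (max_lt (aux _ _ h1 le_rfl) (aux _ _ h2 hV1))
    rw [e, Polynomial.degree_mul, Polynomial.degree_eq_natDegree hP0, Polynomial.degree_eq_natDegree hα] at hd
    have : P.natDegree < P.natDegree := by
      have h3 : (((U1 * V2 - U2 * V1).natDegree + P.natDegree : ℕ) : WithBot ℕ) < (P.natDegree : WithBot ℕ) := by
        exact_mod_cast hd
      have := Nat.cast_lt.1 h3
      omega
    omega
  have e1 : V1 = V2 * (Polynomial.C ε⁻¹ * (V1 * U' - U1 * V')) := by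
    have : Polynomial.C ε * V1 = V2 * (V1 * U' - U1 * V') := by
      rw [← hdet]; linear_combination V' * hα
    calc V1 = Polynomial.C ε⁻¹ * (Polynomial.C ε * V1) := by
          rw [← mul_assoc, ← map_mul, inv_mul_cancel₀ hε, map_one, one_mul]
      _ = _ := by rw [this]; ring
  set W := Polynomial.C ε⁻¹ * (V1 * U' - U1 * V')
  have e2 : U1 = W * U2 := by
    apply mul_right_cancel₀ hV2
    rw [e1] at hα
    linear_combination hα
  have hW0 : W ≠ 0 := by
    rintro hW
    rw [hW] at e1 e2
    rcases hne with h | h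
    · exact h (by rw [e2, zero_mul])
    · exact h (by rw [e1, mul_zero])
  have hWd : W.natDegree = 0 := by
    rw [e1, Polynomial.natDegree_mul hV2 hW0] at hV1
    omega
  rw [Polynomial.eq_C_of_natDegree_eq_zero hWd] at e1 e2 hW0
  exact ⟨W.coeff 0, by simpa using hW0, e2, by rw [mul_comm]; exact e1⟩

structure Chain {A : Type*} [CommRing A] (B : ℕ → AddSubgroup A) (Δ Δ' D M : ℕ) (S : ℕ → A[X]) (a c : ℕ → A) :
    Prop where
  pos : 1 ≤ M
  S0 : ∀ i, S i ≠ 0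
  SB : ∀ i, S i ∈ WP B 0 Δ
  Sd : ∀ i, (S i).natDegree ≤ D
  a0 : ∀ i, a i ≠ 0
  aB : ∀ i, a i ∈ B Δ'
  c0 : ∀ i, c i ≠ 0
  cB : ∀ i, c i ∈ B Δ'
  rel : ∀ i, i + 1 < M → S (i + 1) ∣ Polynomial.C (a (i + 1)) * S i + Polynomial.C (c (i + 1)) * S (i + 2)
  last : ∀ i, i + 1 = M → S M ∣ Polynomial.C (a M) * S i

theorem Chain.cons {A : Type*} [CommRing A] {B : ℕ → AddSubgroup A} {Δ Δ' D M : ℕ} {S : ℕ → A[X]} {a c : ℕ → A}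
    (h : Chain B Δ Δ' D M S a c) {G : A[X]} (hG0 : G ≠ 0) (hGB : G ∈ WP B 0 Δ) (hGd : G.natDegree ≤ D)
    {a1 c1 : A} (ha0 : a1 ≠ 0) (haB : a1 ∈ B Δ') (hc0 : c1 ≠ 0) (hcB : c1 ∈ B Δ')
    (hrel : S 0 ∣ Polynomial.C a1 * G + Polynomial.C c1 * S 1) :
    Chain B Δ Δ' D (M + 1) (fun i => Nat.casesOn i G S)
      (fun i => Nat.casesOn i a1 fun j => Nat.casesOn j a1 fun j => a (j + 1))
      (fun i => Nat.casesOn i c1 fun j => Nat.casesOn j c1 fun j => c (j + 1)) where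
  pos := by omega
  S0 := fun i => by cases i; exacts [hG0, h.S0 _]
  SB := fun i => by cases i; exacts [hGB, h.SB _]
  Sd := fun i => by cases i; exacts [hGd, h.Sd _]
  a0 := fun i => by rcases i with _ | _ | i; exacts [ha0, ha0, h.a0 _]
  aB := fun i => by rcases i with _ | _ | i; exacts [haB, haB, h.aB _]
  c0 := fun i => by rcases i with _ | _ | i; exacts [hc0, hc0, h.c0 _]
  cB := fun i => by rcases i with _ | _ | i; exacts [hcB, hcB, h.cB _]
  rel := fun i hi => by
    rcases i with _ | i
    · exact hrel
    · exact h.rel i (by omega)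
  last := fun i hi => by
    have := h.pos
    obtain rfl : i = M := by omega
    obtain ⟨j, rfl⟩ : ∃ j, i = j + 1 := ⟨i - 1, by omega⟩
    exact h.last j rfl

section Euclid
variable {A : Type*} [CommRing A] [IsDomain A] {B : ℕ → AddSubgroup A}

theorem euclid_loop (h : IsGr B) {P S1 : A[X]} {δ Δ Δ' : ℕ} (hP : P ∈ WP B 0 δ) (hS : S1 ∈ WP B 0 δ) (hP0 : P ≠ 0)
    (hSP : S1.natDegree ≤ P.natDegree) (hΔ : Δ = (2 * P.natDegree + 3) * δ) (hΔ' : Δ' = (P.natDegree + 2) * Δ) (n : ℕ) :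
    ∀ G H : A[X], H.natDegree = n → H ≠ 0 → G ∈ WP B 0 Δ → H ∈ WP B 0 Δ → G.natDegree ≤ P.natDegree →
    H.degree < G.degree → H.natDegree ≤ S1.natDegree →
    (∃ U V U' V' : (FractionRing A)[X], ∃ ε : FractionRing A, ε ≠ 0 ∧
      G.map (algebraMap A (FractionRing A)) = U * P.map (algebraMap A (FractionRing A)) +
        V * S1.map (algebraMap A (FractionRing A)) ∧
      H.map (algebraMap A (FractionRing A)) = U' * P.map (algebraMap A (FractionRing A)) +
        V' * S1.map (algebraMap A (FractionRing A)) ∧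
      U * V' - U' * V = Polynomial.C ε ∧ V' ≠ 0 ∧ V'.natDegree + G.natDegree = P.natDegree ∧ V.degree < V'.degree) →
    ∃ M S a c, Chain B Δ Δ' P.natDegree M S a c ∧ S 0 = G ∧ S 1 = H ∧ M ≤ n + 1 := by
  set φ := algebraMap A (FractionRing A) with hφdef
  have hφ : Function.Injective φ := IsFractionRing.injective A (FractionRing A)
  have hmap : Function.Injective (Polynomial.map φ) := Polynomial.map_injective φ hφ
  induction n using Nat.strong_induction_on with
  | _ n ih =>
  intro G H hHn hH0 hGB hHB hGd hHG hHS hst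
  obtain ⟨U, V, U', V', ε, hε, hG, hH, hdet, hV'0, hV'd, hVV'⟩ := hst
  have hG0 : G ≠ 0 := by rintro rfl; simp at hHG
  have hndHG : H.natDegree < G.natDegree := Polynomial.natDegree_lt_natDegree hH0 hHG
  set e := P.natDegree + 1 with he
  set lc := H.leadingCoeff with hlc
  have hlc0 : lc ≠ 0 := Polynomial.leadingCoeff_ne_zero.2 hH0
  have hlcB : lc ∈ B Δ := WP0.1 hHB _
  obtain ⟨R, hRB, hRd, q, hq⟩ := prem h H hHB hH0 e G Δ hGB (by
    refine lt_of_le_of_lt Polynomial.degree_le_natDegree ?_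
    rw [Nat.cast_lt]; omega)
  by_cases hR0 : R = 0
  · refine ⟨1, fun i => Nat.casesOn i G fun _ => H, fun _ => lc ^ e, fun _ => 1, ?_, rfl, rfl, by omega⟩
    refine ⟨le_rfl, ?_, ?_, ?_, ?_, ?_, ?_, ?_, ?_, ?_⟩
    · intro i; cases i; exacts [hG0, hH0]
    · intro i; cases i; exacts [hGB, hHB]
    · intro i; cases i
      · exact hGd
      · simp only; omega
    · intro i; exact pow_ne_zero _ hlc0
    · intro i; exact h.le (by rw [hΔ', he]; exact Nat.mul_le_mul_right _ (by omega)) (h.pow hlcB e)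
    · intro i; exact one_ne_zero
    · intro i; exact h.one' _
    · intro i hi; omega
    · intro i hi
      obtain rfl : i = 0 := by omega
      rw [hR0, sub_zero] at hq
      exact ⟨q, hq⟩
  -- cofactors of the pseudo-remainder
  have hq0 : q ≠ 0 := by
    rintro rfl
    rw [mul_zero, sub_eq_zero] at hq
    have := congrArg Polynomial.degree hq
    rw [Polynomial.degree_C_mul (pow_ne_zero _ hlc0)] at this
    exact absurd (hHG.trans_eq this) (not_lt.2 hRd.le)
  have hqd : H.natDegree + q.natDegree = G.natDegree := by
    rw [← Polynomial.natDegree_mul hH0 hq0, ← hq]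
    rw [Polynomial.natDegree_sub_eq_left_of_natDegree_lt, Polynomial.natDegree_C_mul (pow_ne_zero _ hlc0)]
    rw [Polynomial.natDegree_C_mul (pow_ne_zero _ hlc0)]
    exact Polynomial.natDegree_lt_natDegree hR0 (hRd.trans hHG)
  set L := φ (lc ^ e) with hL
  have hL0 : L ≠ 0 := by rw [hL, Ne, map_eq_zero_iff φ hφ]; exact pow_ne_zero _ hlc0
  set qh := q.map φ with hqh
  have hqh0 : qh ≠ 0 := by rw [hqh]; exact (Polynomial.map_ne_zero_iff hφ).2 hq0
  have hqhd : qh.natDegree = q.natDegree := Polynomial.natDegree_map_eq_of_injective hφ _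
  set U2 := Polynomial.C L * U - qh * U' with hU2
  set V2 := Polynomial.C L * V - qh * V' with hV2
  have hR : R.map φ = U2 * P.map φ + V2 * S1.map φ := by
    have h1 : R = Polynomial.C (lc ^ e) * G - H * q := by rw [← hq]; ring
    rw [h1, Polynomial.map_sub, Polynomial.map_mul, Polynomial.map_mul, Polynomial.map_C, hG, hH, hU2, hV2]
    ring
  have hVlt : (Polynomial.C L * V).degree < (qh * V').degree := by
    rw [Polynomial.degree_C_mul hL0]
    refine hVV'.trans_le ?_
    rw [mul_comm]
    exact Polynomial.degree_le_mul_left _ hqh0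
  have hV2d' : V2.degree = (qh * V').degree := by
    rw [hV2]
    exact Polynomial.degree_sub_eq_right_of_degree_lt hVlt
  have hqV0 : qh * V' ≠ 0 := mul_ne_zero hqh0 hV'0
  have hV20 : V2 ≠ 0 := by
    intro h0
    rw [h0, Polynomial.degree_zero] at hV2d'
    exact hqV0 (Polynomial.degree_eq_bot.1 hV2d'.symm)
  have hV2d : V2.natDegree + H.natDegree = P.natDegree := by
    rw [Polynomial.natDegree_eq_of_degree_eq hV2d', Polynomial.natDegree_mul hqh0 hV'0, hqhd]
    omega
  have hdet2 : U' * V2 - U2 * V' = Polynomial.C (-(L * ε)) := by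
    rw [map_neg, map_mul, ← hdet, hU2, hV2]; ring
  have hε2 : -(L * ε) ≠ 0 := neg_ne_zero.2 (mul_ne_zero hL0 hε)
  obtain ⟨U1, V1, hne, hV1d, hFB, hFd⟩ := bez h (k := H.natDegree) (u := S1.natDegree - H.natDegree)
    (v := P.natDegree - H.natDegree) hP hS (by omega) (by omega)
  set F := U1 * P + V1 * S1 with hF
  have hFm : F.map φ = U1.map φ * P.map φ + V1.map φ * S1.map φ := by
    rw [hF, Polynomial.map_add, Polynomial.map_mul, Polynomial.map_mul]
  have hdegm : ∀ f : A[X], (f.map φ).degree = f.degree := fun f => Polynomial.degree_map_eq_of_injective hφ f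
  have hndm : ∀ f : A[X], (f.map φ).natDegree = f.natDegree := fun f => Polynomial.natDegree_map_eq_of_injective hφ f
  obtain ⟨β, hβ, e1, e2⟩ := bez_unique (P := P.map φ) (S := S1.map φ) (U1 := U1.map φ) (V1 := V1.map φ) (η := H.natDegree) hε2 hdet2 hV20
    (by rw [hndm]; exact hV2d) ((Polynomial.map_ne_zero_iff hφ).2 hP0) (by rw [hndm]; omega)
    (by rw [← hFm, hdegm]; exact hFd) (by
      rw [← hR, hdegm]; rwa [Polynomial.degree_eq_natDegree hH0] at hRd) (by
      rcases hne with h1 | h1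
      · exact Or.inl ((Polynomial.map_ne_zero_iff hφ).2 h1)
      · exact Or.inr ((Polynomial.map_ne_zero_iff hφ).2 h1))
  have hFR : F.map φ = Polynomial.C β * R.map φ := by
    rw [hFm, hR, e1, e2]; ring
  have hF0 : F ≠ 0 := by
    rw [← Polynomial.map_ne_zero_iff hφ, hFR]
    exact mul_ne_zero (by simpa using hβ) ((Polynomial.map_ne_zero_iff hφ).2 hR0)
  have hlcF : φ F.leadingCoeff = β * φ R.leadingCoeff := by
    have := congrArg Polynomial.leadingCoeff hFR
    rwa [Polynomial.leadingCoeff_mul, Polynomial.leadingCoeff_C, Polynomial.leadingCoeff_map_of_injective hφ,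
      Polynomial.leadingCoeff_map_of_injective hφ] at this
  have hFR' : Polynomial.C R.leadingCoeff * F = Polynomial.C F.leadingCoeff * R := by
    apply hmap
    rw [Polynomial.map_mul, Polynomial.map_mul, Polynomial.map_C, Polynomial.map_C, hlcF, hFR, map_mul]
    ring
  have hFΔ : F ∈ WP B 0 Δ := (WP_gr h).le (by rw [hΔ]; exact Nat.mul_le_mul_right _ (by omega)) hFB
  have hFH : F.degree < H.degree := by rw [Polynomial.degree_eq_natDegree hH0]; exact hFd
  have hFHn := Polynomial.natDegree_lt_natDegree hF0 hFH
  obtain ⟨M, S, a, c, hch, hS0, hS1, hM⟩ := ih F.natDegree (by omega) H F rfl hF0 hHB hFΔ (by omega) hFH (by omega)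
    ⟨U', V', U1.map φ, V1.map φ, β * -(L * ε), mul_ne_zero hβ hε2, hH, hFm, by
      rw [e1, e2, map_mul, ← hdet2]; ring, by
      rw [e2]; exact mul_ne_zero (by simpa using hβ) hV20, by
      rw [e2, Polynomial.natDegree_C_mul hβ]; exact hV2d, by
      rw [e2, Polynomial.degree_C_mul hβ, hV2d']
      rw [Polynomial.degree_eq_natDegree hV'0, Polynomial.degree_eq_natDegree hqV0, Nat.cast_lt,
        Polynomial.natDegree_mul hqh0 hV'0, hqhd]
      omega⟩
  refine ⟨_, _, _, _, hch.cons hG0 hGB hGd (a1 := F.leadingCoeff * lc ^ e) (c1 := -R.leadingCoeff) ?_ ?_ ?_ ?_ ?_, rfl, hS0, by omega⟩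
  · exact mul_ne_zero (Polynomial.leadingCoeff_ne_zero.2 hF0) (pow_ne_zero _ hlc0)
  · refine h.le ?_ (h.mul (WP0.1 hFΔ _) (h.pow hlcB e))
    rw [hΔ', he]; apply le_of_eq; ring
  · exact neg_ne_zero.2 (Polynomial.leadingCoeff_ne_zero.2 hR0)
  · refine neg_mem (h.le ?_ (WP0.1 hRB _))
    rw [hΔ', he]; apply le_of_eq; ring
  · rw [hS0, hS1]
    refine ⟨Polynomial.C F.leadingCoeff * q, ?_⟩
    have : Polynomial.C (-R.leadingCoeff) * F = - (Polynomial.C F.leadingCoeff * R) := by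
      rw [← hFR', map_neg]; ring
    rw [this, map_mul]
    linear_combination Polynomial.C F.leadingCoeff * hq

/-- the bounded signed remainder sequence of `P` and `T` -/
theorem euclid (h : IsGr B) {P T : A[X]} {δ t D Δ Δ' : ℕ} (hP : P ∈ WP B 0 δ) (hT : T ∈ WP B 0 δ) (hP0 : P ≠ 0)
    (hD : P.natDegree ≤ D) (ht : T.natDegree ≤ t) (hΔ : Δ = (2 * D + 3) * ((t + 2) * δ))
    (hΔ' : Δ' = (D + 2) * Δ + (t + 1) * δ) :
    (∃ a, a ≠ 0 ∧ a ∈ B Δ' ∧ P ∣ Polynomial.C a * T) ∨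
    ∃ M S a c, Chain B Δ Δ' D M S a c ∧ S 0 = P ∧ M ≤ D ∧
      P ∣ Polynomial.C (a 0) * T + Polynomial.C (c 0) * S 1 := by
  set lc := P.leadingCoeff with hlc
  have hlc0 : lc ≠ 0 := Polynomial.leadingCoeff_ne_zero.2 hP0
  have hlcB : lc ∈ B δ := WP0.1 hP _
  obtain ⟨R, hRB, hRd, hq⟩ := prem h P hP hP0 (t + 1) T δ hT (by
    refine lt_of_le_of_lt Polynomial.degree_le_natDegree ?_
    rw [Nat.cast_lt]; omega)
  by_cases hR0 : R = 0
  · left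
    rw [hR0, sub_zero] at hq
    exact ⟨lc ^ (t + 1), pow_ne_zero _ hlc0, h.le (by rw [hΔ']; omega) (h.pow hlcB (t + 1)), hq⟩
  right
  have hRn := Polynomial.natDegree_lt_natDegree hR0 hRd
  have e1 : δ + (t + 1) * δ = (t + 2) * δ := by ring
  rw [e1] at hRB
  have e2 : δ ≤ (t + 2) * δ := Nat.le_mul_of_pos_left _ (by omega)
  have e3 : (t + 2) * δ ≤ (2 * P.natDegree + 3) * ((t + 2) * δ) := Nat.le_mul_of_pos_left _ (by omega)
  obtain ⟨M, S, a, c, hch, hS0, hS1, hM⟩ := euclid_loop h (P := P) (S1 := R) ((WP_gr h).le e2 hP) hRB hP0 hRn.le rfl rfl _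
    P R rfl hR0 ((WP_gr h).le (e2.trans e3) hP) ((WP_gr h).le e3 hRB) le_rfl hRd le_rfl
    ⟨1, 0, 0, 1, 1, one_ne_zero, by simp, by simp, by simp, one_ne_zero, by simp, by simp⟩
  have hΔle : (2 * P.natDegree + 3) * ((t + 2) * δ) ≤ Δ := by rw [hΔ]; gcongr
  have hΔle' : (P.natDegree + 2) * ((2 * P.natDegree + 3) * ((t + 2) * δ)) ≤ Δ' := by
    rw [hΔ']; refine le_trans ?_ (Nat.le_add_right _ _); gcongr
  have ha' : ∀ i, (if i = 0 then lc ^ (t + 1) else a i) ≠ 0 := fun i => by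
    split_ifs
    · exact pow_ne_zero _ hlc0
    · exact hch.a0 _
  have haB' : ∀ i, (if i = 0 then lc ^ (t + 1) else a i) ∈ B Δ' := fun i => by
    split_ifs
    · exact h.le (by rw [hΔ']; omega) (h.pow hlcB (t + 1))
    · exact h.le hΔle' (hch.aB _)
  have hc' : ∀ i, (if i = 0 then -1 else c i) ≠ 0 := fun i => by
    split_ifs
    · exact neg_ne_zero.2 one_ne_zero
    · exact hch.c0 _
  have hcB' : ∀ i, (if i = 0 then -1 else c i) ∈ B Δ' := fun i => by
    split_ifs
    · exact neg_mem (h.one' _)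
    · exact h.le hΔle' (hch.cB _)
  refine ⟨M, S, fun i => if i = 0 then lc ^ (t + 1) else a i, fun i => if i = 0 then -1 else c i,
    ⟨hch.pos, hch.S0, fun i => (WP_gr h).le hΔle (hch.SB i), fun i => (hch.Sd i).trans hD, ha', haB', hc', hcB', ?_, ?_⟩,
    hS0, by omega, ?_⟩
  · intro i hi
    simpa using hch.rel i hi
  · intro i hi
    have hM0 : M ≠ 0 := by omega
    simpa [hM0] using hch.last i hi
  · rw [hS1]
    simpa [sub_eq_add_neg] using hq

end Euclid

end ENS
end

section
open MvPolynomial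
open scoped Polynomial

namespace ENS
namespace Filt

section mdl
variable {K : Type} [Field K] {F : Filt K}

theorem Comp.pos_sg {Δ : ℕ} {ι : Type} {f : ι → K[X]} {N : ℕ} {ξ : Fin N → K} {m : ι → Fin N → ℕ} {Q : ι → K[X]}
    (h : Comp F Δ f N ξ m Q) (a b : Fin N) (hab : b ≠ a) :
    F.Sg Δ (ξ a - ξ b) (if a < b then -1 else 1) := by
  have hne : ξ a - ξ b ≠ 0 := sub_ne_zero.2 (h.inj.ne hab.symm)
  split_ifs with h1
  · have := (Sg.of_C (h.lt a b h1) (sub_ne_zero.2 (h.inj.ne hab))).neg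
    rwa [neg_sub] at this
  · exact Sg.of_C (h.lt b a (lt_of_le_of_ne (not_lt.1 h1) hab)) hne

theorem Comp.mdl {Δ R D : ℕ} {ι : Type} {f : ι → K[X]} {κ : ι → ℤˣ} {N : ℕ} {ξ : Fin N → K} {m : ι → Fin N → ℕ} {Q : ι → K[X]}
    (h : Comp F Δ (fun i => Polynomial.C (f i).leadingCoeff⁻¹ * f i) N ξ m Q)
    (hlc : ∀ i, F.Sg Δ (f i).leadingCoeff (κ i)) (hD : ∀ i, (f i).natDegree ≤ D) (hC : F.Cons R)
    (hR : 4 * ((D + 2) * Δ) ≤ R) : Mdl F ((D + 2) * Δ) R f κ N ξ m := by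
  classical
  have hf : ∀ i, f i = Polynomial.C (f i).leadingCoeff * ((∏ a, (Polynomial.X - Polynomial.C (ξ a)) ^ m i a) * Q i) := by
    intro i
    have h1 := h.eq i
    rw [← h1, ← mul_assoc, ← map_mul, mul_inv_cancel₀ (hlc i).1, map_one, one_mul]
  have hnd : ∀ i, (f i).natDegree = ∑ a, m i a + (Q i).natDegree := by
    intro i
    rw [hf i, Polynomial.natDegree_C_mul (hlc i).1, Polynomial.natDegree_mul
      (Finset.prod_ne_zero_iff.2 fun a _ => pow_ne_zero _ (Polynomial.X_sub_C_ne_zero _)) (h.monic i).ne_zero,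
      Polynomial.natDegree_prod _ _ fun a _ => pow_ne_zero _ (Polynomial.X_sub_C_ne_zero _)]
    congr 1
    refine Finset.sum_congr rfl fun a _ => ?_
    rw [Polynomial.natDegree_pow, Polynomial.natDegree_X_sub_C, mul_one]
  refine ⟨hC, hR, ?_, ?_⟩
  · intro i
    rw [hnd, pow_add, (h.even i).neg_one_pow, mul_one, tail_zero]
  · intro i a
    refine ⟨Polynomial.C (f i).leadingCoeff * ((∏ b ∈ Finset.univ.erase a, (Polynomial.X - Polynomial.C (ξ b)) ^ m i b) * Q i), ?_, ?_⟩
    · conv_lhs => rw [hf i]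
      rw [← Finset.mul_prod_erase _ _ (Finset.mem_univ a)]
      ring
    · have h1 := Sg.prod (F := F) (Finset.univ.erase a) (fun b => m i b * Δ) (fun b => (ξ a - ξ b) ^ m i b)
        (fun b => (if a < b then -1 else 1) ^ m i b) (fun b hb => (h.pos_sg a b (Finset.ne_of_mem_erase hb)).pow _)
      have h2 := (hlc i).mul (h1.mul (Sg.of_C (h.pos i a) (h.ne i a)))
      have e1 : (∏ b ∈ Finset.univ.erase a, (if a < b then (-1 : ℤˣ) else 1) ^ m i b) = (-1) ^ tail (m i) (a + 1) := by
        rw [tail, ← Finset.prod_pow_eq_pow_sum, ← Finset.mul_prod_erase Finset.univ _ (Finset.mem_univ a)]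
        rw [if_neg (by omega), pow_zero, one_mul]
        refine Finset.prod_congr rfl fun b _ => ?_
        by_cases hab : a < b
        · rw [if_pos hab, if_pos (by exact hab)]
        · rw [if_neg hab, if_neg (by simpa using hab), one_pow, pow_zero]
      rw [e1, mul_one] at h2
      simp only [Polynomial.eval_mul, Polynomial.eval_C, Polynomial.eval_prod, Polynomial.eval_pow, Polynomial.eval_sub,
        Polynomial.eval_X]
      refine h2.mono ?_
      rw [← Finset.sum_mul]
      have h3 : ∑ b ∈ Finset.univ.erase a, m i b ≤ D := by
        refine le_trans (Finset.sum_le_sum_of_subset (Finset.erase_subset _ _)) ?_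
        have := hnd i
        have := hD i
        omega
      have h4 := Nat.mul_le_mul_right Δ h3
      have e2 : (D + 2) * Δ = Δ + (D * Δ + Δ) := by ring
      rw [e2]; omega

end mdl

/-- the trivial filtration of the reals -/
def real : Filt ℝ where
  B := fun _ => ⊤
  C := fun _ => AddSubmonoid.nonneg ℝ
  gr := ⟨fun _ _ _ => le_rfl, trivial, fun _ _ => trivial⟩
  C_mono := fun _ _ _ => le_rfl
  mul_C := fun ha hb => AddSubmonoid.mem_nonneg.2 (mul_nonneg (AddSubmonoid.mem_nonneg.1 ha) (AddSubmonoid.mem_nonneg.1 hb))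
  C_le := fun _ => trivial
  sq_C := fun _ => AddSubmonoid.mem_nonneg.2 (sq_nonneg _)

theorem real_C {r : ℕ} {x : ℝ} : x ∈ real.C r ↔ 0 ≤ x := AddSubmonoid.mem_nonneg

theorem real_cons (R : ℕ) : real.Cons R := fun b _ h => by
  have : 0 ≤ -(b ^ 2) := real_C.1 h
  have := sq_nonneg b
  exact pow_eq_zero_iff (two_ne_zero) |>.1 (by linarith)

/-- rootless monic real polynomials -/
theorem rootless {Q : ℝ[X]} (hm : Q.Monic) (hr : ∀ x, Q.eval x ≠ 0) : (∀ x, 0 < Q.eval x) ∧ Even Q.natDegree := by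
  have key : ∀ x y, 0 < Q.eval x → 0 < Q.eval y := by
    intro x y hx
    by_contra hy
    have hy' := lt_of_le_of_ne (not_lt.1 hy) (hr y)
    have := mem_range_of_exists_le_of_exists_ge (Polynomial.continuous Q) ⟨y, hy'.le⟩ ⟨x, hx.le⟩
    obtain ⟨z, hz⟩ := this
    exact hr z hz
  by_cases hd : Q.natDegree = 0
  · have := hm.natDegree_eq_zero.1 hd
    subst this
    simp
  have hdeg : 0 < Q.degree := Polynomial.natDegree_pos_iff_degree_pos.1 (by omega)
  have hpos : ∀ x, 0 < Q.eval x := by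
    have h1 := Polynomial.tendsto_atTop_of_leadingCoeff_nonneg Q hdeg (by rw [hm.leadingCoeff]; norm_num)
    obtain ⟨x, hx⟩ := (h1.eventually_gt_atTop 0).exists
    exact fun y => key x y hx
  refine ⟨hpos, ?_⟩
  by_contra hodd
  rw [Nat.not_even_iff_odd] at hodd
  have hnd : (Q.comp (-Polynomial.X)).natDegree = Q.natDegree := by
    rw [Polynomial.natDegree_comp, Polynomial.natDegree_neg, Polynomial.natDegree_X, mul_one]
  have hlc : (Q.comp (-Polynomial.X)).leadingCoeff = -1 := by
    rw [Polynomial.leadingCoeff_comp (by simp), hm.leadingCoeff, Polynomial.leadingCoeff_neg, Polynomial.leadingCoeff_X,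
      hodd.neg_one_pow, one_mul]
  have h1 := Polynomial.tendsto_atBot_of_leadingCoeff_nonpos (Q.comp (-Polynomial.X))
    (Polynomial.natDegree_pos_iff_degree_pos.1 (by omega)) (by rw [hlc]; norm_num)
  obtain ⟨x, hx⟩ := (h1.eventually_lt_atBot 0).exists
  have := hpos (-x)
  simp only [Polynomial.eval_comp, Polynomial.eval_neg, Polynomial.eval_X] at hx
  linarith

theorem real_comp {ι : Type} [Fintype ι] (f : ι → ℝ[X]) (hm : ∀ i, (f i).Monic) (Δ : ℕ) :
    ∃ N ξ m Q, Comp real Δ f N ξ m Q := by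
  classical
  have h0 : ∀ i, f i ≠ 0 := fun i => (hm i).ne_zero
  set Z : Finset ℝ := Finset.univ.biUnion fun i => (f i).roots.toFinset with hZ
  have hex : ∀ i, ∃ q : ℝ[X], ((f i).roots.map fun a => Polynomial.X - Polynomial.C a).prod * q = f i ∧ q.roots = 0 := by
    intro i
    obtain ⟨q, h1, _, h2⟩ := Polynomial.exists_prod_multiset_X_sub_C_mul (f i)
    exact ⟨q, h1, h2⟩
  choose Q hQ hQr using hex
  have hQm : ∀ i, (Q i).Monic := by
    intro i
    have h1 : (((f i).roots.map fun a => Polynomial.X - Polynomial.C a).prod).Monic :=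
      Polynomial.monic_multisetProd_X_sub_C _
    exact h1.of_mul_monic_left (by rw [hQ]; exact hm i)
  have hQ0 : ∀ i x, (Q i).eval x ≠ 0 := by
    intro i x hx
    have : x ∈ (Q i).roots := (Polynomial.mem_roots (hQm i).ne_zero).2 hx
    rw [hQr] at this
    simp at this
  set ξ := Z.orderEmbOfFin rfl with hξ
  refine ⟨Z.card, fun a => ξ a, fun i a => (f i).roots.count (ξ a), Q, ?_, ξ.injective, hQm, fun i => (rootless (hQm i) (hQ0 i)).2, ?_, ?_, ?_⟩
  · intro a b hab
    exact real_C.2 <| sub_nonneg.2 (ξ.monotone hab.le)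
  · intro i
    conv_lhs => rw [← hQ i]
    congr 1
    rw [Finset.prod_multiset_map_count]
    have hsub : (f i).roots.toFinset ⊆ Z := Finset.subset_biUnion_of_mem (fun i => (f i).roots.toFinset) (Finset.mem_univ i)
    rw [Finset.prod_subset hsub (fun x _ hx => by
      rw [Multiset.mem_toFinset] at hx
      rw [Multiset.count_eq_zero_of_notMem hx, pow_zero])]
    rw [← Finset.prod_coe_sort, ← (Z.orderIsoOfFin rfl).toEquiv.prod_comp]
    rfl
  · intro i a
    exact real_C.2 ((rootless (hQm i) (hQ0 i)).1 _).le
  · intro i a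
    exact hQ0 i _

end Filt
end ENS
end

section
open MvPolynomial
open scoped Polynomial

namespace ENS

/-- index of the Sturm chains -/
abbrev EJ (d : ℕ) (α : Type) : Type := (α × α) × (Fin (2 * d) → α) × (Fin (2 * d) → Bool)
/-- index of the polynomial family -/
abbrev EI (d : ℕ) (α : Type) : Type := α ⊕ (α × α) ⊕ (EJ d α × Fin (2 * d + 1))
/-- index of the sign conditions -/
abbrev EX (d : ℕ) (α : Type) : Type := EI d α ⊕ (EJ d α × Fin (2 * d + 1)) ⊕ (EJ d α × Fin (2 * d + 1))

section elim
variable {A : Type} [CommRing A] [IsDomain A] {α : Type}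

open Classical in
/-- derivative of a product -/
noncomputable def EP (c : α → A[X]) (p : α × α) : A[X] :=
  if Polynomial.derivative (c p.1 * c p.2) = 0 then 1 else Polynomial.derivative (c p.1 * c p.2)

/-- the auxiliary products -/
noncomputable def EQ (c : α → A[X]) {E : ℕ} (ι : Fin E → α) (e : Fin E → Bool) : A[X] :=
  ∏ s, c (ι s) ^ (if e s then 2 else 1)

/-- the chains -/
structure EData (B : ℕ → AddSubgroup A) (d δ : ℕ) (c : α → A[X]) where
  M : EJ d α → ℕ
  S : EJ d α → ℕ → A[X]
  a : EJ d α → ℕ → A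
  e : EJ d α → ℕ → A
  cB : ∀ i, c i ∈ WP B 0 δ
  cd : ∀ i, (c i).natDegree ≤ 2 * d
  c0 : ∀ i, c i ≠ 0
  PB : ∀ p, EP c p ∈ WP B 0 δ
  Pd : ∀ p, (EP c p).natDegree ≤ 2 * d
  P0 : ∀ p, EP c p ≠ 0
  hM : ∀ j, M j ≤ 2 * d
  S0 : ∀ j i, S j i ≠ 0
  SB : ∀ j i, S j i ∈ WP B 0 δ
  Sd : ∀ j i, (S j i).natDegree ≤ 2 * d
  SP : ∀ j, S j 0 = EP c j.1
  a0 : ∀ j i, a j i ≠ 0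
  aB : ∀ j i, a j i ∈ B δ
  e0 : ∀ j i, e j i ≠ 0
  eB : ∀ j i, e j i ∈ B δ
  fst : ∀ j, 0 < M j → EP c j.1 ∣ Polynomial.C (a j 0) * (Polynomial.derivative (EP c j.1) * EQ c j.2.1 j.2.2) +
    Polynomial.C (e j 0) * S j 1
  rel : ∀ j i, i + 1 < M j → S j (i + 1) ∣ Polynomial.C (a j (i + 1)) * S j i + Polynomial.C (e j (i + 1)) * S j (i + 2)
  last : ∀ j i, i + 1 = M j → S j (M j) ∣ Polynomial.C (a j (M j)) * S j i
  last0 : ∀ j, M j = 0 → EP c j.1 ∣ Polynomial.C (a j 0) * (Polynomial.derivative (EP c j.1) * EQ c j.2.1 j.2.2)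

theorem WP0_derivative {B : ℕ → AddSubgroup A} {r : ℕ} {f : A[X]} (hf : f ∈ WP B 0 r) :
    Polynomial.derivative f ∈ WP B 0 r := by
  rw [WP0] at hf ⊢
  intro j
  rw [Polynomial.coeff_derivative]
  have := (B r).nsmul_mem (hf (j + 1)) (j + 1)
  rw [nsmul_eq_mul] at this
  rw [mul_comm]; exact_mod_cast this

/-- the degree after one elimination -/
def dNext (d : ℕ) : ℕ := (2 * d + 2) * ((4 * d + 3) * ((4 * d ^ 2 + 2 * d + 2) * (4 * d ^ 2 + 2 * d))) +
  (4 * d ^ 2 + 2 * d + 1) * (4 * d ^ 2 + 2 * d)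

theorem exists_EData {B : ℕ → AddSubgroup A} (hB : IsGr B) {d : ℕ} (c : α → A[X])
    (cB : ∀ i, c i ∈ WP B 0 d) (cd : ∀ i, (c i).natDegree ≤ d) (c0 : ∀ i, c i ≠ 0) :
    Nonempty (EData B d (dNext d) c) := by
  classical
  set t := 4 * d ^ 2 + 2 * d with ht
  set Δ := (4 * d + 3) * ((t + 2) * t) with hΔ
  have hd' : dNext d = (2 * d + 2) * Δ + (t + 1) * t := by rw [dNext, hΔ, ht]
  have htΔ : t ≤ Δ := by rw [hΔ]; nlinarith [Nat.zero_le (d * ((t + 2) * t)), Nat.zero_le (t * t)]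
  have hΔd : Δ ≤ dNext d := by rw [hd']; nlinarith [Nat.zero_le (d * Δ)]
  have hdt : 2 * d ≤ t := by omega
  have hgr := WP_gr (ω := 0) hB
  have hcc : ∀ p : α × α, Polynomial.derivative (c p.1 * c p.2) ∈ WP B 0 (2 * d) := fun p =>
    WP0_derivative (by rw [two_mul]; exact hgr.mul (cB _) (cB _))
  have hPB : ∀ p, EP c p ∈ WP B 0 (2 * d) := by
    intro p
    rw [EP]; split_ifs
    · exact hgr.one' _
    · exact hcc p
  have hPd : ∀ p, (EP c p).natDegree ≤ 2 * d := by
    intro p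
    rw [EP]; split_ifs
    · simp
    · refine (Polynomial.natDegree_derivative_le _).trans ?_
      have h1 := Polynomial.natDegree_mul_le (p := c p.1) (q := c p.2)
      have := cd p.1; have := cd p.2
      omega
  have hP0 : ∀ p, EP c p ≠ 0 := by
    intro p
    rw [EP]; split_ifs with h
    · exact one_ne_zero
    · exact h
  have hQB : ∀ (ι : Fin (2 * d) → α) e, EQ c ι e ∈ WP B 0 (4 * d ^ 2) := by
    intro ι e
    have := hgr.prod Finset.univ (fun s => c (ι s) ^ (if e s then 2 else 1)) (fun _ => 2 * d) (by
      intro s _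
      refine hgr.le ?_ (hgr.pow (cB (ι s)) _)
      split_ifs <;> omega)
    refine hgr.le ?_ this
    simp; nlinarith
  have hQd : ∀ (ι : Fin (2 * d) → α) e, (EQ c ι e).natDegree ≤ 4 * d ^ 2 := by
    intro ι e
    refine (Polynomial.natDegree_prod_le _ _).trans ?_
    refine (Finset.sum_le_card_nsmul _ _ (2 * d) ?_).trans ?_
    · intro s _
      refine Polynomial.natDegree_pow_le.trans ?_
      have := cd (ι s)
      split_ifs <;> omega
    · simp; nlinarith
  have key : ∀ j : EJ d α, ∃ (M : ℕ) (S : ℕ → A[X]) (a e : ℕ → A), M ≤ 2 * d ∧ (∀ i, S i ≠ 0) ∧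
      (∀ i, S i ∈ WP B 0 (dNext d)) ∧ (∀ i, (S i).natDegree ≤ 2 * d) ∧ S 0 = EP c j.1 ∧ (∀ i, a i ≠ 0) ∧
      (∀ i, a i ∈ B (dNext d)) ∧ (∀ i, e i ≠ 0) ∧ (∀ i, e i ∈ B (dNext d)) ∧
      (0 < M → EP c j.1 ∣ Polynomial.C (a 0) * (Polynomial.derivative (EP c j.1) * EQ c j.2.1 j.2.2) +
        Polynomial.C (e 0) * S 1) ∧
      (∀ i, i + 1 < M → S (i + 1) ∣ Polynomial.C (a (i + 1)) * S i + Polynomial.C (e (i + 1)) * S (i + 2)) ∧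
      (∀ i, i + 1 = M → S M ∣ Polynomial.C (a M) * S i) ∧
      (M = 0 → EP c j.1 ∣ Polynomial.C (a 0) * (Polynomial.derivative (EP c j.1) * EQ c j.2.1 j.2.2)) := by
    intro j
    have hT : Polynomial.derivative (EP c j.1) * EQ c j.2.1 j.2.2 ∈ WP B 0 t := by
      rw [ht, add_comm]
      exact hgr.mul (WP0_derivative (hPB _)) (hQB _ _)
    have hTd : (Polynomial.derivative (EP c j.1) * EQ c j.2.1 j.2.2).natDegree ≤ t := by
      refine Polynomial.natDegree_mul_le.trans ?_
      have h1 := Polynomial.natDegree_derivative_le (EP c j.1)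
      have h2 := hPd j.1
      have h3 := hQd j.2.1 j.2.2
      omega
    rcases euclid hB (hgr.le hdt (hPB j.1)) hT (hP0 _) (hPd _) hTd (Δ := Δ) (Δ' := dNext d)
      (by rw [hΔ]; ring) hd' with ⟨a, h1, h2, h3⟩ | ⟨M, S, a, e, hch, h1, h2, h3⟩
    · refine ⟨0, fun _ => EP c j.1, fun _ => a, fun _ => 1, Nat.zero_le _, fun _ => hP0 _, fun _ => hgr.le (hdt.trans (htΔ.trans hΔd)) (hPB _),
        fun _ => hPd _, rfl, fun _ => h1, fun _ => h2, fun _ => one_ne_zero, fun _ => hB.one' _, ?_, ?_, ?_, fun _ => h3⟩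
      · intro h; omega
      · intro i h; omega
      · intro i h; omega
    · refine ⟨M, S, a, e, h2, hch.S0, fun i => hgr.le hΔd (hch.SB i), hch.Sd, h1, hch.a0, hch.aB, hch.c0, hch.cB, fun _ => h3,
        hch.rel, hch.last, ?_⟩
      intro h; have := hch.pos; omega
  choose M S a e k1 k2 k3 k4 k5 k6 k7 k8 k9 k10 k11 k12 k13 using key
  have hle := hdt.trans (htΔ.trans hΔd)
  exact ⟨⟨M, S, a, e, fun i => hgr.le (by omega) (cB i), fun i => (cd i).trans (by omega), c0,
    fun p => hgr.le hle (hPB p), hPd, hP0, k1, k2, k3, k4, k5, k6, k7, k8, k9, k10, k11, k12, k13⟩⟩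

namespace EData
variable {B : ℕ → AddSubgroup A} {d δ : ℕ} {c : α → A[X]} (X : EData B d δ c)

/-- the family -/
noncomputable def f : EI d α → A[X]
  | Sum.inl i => c i
  | Sum.inr (Sum.inl p) => EP c p
  | Sum.inr (Sum.inr (j, i)) => X.S j i

/-- the sign polynomials -/
noncomputable def v : EX d α → A
  | Sum.inl i => (X.f i).leadingCoeff
  | Sum.inr (Sum.inl (j, i)) => X.a j i
  | Sum.inr (Sum.inr (j, i)) => X.e j i

theorem f_B (i : EI d α) : X.f i ∈ WP B 0 δ := by
  rcases i with i | p | ⟨j, i⟩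
  exacts [X.cB i, X.PB p, X.SB j i]

theorem f_d (i : EI d α) : (X.f i).natDegree ≤ 2 * d := by
  rcases i with i | p | ⟨j, i⟩
  exacts [X.cd i, X.Pd p, X.Sd j i]

theorem f_0 (i : EI d α) : X.f i ≠ 0 := by
  rcases i with i | p | ⟨j, i⟩
  exacts [X.c0 i, X.P0 p, X.S0 j i]

theorem v_B (x : EX d α) : X.v x ∈ B δ := by
  rcases x with i | ⟨j, i⟩ | ⟨j, i⟩
  exacts [(WP0.1 (X.f_B i)) _, X.aB j i, X.eB j i]

theorem v_0 (x : EX d α) : X.v x ≠ 0 := by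
  rcases x with i | ⟨j, i⟩ | ⟨j, i⟩
  exacts [Polynomial.leadingCoeff_ne_zero.2 (X.f_0 i), X.a0 j i, X.e0 j i]

/-- index of the chain members -/
def si (j : EJ d α) (i : ℕ) : EI d α :=
  if i = 0 then Sum.inr (Sum.inl j.1) else Sum.inr (Sum.inr (j, Fin.ofNat _ i))

theorem f_si (j : EJ d α) {i : ℕ} (hi : i ≤ 2 * d) : X.f (si j i) = X.S j i := by
  unfold si; split_ifs with h
  · subst h; exact (X.SP j).symm
  · simp only [f]; congr 1
    exact Nat.mod_eq_of_lt (by omega)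

/-- index of `a` -/
def ai (j : EJ d α) (i : ℕ) : EX d α := Sum.inr (Sum.inl (j, Fin.ofNat _ i))
/-- index of `e` -/
def ei (j : EJ d α) (i : ℕ) : EX d α := Sum.inr (Sum.inr (j, Fin.ofNat _ i))

theorem v_ai (j : EJ d α) {i : ℕ} (hi : i ≤ 2 * d) : X.v (ai j i) = X.a j i := by
  simp only [v, ai]; congr 1
  exact Nat.mod_eq_of_lt (by omega)
theorem v_ei (j : EJ d α) {i : ℕ} (hi : i ≤ 2 * d) : X.v (ei j i) = X.e j i := by
  simp only [v, ei]; congr 1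
  exact Nat.mod_eq_of_lt (by omega)

/-- the Sturm count, as a function of the signs -/
noncomputable def Ψ (g : EX d α → ℤˣ) (j : EJ d α) : ℤ :=
  ∑ i ∈ Finset.range (X.M j), ((-∏ k ∈ Finset.range (i + 1), (g (ai j k) * g (ei j k)) : ℤˣ) : ℤ) *
    (g (Sum.inl (si j i)) : ℤˣ) * (g (Sum.inl (si j (i + 1))) : ℤˣ) *
      (1 - (-1) ^ ((X.f (si j i)).natDegree + (X.f (si j (i + 1))).natDegree))

/-- the count condition -/
def Φ (g : EX d α → ℤˣ) (p : α × α) (ι : Fin (2 * d) → α) : Prop := ∑ e, X.Ψ g (p, ι, e) ≠ 0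

/-- a model of the sign conditions -/
structure Model {K : Type} [Field K] (F : Filt K) (W R : ℕ) (ψ : A →+* K) (g : EX d α → ℤˣ) (N : ℕ) (ξ : Fin N → K)
    (m : EI d α → Fin N → ℕ) : Prop where
  mdl : Filt.Mdl F W R (fun i => (X.f i).map ψ) (fun i => g (Sum.inl i)) N ξ m
  sg : ∀ x, F.Sg W (ψ (X.v x)) (g x)

/-- sign of `c i` at a root -/
def sgn (g : EX d α → ℤˣ) {N : ℕ} (m : EI d α → Fin N → ℕ) (z : Fin N) (i : α) : ℤ :=
  if m (Sum.inl i) z = 0 then ((g (Sum.inl (Sum.inl i)) * (-1) ^ Filt.tail (m (Sum.inl i)) (z + 1) : ℤˣ) : ℤ) else 0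

theorem sgn_cases (g : EX d α → ℤˣ) {N : ℕ} (m : EI d α → Fin N → ℕ) (z : Fin N) (i : α) :
    sgn g m z i = 0 ∨ sgn g m z i = 1 ∨ sgn g m z i = -1 := by
  unfold sgn; split_ifs
  · rcases Int.units_eq_one_or (g (Sum.inl (Sum.inl i)) * (-1) ^ Filt.tail (m (Sum.inl i)) (z + 1)) with h | h <;> simp [h]
  · exact Or.inl rfl

theorem Model.nat {K : Type} [Field K] {F : Filt K} {W R : ℕ} {ψ : A →+* K} {g : EX d α → ℤˣ} {N : ℕ} {ξ : Fin N → K}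
    {m : EI d α → Fin N → ℕ} (h : X.Model F W R ψ g N ξ m) (i : EI d α) :
    ((X.f i).map ψ).natDegree = (X.f i).natDegree := by
  refine Polynomial.natDegree_map_of_leadingCoeff_ne_zero _ ?_
  exact (h.sg (Sum.inl i)).1

theorem Model.loc {K : Type} [Field K] {F : Filt K} {W R : ℕ} {ψ : A →+* K} {g : EX d α → ℤˣ} {N : ℕ} {ξ : Fin N → K}
    {m : EI d α → Fin N → ℕ} (h : X.Model F W R ψ g N ξ m) (z : Fin N) (i : α) :
    (sgn g m z i = 0 ∧ ((c i).map ψ).eval (ξ z) = 0) ∨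
      ∃ t : ℤˣ, sgn g m z i = (t : ℤˣ) ∧ F.Sg W (((c i).map ψ).eval (ξ z)) t := by
  obtain ⟨q, h1, h2⟩ := h.mdl.loc (Sum.inl i) z
  have h1' : (c i).map ψ = _ := h1
  unfold sgn; split_ifs with h3
  · refine Or.inr ⟨_, rfl, ?_⟩
    rw [h3, pow_zero, one_mul] at h1'
    rw [h1']; exact h2
  · refine Or.inl ⟨rfl, ?_⟩
    rw [h1']; simp [h3]

theorem Model.Ψ_eq {K : Type} [Field K] {F : Filt K} {W R : ℕ} {ψ : A →+* K} {g : EX d α → ℤˣ} {N : ℕ} {ξ : Fin N → K}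
    {m : EI d α → Fin N → ℕ} (h : X.Model F W R ψ g N ξ m) (hR : (4 * d + 2) * W ≤ R) (j : EJ d α) :
    X.Ψ g j = 2 * ∑ z, if m (Sum.inr (Sum.inl j.1)) z = 0 then 0 else
      ∏ s, sgn g m z (j.2.1 s) ^ (if j.2.2 s then 2 else 1) := by
  have hM := X.hM j
  have hmap : ∀ i, i ≤ 2 * d → (X.f (si j i)).map ψ = (X.S j i).map ψ := fun i hi => by rw [X.f_si j hi]
  have hst := Filt.sturm h.mdl (X.M j) (si j) ((EQ c j.2.1 j.2.2).map ψ)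
    (Polynomial.derivative ((X.f (si j 0)).map ψ) * (EQ c j.2.1 j.2.2).map ψ) (fun i => ψ (X.a j i)) (fun i => ψ (X.e j i))
    (fun i => g (ai j i)) (fun i => g (ei j i))
    (fun i hi => by rw [← X.v_ai j (by omega : i ≤ 2 * d)]; exact h.sg _)
    (fun i hi => by rw [← X.v_ei j (by omega : i ≤ 2 * d)]; exact h.sg _) rfl
    (fun h0 => by
      have := Polynomial.map_dvd ψ (X.fst j h0)
      rw [← X.SP j] at this
      simp only [hmap 0 (Nat.zero_le _), hmap 1 (by omega)]
      simpa [Polynomial.derivative_map] using this)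
    (fun i hi => by
      have := Polynomial.map_dvd ψ (X.rel j i hi)
      simp only [hmap i (by omega), hmap (i + 1) (by omega), hmap (i + 2) (by omega)]
      simpa using this)
    (fun i hi => by
      have := Polynomial.map_dvd ψ (X.last j i hi)
      simp only [hmap i (by omega), hmap (X.M j) hM]
      rw [Polynomial.map_mul, Polynomial.map_C] at this
      have h0 : ψ (X.a j (X.M j)) ≠ 0 := by rw [← X.v_ai j hM]; exact (h.sg _).1
      exact (IsUnit.dvd_mul_left (Polynomial.isUnit_C.2 (isUnit_iff_ne_zero.2 h0))).1 this)
    (fun hi => by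
      have := Polynomial.map_dvd ψ (X.last0 j hi)
      rw [← X.SP j] at this
      simp only [hmap 0 (Nat.zero_le _)]
      rw [Polynomial.map_mul, Polynomial.map_C, Polynomial.map_mul] at this
      have h0 : ψ (X.a j 0) ≠ 0 := by rw [← X.v_ai j (Nat.zero_le _)]; exact (h.sg _).1
      have := (IsUnit.dvd_mul_left (Polynomial.isUnit_C.2 (isUnit_iff_ne_zero.2 h0))).1 this
      simpa [Polynomial.derivative_map] using this)
    (4 * d * W) (by linarith [add_mul (4 * d) 2 W])
    (fun z => ∏ s, sgn g m z (j.2.1 s) ^ (if j.2.2 s then 2 else 1)) ?_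
  · simp only [h.nat] at hst
    exact hst
  · intro z
    have he : ((EQ c j.2.1 j.2.2).map ψ).eval (ξ z) = ∏ s, (((c (j.2.1 s)).map ψ).eval (ξ z)) ^ (if j.2.2 s then 2 else 1) := by
      rw [EQ, Polynomial.map_prod, Polynomial.eval_prod]
      simp only [Polynomial.map_pow, Polynomial.eval_pow]
    by_cases hz : ∃ s, sgn g m z (j.2.1 s) = 0 ∧ ((c (j.2.1 s)).map ψ).eval (ξ z) = 0
    · obtain ⟨s, h1, h2⟩ := hz
      left
      rw [he]
      refine ⟨Finset.prod_eq_zero (Finset.mem_univ s) ?_, Finset.prod_eq_zero (Finset.mem_univ s) ?_⟩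
      · rw [h1]; split_ifs <;> simp
      · rw [h2]; split_ifs <;> simp
    · push Not at hz
      right
      have hz' : ∀ s, ∃ t : ℤˣ, sgn g m z (j.2.1 s) = (t : ℤˣ) ∧ F.Sg W (((c (j.2.1 s)).map ψ).eval (ξ z)) t := by
        intro s
        rcases h.loc X z (j.2.1 s) with h1 | h1
        · exact absurd h1.2 (hz s h1.1)
        · exact h1
      choose t ht1 ht2 using hz'
      refine ⟨∏ s, t s ^ (if j.2.2 s then 2 else 1), ?_, ?_⟩
      · simp only [ht1, Units.coe_prod, Units.val_pow_eq_pow_val]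
      · rw [he]
        refine (Filt.Sg.prod Finset.univ (fun s => (if j.2.2 s then 2 else 1) * W) _ _ (fun s _ => (ht2 s).pow _)).mono ?_
        refine (Finset.sum_le_card_nsmul _ _ (2 * W) ?_).trans ?_
        · intro s _; split_ifs <;> omega
        · simp; nlinarith

theorem Model.Φ_iff {K : Type} [Field K] {F : Filt K} {W R : ℕ} {ψ : A →+* K} {g : EX d α → ℤˣ} {N : ℕ} {ξ : Fin N → K}
    {m : EI d α → Fin N → ℕ} (h : X.Model F W R ψ g N ξ m) (hR : (4 * d + 2) * W ≤ R) (p : α × α) (ι : Fin (2 * d) → α) :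
    X.Φ g p ι ↔ ∃ z, m (Sum.inr (Sum.inl p)) z ≠ 0 ∧ ∀ s, sgn g m z (ι s) = 1 := by
  have h1 : ∑ e, X.Ψ g (p, ι, e) = 2 * ∑ z, if m (Sum.inr (Sum.inl p)) z = 0 then 0 else
      ∏ s, (sgn g m z (ι s) + sgn g m z (ι s) ^ 2) := by
    simp_rw [h.Ψ_eq X hR]
    rw [← Finset.mul_sum, Finset.sum_comm]
    congr 1
    refine Finset.sum_congr rfl fun z _ => ?_
    split_ifs with hz
    · simp
    · have := Finset.prod_univ_sum (fun _ : Fin (2 * d) => (Finset.univ : Finset Bool))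
        (fun s b => sgn g m z (ι s) ^ (if b then 2 else 1))
      rw [Fintype.piFinset_univ] at this
      rw [← this]
      refine Finset.prod_congr rfl fun s _ => ?_
      rw [Fintype.sum_bool]; simp [add_comm]
  have h2 : ∀ z s, 0 ≤ sgn g m z (ι s) + sgn g m z (ι s) ^ 2 := by
    intro z s
    rcases sgn_cases g m z (ι s) with h | h | h <;> simp [h]
  unfold Φ
  rw [h1]
  constructor
  · intro hne
    by_contra hcon
    push Not at hcon
    refine hne ?_
    rw [Finset.sum_eq_zero, mul_zero]
    intro z _
    split_ifs with hz
    · rfl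
    · obtain ⟨s, hs⟩ := hcon z hz
      refine Finset.prod_eq_zero (Finset.mem_univ s) ?_
      rcases sgn_cases g m z (ι s) with h | h | h <;> simp_all
  · rintro ⟨z, hz, hs⟩
    have : 0 < ∑ z, if m (Sum.inr (Sum.inl p)) z = 0 then 0 else
      ∏ s, (sgn g m z (ι s) + sgn g m z (ι s) ^ 2) := by
      refine Finset.sum_pos' ?_ ⟨z, Finset.mem_univ _, ?_⟩
      · intro z _; split_ifs
        · exact le_rfl
        · exact Finset.prod_nonneg fun s _ => h2 z s
      · rw [if_neg hz]
        refine Finset.prod_pos fun s _ => ?_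
        rw [hs s]; norm_num
    omega

end EData
end elim
end ENS
end

section
open MvPolynomial
open scoped Polynomial

namespace ENS

theorem Filt.tail_eq {N : ℕ} {m : Fin N → ℕ} {i j : ℕ} (hij : i ≤ j) (h : ∀ b : Fin N, i ≤ b → (b : ℕ) < j → m b = 0) :
    Filt.tail m i = Filt.tail m j := by
  unfold Filt.tail
  refine Finset.sum_congr rfl fun b _ => ?_
  by_cases h1 : i ≤ b
  · by_cases h2 : j ≤ b
    · rw [if_pos h1, if_pos h2]
    · rw [if_pos h1, if_neg h2, h b h1 (by omega)]
  · rw [if_neg h1, if_neg (by omega)]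

theorem Filt.Loc.ne_zero {K : Type} [Field K] {F : Filt K} {w k : ℕ} {x : K} {s : ℤˣ} : ¬ F.Loc w x 0 k s := by
  rintro ⟨g, h1, h2⟩
  have : g = 0 := by
    rcases mul_eq_zero.1 h1.symm with h | h
    · exact absurd h (pow_ne_zero _ (Polynomial.X_sub_C_ne_zero _))
    · exact h
  subst this
  exact h2.1 (by simp)

section elim
variable {A : Type} [CommRing A] [IsDomain A] {α : Type}
namespace EData
variable {B : ℕ → AddSubgroup A} {d δ : ℕ} {c : α → A[X]} (X : EData B d δ c)

theorem sgn_one {g : EX d α → ℤˣ} {N : ℕ} {m : EI d α → Fin N → ℕ} {z : Fin N} {i : α} :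
    sgn g m z i = 1 ↔ m (Sum.inl i) z = 0 ∧ g (Sum.inl (Sum.inl i)) * (-1) ^ Filt.tail (m (Sum.inl i)) (z + 1) = 1 := by
  unfold sgn
  split_ifs with h
  · simp [h, ← Units.val_inj]
  · simp [h]

theorem Model.rolle {K : Type} [Field K] {F : Filt K} {W R : ℕ} {ψ : A →+* K} {g : EX d α → ℤˣ} {N : ℕ} {ξ : Fin N → K}
    {m : EI d α → Fin N → ℕ} (h : X.Model F W R ψ g N ξ m) (z0 : Fin N) (hpos : ∀ i, sgn g m z0 i = 1) (q : α)
    (hq : Even (c q).natDegree) (hgq : g (Sum.inl (Sum.inl q)) = -1) :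
    ∃ p z, m (Sum.inr (Sum.inl p)) z ≠ 0 ∧ ∀ i, sgn g m z i = 1 := by
  classical
  have hm0 : ∀ i, m (Sum.inl i) z0 = 0 := fun i => (sgn_one.1 (hpos i)).1
  have hq1 := (sgn_one.1 (hpos q)).2
  rw [hgq] at hq1
  have habove : ∃ b, z0 < b ∧ m (Sum.inl q) b ≠ 0 := by
    by_contra hcon
    push Not at hcon
    have := Filt.tail_eq (m := m (Sum.inl q)) (i := z0 + 1) (j := N) (by omega) (fun b h1 _ => hcon b (by
      rw [Fin.lt_def]; omega))
    rw [this, Filt.tail_top] at hq1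
    simp at hq1
  have hbelow : ∃ b, b < z0 ∧ m (Sum.inl q) b ≠ 0 := by
    by_contra hcon
    push Not at hcon
    have := Filt.tail_eq (m := m (Sum.inl q)) (i := 0) (j := z0 + 1) (by omega) (fun b _ h1 => by
      rcases lt_or_eq_of_le (Nat.lt_succ_iff.1 h1) with h2 | h2
      · exact hcon b h2
      · rw [Fin.ext h2]; exact hm0 q)
    have h2 := h.mdl.deg (Sum.inl q)
    rw [h.nat X (Sum.inl q)] at h2
    have h3 : X.f (Sum.inl q) = c q := rfl
    rw [h3, hq.neg_one_pow, this] at h2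
    rw [← h2] at hq1
    simp at hq1
  obtain ⟨bp, hbp, hbpmin⟩ := (Finset.univ.filter fun b => z0 < b ∧ ∃ i, m (Sum.inl i) b ≠ 0).exists_min_image id (by
    obtain ⟨b, h1, h2⟩ := habove
    exact ⟨b, by simp only [Finset.mem_filter, Finset.mem_univ, true_and]; exact ⟨h1, q, h2⟩⟩)
  obtain ⟨bm, hbm, hbmmax⟩ := (Finset.univ.filter fun b => b < z0 ∧ ∃ i, m (Sum.inl i) b ≠ 0).exists_max_image id (by
    obtain ⟨b, h1, h2⟩ := hbelow
    exact ⟨b, by simp only [Finset.mem_filter, Finset.mem_univ, true_and]; exact ⟨h1, q, h2⟩⟩)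
  simp only [Finset.mem_filter, Finset.mem_univ, true_and, id] at hbp hbm hbpmin hbmmax
  obtain ⟨hp1, i2, hi2⟩ := hbp
  obtain ⟨hm1, i1, hi1⟩ := hbm
  have hbetween : ∀ (b : Fin N) i, bm < b → b < bp → m (Sum.inl i) b = 0 := by
    intro b i h1 h2
    by_contra hne
    rcases lt_trichotomy b z0 with h3 | h3 | h3
    · exact absurd (hbmmax b ⟨h3, i, hne⟩) (not_le.2 h1)
    · exact hne (by rw [h3]; exact hm0 i)
    · exact absurd (hbpmin b ⟨h3, i, hne⟩) (not_le.2 h2)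
  have htl : ∀ i, ∀ z : Fin N, bm ≤ z → z < bp → Filt.tail (m (Sum.inl i)) (z + 1) = Filt.tail (m (Sum.inl i)) bp := by
    intro i z h1 h2
    exact Filt.tail_eq (by rw [Fin.lt_def] at h2; omega) (fun b h3 h4 => hbetween b i (by rw [Fin.le_def] at h1; rw [Fin.lt_def]; omega) h4)
  have hlt : bm < bp := hm1.trans hp1
  have hloc : ∀ b, m (Sum.inl i1) b + m (Sum.inl i2) b ≠ 0 →
      F.Loc (W + W) (ξ b) ((Polynomial.derivative (c i1 * c i2)).map ψ) (m (Sum.inl i1) b + m (Sum.inl i2) b - 1)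
        ((g (Sum.inl (Sum.inl i1)) * (-1) ^ Filt.tail (m (Sum.inl i1)) (b + 1)) * (g (Sum.inl (Sum.inl i2)) * (-1) ^ Filt.tail (m (Sum.inl i2)) (b + 1))) := by
    intro b hb
    rw [← Polynomial.derivative_map, Polynomial.map_mul]
    have := (h.mdl.loc (Sum.inl i1) b).mul (h.mdl.loc (Sum.inl i2) b)
    obtain ⟨k, hk⟩ := Nat.exists_eq_succ_of_ne_zero hb
    rw [hk] at this ⊢
    exact this.derivative h.mdl.cons
  have hP : EP c (i1, i2) = Polynomial.derivative (c i1 * c i2) := by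
    rw [EP, if_neg]
    intro h0
    have := hloc bm (by omega)
    simp only at h0
    rw [h0, Polynomial.map_zero] at this
    exact Filt.Loc.ne_zero this
  have hWR := h.mdl.hWR
  have huniq : ∀ b, m (Sum.inl i1) b + m (Sum.inl i2) b ≠ 0 → _ := fun b hb =>
    Filt.Loc.unique h.mdl.cons (h.mdl.loc (Sum.inr (Sum.inl (i1, i2))) b) (by
      show F.Loc (W + W) (ξ b) ((EP c (i1, i2)).map ψ) _ _
      rw [hP]; exact hloc b hb) (by omega) (by omega)
  obtain ⟨u1, u2⟩ := huniq bm (by omega)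
  obtain ⟨v1, v2⟩ := huniq bp (by omega)
  have hz : ∃ z, bm < z ∧ z < bp ∧ m (Sum.inr (Sum.inl (i1, i2))) z ≠ 0 := by
    by_contra hcon
    push Not at hcon
    have e1 : Filt.tail (m (Sum.inr (Sum.inl (i1, i2)))) (bm + 1) = Filt.tail (m (Sum.inr (Sum.inl (i1, i2)))) bp :=
      Filt.tail_eq (by rw [Fin.lt_def] at hlt; omega) (fun b h1 h2 => hcon b (by rw [Fin.lt_def]; omega) h2)
    rw [e1, Filt.tail_succ, v1, htl i1 bm le_rfl hlt, htl i2 bm le_rfl hlt, Filt.tail_succ, Filt.tail_succ (m (Sum.inl i2))] at u2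
    obtain ⟨k, hk⟩ := Nat.exists_eq_succ_of_ne_zero (show m (Sum.inl i1) bp + m (Sum.inl i2) bp ≠ 0 by omega)
    rw [hk, Nat.succ_sub_one, pow_add, pow_add, pow_add] at u2
    have e2 : ((-1 : ℤˣ)) ^ m (Sum.inl i1) bp * (-1) ^ m (Sum.inl i2) bp = (-1) ^ (k + 1) := by rw [← pow_add, hk]
    have e3 : ((-1 : ℤˣ)) ^ k * (g (Sum.inl (Sum.inr (Sum.inl (i1, i2)))) * (-1) ^ Filt.tail (m (Sum.inr (Sum.inl (i1, i2)))) (bp + 1)) =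
        (-1) ^ (k + 1) * (g (Sum.inl (Sum.inl i1)) * (-1) ^ Filt.tail (m (Sum.inl i1)) (bp + 1) * (g (Sum.inl (Sum.inl i2)) * (-1) ^ Filt.tail (m (Sum.inl i2)) (bp + 1))) := by
      rw [← e2]
      calc _ = _ := mul_left_comm _ _ _
        _ = _ := u2
        _ = _ := by ac_rfl
    rw [v2, mul_left_inj, pow_succ] at e3
    simp at e3
  obtain ⟨z, hz1, hz2, hz3⟩ := hz
  refine ⟨(i1, i2), z, hz3, fun i => ?_⟩
  rw [sgn_one]
  refine ⟨hbetween z i hz1 hz2, ?_⟩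
  rw [htl i z hz1.le hz2, ← htl i z0 hm1.le hp1]
  exact (sgn_one.1 (hpos i)).2

theorem real_side [Finite α] (ψ : A →+* ℝ) (g : EX d α → ℤˣ) (hg : ∀ x, 0 < (((g x : ℤˣ) : ℤ) : ℝ) * ψ (X.v x))
    (p : α × α) (hΦ : ∀ ι, X.Φ g p ι) : ∃ y : ℝ, ∀ i, 0 < ((c i).map ψ).eval y := by
  classical
  have := Fintype.ofFinite α
  have hne : ∀ x, ψ (X.v x) ≠ 0 := fun x h0 => by have := hg x; rw [h0] at this; simp at this
  have hsg : ∀ x, Filt.real.Sg 0 (ψ (X.v x)) (g x) := fun x => ⟨hne x, Filt.real_C.2 (hg x).le⟩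
  have hlc : ∀ i, ((X.f i).map ψ).leadingCoeff = ψ (X.v (Sum.inl i)) := fun i =>
    Polynomial.leadingCoeff_map_of_leadingCoeff_ne_zero _ (hne (Sum.inl i))
  obtain ⟨N, ξ, m, Q, hcomp⟩ := Filt.real_comp (fun i => Polynomial.C ((X.f i).map ψ).leadingCoeff⁻¹ * (X.f i).map ψ)
    (fun i => by
      rw [Polynomial.Monic, Polynomial.leadingCoeff_mul, Polynomial.leadingCoeff_C, inv_mul_cancel₀]
      rw [hlc]; exact hne _) 0
  have hmdl := hcomp.mdl (κ := fun i => g (Sum.inl i)) (D := 2 * d) (R := 0) (fun i => by rw [hlc]; exact hsg _)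
    (fun i => Polynomial.natDegree_map_le.trans (X.f_d i)) (Filt.real_cons 0) (by simp)
  have hM : X.Model Filt.real ((2 * d + 2) * 0) 0 ψ g N ξ m := ⟨hmdl, fun x => (hsg x).mono (by simp)⟩
  by_contra hcon
  push Not at hcon
  have hbad : ∀ z, ∃ i, sgn g m z i ≠ 1 := by
    intro z
    obtain ⟨i, hi⟩ := hcon (ξ z)
    refine ⟨i, fun h1 => ?_⟩
    rcases hM.loc X z i with h2 | ⟨t, h2, h3⟩
    · omega
    · have h4 : t = 1 := by rw [h1] at h2; exact Units.val_inj.1 h2.symm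
      rw [h4] at h3
      exact h3.1 (le_antisymm hi (Filt.real_C.1 h3.one_C))
  choose bad hb using hbad
  set Z := Finset.univ.filter fun z => m (Sum.inr (Sum.inl p)) z ≠ 0 with hZ
  have hP0 : (EP c p).map ψ ≠ 0 := by
    have := hne (Sum.inl (Sum.inr (Sum.inl p)))
    rw [← hlc, Polynomial.leadingCoeff_ne_zero] at this
    exact this
  have hcard : Z.card ≤ 2 * d := by
    have h1 : Z.image ξ ⊆ ((EP c p).map ψ).roots.toFinset := by
      intro y hy
      rw [Finset.mem_image] at hy
      obtain ⟨z, hz, rfl⟩ := hy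
      rw [Multiset.mem_toFinset, Polynomial.mem_roots hP0]
      obtain ⟨q, h1, h2⟩ := hM.mdl.loc (Sum.inr (Sum.inl p)) z
      have h1' : (EP c p).map ψ = _ := h1
      rw [h1']
      simp only [hZ, Finset.mem_filter] at hz
      simp [hz.2]
    have h2 := Finset.card_le_card h1
    rw [Finset.card_image_of_injective _ hcomp.inj] at h2
    exact h2.trans ((Multiset.toFinset_card_le _).trans ((Polynomial.card_roots' _).trans (Polynomial.natDegree_map_le.trans (X.Pd p))))
  let ι : Fin (2 * d) → α := fun s => if h : (s : ℕ) < Z.card then bad (Z.equivFin.symm ⟨s, h⟩) else p.1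
  obtain ⟨z, hz, hs⟩ := (hM.Φ_iff X (by simp) p ι).1 (hΦ ι)
  have hzZ : z ∈ Z := by simp [hZ, hz]
  set s := Z.equivFin ⟨z, hzZ⟩ with hsdef
  have := hs ⟨s, lt_of_lt_of_le s.2 hcard⟩
  simp only [ι] at this
  rw [dif_pos s.2] at this
  simp only [hsdef, Fin.eta, Equiv.symm_apply_apply] at this
  exact hb z this

/-- number of family members -/
theorem card_EI [Fintype α] : Fintype.card (EI d α) =
    Fintype.card α + (Fintype.card α ^ 2 + Fintype.card α ^ 2 * (Fintype.card α ^ (2 * d) * 2 ^ (2 * d)) * (2 * d + 1)) := by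
  simp [EI, EJ, sq]

theorem card_EX [Fintype α] : Fintype.card (EX d α) = Fintype.card (EI d α) +
    2 * (Fintype.card α ^ 2 * (Fintype.card α ^ (2 * d) * 2 ^ (2 * d)) * (2 * d + 1)) := by
  rw [Fintype.card_sum (α := EI d α)]
  congr 1
  simp [EJ, sq]
  ring

end EData
end elim

/-- size parameter -/
def tt (d N : ℕ) : ℕ := 8 * (d + 1) ^ 2 * ((2 * N) ^ (2 * d + 2) + 1)
/-- weight -/
def ww (d N : ℕ) : ℕ := 3 * tt d N * dNext d + 3 * tt d N
/-- cost factor -/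
def kk (d N : ℕ) : ℕ := 2 ^ (tt d N) * (2 * Filt.cst (tt d N) ^ tt d N)
/-- minimal level -/
def rr (d N : ℕ) : ℕ := (4 * d + 4) * ((2 * d + 2) * (tt d N * ww d N))

theorem card_le_tt {α : Type} [Fintype α] [Nonempty α] {d N : ℕ} (hN : Fintype.card α ≤ N) :
    Fintype.card (EX d α) ≤ tt d N ∧ Fintype.card (EI d α) ≤ tt d N ∧ 1 + Fintype.card (EI d α) * (2 * d) ≤ tt d N := by
  have hn : 1 ≤ Fintype.card α := Fintype.card_pos
  set n := Fintype.card α with hnd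
  set Y := N ^ 2 * (N ^ (2 * d) * 2 ^ (2 * d)) with hY
  have hYn : n ^ 2 * (n ^ (2 * d) * 2 ^ (2 * d)) ≤ Y := by rw [hY]; gcongr
  have e1 : (2 * N) ^ (2 * d + 2) = 4 * Y := by rw [hY]; ring
  have h1 : 1 ≤ N ^ (2 * d) * 2 ^ (2 * d) := Nat.one_le_iff_ne_zero.2 (by
    have : N ≠ 0 := by omega
    positivity)
  have h2 : n ^ 2 ≤ Y := by
    rw [hY]
    calc n ^ 2 ≤ N ^ 2 * 1 := by rw [mul_one]; gcongr
      _ ≤ _ := Nat.mul_le_mul_left _ h1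
  have h3 : n ≤ n ^ 2 := by nlinarith
  have h4 : Fintype.card (EI d α) ≤ Y * (2 * d + 3) := by
    rw [EData.card_EI]
    have := Nat.mul_le_mul_right (2 * d + 1) hYn
    nlinarith
  have h5 : Fintype.card (EX d α) ≤ Y * (6 * d + 5) := by
    rw [EData.card_EX]
    have := Nat.mul_le_mul_right (2 * d + 1) hYn
    nlinarith
  have e2 : tt d N = 8 * (d + 1) ^ 2 * (4 * Y + 1) := by rw [tt, e1]
  have h6 : Fintype.card (EI d α) * (2 * d) ≤ Y * (2 * d + 3) * (2 * d) := Nat.mul_le_mul_right _ h4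
  rw [e2]
  refine ⟨h5.trans ?_, h4.trans ?_, ?_⟩ <;> nlinarith [Nat.zero_le (Y * d), Nat.zero_le (Y * d * d), Nat.zero_le (d * d)]

theorem le_dNext (d : ℕ) : 2 * d ≤ dNext d := by
  unfold dNext
  nlinarith [Nat.zero_le ((2 * d + 2) * ((4 * d + 3) * ((4 * d ^ 2 + 2 * d + 2) * (4 * d ^ 2 + 2 * d)))), Nat.zero_le ((4 * d ^ 2 + 2 * d) * (4 * d ^ 2 + 2 * d))]

theorem Filt.Sg.le {K K' : Type} [Field K] [Field K'] {F : Filt K} {F' : Filt K'} {φ : K →+* K'} (h : Filt.Le F F' φ) {w : ℕ} {x : K}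
    {s : ℤˣ} (hx : F.Sg w x s) : F'.Sg w (φ x) s := by
  refine ⟨(map_ne_zero φ).2 hx.1, ?_⟩
  have := h.C hx.2
  simpa using this

set_option maxHeartbeats 400000 in
theorem EData.formal_side {A : Type} [CommRing A] [IsDomain A] {α : Type} [Fintype α] {B : ℕ → AddSubgroup A} {d δ : ℕ} {c : α → A[X]}
    (hδ : δ = dNext d) (X : EData B d δ c) {K : Type} [Field K] {F : Filt K} {ψ : A →+* K} (hψ : Function.Injective ψ)
    (hψB : ∀ r x, x ∈ B r → ψ x ∈ F.B r) (y : K) (hy : y ∈ F.B 1) (hpos : ∀ i, ((c i).map ψ).eval y ∈ F.C d)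
    (hne : ∀ i, ((c i).map ψ).eval y ≠ 0) (q : α) (hq : Even (c q).natDegree) (hqlc : (c q).leadingCoeff = -1)
    {N R : ℕ} (hN : Fintype.card α ≤ N) (hR : rr d N ≤ R) (hC : F.Cons (kk d N * R)) :
    ∃ (F' : Filt K) (g : EX d α → ℤˣ), Filt.Le F F' (RingHom.id K) ∧ F'.Cons R ∧
      (∀ x, F'.Sg δ (ψ (X.v x)) (g x)) ∧ ∃ p, ∀ ι, X.Φ g p ι := by
  classical
  have : Nonempty α := ⟨q⟩
  obtain ⟨ht1, ht2, ht3⟩ := card_le_tt (d := d) hN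
  obtain ⟨T, hT⟩ : ∃ T, T = tt d N := ⟨_, rfl⟩
  obtain ⟨ω, hω⟩ : ∃ ω, ω = ww d N := ⟨_, rfl⟩
  have hωe : ω = 3 * T * δ + 3 * T := by rw [hω, hT, hδ, ww]
  have hrr : rr d N = (4 * d + 4) * ((2 * d + 2) * (T * ω)) := by rw [hω, hT, rr]
  rw [← hT] at ht1 ht2 ht3
  have hT1 : 1 ≤ T := by omega
  have hω1 : 1 ≤ ω := by rw [hωe]; nlinarith
  have hTω : T * ω ≤ R := le_trans (by rw [hrr]; nlinarith [Nat.zero_le (d * (T * ω)), Nat.zero_le (d * (d * (T * ω)))]) hR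
  have hδω : δ ≤ ω := by rw [hωe]; nlinarith
  have hωT : ω ≤ T * ω := by nlinarith
  have hv0 : ∀ x, ψ (X.v x) ≠ 0 := fun x h => X.v_0 x (hψ (by rw [h, map_zero]))
  -- decide signs
  obtain ⟨F1, hL1, hC1, hdec⟩ := Filt.exists_dec (F := F) (Finset.univ.image fun x => ψ (X.v x)) (δ := δ)
    (R := 2 * (Filt.cst T ^ T * R)) (by
      intro x hx
      rw [Finset.mem_image] at hx
      obtain ⟨x, _, rfl⟩ := hx
      exact hψB _ _ (X.v_B x)) (hC.mono (by
      rw [kk, ← hT]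
      calc _ ≤ 2 ^ T * (2 * (Filt.cst T ^ T * R)) := by
            gcongr
            · norm_num
            · exact Finset.card_image_le.trans ht1
        _ = _ := by ring))
  have hg : ∀ x, ∃ s, F1.Sg δ (ψ (X.v x)) s := by
    intro x
    rcases hdec _ (Finset.mem_image_of_mem _ (Finset.mem_univ x)) with h | h
    · exact ⟨1, Filt.Sg.of_C h (hv0 x)⟩
    · refine ⟨-1, ?_⟩
      have := (Filt.Sg.of_C h (neg_ne_zero.2 (hv0 x))).neg
      rwa [neg_neg] at this
  choose g hg using hg
  have hcst : 1 ≤ Filt.cst T := Nat.one_le_iff_ne_zero.2 (by unfold Filt.cst; positivity)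
  have hC1' : F1.Cons R := hC1.mono (by nlinarith [Nat.one_le_pow T _ hcst])
  refine ⟨F1, g, hL1, hC1', hg, ?_⟩
  -- invert the leading coefficients
  obtain ⟨lc, hlc⟩ : ∃ lc : EI d α → K, ∀ i, lc i = ψ (X.v (Sum.inl i)) := ⟨_, fun _ => rfl⟩
  have hlc0 : ∀ i, lc i ≠ 0 := fun i => by rw [hlc]; exact hv0 _
  have hlcB : ∀ i, lc i ∈ F1.B δ := fun i => by
    rw [hlc]; exact hL1.B (hψB _ _ (X.v_B _))
  obtain ⟨Θ, hΘ⟩ : ∃ Θ, Θ = ∏ i, lc i := ⟨_, rfl⟩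
  have hprodB : ∀ s : Finset (EI d α), ∏ i ∈ s, lc i ∈ F1.B (T * δ + T) := by
    intro s
    refine F1.B_of_le ?_ (F1.gr.prod s lc (fun _ => δ) (fun i _ => hlcB i))
    rw [Finset.sum_const, smul_eq_mul]
    have : s.card ≤ T := (Finset.card_le_univ s).trans ht2
    nlinarith
  have hΘ0 : Θ ≠ 0 := hΘ ▸ Finset.prod_ne_zero_iff.2 fun i _ => hlc0 i
  have hC2 := Filt.inv_cons hC1 hΘ0 (δ := T * δ + T) (by nlinarith) (hΘ ▸ hprodB _)
  obtain ⟨F2, hF2⟩ : ∃ F2, F2 = F1.adj (RingHom.id K) Θ⁻¹ (T * δ + T) := ⟨_, rfl⟩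
  rw [← hF2] at hC2
  have hL2 : Filt.Le F1 F2 (RingHom.id K) := hF2 ▸ Filt.le_adj _ _ _ _
  have hΘB : Θ⁻¹ ∈ F2.B (T * δ + T) := hF2 ▸ Filt.mem_adj _ _ _ _
  have hinv : ∀ i, (lc i)⁻¹ ∈ F2.B (2 * (T * δ + T)) := by
    intro i
    have e : (lc i)⁻¹ = Θ⁻¹ * ∏ j ∈ Finset.univ.erase i, lc j := by
      rw [hΘ, ← Finset.mul_prod_erase _ _ (Finset.mem_univ i), mul_inv, mul_assoc, inv_mul_cancel₀, mul_one]
      exact Finset.prod_ne_zero_iff.2 fun i _ => hlc0 i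
    rw [e, two_mul]
    exact F2.gr.mul hΘB (hL2.B (hprodB _))
  have hfl : ∀ i, ((X.f i).map ψ).leadingCoeff = lc i := fun i => by
    rw [hlc]; exact Polynomial.leadingCoeff_map_of_leadingCoeff_ne_zero _ (hv0 (Sum.inl i))
  obtain ⟨fh, hfh⟩ : ∃ fh : EI d α → K[X], ∀ i, fh i = Polynomial.C (lc i)⁻¹ * (X.f i).map ψ := ⟨_, fun _ => rfl⟩
  have hmon : ∀ i, (fh i).Monic := by
    intro i
    rw [Polynomial.Monic, hfh, Polynomial.leadingCoeff_mul, Polynomial.leadingCoeff_C, hfl, inv_mul_cancel₀ (hlc0 i)]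
  have hfd : ∀ i, (fh i).natDegree ≤ 2 * d := fun i => by
    rw [hfh]; exact (Polynomial.natDegree_C_mul_le _ _).trans (Polynomial.natDegree_map_le.trans (X.f_d i))
  have hfB : ∀ i, fh i ∈ WP F2.B ω ((fh i).natDegree * ω) := by
    intro i
    rw [mem_WP]
    intro j
    rcases lt_trichotomy j (fh i).natDegree with hj | hj | hj
    · refine Bz_of_le F2.gr (s := ω) (by nlinarith) ?_
      rw [hfh, Polynomial.coeff_C_mul, Polynomial.coeff_map]
      refine F2.B_of_le ?_ (F2.gr.mul (hinv i) (hL2.B (hL1.B (hψB _ _ (WP0.1 (X.f_B i) j)))))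
      rw [hωe]; nlinarith
    · rw [hj, (hmon i).coeff_natDegree]
      exact Bz_of_le F2.gr (s := 0) (by simp) F2.gr.one
    · rw [Polynomial.coeff_eq_zero_of_natDegree_lt hj]
      exact zero_mem _
  obtain ⟨K', _, F3, φ, n', ξ, m, Q, hL3, hC3, hcomp, a0, ha0⟩ := Filt.completion F2 fh y T ω R ht2 hTω (by omega) hmon hfB
    (F2.B_of_le hω1 (hL2.B (hL1.B hy))) (by
      refine le_trans ?_ ht3
      have := Finset.sum_le_card_nsmul Finset.univ (fun i => (fh i).natDegree) (2 * d) (fun i _ => hfd i)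
      simp only [smul_eq_mul, Finset.card_univ] at this
      omega) hC2
  have hL : Filt.Le F1 F3 φ := by simpa using hL2.trans hL3
  have hL0 : Filt.Le F F3 φ := by simpa using hL1.trans hL
  have hfl' : ∀ i, ((X.f i).map (φ.comp ψ)).leadingCoeff = φ (lc i) := fun i => by
    rw [hlc]
    refine Polynomial.leadingCoeff_map_of_leadingCoeff_ne_zero _ ?_
    exact (map_ne_zero φ).2 (hv0 (Sum.inl i))
  have efh : (fun i => (fh i).map φ) = fun i => Polynomial.C ((X.f i).map (φ.comp ψ)).leadingCoeff⁻¹ * (X.f i).map (φ.comp ψ) := by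
    funext i
    rw [hfl', hfh]
    simp [Polynomial.map_map]
  rw [efh] at hcomp
  have hsg3 : ∀ x, F3.Sg δ ((φ.comp ψ) (X.v x)) (g x) := fun x => (hg x).le hL
  have hWR : 4 * ((2 * d + 2) * (T * ω)) ≤ R := le_trans (by rw [hrr]; nlinarith [Nat.zero_le (d * (T * ω)), Nat.zero_le (d * (d * (T * ω)))]) hR
  have hmdl := hcomp.mdl (κ := fun i => g (Sum.inl i)) (D := 2 * d) (R := R) (fun i => by
      rw [hfl', hlc]; exact (hsg3 (Sum.inl i)).mono (hδω.trans hωT))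
    (fun i => Polynomial.natDegree_map_le.trans (X.f_d i)) hC3 hWR
  have hM : X.Model F3 ((2 * d + 2) * (T * ω)) R (φ.comp ψ) g n' ξ m := ⟨hmdl, fun x => (hsg3 x).mono (by nlinarith)⟩
  have hd : d ≤ R := by
    have := le_dNext d
    rw [← hδ] at this
    omega
  have hs0 : ∀ i, sgn g m a0 i = 1 := by
    intro i
    have h1 : F3.Sg d (((c i).map (φ.comp ψ)).eval (ξ a0)) 1 := by
      have h2 : ((c i).map (φ.comp ψ)).eval (ξ a0) = φ (((c i).map ψ).eval y) := by
        rw [ha0, ← Polynomial.map_map, Polynomial.eval_map, Polynomial.eval₂_hom]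
      rw [h2]
      exact Filt.Sg.of_C (hL0.C (hpos i)) ((map_ne_zero φ).2 (hne i))
    obtain ⟨h3, h4⟩ := Filt.Loc.unique hC3 (hM.mdl.loc (Sum.inl i) a0) (Filt.Loc.of_eval h1) (by omega) hd
    rw [sgn_one]; exact ⟨h3, h4⟩
  have hgq : g (Sum.inl (Sum.inl q)) = -1 := by
    have h1 := hg (Sum.inl (Sum.inl q))
    have h2 : X.v (Sum.inl (Sum.inl q)) = -1 := hqlc
    rw [h2, map_neg, map_one] at h1
    exact Filt.Sg.unique hC1' h1 (Filt.Sg.one 0).neg (by omega) (Nat.zero_le _)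
  obtain ⟨p, z, hz, hs⟩ := hM.rolle X a0 hs0 q hq hgq
  refine ⟨p, fun ι => ?_⟩
  refine (hM.Φ_iff X ?_ p ι).2 ⟨z, hz, fun s => hs _⟩
  refine le_trans ?_ hR
  rw [hrr]; exact Nat.mul_le_mul_right _ (by omega)

end ENS
end

section
open MvPolynomial
open scoped Polynomial

namespace ENS

/-- the graded cone generated by squares and weighted generators -/
inductive Cone {σ : Type} (G : Set (MvPolynomial σ ℝ × ℕ)) : ℕ → MvPolynomial σ ℝ → Prop
  | zero (s : ℕ) : Cone G s 0
  | sq {r s : ℕ} {p : MvPolynomial σ ℝ} (hp : p.totalDegree ≤ r) (hrs : 2 * r ≤ s) : Cone G s (p ^ 2)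
  | gen {w s : ℕ} {f : MvPolynomial σ ℝ} (hf : (f, w) ∈ G) (hd : f.totalDegree ≤ w) (hws : w ≤ s) : Cone G s f
  | add {s : ℕ} {f g : MvPolynomial σ ℝ} (hf : Cone G s f) (hg : Cone G s g) : Cone G s (f + g)
  | mul {r s t : ℕ} {f g : MvPolynomial σ ℝ} (hf : Cone G r f) (hg : Cone G s g) (h : r + s ≤ t) : Cone G t (f * g)

theorem Cone.mono {σ : Type} {G : Set (MvPolynomial σ ℝ × ℕ)} {r s : ℕ} {f : MvPolynomial σ ℝ} (h : Cone G r f) (hrs : r ≤ s) :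
    Cone G s f := by
  induction h generalizing s with
  | zero => exact .zero _
  | sq hp h => exact .sq hp (h.trans hrs)
  | gen hf hd h => exact .gen hf hd (h.trans hrs)
  | add _ _ h1 h2 => exact .add (h1 hrs) (h2 hrs)
  | mul h1 h2 h _ _ => exact .mul h1 h2 (h.trans hrs)

theorem Cone.deg {σ : Type} {G : Set (MvPolynomial σ ℝ × ℕ)} {r : ℕ} {f : MvPolynomial σ ℝ} (h : Cone G r f) :
    f.totalDegree ≤ r := by
  induction h with
  | zero => simp
  | sq hp h => exact (totalDegree_pow _ _).trans ((Nat.mul_le_mul_left 2 hp).trans h)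
  | gen hf hd h => exact hd.trans h
  | add _ _ h1 h2 => exact (totalDegree_add _ _).trans (max_le h1 h2)
  | mul _ _ h h1 h2 => exact (totalDegree_mul _ _).trans ((add_le_add h1 h2).trans h)

/-- the degree filtration -/
noncomputable def MB (σ : Type) (r : ℕ) : AddSubgroup (MvPolynomial σ ℝ) where
  carrier := {f | f.totalDegree ≤ r}
  zero_mem' := by simp
  add_mem' := fun {a b} ha hb => (totalDegree_add a b).trans (max_le ha hb)
  neg_mem' := fun {a} ha => by simpa using ha

theorem mem_MB {σ : Type} {r : ℕ} {f : MvPolynomial σ ℝ} : f ∈ MB σ r ↔ f.totalDegree ≤ r := Iff.rfl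

theorem MB_gr (σ : Type) : IsGr (MB σ) where
  mono := fun r s h f hf => le_trans (show f.totalDegree ≤ r from hf) h
  one := by rw [mem_MB]; simp
  mul := fun {r s a b} ha hb => (totalDegree_mul a b).trans (add_le_add ha hb)

noncomputable def MF {σ : Type} (G : Set (MvPolynomial σ ℝ × ℕ)) : Filt (MvPolynomial σ ℝ) where
  B := MB σ
  C := fun r => { carrier := {f | Cone G r f}, zero_mem' := .zero _, add_mem' := fun ha hb => .add ha hb }
  gr := MB_gr σ
  C_mono := fun r s h f hf => Cone.mono hf h
  mul_C := fun ha hb => Cone.mul ha hb le_rfl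
  C_le := fun ha => Cone.deg ha
  sq_C := fun ha => Cone.sq ha le_rfl

theorem mem_MF_C {σ : Type} {G : Set (MvPolynomial σ ℝ × ℕ)} {r : ℕ} {f : MvPolynomial σ ℝ} : f ∈ (MF G).C r ↔ Cone G r f := Iff.rfl

theorem mem_MF_B {σ : Type} {G : Set (MvPolynomial σ ℝ × ℕ)} {r : ℕ} {f : MvPolynomial σ ℝ} : f ∈ (MF G).B r ↔ f.totalDegree ≤ r := Iff.rfl

theorem MF_le {σ : Type} {G : Set (MvPolynomial σ ℝ × ℕ)} {K : Type} [CommRing K] {F : Filt K} {φ : MvPolynomial σ ℝ →+* K}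
    (hB : ∀ r f, f.totalDegree ≤ r → φ f ∈ F.B r) (hG : ∀ f w, (f, w) ∈ G → f.totalDegree ≤ w → φ f ∈ F.C w) :
    Filt.Le (MF G) F φ := by
  refine ⟨fun {r a} ha => hB r a ha, fun {r a} ha => ?_⟩
  have ha : Cone G r a := ha
  induction ha with
  | zero => simp
  | sq hp h => rw [map_pow]; exact F.C_of_le h (F.sq_C (hB _ _ hp))
  | gen hf hd h => exact F.C_of_le h (hG _ _ hf hd)
  | add _ _ h1 h2 => rw [map_add]; exact add_mem (h1 ‹_›) (h2 ‹_›)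
  | mul _ _ h h1 h2 => rw [map_mul]; exact F.C_of_le h (F.mul_C (h1 ‹_›) (h2 ‹_›))

theorem finSucc_eval_X {m : ℕ} (f : MvPolynomial (Fin (m + 1)) ℝ) :
    ((finSuccEquiv ℝ m f).map (rename (Fin.succ : Fin m → Fin (m+1)) : MvPolynomial (Fin m) ℝ →ₐ[ℝ] _).toRingHom).eval (X 0) = f := by
  induction f using MvPolynomial.induction_on with
  | C a => simp [finSuccEquiv_apply]
  | add p q hp hq => rw [map_add, Polynomial.map_add, Polynomial.eval_add, hp, hq]
  | mul_X p i hp =>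
    rw [map_mul, Polynomial.map_mul, Polynomial.eval_mul, hp]
    congr 1
    refine Fin.cases ?_ (fun j => ?_) i
    · simp [finSuccEquiv_X_zero]
    · simp [finSuccEquiv_X_succ]

theorem finSucc_rename {m : ℕ} (f : MvPolynomial (Fin m) ℝ) : finSuccEquiv ℝ m (rename Fin.succ f) = Polynomial.C f := by
  induction f using MvPolynomial.induction_on with
  | C a => simp [finSuccEquiv_apply]
  | add p q hp hq => rw [map_add, map_add, hp, hq, map_add]
  | mul_X p i hp => rw [map_mul, map_mul, hp, rename_X, finSuccEquiv_X_succ, map_mul]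

theorem MF_step {m : ℕ} {α : Type} [Fintype α] {d N R : ℕ} (hd : 2 ≤ d) (hN : Fintype.card α ≤ N)
    (c : α → MvPolynomial (Fin (m + 1)) ℝ) (c0 : ∀ i, c i ≠ 0) (cd : ∀ i, (c i).totalDegree ≤ d)
    (G' : Set (MvPolynomial (Fin m) ℝ × ℕ)) (q : α) (q' : MvPolynomial (Fin m) ℝ) (hq : c q = -X 0 ^ 2 + rename Fin.succ q')
    (hq0 : q' ≠ 0) (hqd : q'.totalDegree ≤ d) (hR : rr d N ≤ R)
    (hC : (MF ({fw | ∃ f w, (f, w) ∈ G' ∧ fw = (rename Fin.succ f, w)} ∪ {fw | ∃ i, fw = (c i, d)})).Cons (kk d N * R)) :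
    ∃ c' : Option (EX d α) → MvPolynomial (Fin m) ℝ, c' none = q' ∧ (∀ j, c' j ≠ 0) ∧ (∀ j, (c' j).totalDegree ≤ dNext d) ∧
      (MF (G' ∪ {fw | ∃ j, fw = (c' j, dNext d)})).Cons R ∧
      ∀ t : Fin m → ℝ, (∀ j, 0 < eval t (c' j)) → ∃ y : ℝ, ∀ i, 0 < eval (Fin.cons y t) (c i) := by
  classical
  obtain ⟨G, hG⟩ : ∃ G, G = ({fw | ∃ f w, (f, w) ∈ G' ∧ fw = (rename (Fin.succ : Fin m → Fin (m+1)) f, w)} ∪ {fw | ∃ i, fw = (c i, d)} : Set (MvPolynomial (Fin (m+1)) ℝ × ℕ)) := ⟨_, rfl⟩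
  rw [← hG] at hC
  obtain ⟨e, he⟩ : ∃ e : α → (MvPolynomial (Fin m) ℝ)[X], e = fun i => finSuccEquiv ℝ m (c i) := ⟨_, rfl⟩
  have he' : ∀ i, e i = finSuccEquiv ℝ m (c i) := fun i => by rw [he]
  have e0 : ∀ i, e i ≠ 0 := fun i h => c0 i (by
    rw [he'] at h; exact (map_eq_zero_iff _ (finSuccEquiv ℝ m).injective).1 h)
  have eB : ∀ i, e i ∈ WP (MB (Fin m)) 0 d := by
    intro i j
    refine Bz_of_le (MB_gr _) (s := d) (by simp) ?_
    rw [mem_MB, he']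
    by_cases hz : ((finSuccEquiv ℝ m) (c i)).coeff j = 0
    · simp [hz]
    · have := totalDegree_coeff_finSuccEquiv_add_le (c i) j hz
      have := cd i
      omega
  have ed : ∀ i, (e i).natDegree ≤ d := fun i => by
    rw [he', natDegree_finSuccEquiv]
    exact (degreeOf_le_totalDegree _ _).trans (cd i)
  obtain ⟨X⟩ := exists_EData (MB_gr (Fin m)) e eB ed e0
  let K := FractionRing (MvPolynomial (Fin (m + 1)) ℝ)
  let φ : MvPolynomial (Fin (m + 1)) ℝ →+* K := algebraMap _ _
  have hφ : Function.Injective φ := IsFractionRing.injective _ _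
  obtain ⟨rn, hrn⟩ : ∃ rn, rn = (rename (Fin.succ : Fin m → Fin (m+1)) : MvPolynomial (Fin m) ℝ →ₐ[ℝ] _).toRingHom := ⟨_, rfl⟩
  have hrn' : ∀ f, rn f = rename Fin.succ f := fun f => by rw [hrn]; rfl
  have hrninj : Function.Injective rn := fun a b h => rename_injective _ (Fin.succ_injective _) (by rwa [hrn', hrn'] at h)
  have hrnd : ∀ f, (rn f).totalDegree ≤ f.totalDegree := fun f => by rw [hrn']; exact totalDegree_rename_le _ _
  have hey : ∀ i, ((e i).map (φ.comp rn)).eval (φ (MvPolynomial.X 0)) = φ (c i) := by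
    intro i
    rw [← Polynomial.map_map, Polynomial.eval_map, Polynomial.eval₂_at_apply, hrn, he', finSucc_eval_X]
  have hL0 : Filt.Le (MF G) ((MF G).map φ) φ := Filt.le_map _ _
  have hqe : e q = -Polynomial.X ^ 2 + Polynomial.C q' := by
    rw [he', hq, map_add, map_neg, map_pow, finSuccEquiv_X_zero, finSucc_rename]
  have hqdeg : (e q).natDegree = 2 := by
    rw [hqe]; compute_degree!
  obtain ⟨F', g, hL, hC', hs, p, hp⟩ := EData.formal_side rfl X (F := (MF G).map φ) (ψ := φ.comp rn) (hφ.comp hrninj)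
    (fun r x hx => hL0.B (by rw [mem_MF_B]; exact (hrnd x).trans hx)) (φ (MvPolynomial.X 0))
    (hL0.B (by rw [mem_MF_B]; simp))
    (fun i => by
      rw [hey]; exact hL0.C (Cone.gen (by rw [hG]; exact Or.inr ⟨i, rfl⟩) (cd i) le_rfl))
    (fun i => by rw [hey]; exact fun h => c0 i (hφ (by rw [h, map_zero])))
    q (by rw [hqdeg]; exact even_two) (by rw [Polynomial.leadingCoeff, hqdeg, hqe]; simp [Polynomial.coeff_C])
    hN hR (hC.map hφ)
  have hL1 : Filt.Le (MF G) F' φ := by simpa using hL0.trans hL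
  refine ⟨fun j => j.elim q' (fun x => C (((g x : ℤˣ) : ℤ) : ℝ) * X.v x), rfl, ?_, ?_, ?_, ?_⟩
  · rintro (_ | x)
    · exact hq0
    · refine mul_ne_zero ?_ (X.v_0 x)
      rw [Ne, C_eq_zero]; exact_mod_cast (g x).ne_zero
  · rintro (_ | x)
    · have := le_dNext d
      exact hqd.trans (by omega)
    · refine (totalDegree_mul _ _).trans ?_
      rw [totalDegree_C, zero_add]; exact X.v_B x
  · refine Filt.Cons.of_le (F' := F') (φ := φ.comp rn) (MF_le ?_ ?_) (hφ.comp hrninj) hC'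
    · intro r f hf
      exact hL1.B (by rw [mem_MF_B]; exact (hrnd f).trans hf)
    · rintro f w (hfw | ⟨j, hj⟩) hfd
      · refine hL1.C (Cone.gen ?_ ((hrnd f).trans hfd) le_rfl)
        rw [hG]; exact Or.inl ⟨f, w, hfw, congrArg (fun a => (a, w)) (hrn' f)⟩
      · rw [Prod.mk.injEq] at hj
        obtain ⟨rfl, rfl⟩ := hj
        rcases j with _ | x
        · have h1 : Cone G d (rn q') := by
            have : rn q' = c q + (MvPolynomial.X 0) ^ 2 := by rw [hq, hrn']; ring
            rw [this]
            refine .add (.gen (by rw [hG]; exact Or.inr ⟨q, rfl⟩) (cd q) le_rfl) (.sq (r := 1) (by simp) (by omega))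
          exact hL1.C (h1.mono (by have := le_dNext d; omega))
        · have := (hs x).2
          simpa using this
  · intro t ht
    obtain ⟨y, hy⟩ := X.real_side (eval t) g (fun x => by
      have := ht (some x)
      simpa using this) p hp
    refine ⟨y, fun i => ?_⟩
    have := hy i
    rw [he'] at this
    rwa [eval_eq_eval_mv_eval']

end ENS
end

section
open MvPolynomial
open scoped Polynomial

namespace ENS
open Filter Topology

/-- positivity for `ρ → ∞` and then `μ → 0+` -/
def EvPos (f : MvPolynomial (Fin 2) ℝ) : Prop :=
  ∀ᶠ ρ : ℝ in atTop, ∀ᶠ μ : ℝ in 𝓝[>] 0, 0 < eval ![μ, ρ] f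

theorem poly_ev_pos (p : ℝ[X]) (hp : 0 < p.leadingCoeff) : ∀ᶠ ρ : ℝ in atTop, 0 < p.eval ρ := by
  by_cases hd : 0 < p.degree
  · exact (p.tendsto_atTop_of_leadingCoeff_nonneg hd hp.le).eventually_gt_atTop 0
  · have h := Polynomial.eq_C_of_degree_le_zero (not_lt.1 hd)
    rw [h] at hp ⊢
    rw [Polynomial.leadingCoeff_C] at hp
    simp [hp]

theorem mv1_ev (c : MvPolynomial (Fin 1) ℝ) (hc : c ≠ 0) :
    (∀ᶠ ρ : ℝ in atTop, 0 < eval ![ρ] c) ∨ (∀ᶠ ρ : ℝ in atTop, 0 < eval ![ρ] (-c)) := by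
  obtain ⟨p, hp⟩ : ∃ p : ℝ[X], p = aeval (fun _ => Polynomial.X) c := ⟨_, rfl⟩
  have he : ∀ ρ : ℝ, eval ![ρ] c = p.eval ρ := by
    intro ρ
    have h : ∀ c : MvPolynomial (Fin 1) ℝ, eval ![ρ] c = (aeval (fun _ => Polynomial.X) c : ℝ[X]).eval ρ := by
      intro c
      induction c using MvPolynomial.induction_on with
      | C a => simp
      | add p q hp hq => rw [map_add, map_add, hp, hq, Polynomial.eval_add]
      | mul_X p i hp => rw [map_mul, map_mul, hp, Polynomial.eval_mul]; simp
    rw [hp, h]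
  have hp0 : p ≠ 0 := by
    rintro h
    apply hc
    apply MvPolynomial.funext
    intro x
    have : x = ![x 0] := by ext i; fin_cases i; rfl
    rw [this, he, h]; simp
  rcases lt_or_gt_of_ne (Polynomial.leadingCoeff_ne_zero.2 hp0) with h | h
  · right
    filter_upwards [poly_ev_pos (-p) (by rw [Polynomial.leadingCoeff_neg]; linarith)] with ρ hρ
    rw [map_neg, he]; simpa using hρ
  · left
    filter_upwards [poly_ev_pos p h] with ρ hρ
    rwa [he]

theorem evPos_of_trailing (f : MvPolynomial (Fin 2) ℝ) (P' : (MvPolynomial (Fin 1) ℝ)[X]) (k : ℕ)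
    (hP : finSuccEquiv ℝ 1 f = Polynomial.X ^ k * P')
    (h : ∀ᶠ ρ : ℝ in atTop, 0 < eval ![ρ] (P'.coeff 0)) : EvPos f := by
  filter_upwards [h] with ρ hρ
  have hc : Continuous fun μ : ℝ => (P'.map (eval ![ρ])).eval μ := Polynomial.continuous _
  have h1 : ∀ᶠ μ : ℝ in 𝓝 0, 0 < (P'.map (eval ![ρ])).eval μ := by
    apply hc.continuousAt.eventually_const_lt
    change 0 < (P'.map (eval ![ρ])).eval 0
    rwa [← Polynomial.coeff_zero_eq_eval_zero, Polynomial.coeff_map]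
  filter_upwards [nhdsWithin_le_nhds h1, self_mem_nhdsWithin] with μ h2 h3
  have : (![μ, ρ] : Fin 2 → ℝ) = Fin.cons μ ![ρ] := rfl
  rw [this, eval_eq_eval_mv_eval', hP, Polynomial.map_mul, Polynomial.eval_mul]
  exact mul_pos (by simpa using pow_pos h3 k) h2

theorem evPos_or (f : MvPolynomial (Fin 2) ℝ) (hf : f ≠ 0) : EvPos f ∨ EvPos (-f) := by
  have h0 : finSuccEquiv ℝ 1 f ≠ 0 := fun h => hf ((map_eq_zero_iff _ (finSuccEquiv ℝ 1).injective).1 h)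
  obtain ⟨P', hP'⟩ : Polynomial.X ^ (finSuccEquiv ℝ 1 f).natTrailingDegree ∣ finSuccEquiv ℝ 1 f := by
    rw [Polynomial.X_pow_dvd_iff]
    intro d hd
    exact Polynomial.coeff_eq_zero_of_lt_natTrailingDegree hd
  have hc : P'.coeff 0 ≠ 0 := by
    have h1 : (finSuccEquiv ℝ 1 f).coeff (finSuccEquiv ℝ 1 f).natTrailingDegree = P'.coeff 0 := by
      conv_lhs => rw [hP']
      have := Polynomial.coeff_X_pow_mul P' (finSuccEquiv ℝ 1 f).natTrailingDegree 0
      rw [zero_add] at this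
      rw [← this, ← hP']
    rw [← h1]
    exact Polynomial.trailingCoeff_nonzero_iff_nonzero.2 h0
  rcases mv1_ev _ hc with h | h
  · exact Or.inl (evPos_of_trailing f P' _ hP' h)
  · refine Or.inr (evPos_of_trailing (-f) (-P') (finSuccEquiv ℝ 1 f).natTrailingDegree ?_ (by simpa using h))
    have : -(Polynomial.X ^ ((MvPolynomial.finSuccEquiv ℝ 1) f).natTrailingDegree * P') = Polynomial.X ^ ((MvPolynomial.finSuccEquiv ℝ 1) f).natTrailingDegree * -P' := by ring
    rw [map_neg, ← this, ← hP']

def lft : (k : ℕ) → Fin 2 → Fin (k + 2)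
  | 0 => id
  | k + 1 => fun i => (lft k i).succ

theorem lft_val (k : ℕ) (i : Fin 2) : (lft k i : ℕ) = k + i := by
  induction k with
  | zero => simp [lft]
  | succ k ih => simp only [lft, Fin.val_succ, ih]; omega

theorem lft_eq (k : ℕ) : lft k = Fin.natAdd k := by
  ext i; rw [lft_val, Fin.val_natAdd]

noncomputable def qk : (k : ℕ) → MvPolynomial (Fin (k + 2)) ℝ
  | 0 => X 1
  | k + 1 => -X 0 ^ 2 + rename Fin.succ (qk k)

def Lam : (k : ℕ) → Set (MvPolynomial (Fin (k + 2)) ℝ × ℕ)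
  | 0 => {fw | EvPos fw.1 ∧ fw.1.totalDegree ≤ fw.2}
  | k + 1 => {fw | ∃ f w, (f, w) ∈ Lam k ∧ fw = (rename Fin.succ f, w)}

theorem mem_Lam {k : ℕ} {f : MvPolynomial (Fin (k + 2)) ℝ} {w : ℕ} (h : (f, w) ∈ Lam k) :
    ∃ f0, EvPos f0 ∧ f0.totalDegree ≤ w ∧ f = rename (Fin.natAdd k) f0 := by
  rw [← lft_eq]
  induction k with
  | zero => exact ⟨f, h.1, h.2, by simp [lft]⟩
  | succ k ih =>
    obtain ⟨f1, w1, h1, h2⟩ := h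
    rw [Prod.mk.injEq] at h2
    obtain ⟨rfl, rfl⟩ := h2
    obtain ⟨f0, h3, h4, rfl⟩ := ih h1
    exact ⟨f0, h3, h4, by rw [rename_rename]; rfl⟩

theorem qk_deg (k : ℕ) : (qk k).totalDegree ≤ 2 := by
  induction k with
  | zero => simp [qk]
  | succ k ih =>
    rw [qk]
    refine (totalDegree_add _ _).trans (max_le ?_ ((totalDegree_rename_le _ _).trans ih))
    rw [totalDegree_neg]
    exact (totalDegree_pow _ _).trans (by simp)

theorem qk_ne (k : ℕ) : qk k ≠ 0 := by
  suffices h : ∃ x, eval x (qk k) ≠ 0 by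
    obtain ⟨x, hx⟩ := h
    rintro h0
    rw [h0] at hx; simp at hx
  induction k with
  | zero => exact ⟨fun _ => 1, by simp [qk]⟩
  | succ k ih =>
    obtain ⟨x, hx⟩ := ih
    refine ⟨Fin.cons 0 x, ?_⟩
    rw [qk, map_add, eval_rename]
    simpa [Function.comp_def] using hx

def KK : ℕ → ℕ → ℕ → ℕ
  | 0, d, _ => d
  | k + 1, d, N => kk d N * max (rr d N) (KK k (dNext d) (tt d N + 1))

theorem main_ind (k : ℕ) : ∀ (α : Type) [Fintype α] (d N : ℕ) (_ : 2 ≤ d) (_ : Fintype.card α ≤ N)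
    (c : α → MvPolynomial (Fin (k + 2)) ℝ) (_ : ∀ i, c i ≠ 0) (_ : ∀ i, (c i).totalDegree ≤ d)
    (_ : ∃ q, c q = qk k) (_ : (MF (Lam k ∪ {fw | ∃ i, fw = (c i, d)})).Cons (KK k d N)),
    ∀ᶠ ρ : ℝ in atTop, ∀ᶠ μ : ℝ in 𝓝[>] 0, ∃ x : Fin (k + 2) → ℝ, x ∘ lft k = ![μ, ρ] ∧ ∀ i, 0 < eval x (c i) := by
  induction k with
  | zero =>
    intro α _ d N hd hN c c0 cd _ hC
    have h : ∀ i, EvPos (c i) := by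
      intro i
      rcases evPos_or _ (c0 i) with h | h
      · exact h
      · exfalso
        refine c0 i (hC.zero (r := d) (s := d) (Cone.gen (Or.inr ⟨i, rfl⟩) (cd i) le_rfl) (Cone.gen (Or.inl ⟨h, ?_⟩) ?_ le_rfl) le_rfl le_rfl)
        · simpa using cd i
        · simpa using cd i
    have h2 : ∀ᶠ ρ : ℝ in atTop, ∀ i, ∀ᶠ μ : ℝ in 𝓝[>] 0, 0 < eval ![μ, ρ] (c i) := eventually_all.2 h
    filter_upwards [h2] with ρ hρ
    filter_upwards [eventually_all.2 hρ] with μ hμ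
    exact ⟨![μ, ρ], rfl, hμ⟩
  | succ k ih =>
    intro α _ d N hd hN c c0 cd ⟨q, hq⟩ hC
    obtain ⟨c', hn, h0, hdeg, hC', hreal⟩ := MF_step hd hN c c0 cd (Lam k) q (qk k) hq (qk_ne k) ((qk_deg k).trans hd)
      (le_max_left (rr d N) (KK k (dNext d) (tt d N + 1))) hC
    have hcard : Fintype.card (Option (EX d α)) ≤ tt d N + 1 := by
      have : Nonempty α := ⟨q⟩
      rw [Fintype.card_option]
      have := (card_le_tt (d := d) hN).1
      omega
    have h := ih (Option (EX d α)) (dNext d) (tt d N + 1) (by have := le_dNext d; omega) hcard c' h0 hdeg ⟨none, hn⟩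
      (hC'.mono (le_max_right _ _))
    filter_upwards [h] with ρ hρ
    filter_upwards [hρ] with μ hμ
    obtain ⟨x, hx, hpos⟩ := hμ
    obtain ⟨y, hy⟩ := hreal x hpos
    refine ⟨Fin.cons y x, ?_, hy⟩
    rw [← hx]
    ext i
    simp [lft]

theorem eval_qk (k : ℕ) (x : Fin (k + 2) → ℝ) : eval x (qk k) = x (Fin.natAdd k 1) - ∑ i, x (Fin.castAdd 2 i) ^ 2 := by
  induction k with
  | zero => simp [qk]
  | succ k ih =>
    rw [qk, map_add, eval_rename, ih, Fin.sum_univ_succ]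
    have h1 : (Fin.natAdd (k + 1) (1 : Fin 2) : Fin (k + 1 + 2)) = (Fin.natAdd k (1 : Fin 2)).succ := by
      ext; simp
    have h2 : ∀ i : Fin k, (Fin.castAdd 2 i.succ : Fin (k + 1 + 2)) = (Fin.castAdd 2 i).succ := by
      intro i; ext; simp
    have h3 : (Fin.castAdd 2 (0 : Fin (k+1)) : Fin (k + 1 + 2)) = 0 := by ext; simp
    rw [h1, h3]
    simp only [h2, Function.comp_def]
    simp
    ring

/-- the three inequalities of the Positivstellensatz system -/
noncomputable def fam {n : ℕ} (p g : MvPolynomial (Fin n) ℝ) : Fin 3 → MvPolynomial (Fin (n + 2)) ℝ :=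
  ![qk n, X (Fin.natAdd n 1) * rename (Fin.castAdd 2) p ^ 2 - 1, X (Fin.natAdd n 0) - rename (Fin.castAdd 2) g]

theorem certificate {n : ℕ} (p g : MvPolynomial (Fin n) ℝ) (hg : ∀ x, 0 ≤ eval x g) (hgp : ∀ x, eval x g = 0 → eval x p = 0)
    {d : ℕ} (hd : 2 ≤ d) (hpd : 1 + 2 * p.totalDegree ≤ d) (hgd : g.totalDegree ≤ d) :
    ∃ b : MvPolynomial (Fin (n + 2)) ℝ, b ≠ 0 ∧ b.totalDegree ≤ KK n d 3 ∧
      Cone (Lam n ∪ {fw | ∃ i, fw = (fam p g i, d)}) (2 * KK n d 3) (-(b ^ 2)) := by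
  by_contra hcon
  have hC : (MF (Lam n ∪ {fw | ∃ i, fw = (fam p g i, d)})).Cons (KK n d 3) := by
    intro b hb hbc
    by_contra hb0
    exact hcon ⟨b, hb0, hb, hbc⟩
  have h0 : ∀ i, fam p g i ≠ 0 := by
    intro i
    fin_cases i
    · exact qk_ne n
    · intro h
      have := congrArg (eval (0 : Fin (n + 2) → ℝ)) h
      simp [fam] at this
    · intro h
      have := congrArg (eval (Fin.append (0 : Fin n → ℝ) (![eval 0 g + 1, 0] : Fin 2 → ℝ))) h
      simp [fam, eval_rename, Function.comp_def] at this
  have hdeg : ∀ i, (fam p g i).totalDegree ≤ d := by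
    intro i
    fin_cases i
    · exact (qk_deg n).trans hd
    · refine (totalDegree_sub _ _).trans (max_le ((totalDegree_mul _ _).trans ?_) (by simp))
      refine le_trans (add_le_add (b := 1) (by simp) ((totalDegree_pow _ _).trans (Nat.mul_le_mul_left 2 (totalDegree_rename_le _ _)))) hpd
    · refine (totalDegree_sub _ _).trans (max_le (by simp; omega) ((totalDegree_rename_le _ _).trans hgd))
  have H := main_ind n (Fin 3) d 3 hd (by simp) (fam p g) h0 hdeg ⟨0, rfl⟩ hC
  obtain ⟨ρ, hρ, hρ0⟩ := (H.and (eventually_gt_atTop (0:ℝ))).exists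
  have hex : ∀ᶠ μ : ℝ in 𝓝[>] 0, ∃ x : Fin n → ℝ, ∑ i, x i ^ 2 < ρ ∧ 1 < ρ * (eval x p) ^ 2 ∧ eval x g < μ := by
    filter_upwards [hρ] with μ hμ
    obtain ⟨x, hx, hpos⟩ := hμ
    rw [lft_eq] at hx
    have hxμ : x (Fin.natAdd n 0) = μ := congrFun hx 0
    have hxρ : x (Fin.natAdd n 1) = ρ := congrFun hx 1
    refine ⟨x ∘ Fin.castAdd 2, ?_, ?_, ?_⟩
    · have := hpos 0
      simp only [fam, Matrix.cons_val_zero, eval_qk, hxρ] at this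
      simpa using this
    · have := hpos 1
      simp only [fam, Matrix.cons_val_one, Matrix.cons_val_zero, map_sub, map_mul, map_pow, eval_X, eval_rename, map_one, hxρ] at this
      linarith
    · have := hpos 2
      simp only [fam, Matrix.cons_val, map_sub, eval_X, eval_rename, hxμ] at this
      linarith
  have hcp : Continuous fun x : Fin n → ℝ => eval x p := MvPolynomial.continuous_eval p
  have hcg : Continuous fun x : Fin n → ℝ => eval x g := MvPolynomial.continuous_eval g
  obtain ⟨S, hS⟩ : ∃ S : Set (Fin n → ℝ), S = {x | ∑ i, x i ^ 2 ≤ ρ ∧ 1 ≤ ρ * (eval x p) ^ 2} := ⟨_, rfl⟩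
  have hSc : IsCompact S := by
    refine Metric.isCompact_of_isClosed_isBounded ?_ ?_
    · rw [hS]
      have h1 : Continuous fun x : Fin n → ℝ => ∑ i, x i ^ 2 := by fun_prop
      have h2 : Continuous fun x : Fin n → ℝ => ρ * (eval x p) ^ 2 := by fun_prop
      exact IsClosed.inter (isClosed_le h1 continuous_const) (isClosed_le continuous_const h2)
    · refine (Metric.isBounded_closedBall (x := (0 : Fin n → ℝ)) (r := ρ + 1)).subset ?_
      intro x hx
      rw [hS] at hx
      rw [mem_closedBall_zero_iff, pi_norm_le_iff_of_nonneg (by linarith)]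
      intro i
      have h1 : x i ^ 2 ≤ ρ := (Finset.single_le_sum (fun j _ => sq_nonneg (x j)) (Finset.mem_univ i)).trans hx.1
      rw [Real.norm_eq_abs, abs_le]
      constructor <;> nlinarith
  have hSne : S.Nonempty := by
    obtain ⟨μ, x, h1, h2, _⟩ := hex.exists
    rw [hS]; exact ⟨x, h1.le, h2.le⟩
  obtain ⟨z, hz, hmin⟩ := hSc.exists_isMinOn hSne hcg.continuousOn
  have hz0 : eval z g ≤ 0 := by
    refine le_of_forall_gt_imp_ge_of_dense fun μ hμ => ?_
    obtain ⟨ν, ⟨x, h1, h2, h3⟩, h4⟩ := (hex.and (Ioo_mem_nhdsGT hμ)).exists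
    have : eval z g ≤ eval x g := hmin (by rw [hS]; exact ⟨h1.le, h2.le⟩)
    linarith [h4.2]
  have := hgp z (le_antisymm hz0 (hg z))
  rw [hS] at hz
  have h2 := hz.2
  rw [this] at h2
  norm_num at h2

end ENS
end

section
open MvPolynomial
open scoped Polynomial

namespace ENS
open Filter Topology

/-! ### leading terms -/

theorem mono_ev {c ε : ℝ} (hc : 0 ≤ c) (hε : 0 < ε) {i j i0 j0 : ℕ} (h : i0 < i ∨ (i = i0 ∧ j < j0)) :
    ∀ᶠ ρ : ℝ in atTop, ∀ᶠ μ : ℝ in 𝓝[>] 0, c * (μ ^ i * ρ ^ j) ≤ ε * (μ ^ i0 * ρ ^ j0) := by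
  rcases h with h | ⟨rfl, h⟩
  · filter_upwards [eventually_ge_atTop (1 : ℝ)] with ρ hρ
    have hK : 0 ≤ c * ρ ^ j := mul_nonneg hc (by positivity)
    have hpos : 0 < min 1 (ε / (c * ρ ^ j + 1)) := lt_min one_pos (by positivity)
    filter_upwards [Ioo_mem_nhdsGT hpos] with μ hμ
    have h0 : 0 < μ := hμ.1
    have h1 : μ ≤ 1 := (hμ.2.trans_le (min_le_left _ _)).le
    have h2 : μ ≤ ε / (c * ρ ^ j + 1) := (hμ.2.trans_le (min_le_right _ _)).le
    have h3 : c * ρ ^ j * μ ≤ ε := by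
      rw [le_div_iff₀ (by positivity)] at h2
      nlinarith
    have h4 : μ ^ i ≤ μ ^ (i0 + 1) := pow_le_pow_of_le_one h0.le h1 h
    have h5 : 1 ≤ ρ ^ j0 := one_le_pow₀ hρ
    calc c * (μ ^ i * ρ ^ j) = (c * ρ ^ j) * μ ^ i := by ring
      _ ≤ (c * ρ ^ j) * μ ^ (i0 + 1) := mul_le_mul_of_nonneg_left h4 hK
      _ = (c * ρ ^ j * μ) * μ ^ i0 := by ring
      _ ≤ ε * μ ^ i0 := mul_le_mul_of_nonneg_right h3 (by positivity)
      _ ≤ ε * (μ ^ i0 * ρ ^ j0) := mul_le_mul_of_nonneg_left (le_mul_of_one_le_right (by positivity) h5) hε.le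
  · filter_upwards [eventually_ge_atTop (1 : ℝ), eventually_ge_atTop (c / ε)] with ρ hρ hρ2
    filter_upwards [self_mem_nhdsWithin] with μ hμ
    have h0 : 0 < μ := hμ
    rw [div_le_iff₀ hε] at hρ2
    have h5 : ρ ^ (j + 1) ≤ ρ ^ j0 := pow_le_pow_right₀ hρ h
    calc c * (μ ^ i * ρ ^ j) = c * (μ ^ i * ρ ^ j) := rfl
      _ ≤ (ρ * ε) * (μ ^ i * ρ ^ j) := mul_le_mul_of_nonneg_right hρ2 (by positivity)
      _ = ε * μ ^ i * ρ ^ (j + 1) := by ring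
      _ ≤ ε * μ ^ i * ρ ^ j0 := mul_le_mul_of_nonneg_left h5 (by positivity)
      _ = _ := by ring

theorem exists_dom' (f : MvPolynomial (Fin 2) ℝ) (hf : f ≠ 0) : ∃ m0 ∈ f.support,
    (∀ m ∈ f.support, m0 0 ≤ m 0 ∧ (m 0 = m0 0 → m 1 ≤ m0 1)) ∧
    ∀ᶠ ρ : ℝ in atTop, ∀ᶠ μ : ℝ in 𝓝[>] 0,
      ∑ m ∈ f.support.erase m0, |coeff m f| * (μ ^ m 0 * ρ ^ m 1) < |coeff m0 f| * (μ ^ m0 0 * ρ ^ m0 1) := by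
  classical
  have hne : f.support.Nonempty := by
    rw [Finset.nonempty_iff_ne_empty, Ne, support_eq_empty]; exact hf
  obtain ⟨m1, hm1, h1⟩ := Finset.exists_min_image f.support (fun m => m 0) hne
  obtain ⟨m0, hm0, h0⟩ := Finset.exists_max_image (f.support.filter fun m => m 0 = m1 0) (fun m => m 1)
    ⟨m1, by simpa using hm1⟩
  rw [Finset.mem_filter] at hm0
  have hP : ∀ m ∈ f.support, m0 0 ≤ m 0 ∧ (m 0 = m0 0 → m 1 ≤ m0 1) := by
    intro m hm
    refine ⟨by rw [hm0.2]; exact h1 m hm, fun h => h0 m ?_⟩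
    rw [Finset.mem_filter]; exact ⟨hm, by rw [h, hm0.2]⟩
  refine ⟨m0, hm0.1, hP, ?_⟩
  have ha : 0 < |coeff m0 f| := abs_pos.2 (mem_support_iff.1 hm0.1)
  obtain ⟨N, hN⟩ : ∃ N : ℝ, N = (f.support.erase m0).card := ⟨_, rfl⟩
  have hN0 : 0 ≤ N := by rw [hN]; positivity
  obtain ⟨ε, hε⟩ : ∃ ε : ℝ, ε = |coeff m0 f| / (N + 1) := ⟨_, rfl⟩
  have hε0 : 0 < ε := by rw [hε]; positivity
  have key : ∀ᶠ ρ : ℝ in atTop, ∀ᶠ μ : ℝ in 𝓝[>] 0, ∀ m ∈ f.support.erase m0,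
      |coeff m f| * (μ ^ m 0 * ρ ^ m 1) ≤ ε * (μ ^ m0 0 * ρ ^ m0 1) := by
    have : ∀ᶠ ρ : ℝ in atTop, ∀ m ∈ f.support.erase m0, ∀ᶠ μ : ℝ in 𝓝[>] 0,
        |coeff m f| * (μ ^ m 0 * ρ ^ m 1) ≤ ε * (μ ^ m0 0 * ρ ^ m0 1) := by
      rw [Filter.eventually_all_finset]
      intro m hm
      rw [Finset.mem_erase] at hm
      refine mono_ev (abs_nonneg _) hε0 ?_
      obtain ⟨h2, h3⟩ := hP m hm.2
      rcases h2.lt_or_eq with h | h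
      · exact Or.inl h
      · refine Or.inr ⟨h.symm, lt_of_le_of_ne (h3 h.symm) fun h4 => hm.1 ?_⟩
        ext i; fin_cases i
        · exact h.symm
        · exact h4
    filter_upwards [this] with ρ hρ
    rwa [Filter.eventually_all_finset]
  filter_upwards [key, eventually_gt_atTop (0 : ℝ)] with ρ hρ hρ0
  filter_upwards [hρ, self_mem_nhdsWithin] with μ hμ hμ0
  have hμ0 : 0 < μ := hμ0
  have hmon : 0 < μ ^ m0 0 * ρ ^ m0 1 := by positivity
  calc _ ≤ ∑ m ∈ f.support.erase m0, ε * (μ ^ m0 0 * ρ ^ m0 1) := Finset.sum_le_sum hμ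
    _ = N * ε * (μ ^ m0 0 * ρ ^ m0 1) := by rw [Finset.sum_const, nsmul_eq_mul, hN]; ring
    _ < |coeff m0 f| * (μ ^ m0 0 * ρ ^ m0 1) := by
      refine mul_lt_mul_of_pos_right ?_ hmon
      rw [hε, mul_div_assoc', div_lt_iff₀ (by positivity)]
      nlinarith

theorem eval_two (f : MvPolynomial (Fin 2) ℝ) (μ ρ : ℝ) :
    eval ![μ, ρ] f = ∑ m ∈ f.support, coeff m f * (μ ^ m 0 * ρ ^ m 1) := by
  rw [eval_eq']
  simp [Fin.prod_univ_two]

theorem exists_dom (f : MvPolynomial (Fin 2) ℝ) (hf : EvPos f) : ∃ m0 ∈ f.support,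
    (∀ m ∈ f.support, m0 0 ≤ m 0 ∧ (m 0 = m0 0 → m 1 ≤ m0 1)) ∧
    ∀ᶠ ρ : ℝ in atTop, ∀ᶠ μ : ℝ in 𝓝[>] 0,
      ∑ m ∈ f.support.erase m0, |coeff m f| * (μ ^ m 0 * ρ ^ m 1) < coeff m0 f * (μ ^ m0 0 * ρ ^ m0 1) := by
  classical
  have hf0 : f ≠ 0 := by
    rintro rfl
    obtain ⟨ρ, hρ⟩ := hf.exists
    obtain ⟨μ, hμ⟩ := hρ.exists
    simp at hμ
  obtain ⟨m0, hm0, hP, hd⟩ := exists_dom' f hf0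
  refine ⟨m0, hm0, hP, ?_⟩
  rcases le_or_gt 0 (coeff m0 f) with h | h
  · rwa [abs_of_nonneg h] at hd
  · exfalso
    obtain ⟨ρ, ⟨h1, h2⟩, h3⟩ := ((hf.and hd).and (eventually_gt_atTop 0)).exists
    obtain ⟨μ, ⟨h4, h5⟩, h6⟩ := ((h1.and h2).and self_mem_nhdsWithin).exists
    have h6 : 0 < μ := h6
    rw [eval_two, ← Finset.add_sum_erase _ _ hm0] at h4
    rw [abs_of_neg h] at h5
    have : ∑ m ∈ f.support.erase m0, coeff m f * (μ ^ m 0 * ρ ^ m 1) ≤ ∑ m ∈ f.support.erase m0, |coeff m f| * (μ ^ m 0 * ρ ^ m 1) :=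
      Finset.sum_le_sum fun m _ => mul_le_mul_of_nonneg_right (le_abs_self _) (by positivity)
    linarith

/-! ### generalities -/

theorem deg_ind {σ : Type} (S : ℕ → MvPolynomial σ ℝ → Prop) (mono : ∀ r s f, r ≤ s → S r f → S s f) (one : S 0 1)
    (hadd : ∀ k f g, S k f → S k g → S k (f + g)) (smul : ∀ k (a : ℝ) f, S k f → S k (C a * f))
    (mulX : ∀ k f i, S k f → S (k + 1) (f * X i)) {k : ℕ} {f : MvPolynomial σ ℝ} (hf : f.totalDegree ≤ k) : S k f := by
  classical
  have h0 : ∀ k, S k 0 := fun k => by simpa using smul k 0 1 (mono 0 k 1 (Nat.zero_le _) one)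
  have hm : ∀ k (m : σ →₀ ℕ), m.degree = k → S k (monomial m 1) := by
    intro k
    induction k with
    | zero =>
      intro m hm
      rw [Finsupp.degree_eq_zero_iff] at hm
      subst hm; exact one
    | succ k ih =>
      intro m hm
      have hm0 : m ≠ 0 := by rintro rfl; simp at hm
      obtain ⟨i, hi⟩ := Finsupp.ne_iff.1 hm0
      have hle : Finsupp.single i 1 ≤ m := by
        rw [Finsupp.single_le_iff]; exact Nat.one_le_iff_ne_zero.2 hi
      have hsum : m - Finsupp.single i 1 + Finsupp.single i 1 = m := tsub_add_cancel_of_le hle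
      have := mulX k _ i (ih (m - Finsupp.single i 1) (by
        have h := congrArg Finsupp.degree hsum
        rw [map_add, Finsupp.degree_single, hm] at h
        omega))
      rwa [X, monomial_mul, hsum, one_mul] at this
  rw [f.as_sum]
  have : ∀ s : Finset (σ →₀ ℕ), s ⊆ f.support → S k (∑ v ∈ s, monomial v (coeff v f)) := by
    intro s
    induction s using Finset.induction_on with
    | empty => intro _; simpa using h0 k
    | insert a s ha ih =>
      intro hs
      rw [Finset.sum_insert ha]
      refine hadd _ _ _ ?_ (ih fun x hx => hs (Finset.mem_insert_of_mem hx))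
      have h1 : a.degree ≤ k := (le_totalDegree (hs (Finset.mem_insert_self _ _))).trans hf
      have := smul k (coeff a f) _ (mono _ k _ h1 (hm _ a rfl))
      rwa [C_mul_monomial, mul_one] at this
  exact this _ (Finset.Subset.refl _)

theorem Cone.mono_G {σ : Type} {G G' : Set (MvPolynomial σ ℝ × ℕ)} (hG : G ⊆ G') {r : ℕ} {f : MvPolynomial σ ℝ} (h : Cone G r f) :
    Cone G' r f := by
  induction h with
  | zero => exact .zero _
  | sq hp h => exact .sq hp h
  | gen hf hd h => exact .gen (hG hf) hd h
  | add _ _ h1 h2 => exact .add h1 h2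
  | mul _ _ h h1 h2 => exact .mul h1 h2 h

theorem Cone.finite {σ : Type} {G : Set (MvPolynomial σ ℝ × ℕ)} {r : ℕ} {f : MvPolynomial σ ℝ} (h : Cone G r f) :
    ∃ G0 : Set (MvPolynomial σ ℝ × ℕ), G0.Finite ∧ G0 ⊆ G ∧ (∀ fw ∈ G0, fw.2 ≤ r) ∧ Cone G0 r f := by
  induction h with
  | zero => exact ⟨∅, Set.finite_empty, Set.empty_subset _, by simp, .zero _⟩
  | sq hp h => exact ⟨∅, Set.finite_empty, Set.empty_subset _, by simp, .sq hp h⟩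
  | @gen w s f hf hd h => exact ⟨{(f, w)}, Set.finite_singleton _, by simpa using hf, by simpa using h, .gen rfl hd h⟩
  | add _ _ h1 h2 =>
    obtain ⟨G1, a1, b1, c1, d1⟩ := h1
    obtain ⟨G2, a2, b2, c2, d2⟩ := h2
    refine ⟨G1 ∪ G2, a1.union a2, Set.union_subset b1 b2, ?_, .add (d1.mono_G Set.subset_union_left) (d2.mono_G Set.subset_union_right)⟩
    rintro fw (h | h)
    · exact c1 _ h
    · exact c2 _ h
  | mul _ _ h h1 h2 =>
    obtain ⟨G1, a1, b1, c1, d1⟩ := h1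
    obtain ⟨G2, a2, b2, c2, d2⟩ := h2
    refine ⟨G1 ∪ G2, a1.union a2, Set.union_subset b1 b2, ?_, .mul (d1.mono_G Set.subset_union_left) (d2.mono_G Set.subset_union_right) h⟩
    rintro fw (h' | h')
    · exact (c1 _ h').trans (by omega)
    · exact (c2 _ h').trans (by omega)

/-- regrading -/
def Filt.scale {K : Type} [CommRing K] (F : Filt K) (κ : ℕ) : Filt K where
  B := fun r => F.B (κ * r)
  C := fun r => F.C (κ * r)
  gr := 
    { mono := fun r s h => F.gr.mono (Nat.mul_le_mul_left κ h)
      one := by simpa using F.gr.one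
      mul := fun {r s a b} ha hb => by rw [mul_add]; exact F.gr.mul ha hb }
  C_mono := fun _ _ h => F.C_mono (Nat.mul_le_mul_left κ h)
  mul_C := fun {r s a b} ha hb => by rw [mul_add]; exact F.mul_C ha hb
  C_le := fun ha => F.C_le ha
  sq_C := fun {r a} ha => by
    rw [show κ * (2 * r) = 2 * (κ * r) by ring]; exact F.sq_C ha

theorem Filt.neg_sq_sum {K : Type} [CommRing K] {F : Filt K} {r : ℕ} {ι : Type} (s : Finset ι) (a : ι → K)
    (h : ∀ i ∈ s, a i ∈ F.B r ∧ -(a i) ^ 2 ∈ F.C (2 * r)) : (∑ i ∈ s, a i) ∈ F.B r ∧ -(∑ i ∈ s, a i) ^ 2 ∈ F.C (2 * r) := by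
  classical
  induction s using Finset.induction_on with
  | empty => simp
  | insert j s hj ih =>
    obtain ⟨h1, h2⟩ := h j (Finset.mem_insert_self _ _)
    obtain ⟨h3, h4⟩ := ih fun i hi => h i (Finset.mem_insert_of_mem hi)
    rw [Finset.sum_insert hj]
    refine ⟨add_mem h1 h3, ?_⟩
    have := add_mem (add_mem (add_mem h2 h2) (add_mem h4 h4)) (F.sq_C (sub_mem h1 h3))
    convert this using 1
    ring

/-! ### bounded elements -/

section Bd
variable {L : Type} [Field L] [Algebra ℝ L] {F : Filt L}

def Bd (F : Filt L) (r : ℕ) (c : ℝ) (a : L) : Prop := algebraMap ℝ L c - a ∈ F.C r ∧ algebraMap ℝ L c + a ∈ F.C r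

theorem real_mem_C (hF : ∀ c : ℝ, algebraMap ℝ L c ∈ F.B 0) {c : ℝ} (hc : 0 ≤ c) (r : ℕ) : algebraMap ℝ L c ∈ F.C r := by
  have := F.sq_C (hF (Real.sqrt c))
  rw [← map_pow, Real.sq_sqrt hc] at this
  exact F.C_of_le (by omega) this

theorem real_mem_B (hF : ∀ c : ℝ, algebraMap ℝ L c ∈ F.B 0) (c : ℝ) (r : ℕ) : algebraMap ℝ L c ∈ F.B r := F.B_of_le (Nat.zero_le _) (hF c)

theorem smul_mem_C (hF : ∀ c : ℝ, algebraMap ℝ L c ∈ F.B 0) {c : ℝ} (hc : 0 ≤ c) {r : ℕ} {a : L} (ha : a ∈ F.C r) : algebraMap ℝ L c * a ∈ F.C r := by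
  have := F.mul_C (real_mem_C hF hc 0) ha
  rwa [zero_add] at this

theorem smul_mem_B (hF : ∀ c : ℝ, algebraMap ℝ L c ∈ F.B 0) (c : ℝ) {r : ℕ} {a : L} (ha : a ∈ F.B r) : algebraMap ℝ L c * a ∈ F.B r := by
  have := F.gr.mul (hF c) ha
  rwa [zero_add] at this

theorem Bd.mono (hF : ∀ c : ℝ, algebraMap ℝ L c ∈ F.B 0) {r s : ℕ} {c c' : ℝ} {a : L} (h : Bd F r c a) (hrs : r ≤ s) (hc : c ≤ c') : Bd F s c' a := by
  have h0 := real_mem_C hF (sub_nonneg.2 hc) s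
  constructor
  · have := add_mem h0 (F.C_of_le hrs h.1)
    convert this using 1; rw [map_sub]; ring
  · have := add_mem h0 (F.C_of_le hrs h.2)
    convert this using 1; rw [map_sub]; ring

theorem Bd.const (hF : ∀ c : ℝ, algebraMap ℝ L c ∈ F.B 0) (c : ℝ) (r : ℕ) : Bd F r |c| (algebraMap ℝ L c) := by
  constructor
  · rw [← map_sub]; exact real_mem_C hF (sub_nonneg.2 (le_abs_self c)) r
  · rw [← map_add]; exact real_mem_C hF (by linarith [neg_abs_le c]) r

theorem Bd.one (hF : ∀ c : ℝ, algebraMap ℝ L c ∈ F.B 0) : Bd F 0 1 1 := by simpa using Bd.const hF 1 0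

theorem Bd.add {r : ℕ} {c c' : ℝ} {a b : L} (h : Bd F r c a) (h' : Bd F r c' b) : Bd F r (c + c') (a + b) := by
  constructor
  · have := add_mem h.1 h'.1
    convert this using 1; rw [map_add]; ring
  · have := add_mem h.2 h'.2
    convert this using 1; rw [map_add]; ring

theorem Bd.mul (hF : ∀ c : ℝ, algebraMap ℝ L c ∈ F.B 0) {r s : ℕ} {c c' : ℝ} {a b : L} (h : Bd F r c a) (h' : Bd F s c' b) : Bd F (r + s) (c * c') (a * b) := by
  have h2 : (algebraMap ℝ L 2) * algebraMap ℝ L (1/2) = 1 := by rw [← map_mul]; norm_num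
  have e2 : (algebraMap ℝ L 2) = 2 := map_ofNat (algebraMap ℝ L) 2
  rw [e2] at h2
  constructor
  · have := smul_mem_C hF (by norm_num : (0:ℝ) ≤ 1/2) (add_mem (F.mul_C h.1 h'.2) (F.mul_C h.2 h'.1))
    convert this using 1
    rw [map_mul]; linear_combination (-(algebraMap ℝ L c * algebraMap ℝ L c' - a * b)) * h2
  · have := smul_mem_C hF (by norm_num : (0:ℝ) ≤ 1/2) (add_mem (F.mul_C h.1 h'.1) (F.mul_C h.2 h'.2))
    convert this using 1
    rw [map_mul]; linear_combination (-(algebraMap ℝ L c * algebraMap ℝ L c' + a * b)) * h2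

theorem Bd.pow (hF : ∀ c : ℝ, algebraMap ℝ L c ∈ F.B 0) {r : ℕ} {a : L} (h : Bd F r 1 a) (k : ℕ) : Bd F (r * k) 1 (a ^ k) := by
  induction k with
  | zero => simpa using Bd.one hF
  | succ k ih =>
    have := Bd.mul hF ih h
    rw [one_mul] at this
    rw [pow_succ, mul_add, mul_one]; exact this

theorem Bd.smul (hF : ∀ c : ℝ, algebraMap ℝ L c ∈ F.B 0) {r : ℕ} {c : ℝ} {a : L} (h : Bd F r c a) (t : ℝ) : Bd F r (|t| * c) (algebraMap ℝ L t * a) := by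
  have := Bd.mul hF (Bd.const hF t 0) h
  simpa using this

theorem Bd.sum (hF : ∀ c : ℝ, algebraMap ℝ L c ∈ F.B 0) {ι : Type} (s : Finset ι) {r : ℕ} (c : ι → ℝ) (a : ι → L) (h : ∀ i ∈ s, Bd F r (c i) (a i)) :
    Bd F r (∑ i ∈ s, c i) (∑ i ∈ s, a i) := by
  classical
  induction s using Finset.induction_on with
  | empty =>
    have := Bd.const hF 0 r
    simpa using this
  | insert j s hj ih =>
    rw [Finset.sum_insert hj, Finset.sum_insert hj]
    exact Bd.add (h j (Finset.mem_insert_self _ _)) (ih fun i hi => h i (Finset.mem_insert_of_mem hi))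

end Bd

/-! ### finite differences -/

theorem exists_kappa (a : ℕ) : ∃ κ : Fin (a + 1) → ℝ, ∀ m : Fin (a + 1), ∑ j, κ j * ((j : ℕ) : ℝ) ^ (m : ℕ) = if (m : ℕ) = a then 1 else 0 := by
  have hdet : IsUnit (Matrix.vandermonde (fun j : Fin (a + 1) => ((j : ℕ) : ℝ))).det := by
    rw [isUnit_iff_ne_zero, Matrix.det_vandermonde_ne_zero_iff]
    intro i j h
    have h' : ((i : ℕ) : ℝ) = ((j : ℕ) : ℝ) := h
    exact Fin.ext (by exact_mod_cast h')
  refine ⟨Matrix.vecMul (fun m : Fin (a + 1) => if (m : ℕ) = a then 1 else 0) (Matrix.vandermonde (fun j : Fin (a + 1) => ((j : ℕ) : ℝ)))⁻¹, fun m => ?_⟩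
  have h := Matrix.vecMul_vecMul (fun m : Fin (a + 1) => if (m : ℕ) = a then (1:ℝ) else 0) (Matrix.vandermonde (fun j : Fin (a + 1) => ((j : ℕ) : ℝ)))⁻¹
    (Matrix.vandermonde (fun j : Fin (a + 1) => ((j : ℕ) : ℝ)))
  rw [Matrix.nonsing_inv_mul _ hdet, Matrix.vecMul_one] at h
  exact congrFun h m

theorem kappa_spec {L : Type} [CommRing L] [Algebra ℝ L] {a : ℕ} {κ : Fin (a + 1) → ℝ}
    (hκ : ∀ m : Fin (a + 1), ∑ j, κ j * ((j : ℕ) : ℝ) ^ (m : ℕ) = if (m : ℕ) = a then 1 else 0) (x s : L) (m : ℕ) (hm : m ≤ a) :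
    ∑ j, algebraMap ℝ L (κ j) * (x + algebraMap ℝ L ((j : ℕ) : ℝ) * s) ^ m = if m = a then s ^ a else 0 := by
  have h1 : ∀ j : Fin (a + 1), algebraMap ℝ L (κ j) * (x + algebraMap ℝ L ((j : ℕ) : ℝ) * s) ^ m =
      ∑ l ∈ Finset.range (m + 1), algebraMap ℝ L (κ j * ((j : ℕ) : ℝ) ^ l) * (s ^ l * x ^ (m - l) * (m.choose l : L)) := by
    intro j
    rw [add_comm, add_pow, Finset.mul_sum]
    refine Finset.sum_congr rfl fun l _ => ?_
    rw [map_mul, map_pow]; ring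
  rw [Finset.sum_congr rfl fun j _ => h1 j, Finset.sum_comm]
  have h2 : ∀ l ∈ Finset.range (m + 1), ∑ j : Fin (a + 1), algebraMap ℝ L (κ j * ((j : ℕ) : ℝ) ^ l) * (s ^ l * x ^ (m - l) * (m.choose l : L)) =
      if l = a then (s ^ l * x ^ (m - l) * (m.choose l : L)) else 0 := by
    intro l hl
    rw [← Finset.sum_mul, ← map_sum, hκ ⟨l, by rw [Finset.mem_range] at hl; omega⟩]
    by_cases h : l = a <;> simp [h]
  rw [Finset.sum_congr rfl h2, Finset.sum_ite_eq']
  by_cases h : m = a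
  · subst h; simp
  · rw [if_neg h, if_neg (by rw [Finset.mem_range]; omega)]

end ENS
end

section
open MvPolynomial
open scoped Polynomial

namespace ENS
open Filter Topology

/-- the set-up of the shift argument -/
structure Sh {n : ℕ} {L : Type} [Field L] [Algebra ℝ L] (F : Filt L) (x : Fin n → L) (P G v o l : L) : Prop where
  hF : ∀ c : ℝ, algebraMap ℝ L c ∈ F.B 0
  hx : ∀ i, x i ∈ F.B 1
  hP : P ∈ F.B 1
  hP0 : P ≠ 0
  hv : v * (1 + ∑ i, x i ^ 2) = 1
  ho : o * (1 + P ^ 2) = 1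
  hl : v * (P * o) * l = 1
  vB : v ∈ F.B 1
  vxB : ∀ i, v * x i ∈ F.B 1
  oB : o ∈ F.B 1
  pB : P * o ∈ F.B 1
  lB : l ∈ F.B 1
  hG : -G ∈ F.C 1

namespace Sh
variable {n : ℕ} {L : Type} [Field L] [Algebra ℝ L] {F : Filt L} {x : Fin n → L} {P G v o l : L}

theorem sumsq (h : Sh F x P G v o l) : ∑ i, x i ^ 2 ∈ F.C 2 := sum_mem fun i _ => F.sq_C (h.hx i)

theorem vC (h : Sh F x P G v o l) : v ∈ F.C 2 := by
  have h1 := F.sq_C h.vB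
  have h2 : ∑ i, (v * x i) ^ 2 ∈ F.C 2 := sum_mem fun i _ => F.sq_C (h.vxB i)
  have := add_mem h1 h2
  convert this using 1
  simp only [mul_pow]
  rw [← Finset.mul_sum]
  linear_combination (-v) * h.hv

theorem oC (h : Sh F x P G v o l) : o ∈ F.C 2 := by
  have := add_mem (F.sq_C h.oB) (F.sq_C h.pB)
  convert this using 1
  linear_combination (-o) * h.ho

theorem v_bd (h : Sh F x P G v o l) : Bd F 4 1 v := by
  constructor
  · have := F.mul_C h.vC h.sumsq
    convert this using 1
    rw [map_one]; linear_combination (-1 : L) * h.hv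
  · rw [map_one]; exact add_mem (F.one_C _) (F.C_of_le (by norm_num) h.vC)

theorem quad (h : Sh F x P G v o l) {a : L} (ha : a ∈ F.B 1) : 1 + a ^ 2 - a ∈ F.C 2 := by
  have e : (algebraMap ℝ L (1/2)) * 2 = 1 := by
    rw [← map_ofNat (algebraMap ℝ L) 2, ← map_mul]; norm_num
  have e' : (algebraMap ℝ L (3/4)) = 3 * algebraMap ℝ L (1/2) ^ 2 := by
    rw [← map_ofNat (algebraMap ℝ L) 3, ← map_pow, ← map_mul]; norm_num
  have := add_mem (F.sq_C (sub_mem ha (real_mem_B h.hF (1/2) 1))) (real_mem_C h.hF (by norm_num : (0:ℝ) ≤ 3/4) (2 * 1))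
  convert this using 1
  rw [e']
  linear_combination (-1 + a - 2 * algebraMap ℝ L (1/2)) * e

theorem vx_bd (h : Sh F x P G v o l) (i : Fin n) : Bd F 4 1 (v * x i) := by
  classical
  have key : ∀ a ∈ F.B 1, a ^ 2 = x i ^ 2 → 1 - v * a ∈ F.C 4 := by
    intro a ha ha2
    have h1 : ∑ j ∈ Finset.univ.erase i, x j ^ 2 ∈ F.C 2 := sum_mem fun i _ => F.sq_C (h.hx i)
    have := F.mul_C h.vC (add_mem (h.quad ha) h1)
    convert this using 1
    have h2 := h.hv
    rw [← Finset.add_sum_erase _ _ (Finset.mem_univ i)] at h2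
    rw [ha2]
    linear_combination (-1 : L) * h2
  constructor
  · rw [map_one]; exact key _ (h.hx i) rfl
  · have := key _ (neg_mem (h.hx i)) (by ring)
    convert this using 1
    rw [map_one]; ring

theorem o_bd (h : Sh F x P G v o l) : Bd F 4 1 o := by
  constructor
  · have := F.mul_C h.oC (F.sq_C h.hP)
    convert this using 1
    rw [map_one]; linear_combination (-1 : L) * h.ho
  · rw [map_one]; exact add_mem (F.one_C _) (F.C_of_le (by norm_num) h.oC)

theorem p_bd (h : Sh F x P G v o l) : Bd F 4 1 (P * o) := by
  constructor
  · have := F.mul_C h.oC (h.quad h.hP)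
    convert this using 1
    rw [map_one]; linear_combination (-1 : L) * h.ho
  · have := F.mul_C h.oC (h.quad (neg_mem h.hP))
    convert this using 1
    rw [map_one]; linear_combination (-1 : L) * h.ho

theorem u_bd (h : Sh F x P G v o l) : Bd F 8 1 (v * (P * o)) := by
  have := Bd.mul h.hF h.v_bd h.p_bd
  rwa [one_mul] at this

theorem uB (h : Sh F x P G v o l) : v * (P * o) ∈ F.B 2 := F.gr.mul h.vB h.pB

theorem powB (_h : Sh F x P G v o l) {a : L} {r : ℕ} (ha : a ∈ F.B r) (k s : ℕ) (hs : k * r ≤ s) : a ^ k ∈ F.B s :=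
  F.B_of_le hs (F.gr.pow ha k)

theorem sC (_h : Sh F x P G v o l) {a : L} {r : ℕ} (ha : a ∈ F.B r) (s : ℕ) (hs : 2 * r ≤ s) : a ^ 2 ∈ F.C s :=
  F.C_of_le hs (F.sq_C ha)

/-- substituted polynomials -/
theorem aeval_B (hF : ∀ c : ℝ, algebraMap ℝ L c ∈ F.B 0) {σ : Type} (y : σ → L) {κ : ℕ} (hy : ∀ i, y i ∈ F.B κ) {k : ℕ} {f : MvPolynomial σ ℝ}
    (hf : f.totalDegree ≤ k) : aeval y f ∈ F.B (κ * k) := by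
  refine deg_ind (fun k f => aeval y f ∈ F.B (κ * k)) ?_ ?_ ?_ ?_ ?_ hf
  · intro r s f hrs h
    exact F.B_of_le (Nat.mul_le_mul_left _ hrs) h
  · simpa using F.gr.one
  · intro k f g h1 h2
    rw [map_add]; exact add_mem h1 h2
  · intro k a f h
    rw [map_mul, algHom_C]; exact smul_mem_B hF a h
  · intro k f i h
    rw [map_mul, aeval_X, mul_add, mul_one]; exact F.gr.mul h (hy i)

theorem good (h : Sh F x P G v o l) {W : ℕ} {s : L} (hs : Bd F W 1 s) (τ : Fin n → ℝ) {k : ℕ} {f : MvPolynomial (Fin n) ℝ}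
    (hf : f.totalDegree ≤ k) : (∃ c, 0 ≤ c ∧ Bd F (k * (W + 8)) c (v ^ k * aeval x f)) ∧
      ∃ c, 0 ≤ c ∧ ∀ t : ℝ, 0 ≤ t → t ≤ 1 → ∃ f1 : L,
        aeval (fun i => x i + algebraMap ℝ L (τ i) * (algebraMap ℝ L t * s)) f = aeval x f + algebraMap ℝ L t * s * f1 ∧
        Bd F (k * (W + 8)) c (v ^ k * f1) := by
  refine deg_ind (fun k f => (∃ c, 0 ≤ c ∧ Bd F (k * (W + 8)) c (v ^ k * aeval x f)) ∧
      ∃ c, 0 ≤ c ∧ ∀ t : ℝ, 0 ≤ t → t ≤ 1 → ∃ f1 : L,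
        aeval (fun i => x i + algebraMap ℝ L (τ i) * (algebraMap ℝ L t * s)) f = aeval x f + algebraMap ℝ L t * s * f1 ∧
        Bd F (k * (W + 8)) c (v ^ k * f1)) ?_ ?_ ?_ ?_ ?_ hf
  · rintro r s' f hrs ⟨⟨c0, hc0, h0⟩, c1, hc1, h1⟩
    obtain ⟨e, rfl⟩ := Nat.exists_eq_add_of_le hrs
    have hb : ∀ c a, Bd F (r * (W + 8)) c (v ^ r * a) → Bd F ((r + e) * (W + 8)) c (v ^ (r + e) * a) := by
      intro c a ha
      have := Bd.mul h.hF (Bd.pow h.hF h.v_bd e) ha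
      rw [one_mul] at this
      refine Bd.mono h.hF (a := v ^ (r + e) * a) ?_ ?_ le_rfl (r := 4 * e + r * (W + 8))
      · convert this using 1; ring
      · nlinarith
    refine ⟨⟨c0, hc0, hb _ _ h0⟩, c1, hc1, fun t ht ht1 => ?_⟩
    obtain ⟨f1, e1, b1⟩ := h1 t ht ht1
    exact ⟨f1, e1, hb _ _ b1⟩
  · refine ⟨⟨1, zero_le_one, ?_⟩, 0, le_rfl, fun t _ _ => ⟨0, by simp, ?_⟩⟩
    · simpa using Bd.one h.hF
    · have := Bd.const h.hF 0 0
      simpa using this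
  · rintro k f g ⟨⟨c0, hc0, h0⟩, c1, hc1, h1⟩ ⟨⟨c0', hc0', h0'⟩, c1', hc1', h1'⟩
    refine ⟨⟨c0 + c0', by positivity, ?_⟩, c1 + c1', by positivity, fun t ht ht1 => ?_⟩
    · rw [map_add, mul_add (v ^ k)]; exact Bd.add h0 h0'
    · obtain ⟨f1, e1, b1⟩ := h1 t ht ht1
      obtain ⟨f1', e1', b1'⟩ := h1' t ht ht1
      refine ⟨f1 + f1', ?_, ?_⟩
      · rw [map_add, map_add, e1, e1']; ring
      · rw [mul_add (v ^ k)]; exact Bd.add b1 b1'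
  · rintro k a f ⟨⟨c0, hc0, h0⟩, c1, hc1, h1⟩
    refine ⟨⟨|a| * c0, by positivity, ?_⟩, |a| * c1, by positivity, fun t ht ht1 => ?_⟩
    · rw [map_mul, algHom_C, mul_left_comm]; exact Bd.smul h.hF h0 a
    · obtain ⟨f1, e1, b1⟩ := h1 t ht ht1
      refine ⟨algebraMap ℝ L a * f1, ?_, ?_⟩
      · rw [map_mul, map_mul, algHom_C, algHom_C, e1]; ring
      · rw [mul_left_comm]; exact Bd.smul h.hF b1 a
  · rintro k f i ⟨⟨c0, hc0, h0⟩, c1, hc1, h1⟩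
    refine ⟨⟨c0, hc0, ?_⟩, c1 + |τ i| * c0 + |τ i| * c1, by positivity, fun t ht ht1 => ?_⟩
    · have := Bd.mul h.hF h0 (h.vx_bd i)
      rw [mul_one] at this
      refine Bd.mono h.hF (r := k * (W + 8) + 4) ?_ (by nlinarith) le_rfl
      convert this using 1
      rw [map_mul, aeval_X]; ring
    · obtain ⟨f1, e1, b1⟩ := h1 t ht ht1
      refine ⟨f1 * x i + algebraMap ℝ L (τ i) * aeval x f + algebraMap ℝ L (τ i) * (algebraMap ℝ L t * s * f1), ?_, ?_⟩
      · rw [map_mul, map_mul, aeval_X, aeval_X, e1]; ring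
      · have i1 := Bd.mul h.hF b1 (h.vx_bd i)
        have i2 := Bd.smul h.hF (Bd.mul h.hF h.v_bd h0) (τ i)
        have i3 := Bd.smul h.hF (Bd.smul h.hF (Bd.mul h.hF (Bd.mul h.hF h.v_bd hs) b1) t) (τ i)
        have j1 := Bd.mono h.hF i1 (show _ ≤ (k + 1) * (W + 8) by nlinarith) (show _ ≤ c1 by linarith)
        have j2 := Bd.mono h.hF i2 (show _ ≤ (k + 1) * (W + 8) by nlinarith) (show _ ≤ |τ i| * c0 by rw [one_mul])
        have j3 := Bd.mono h.hF i3 (show _ ≤ (k + 1) * (W + 8) by nlinarith) (show _ ≤ |τ i| * c1 by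
          rw [abs_of_nonneg ht, one_mul, one_mul]
          exact mul_le_mul_of_nonneg_left (by nlinarith) (abs_nonneg _))
        have := Bd.add (Bd.add j1 j2) j3
        convert this using 1
        ring

end Sh
end ENS
end

section
open MvPolynomial
open scoped Polynomial

namespace ENS
open Filter Topology
namespace Sh
variable {n : ℕ} {L : Type} [Field L] [Algebra ℝ L] {F : Filt L} {x : Fin n → L} {P G v o l u : L}

theorem QB (h : Sh F x P G v o l) : 1 + ∑ i, x i ^ 2 ∈ F.B 2 := F.C_le (add_mem (F.one_C _) h.sumsq)

theorem lP (h : Sh F x P G v o l) : l * P = (1 + ∑ i, x i ^ 2) * (1 + P ^ 2) := by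
  obtain ⟨Q, hQ⟩ : ∃ Q, Q = 1 + ∑ i, x i ^ 2 := ⟨_, rfl⟩
  have h1 := h.hv
  have h2 := h.hl
  have h3 := h.ho
  rw [← hQ] at h1 ⊢
  linear_combination (-(l * P)) * h1 - (v * Q * l * P) * h3 + (Q * (1 + P ^ 2)) * h2

theorem l_sq (h : Sh F x P G v o l) : l ^ 2 = (l - 2 * ((1 + ∑ i, x i ^ 2) * P)) ^ 2 + 4 * (1 + ∑ i, x i ^ 2) ^ 2 := by
  have h1 := h.lP
  linear_combination (-4 * -(1 + ∑ i, x i ^ 2)) * h1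

theorem genA (h : Sh F x P G v o l) (hu : u = v * (P * o)) (τ : Fin n → ℝ) {ρ0 t : ℝ} (hρ : 4 ≤ ρ0) (ht : 0 ≤ t) (ht1 : t ≤ 1)
    (hT : (∑ i, τ i ^ 2) * t ≤ 1) (M : ℕ) :
    algebraMap ℝ L ρ0 * l ^ 2 - ∑ i, (x i + algebraMap ℝ L (τ i) * (algebraMap ℝ L t * u ^ (2 * M))) ^ 2 ∈ F.C (32 * M + 6) := by
  have huB : u ∈ F.B 2 := hu ▸ h.uB
  have hub : Bd F 8 1 u := hu ▸ h.u_bd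
  obtain ⟨T, hTd⟩ : ∃ T, T = ∑ i, τ i ^ 2 := ⟨_, rfl⟩
  have hT0 : 0 ≤ T := hTd ▸ Finset.sum_nonneg fun i _ => sq_nonneg _
  rw [← hTd] at hT
  obtain ⟨q, hq⟩ : ∃ q, q = ∑ i, x i ^ 2 := ⟨_, rfl⟩
  have hqC : q ∈ F.C 2 := hq ▸ h.sumsq
  obtain ⟨s, hs⟩ : ∃ s, s = u ^ (2 * M) := ⟨_, rfl⟩
  have hsB : s ∈ F.B (4 * M) := hs ▸ h.powB huB _ _ (by omega)
  have e1 : algebraMap ℝ L ρ0 * (l - 2 * ((1 + q) * P)) ^ 2 ∈ F.C (32 * M + 6) := by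
    refine smul_mem_C h.hF (by linarith) (h.sC (r := 3) ?_ _ (by omega))
    refine sub_mem (F.B_of_le (by norm_num) h.lB) ?_
    have h2 := F.gr.mul (hq ▸ h.QB) h.hP
    have := add_mem h2 h2
    rwa [← two_mul] at this
  have e2 : ∑ i, (x i - algebraMap ℝ L (τ i) * (algebraMap ℝ L t * s)) ^ 2 ∈ F.C (32 * M + 6) := by
    refine sum_mem fun i _ => h.sC (r := 4 * M + 1) (sub_mem (F.B_of_le (by omega) (h.hx i)) ?_) _ (by omega)
    exact F.B_of_le (by omega) (smul_mem_B h.hF _ (smul_mem_B h.hF _ hsB))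
  have e3 : algebraMap ℝ L (4 * ρ0) * q ^ 2 ∈ F.C (32 * M + 6) :=
    smul_mem_C h.hF (by linarith) (h.sC (F.C_le hqC) _ (by omega))
  have e4 : algebraMap ℝ L (8 * ρ0 - 2) * q ∈ F.C (32 * M + 6) := smul_mem_C h.hF (by linarith) (F.C_of_le (by omega) hqC)
  have e5 : algebraMap ℝ L (4 * ρ0 - 2 * T * t ^ 2) ∈ F.C (32 * M + 6) := by
    refine real_mem_C h.hF ?_ _
    have : T * t ^ 2 ≤ 1 := by nlinarith
    linarith
  have e6 : algebraMap ℝ L (2 * T * t ^ 2) * (algebraMap ℝ L 1 - u ^ (4 * M)) ∈ F.C (32 * M + 6) := by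
    refine smul_mem_C h.hF (by positivity) ?_
    exact F.C_of_le (by omega) (Bd.pow h.hF hub (4 * M)).1
  have hu4 : u ^ (4 * M) = s ^ 2 := by rw [hs, ← pow_mul]; congr 1; ring
  have id1 : ∑ i, (x i + algebraMap ℝ L (τ i) * (algebraMap ℝ L t * s)) ^ 2 + ∑ i, (x i - algebraMap ℝ L (τ i) * (algebraMap ℝ L t * s)) ^ 2
      = 2 * q + 2 * algebraMap ℝ L T * (algebraMap ℝ L t * s) ^ 2 := by
    rw [hq, hTd, map_sum, ← Finset.sum_add_distrib, Finset.mul_sum, Finset.mul_sum, Finset.sum_mul, ← Finset.sum_add_distrib]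
    refine Finset.sum_congr rfl fun i _ => ?_
    rw [map_pow]; ring
  have hl2 := h.l_sq
  rw [← hq] at hl2
  have := add_mem (add_mem (add_mem (add_mem (add_mem e1 e2) e3) e4) e5) e6
  rw [← hs]
  convert this using 1
  rw [hu4]
  simp only [map_sub, map_mul, map_pow, map_ofNat, map_one]
  linear_combination algebraMap ℝ L ρ0 * hl2 - id1

theorem genB (h : Sh F x P G v o l) (hu : u = v * (P * o)) {ρ0 t : ℝ} (hρ : 4 ≤ ρ0) (ht : 0 ≤ t)
    {M k : ℕ} (hk : k ≤ M) (hM : 1 ≤ M) {p1 : L} {c : ℝ} {W : ℕ} (hp1 : Bd F W c (v ^ k * p1)) (htc : t * c ≤ 1 / 2) {r : ℕ}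
    (hB : P + algebraMap ℝ L t * u ^ (2 * M) * p1 ∈ F.B r) :
    algebraMap ℝ L ρ0 * l ^ 2 * (P + algebraMap ℝ L t * u ^ (2 * M) * p1) ^ 2 - 1 ∈ F.C (2 * r + 32 * M + 2 * W + 16) := by
  obtain ⟨m, hm⟩ : ∃ m, 2 * M = m + 1 := ⟨2 * M - 1, by omega⟩
  obtain ⟨j, hj⟩ : ∃ j, m + 1 = j + k := ⟨m + 1 - k, by omega⟩
  obtain ⟨w, hw⟩ : ∃ w, w = o * (P * o) ^ m * v ^ j * (v ^ k * p1) := ⟨_, rfl⟩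
  have hwb : Bd F (4 + 4 * m + 4 * j + W) c w := by
    have := Bd.mul h.hF (Bd.mul h.hF (Bd.mul h.hF h.o_bd (Bd.pow h.hF h.p_bd m)) (Bd.pow h.hF h.v_bd j)) hp1
    rw [hw]; simpa only [one_mul] using this
  have he : u ^ (2 * M) * p1 = P * w := by
    rw [hw, hm, hu, mul_pow, hj, pow_add, ← hj, mul_pow (P) o (m + 1)]; ring
  have hwt : Bd F (4 + 4 * m + 4 * j + W) (1/2) (algebraMap ℝ L t * w) := by
    refine Bd.mono h.hF (Bd.smul h.hF hwb t) le_rfl ?_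
    rw [abs_of_nonneg ht]; exact htc
  have hh : (algebraMap ℝ L (1/2)) * 2 = 1 := by
    rw [← map_ofNat (algebraMap ℝ L) 2, ← map_mul]; norm_num
  obtain ⟨e, hed⟩ : ∃ e, e = algebraMap ℝ L t * u ^ (2 * M) * p1 := ⟨_, rfl⟩
  have hee : e = P * (algebraMap ℝ L t * w) := by rw [hed, mul_assoc, he]; ring
  rw [← hed] at hB ⊢
  obtain ⟨y, hy⟩ : ∃ y, y = algebraMap ℝ L t * w := ⟨_, rfl⟩
  rw [← hy] at hee hwt
  have heB : P ∈ F.B (r + 1) := F.B_of_le (by omega) h.hP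
  have e1 : algebraMap ℝ L (2 * ρ0) * (l * (P + e - algebraMap ℝ L (1/2) * P)) ^ 2 ∈ F.C (2 * r + 32 * M + 2 * W + 16) := by
    refine smul_mem_C h.hF (by linarith) (h.sC (r := 1 + (r + 1)) (F.gr.mul h.lB (sub_mem (F.B_of_le (by omega) hB) (smul_mem_B h.hF _ heB))) _ (by omega))
  have hlP : l * P - 1 ∈ F.C 4 := by
    rw [h.lP]
    have := add_mem (F.C_of_le (show 2 ≤ 4 by norm_num) h.sumsq) (F.mul_C (add_mem (F.one_C 2) h.sumsq) (F.sq_C h.hP))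
    convert this using 1
    ring
  have e2 : algebraMap ℝ L ρ0 * ((l * P) ^ 2 * ((algebraMap ℝ L (1/2) - y) * (algebraMap ℝ L (1/2) + y))) ∈ F.C (2 * r + 32 * M + 2 * W + 16) := by
    have := F.mul_C (F.sq_C (F.gr.mul h.lB h.hP)) (F.mul_C hwt.1 hwt.2)
    exact smul_mem_C h.hF (by linarith) (F.C_of_le (by omega) this)
  have e3 : algebraMap ℝ L (ρ0 / 4) * ((l * P - 1) * (l * P - 1 + (1 + 1))) ∈ F.C (2 * r + 32 * M + 2 * W + 16) := by
    have := F.mul_C hlP (add_mem hlP (add_mem (F.one_C 4) (F.one_C 4)))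
    exact smul_mem_C h.hF (by linarith) (F.C_of_le (by omega) this)
  have e4 := real_mem_C h.hF (show 0 ≤ ρ0 / 4 - 1 by linarith) (2 * r + 32 * M + 2 * W + 16)
  have := add_mem (add_mem (add_mem e1 e2) e3) e4
  convert this using 1
  have q1 : algebraMap ℝ L (ρ0 / 4) = algebraMap ℝ L ρ0 * algebraMap ℝ L (1/2) ^ 2 := by
    rw [← map_pow, ← map_mul]; congr 1; ring
  have q2 : algebraMap ℝ L (2 * ρ0) = 2 * algebraMap ℝ L ρ0 := by rw [map_mul, map_ofNat]
  rw [map_sub, q1, q2, hee, map_one]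
  obtain ⟨z, hz⟩ : ∃ z, z = algebraMap ℝ L (1/2) := ⟨_, rfl⟩
  obtain ⟨a, ha⟩ : ∃ z, z = algebraMap ℝ L ρ0 := ⟨_, rfl⟩
  rw [← hz] at hh ⊢
  rw [← ha]
  linear_combination (a * l ^ 2 * P ^ 2 * (1 + 2 * y - 2 * z)) * hh

theorem genC (h : Sh F x P G v o l) (hu : u = v * (P * o)) {μ0 t : ℝ} (ht : 0 ≤ t)
    {M k : ℕ} {g1 : L} {c : ℝ} {W : ℕ} (hp1 : Bd F W c (v ^ k * g1)) (htc : t * c ≤ μ0) :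
    algebraMap ℝ L μ0 * u ^ (2 * M) - (G + algebraMap ℝ L t * u ^ (2 * (M + k)) * g1) ∈ F.C (4 * M + 16 * k + W + 1) := by
  have huB : u ∈ F.B 2 := hu ▸ h.uB
  have hb : Bd F (12 * k + W) c (u ^ (2 * k) * g1) := by
    have := Bd.mul h.hF (Bd.mul h.hF (Bd.pow h.hF h.p_bd (2 * k)) (Bd.pow h.hF h.v_bd k)) hp1
    simp only [one_mul] at this
    refine Bd.mono h.hF (r := 4 * (2 * k) + 4 * k + W) ?_ (by omega) le_rfl
    convert this using 1
    rw [hu, mul_pow v, show 2 * k = k + k by ring, pow_add v]; ring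
  have hbt : Bd F (12 * k + W) μ0 (algebraMap ℝ L t * (u ^ (2 * k) * g1)) := by
    refine Bd.mono h.hF (Bd.smul h.hF hb t) le_rfl ?_
    rw [abs_of_nonneg ht]; exact htc
  have hs : (u ^ M) ^ 2 ∈ F.C (4 * M) := h.sC (h.powB huB M (2 * M) (by omega)) _ (by omega)
  have := add_mem (F.C_of_le (show _ ≤ 4 * M + 16 * k + W + 1 by omega) (F.mul_C hs hbt.1)) (F.C_of_le (show 1 ≤ 4 * M + 16 * k + W + 1 by omega) h.hG)
  convert this using 1
  rw [mul_add 2 M k, pow_add, ← pow_mul, mul_comm M 2]; ring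

theorem genD (h : Sh F x P G v o l) (hu : u = v * (P * o)) {f : MvPolynomial (Fin 2) ℝ} {m0 : Fin 2 →₀ ℕ} (hm0 : m0 ∈ f.support)
    (hm : ∀ m ∈ f.support, m0 0 ≤ m 0 ∧ (m 0 = m0 0 → m 1 ≤ m0 1)) {M w : ℕ} (hw : f.totalDegree ≤ w) (hM : w ≤ M) {μ0 ρ0 ε : ℝ}
    (hμ : 0 ≤ μ0) (hρ : 0 ≤ ρ0)
    (hdom : ε + ∑ m ∈ f.support.erase m0, |coeff m f| * (μ0 ^ m 0 * ρ0 ^ m 1) ≤ coeff m0 f * (μ0 ^ m0 0 * ρ0 ^ m0 1)) :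
    aeval ![algebraMap ℝ L μ0 * u ^ (2 * M), algebraMap ℝ L ρ0 * l ^ 2] f - algebraMap ℝ L ε * (u ^ (2 * (M * m0 0)) * l ^ (2 * m0 1))
      ∈ F.C (20 * (M + 1) * w) := by
  classical
  have huB : u ∈ F.B 2 := hu ▸ h.uB
  have hub : Bd F 8 1 u := hu ▸ h.u_bd
  have hul : u * l = 1 := hu ▸ h.hl
  have hdeg : ∀ m ∈ f.support, m 0 + m 1 ≤ w := by
    intro m hm
    have := (le_totalDegree hm).trans hw
    rw [Finsupp.sum_fintype _ _ (fun _ => rfl)] at this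
    simpa [Fin.sum_univ_two] using this
  obtain ⟨y, hy⟩ : ∃ y, y = u ^ (2 * (M * m0 0)) * l ^ (2 * m0 1) := ⟨_, rfl⟩
  have hyC : y ∈ F.C (4 * M * w + 2 * w) := by
    have h1 := hdeg _ hm0
    have : (u ^ (M * m0 0) * l ^ m0 1) ^ 2 ∈ F.C (4 * M * w + 2 * w) := by
      refine h.sC (r := 2 * (M * m0 0) + m0 1) (F.gr.mul (h.powB huB _ _ (by omega)) (h.powB h.lB _ _ (by omega))) _ ?_
      have : M * m0 0 ≤ M * w := Nat.mul_le_mul_left _ (by omega)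
      nlinarith
    rw [hy]
    convert this using 1
    ring
  have hval : aeval ![algebraMap ℝ L μ0 * u ^ (2 * M), algebraMap ℝ L ρ0 * l ^ 2] f
      = ∑ m ∈ f.support, algebraMap ℝ L (coeff m f * (μ0 ^ m 0 * ρ0 ^ m 1)) * (u ^ (2 * (M * m 0)) * l ^ (2 * m 1)) := by
    rw [aeval_def, eval₂_eq']
    refine Finset.sum_congr rfl fun m _ => ?_
    rw [Fin.prod_univ_two]
    simp only [Matrix.cons_val_zero, Matrix.cons_val_one, map_mul, map_pow, mul_pow, ← pow_mul]
    ring_nf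
  have hterm : ∀ m ∈ f.support, ∃ e : ℕ, e ≤ (M + 1) * w ∧ u ^ (2 * (M * m 0)) * l ^ (2 * m 1) = y * u ^ (2 * e) := by
    intro m hmm
    obtain ⟨h1, h2⟩ := hm m hmm
    have h3 := hdeg m hmm
    have h4 := hdeg m0 hm0
    obtain ⟨e, he⟩ : ∃ e, M * m 0 + m0 1 = M * m0 0 + m 1 + e := by
      refine Nat.exists_eq_add_of_le ?_
      rcases Nat.eq_or_lt_of_le h1 with h5 | h5
      · have := h2 h5.symm
        rw [h5]; omega
      · have : M * (m0 0 + 1) ≤ M * m 0 := Nat.mul_le_mul_left _ h5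
        rw [mul_add] at this
        omega
    refine ⟨e, ?_, ?_⟩
    · have : M * m 0 ≤ M * w := Nat.mul_le_mul_left _ (by omega)
      rw [add_mul]; omega
    · have hul' : ∀ j : ℕ, u ^ j * l ^ j = 1 := fun j => by rw [← mul_pow, hul, one_pow]
      calc u ^ (2 * (M * m 0)) * l ^ (2 * m 1) = u ^ (2 * (M * m 0)) * l ^ (2 * m 1) * (u ^ (2 * m0 1) * l ^ (2 * m0 1)) := by rw [hul', mul_one]
        _ = u ^ (2 * (M * m 0 + m0 1)) * l ^ (2 * m 1) * l ^ (2 * m0 1) := by rw [mul_add 2, pow_add]; ring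
        _ = (u ^ (2 * m 1) * l ^ (2 * m 1)) * (u ^ (2 * (M * m0 0)) * l ^ (2 * m0 1) * u ^ (2 * e)) := by rw [he, mul_add 2, mul_add 2, pow_add, pow_add]; ring
        _ = _ := by rw [hul', one_mul, hy]
  choose! e he1 he2 using hterm
  rw [hval, ← hy, ← Finset.add_sum_erase _ _ hm0, ← hy]
  have hsum : ∑ m ∈ f.support.erase m0, algebraMap ℝ L (coeff m f * (μ0 ^ m 0 * ρ0 ^ m 1)) * (u ^ (2 * (M * m 0)) * l ^ (2 * m 1))
      = y * ∑ m ∈ f.support.erase m0, algebraMap ℝ L (coeff m f * (μ0 ^ m 0 * ρ0 ^ m 1)) * u ^ (2 * e m) := by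
    rw [Finset.mul_sum]
    refine Finset.sum_congr rfl fun m hmm => ?_
    rw [he2 m (Finset.mem_of_mem_erase hmm)]; ring
  have hb : Bd F (16 * ((M + 1) * w)) (∑ m ∈ f.support.erase m0, |coeff m f| * (μ0 ^ m 0 * ρ0 ^ m 1))
      (∑ m ∈ f.support.erase m0, algebraMap ℝ L (coeff m f * (μ0 ^ m 0 * ρ0 ^ m 1)) * u ^ (2 * e m)) := by
    refine Bd.sum h.hF _ _ _ fun m hmm => ?_
    have h1 := he1 m (Finset.mem_of_mem_erase hmm)
    refine Bd.mono h.hF (Bd.smul h.hF (Bd.pow h.hF hub (2 * e m)) (coeff m f * (μ0 ^ m 0 * ρ0 ^ m 1))) (by omega) ?_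
    rw [mul_one, abs_mul, abs_of_nonneg (show 0 ≤ μ0 ^ m 0 * ρ0 ^ m 1 by positivity)]
  rw [hsum]
  have hc := real_mem_C h.hF (sub_nonneg.2 hdom) (16 * ((M + 1) * w))
  have := F.mul_C hyC (add_mem hb.2 hc)
  have h2 := F.C_of_le (show _ ≤ 20 * (M + 1) * w by nlinarith) this
  convert h2 using 1
  rw [map_sub, map_add]; ring

end Sh
end ENS
end

section
open MvPolynomial
open scoped Polynomial

namespace ENS
open Filter Topology

theorem degree_sum_le {σ : Type} [Fintype σ] {f : MvPolynomial σ ℝ} {d : σ →₀ ℕ} (hd : d ∈ f.support) : ∑ i, d i ≤ f.totalDegree := by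
  have := le_totalDegree hd
  rwa [Finsupp.sum_fintype _ _ (fun _ => rfl)] at this

theorem combination {n : ℕ} (b : MvPolynomial (Fin (n + 2)) ℝ) (hb : b ≠ 0) : ∃ (A : ℕ) (f : MvPolynomial (Fin 2) ℝ) (α : Fin n → ℕ)
    (κ : ((i : Fin n) → Fin (α i + 1)) → ℝ), A ≤ b.totalDegree ∧ f ≠ 0 ∧ f.totalDegree ≤ b.totalDegree ∧
      ∀ (L : Type) [Field L] [Algebra ℝ L] (x : Fin n → L) (s : L) (z : Fin 2 → L),
        ∑ τ, algebraMap ℝ L (κ τ) * aeval (Fin.append (fun i => x i + algebraMap ℝ L ((τ i : ℕ) : ℝ) * s) z) b = s ^ A * aeval z f := by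
  classical
  obtain ⟨d0, hd0, hmax⟩ := Finset.exists_max_image b.support (fun d => ∑ i : Fin n, d (Fin.castAdd 2 i)) (support_nonempty.2 hb)
  choose κ1 hκ1 using exists_kappa
  obtain ⟨tl, htl⟩ : ∃ tl : (Fin (n + 2) →₀ ℕ) → (Fin 2 →₀ ℕ), ∀ d i, tl d i = d (Fin.natAdd n i) :=
    ⟨fun d => Finsupp.equivFunOnFinite.symm fun i => d (Fin.natAdd n i), fun d i => rfl⟩
  obtain ⟨sp, hsp⟩ : ∃ sp, sp = b.support.filter (fun d => ∀ i, d (Fin.castAdd 2 i) = d0 (Fin.castAdd 2 i)) := ⟨_, rfl⟩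
  have hsp' : ∀ d, d ∈ sp ↔ d ∈ b.support ∧ ∀ i, d (Fin.castAdd 2 i) = d0 (Fin.castAdd 2 i) := by
    intro d; rw [hsp, Finset.mem_filter]
  have hds : ∀ d : Fin (n + 2) →₀ ℕ, ∑ i, d i = ∑ i : Fin n, d (Fin.castAdd 2 i) + ∑ i, tl d i := by
    intro d; rw [Fin.sum_univ_add]; simp only [htl]
  refine ⟨∑ i : Fin n, d0 (Fin.castAdd 2 i), ∑ d ∈ sp, monomial (tl d) (coeff d b), fun i => d0 (Fin.castAdd 2 i),
    fun τ => ∏ i, κ1 _ (τ i), ?_, ?_, ?_, ?_⟩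
  · have := degree_sum_le hd0
    rw [hds] at this; omega
  · intro h0
    have h1 : coeff (tl d0) (∑ d ∈ sp, monomial (tl d) (coeff d b)) = coeff d0 b := by
      rw [coeff_sum, Finset.sum_eq_single d0]
      · rw [coeff_monomial, if_pos rfl]
      · intro d hd hne
        rw [coeff_monomial, if_neg]
        intro heq
        apply hne
        ext i
        refine Fin.addCases (fun i => ((hsp' d).1 hd).2 i) (fun i => ?_) i
        rw [← htl, ← htl, heq]
      · intro h
        exact absurd ((hsp' d0).2 ⟨hd0, fun _ => rfl⟩) h
    rw [h0, coeff_zero] at h1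
    exact (mem_support_iff.1 hd0) h1.symm
  · refine (totalDegree_finsetSum _ _).trans (Finset.sup_le fun d hd => ?_)
    refine (totalDegree_monomial_le _ _).trans ?_
    have := degree_sum_le ((hsp' d).1 hd).1
    rw [hds] at this
    rw [Finsupp.sum_fintype _ _ (fun _ => rfl)]
    simp only [id]
    omega
  · intro L _ _ x s z
    have hev : ∀ τ : (i : Fin n) → Fin (d0 (Fin.castAdd 2 i) + 1),
        aeval (Fin.append (fun i => x i + algebraMap ℝ L ((τ i : ℕ) : ℝ) * s) z) b
        = ∑ d ∈ b.support, (∏ i : Fin n, (x i + algebraMap ℝ L ((τ i : ℕ) : ℝ) * s) ^ d (Fin.castAdd 2 i)) * (algebraMap ℝ L (coeff d b) * ∏ i, z i ^ tl d i) := by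
      intro τ
      rw [aeval_def, eval₂_eq']
      refine Finset.sum_congr rfl fun d _ => ?_
      rw [Fin.prod_univ_add]
      simp only [Fin.append_left, Fin.append_right, htl]
      ring
    simp only [hev, Finset.mul_sum]
    rw [Finset.sum_comm]
    have hin : ∀ d ∈ b.support, (∑ τ : (i : Fin n) → Fin (d0 (Fin.castAdd 2 i) + 1), algebraMap ℝ L (∏ i, κ1 _ (τ i)) *
        ((∏ i : Fin n, (x i + algebraMap ℝ L ((τ i : ℕ) : ℝ) * s) ^ d (Fin.castAdd 2 i)) * (algebraMap ℝ L (coeff d b) * ∏ i, z i ^ tl d i)))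
        = if (∀ i, d (Fin.castAdd 2 i) = d0 (Fin.castAdd 2 i)) then s ^ (∑ i : Fin n, d0 (Fin.castAdd 2 i)) * (algebraMap ℝ L (coeff d b) * ∏ i, z i ^ tl d i) else 0 := by
      intro d hd
      have h1 : (∑ τ : (i : Fin n) → Fin (d0 (Fin.castAdd 2 i) + 1), algebraMap ℝ L (∏ i, κ1 _ (τ i)) *
        ((∏ i : Fin n, (x i + algebraMap ℝ L ((τ i : ℕ) : ℝ) * s) ^ d (Fin.castAdd 2 i)) * (algebraMap ℝ L (coeff d b) * ∏ i, z i ^ tl d i)))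
        = (∏ i : Fin n, ∑ j : Fin (d0 (Fin.castAdd 2 i) + 1), algebraMap ℝ L (κ1 _ j) * (x i + algebraMap ℝ L ((j : ℕ) : ℝ) * s) ^ d (Fin.castAdd 2 i))
          * (algebraMap ℝ L (coeff d b) * ∏ i, z i ^ tl d i) := by
        rw [Finset.prod_univ_sum, Finset.sum_mul, Fintype.piFinset_univ]
        refine Finset.sum_congr rfl fun τ _ => ?_
        rw [Finset.prod_mul_distrib, map_prod]; ring
      rw [h1]
      by_cases hall : ∀ i, d (Fin.castAdd 2 i) = d0 (Fin.castAdd 2 i)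
      · rw [if_pos hall, ← Finset.prod_pow_eq_pow_sum]
        congr 1
        refine Finset.prod_congr rfl fun i _ => ?_
        rw [kappa_spec (hκ1 _) _ _ _ (hall i).le, if_pos (hall i)]
      · rw [if_neg hall]
        obtain ⟨i, hi⟩ : ∃ i : Fin n, d (Fin.castAdd 2 i) < d0 (Fin.castAdd 2 i) := by
          by_contra hcon
          push Not at hcon
          have hle := hmax d hd
          have heq := (Finset.sum_eq_sum_iff_of_le (s := Finset.univ) fun i _ => hcon i).1 (le_antisymm (Finset.sum_le_sum fun i _ => hcon i) hle)
          exact hall fun i => (heq i (Finset.mem_univ i)).symm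
        rw [Finset.prod_eq_zero (Finset.mem_univ i), zero_mul]
        rw [kappa_spec (hκ1 _) _ _ _ hi.le, if_neg hi.ne]
    rw [Finset.sum_congr rfl hin, ← Finset.sum_filter, ← hsp, map_sum, Finset.mul_sum]
    refine Finset.sum_congr rfl fun d _ => ?_
    rw [aeval_monomial, Finsupp.prod_fintype _ _ (fun _ => pow_zero _)]

def DomAt (f : MvPolynomial (Fin 2) ℝ) (μ ρ : ℝ) : Prop := ∃ m0 ∈ f.support,
    (∀ m ∈ f.support, m0 0 ≤ m 0 ∧ (m 0 = m0 0 → m 1 ≤ m0 1)) ∧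
      ∑ m ∈ f.support.erase m0, |coeff m f| * (μ ^ m 0 * ρ ^ m 1) < coeff m0 f * (μ ^ m0 0 * ρ ^ m0 1)

theorem EvPos.domAt {f : MvPolynomial (Fin 2) ℝ} (hf : EvPos f) : ∀ᶠ ρ : ℝ in atTop, ∀ᶠ μ : ℝ in 𝓝[>] 0, DomAt f μ ρ := by
  obtain ⟨m0, h1, h2, h3⟩ := exists_dom f hf
  filter_upwards [h3] with ρ h
  filter_upwards [h] with μ h
  exact ⟨m0, h1, h2, h⟩

theorem ev_small (c : ℝ) {ε : ℝ} (hε : 0 < ε) : ∀ᶠ t : ℝ in 𝓝[>] 0, t * c ≤ ε := by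
  have : Continuous fun t : ℝ => t * c := by fun_prop
  have h := (this.tendsto' 0 0 (by simp)).eventually_lt_const hε
  filter_upwards [nhdsWithin_le_nhds h] with t ht using ht.le

theorem aeval_qk {L : Type} [CommRing L] [Algebra ℝ L] (n : ℕ) (y : Fin (n + 2) → L) :
    aeval y (qk n) = y (Fin.natAdd n 1) - ∑ i, y (Fin.castAdd 2 i) ^ 2 := by
  have : qk n = X (Fin.natAdd n 1) - ∑ i, X (Fin.castAdd 2 i) ^ 2 := by
    apply MvPolynomial.funext
    intro x
    rw [eval_qk]; simp
  rw [this]; simp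

end ENS
end

section
open MvPolynomial
open scoped Polynomial

namespace ENS
open Filter Topology
namespace Sh
variable {n : ℕ} {L : Type} [Field L] [Algebra ℝ L] {F : Filt L} {x : Fin n → L} {v o l u : L}

/-- one substitution -/
theorem one_shift {p g : MvPolynomial (Fin n) ℝ} (h : Sh F x (aeval x p) (aeval x g) v o l) (hu : u = v * (aeval x p * o))
    {d0 R M : ℕ} (hd0 : 1 ≤ d0) (hM : M = 2 * R + 1) (hp : p.totalDegree ≤ d0) (hg : g.totalDegree ≤ d0)
    {b : MvPolynomial (Fin (n + 2)) ℝ} (hb : b.totalDegree ≤ R) {G0 : Set (MvPolynomial (Fin (n + 2)) ℝ × ℕ)}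
    (hG0 : G0 ⊆ Lam n ∪ {fw | ∃ i, fw = (fam p g i, d0)}) (hGw : ∀ fw ∈ G0, fw.2 ≤ 2 * R) (hC : Cone G0 (2 * R) (-(b ^ 2)))
    {μ0 ρ0 : ℝ} (hμ : 0 < μ0) (hρ : 4 ≤ ρ0)
    (hdom : ∀ fw ∈ G0, fw ∈ Lam n → ∃ f0, f0.totalDegree ≤ fw.2 ∧ fw.1 = rename (Fin.natAdd n) f0 ∧ DomAt f0 μ0 ρ0)
    (τ : Fin n → ℝ) {t : ℝ} (ht : 0 ≤ t) (ht1 : t ≤ 1) (hT : (∑ i, τ i ^ 2) * t ≤ 1)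
    {cp cg : ℝ} (htp : t * cp ≤ 1 / 2) (htg : t * cg ≤ μ0)
    (hgp : ∃ f1 : L, aeval (fun i => x i + algebraMap ℝ L (τ i) * (algebraMap ℝ L t * u ^ (2 * (M + d0)))) p
        = aeval x p + algebraMap ℝ L t * u ^ (2 * (M + d0)) * f1 ∧ Bd F (d0 * (16 * (M + d0) + 8)) cp (v ^ d0 * f1))
    (hgg : ∃ f1 : L, aeval (fun i => x i + algebraMap ℝ L (τ i) * (algebraMap ℝ L t * u ^ (2 * (M + d0)))) g
        = aeval x g + algebraMap ℝ L t * u ^ (2 * (M + d0)) * f1 ∧ Bd F (d0 * (16 * (M + d0) + 8)) cg (v ^ d0 * f1)) :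
    ∃ θ : L, θ = aeval (Fin.append (fun i => x i + algebraMap ℝ L (τ i) * (algebraMap ℝ L t * u ^ (2 * (M + d0))))
        ![algebraMap ℝ L μ0 * u ^ (2 * M), algebraMap ℝ L ρ0 * l ^ 2]) b ∧
      θ ∈ F.B (100 * (M + d0 + 1) * R) ∧ -(θ ^ 2) ∈ F.C (2 * (100 * (M + d0 + 1) * R)) := by
  have huB : u ∈ F.B 2 := hu ▸ h.uB
  refine ⟨_, rfl, ?_⟩
  obtain ⟨xs, hxs⟩ : ∃ xs : Fin n → L, xs = fun i => x i + algebraMap ℝ L (τ i) * (algebraMap ℝ L t * u ^ (2 * (M + d0))) := ⟨_, rfl⟩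
  obtain ⟨z, hz⟩ : ∃ z : Fin 2 → L, z = ![algebraMap ℝ L μ0 * u ^ (2 * M), algebraMap ℝ L ρ0 * l ^ 2] := ⟨_, rfl⟩
  rw [← hxs] at hgp hgg ⊢
  rw [← hz]
  have hz0 : z 0 = algebraMap ℝ L μ0 * u ^ (2 * M) := by rw [hz]; rfl
  have hz1 : z 1 = algebraMap ℝ L ρ0 * l ^ 2 := by rw [hz]; rfl
  have hxsB : ∀ i, xs i ∈ F.B (4 * (M + d0) + 1) := by
    intro i
    rw [hxs]
    refine add_mem (F.B_of_le (by omega) (h.hx i)) (smul_mem_B h.hF _ (smul_mem_B h.hF _ (h.powB huB _ _ (by omega))))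
  have hzB : ∀ i, z i ∈ F.B (4 * (M + d0) + 2) := by
    intro i
    fin_cases i
    · change z 0 ∈ _
      rw [hz0]; exact smul_mem_B h.hF _ (h.powB huB _ _ (by omega))
    · change z 1 ∈ _
      rw [hz1]; exact smul_mem_B h.hF _ (h.powB h.lB _ _ (by omega))
  have hL : Filt.Le (MF G0) (F.scale (100 * (M + d0 + 1))) (aeval (Fin.append xs z) : MvPolynomial (Fin (n + 2)) ℝ →ₐ[ℝ] L).toRingHom := by
    refine MF_le ?_ ?_
    · intro r f hf
      change aeval (Fin.append xs z) f ∈ F.B (100 * (M + d0 + 1) * r)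
      refine aeval_B h.hF _ (fun i => ?_) hf
      refine Fin.addCases (fun i => ?_) (fun i => ?_) i
      · rw [Fin.append_left]; exact F.B_of_le (by omega) (hxsB i)
      · rw [Fin.append_right]; exact F.B_of_le (by omega) (hzB i)
    · intro f w hfw hfd
      change aeval (Fin.append xs z) f ∈ F.C (100 * (M + d0 + 1) * w)
      have hw2 := hGw _ hfw
      have hlam := hdom _ hfw
      have hl : ∀ q : MvPolynomial (Fin n) ℝ, aeval (Fin.append xs z) (rename (Fin.castAdd 2) q) = aeval xs q := by
        intro q
        rw [aeval_rename]; congr 2; ext i; simp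
      rcases hG0 hfw with hf | ⟨i, hi⟩
      · obtain ⟨f0, hf0, hfr, m0, hm0, hm, hd⟩ := hlam hf
        change f = _ at hfr
        change _ ≤ w at hf0
        change w ≤ _ at hw2
        have := h.genD hu hm0 hm hf0 (M := M) (by omega) hμ.le (by linarith : 0 ≤ ρ0) (ε := 0) (by linarith)
        rw [map_zero, zero_mul, sub_zero, ← hz] at this
        rw [hfr, aeval_rename]
        have e : (Fin.append xs z ∘ Fin.natAdd n) = z := by ext i; simp
        rw [e]
        refine F.C_of_le ?_ this
        exact Nat.mul_le_mul_right _ (by omega)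
      · rw [Prod.mk.injEq] at hi
        obtain ⟨rfl, rfl⟩ := hi
        have key : 68 * (M + w + 1) * w ≤ 100 * (M + w + 1) * w := by
          exact Nat.mul_le_mul_right _ (by omega)
        have key2 : 68 * (M + w + 1) ≤ 68 * (M + w + 1) * w := Nat.le_mul_of_pos_right _ (by omega)
        fin_cases i
        · change aeval (Fin.append xs z) (qk n) ∈ _
          rw [aeval_qk, Fin.append_right, hz1]
          have := h.genA hu τ hρ ht ht1 hT (M + w)
          refine F.C_of_le (?_ : 32 * (M + w) + 6 ≤ _) ?_
          · refine le_trans ?_ (key2.trans key); omega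
          · convert this using 2
            refine Finset.sum_congr rfl fun i _ => ?_
            rw [Fin.append_left, hxs]
        · change aeval (Fin.append xs z) (X (Fin.natAdd n 1) * rename (Fin.castAdd 2) p ^ 2 - 1) ∈ _
          rw [map_sub, map_one, map_mul, map_pow, hl, aeval_X, Fin.append_right, hz1]
          obtain ⟨f1, e1, b1⟩ := hgp
          have hB := aeval_B h.hF xs hxsB hp
          rw [e1] at hB ⊢
          refine F.C_of_le ?_ (h.genB hu hρ ht (by omega) (by omega) b1 htp hB)
          nlinarith [Nat.mul_le_mul_left M hd0]
        · change aeval (Fin.append xs z) (X (Fin.natAdd n 0) - rename (Fin.castAdd 2) g) ∈ _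
          rw [map_sub, hl, aeval_X, Fin.append_right, hz0]
          obtain ⟨f1, e1, b1⟩ := hgg
          rw [e1]
          refine F.C_of_le ?_ (h.genC hu ht b1 htg)
          nlinarith [Nat.mul_le_mul_left M hd0]
  constructor
  · exact hL.B (r := R) hb
  · have := hL.C (r := 2 * R) hC
    rw [map_neg, map_pow] at this
    have e : 2 * (100 * (M + d0 + 1) * R) = 100 * (M + d0 + 1) * (2 * R) := by ring
    rw [e]
    exact this

end Sh
end ENS
end

section
open MvPolynomial
open scoped Polynomial

namespace ENS
open Filter Topology
namespace Sh
variable {n : ℕ} {L : Type} [Field L] [Algebra ℝ L] {F : Filt L} {x : Fin n → L} {v o l : L}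

/-- the shift argument -/
theorem shift {p g : MvPolynomial (Fin n) ℝ} (h : Sh F x (aeval x p) (aeval x g) v o l)
    {d0 R : ℕ} (hd0 : 1 ≤ d0) (hp : p.totalDegree ≤ d0) (hg : g.totalDegree ≤ d0)
    {b : MvPolynomial (Fin (n + 2)) ℝ} (hb0 : b ≠ 0) (hb : b.totalDegree ≤ R)
    (hC : Cone (Lam n ∪ {fw | ∃ i, fw = (fam p g i, d0)}) (2 * R) (-(b ^ 2))) :
    ∃ J, J ≤ 4 * (2 * R + 1 + d0) * R ∧ -(aeval x p ^ (2 * J)) ∈ F.C (300 * (2 * R + 2 + d0) * R) := by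
  classical
  obtain ⟨u, hu⟩ : ∃ u, u = v * (aeval x p * o) := ⟨_, rfl⟩
  have huB : u ∈ F.B 2 := hu ▸ h.uB
  have hub : Bd F 8 1 u := hu ▸ h.u_bd
  have hul : u * l = 1 := hu ▸ h.hl
  obtain ⟨M, hM⟩ : ∃ M, M = 2 * R + 1 := ⟨_, rfl⟩
  obtain ⟨A, f', α, κ, hA, hf0', hfR', hcomb⟩ := combination b hb0
  obtain ⟨f, hf0, hfR, hff⟩ : ∃ f, EvPos f ∧ f.totalDegree ≤ R ∧ ∀ z : Fin 2 → L, (aeval z f') ^ 2 = (aeval z f) ^ 2 := by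
    rcases evPos_or f' hf0' with h1 | h1
    · exact ⟨f', h1, hfR'.trans hb, fun z => rfl⟩
    · exact ⟨-f', h1, by rw [totalDegree_neg]; exact hfR'.trans hb, fun z => by rw [map_neg]; ring⟩
  obtain ⟨G0, hfin, hG0, hGw, hC0⟩ := hC.finite
  -- choice of ρ0, μ0
  have hev : ∀ᶠ ρ : ℝ in atTop, ∀ᶠ μ : ℝ in 𝓝[>] 0, ∀ fw ∈ G0, fw ∈ Lam n →
      ∃ f0, f0.totalDegree ≤ fw.2 ∧ fw.1 = rename (Fin.natAdd n) f0 ∧ DomAt f0 μ ρ := by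
    have : ∀ᶠ ρ : ℝ in atTop, ∀ fw ∈ G0, ∀ᶠ μ : ℝ in 𝓝[>] 0, fw ∈ Lam n →
      ∃ f0, f0.totalDegree ≤ fw.2 ∧ fw.1 = rename (Fin.natAdd n) f0 ∧ DomAt f0 μ ρ := by
      rw [Filter.eventually_all_finite hfin]
      intro fw _
      by_cases hlam : fw ∈ Lam n
      · obtain ⟨f0, h1, h2, h3⟩ := mem_Lam hlam
        filter_upwards [h1.domAt] with ρ hρ
        filter_upwards [hρ] with μ hμ
        exact fun _ => ⟨f0, h2, h3, hμ⟩
      · exact Eventually.of_forall fun ρ => Eventually.of_forall fun μ h => absurd h hlam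
    filter_upwards [this] with ρ hρ
    rwa [Filter.eventually_all_finite hfin]
  obtain ⟨ρ0, ⟨h1, h2⟩, hρ⟩ := ((hev.and hf0.domAt).and (eventually_ge_atTop (4:ℝ))).exists
  obtain ⟨μ0, ⟨hdom, m0, hm0, hm, hfd⟩, hμ⟩ := ((h1.and h2).and self_mem_nhdsWithin).exists
  have hμ : 0 < μ0 := hμ
  -- choice of t
  have hs : Bd F (16 * (M + d0)) 1 (u ^ (2 * (M + d0))) := Bd.mono h.hF (Bd.pow h.hF hub _) (by omega) le_rfl
  have gp := fun τ : (i : Fin n) → Fin (α i + 1) => (h.good hs (fun i => ((τ i : ℕ) : ℝ)) hp).2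
  have gg := fun τ : (i : Fin n) → Fin (α i + 1) => (h.good hs (fun i => ((τ i : ℕ) : ℝ)) hg).2
  choose cp hcp gp using gp
  choose cg hcg gg using gg
  have ht : ∀ᶠ t : ℝ in 𝓝[>] 0, ∀ τ : (i : Fin n) → Fin (α i + 1), t * cp τ ≤ 1 / 2 ∧ t * cg τ ≤ μ0 ∧ t * (∑ i, ((τ i : ℕ) : ℝ) ^ 2) ≤ 1 := by
    rw [Filter.eventually_all]
    intro τ
    filter_upwards [ev_small (cp τ) (by norm_num : (0:ℝ) < 1/2), ev_small (cg τ) hμ, ev_small (∑ i, ((τ i : ℕ) : ℝ) ^ 2) one_pos] with t a b c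
    exact ⟨a, b, c⟩
  obtain ⟨t, ⟨ht, ht1⟩, ht0⟩ := ((ht.and (ev_small 1 one_pos)).and self_mem_nhdsWithin).exists
  have ht0 : 0 < t := ht0
  rw [mul_one] at ht1
  -- combine
  obtain ⟨s, hsd⟩ : ∃ s, s = algebraMap ℝ L t * u ^ (2 * (M + d0)) := ⟨_, rfl⟩
  obtain ⟨z, hz⟩ : ∃ z : Fin 2 → L, z = ![algebraMap ℝ L μ0 * u ^ (2 * M), algebraMap ℝ L ρ0 * l ^ 2] := ⟨_, rfl⟩
  have hone := fun τ : (i : Fin n) → Fin (α i + 1) => h.one_shift hu hd0 hM hp hg hb hG0 hGw hC0 hμ hρ hdom (fun i => ((τ i : ℕ) : ℝ)) ht0.le ht1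
    (by rw [mul_comm]; exact (ht τ).2.2) (ht τ).1 (ht τ).2.1 (gp τ t ht0.le ht1) (gg τ t ht0.le ht1)
  rw [← hsd, ← hz] at hone
  have hns := Filt.neg_sq_sum (F := F) (r := 100 * (M + d0 + 1) * R) Finset.univ
    (fun τ => algebraMap ℝ L (κ τ) * aeval (Fin.append (fun i => x i + algebraMap ℝ L ((τ i : ℕ) : ℝ) * s) z) b) (by
      intro τ _
      obtain ⟨θ, h1, h2, h3⟩ := hone τ
      rw [← h1]
      refine ⟨smul_mem_B h.hF _ h2, ?_⟩
      have := smul_mem_C h.hF (sq_nonneg (κ τ)) h3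
      convert this using 1
      rw [map_pow]; ring)
  rw [hcomb L x s z, mul_pow, hff] at hns
  have hneg := hns.2
  -- lower bound for f
  obtain ⟨ε, hε, hfd'⟩ : ∃ ε : ℝ, 0 < ε ∧ ε + ∑ m ∈ f.support.erase m0, |coeff m f| * (μ0 ^ m 0 * ρ0 ^ m 1) ≤ coeff m0 f * (μ0 ^ m0 0 * ρ0 ^ m0 1) :=
    ⟨_, sub_pos.2 hfd, by linarith⟩
  have hY := h.genD hu hm0 hm hfR (M := M) (by omega) hμ.le (by linarith : 0 ≤ ρ0) hfd'
  rw [← hz] at hY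
  have hij : m0 0 + m0 1 ≤ R := by
    have := (degree_sum_le hm0).trans hfR
    rwa [Fin.sum_univ_two] at this
  have hMi : M * m0 0 ≤ M * R := Nat.mul_le_mul_left _ (by omega)
  have hAR : (M + d0) * A ≤ (M + d0) * R := Nat.mul_le_mul_left _ (hA.trans hb)
  obtain ⟨y, hy⟩ : ∃ y, y = u ^ (2 * (M * m0 0)) * l ^ (2 * m0 1) := ⟨_, rfl⟩
  have hyC : y ∈ F.C (20 * (M + 1) * R) := by
    have : (u ^ (M * m0 0) * l ^ m0 1) ^ 2 ∈ F.C (20 * (M + 1) * R) := by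
      refine h.sC (r := 2 * (M * m0 0) + m0 1) (F.gr.mul (h.powB huB _ _ (by omega)) (h.powB h.lB _ _ (by omega))) _ ?_
      nlinarith
    rw [hy]
    convert this using 1
    ring
  rw [← hy] at hY
  have hsC : (s ^ A) ^ 2 ∈ F.C (8 * ((M + d0) * R)) := by
    refine h.sC (r := 4 * ((M + d0) * A)) ?_ _ (by omega)
    refine h.powB (r := 4 * (M + d0)) ?_ _ _ (by nlinarith)
    rw [hsd]; exact smul_mem_B h.hF _ (h.powB huB _ _ (by omega))
  have hYY := F.mul_C hsC (F.mul_C hY (add_mem hY (smul_mem_C h.hF (show 0 ≤ 2 * ε by linarith) hyC)))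
  obtain ⟨S1, hS1⟩ : ∃ S1, S1 = 200 * (M + d0 + 1) * R := ⟨_, rfl⟩
  have hsum := add_mem (F.C_of_le (show _ ≤ S1 by rw [hS1]; nlinarith) hneg) (F.C_of_le (show _ ≤ S1 by rw [hS1]; nlinarith) hYY)
  have hy2 : -(algebraMap ℝ L (ε * t ^ A) ^ 2 * (u ^ (2 * ((M + d0) * A)) * y) ^ 2) ∈ F.C S1 := by
    convert hsum using 1
    have e1 : s ^ A = algebraMap ℝ L t ^ A * u ^ (2 * ((M + d0) * A)) := by
      rw [hsd, mul_pow, ← pow_mul, mul_assoc]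
    rw [e1, map_mul, map_mul, map_pow, map_ofNat]
    ring
  obtain ⟨J, hJ⟩ : ∃ J, J = 2 * ((M + d0) * A) + 2 * (M * m0 0) := ⟨_, rfl⟩
  have hJR : J ≤ 4 * ((M + d0) * R) := by rw [hJ]; nlinarith
  refine ⟨J, ?_, ?_⟩
  · rw [hM] at hJR; rw [mul_assoc]; exact hJR
  · have hmul : (algebraMap ℝ L (1 / (ε * t ^ A)) * (u ^ (2 * m0 1) * (l * aeval x p) ^ J)) ^ 2 ∈ F.C (8 * m0 1 + 4 * J) := by
      refine h.sC (r := 4 * m0 1 + 2 * J) (smul_mem_B h.hF _ (F.gr.mul (h.powB huB _ _ (by omega)) ?_)) _ (by omega)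
      exact h.powB (F.gr.mul h.lB h.hP) _ _ (by omega)
    have := F.mul_C hmul hy2
    refine F.C_of_le (r := 8 * m0 1 + 4 * J + S1) ?_ ?_
    · rw [hS1, hM] at *; nlinarith
    · convert this using 1
      have hc : algebraMap ℝ L (1 / (ε * t ^ A)) * algebraMap ℝ L (ε * t ^ A) = 1 := by
        rw [← map_mul, one_div, inv_mul_cancel₀ (by positivity), map_one]
      have hul' : ∀ j : ℕ, u ^ j * l ^ j = 1 := fun j => by rw [← mul_pow, hul, one_pow]
      have h1 : algebraMap ℝ L (1 / (ε * t ^ A)) * (u ^ (2 * m0 1) * (l * aeval x p) ^ J) * (algebraMap ℝ L (ε * t ^ A) * (u ^ (2 * ((M + d0) * A)) * y))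
          = aeval x p ^ J := by
        calc _ = (algebraMap ℝ L (1 / (ε * t ^ A)) * algebraMap ℝ L (ε * t ^ A)) * (u ^ (2 * m0 1) * l ^ (2 * m0 1)) *
              (u ^ (2 * ((M + d0) * A) + 2 * (M * m0 0)) * l ^ J) * aeval x p ^ J := by rw [hy, pow_add, mul_pow l]; ring
          _ = _ := by rw [← hJ, hul', hul', hc]; ring
      calc -(aeval x p ^ (2 * J)) = -((aeval x p ^ J) ^ 2) := by rw [← pow_mul, mul_comm]
        _ = _ := by rw [← h1]; ring

end Sh
end ENS
end

section
open MvPolynomial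
open scoped Polynomial

namespace ENS

def GT {n : ℕ} (g : MvPolynomial (Fin n) ℝ) : Set (MvPolynomial (Fin n) ℝ × ℕ) := {fw | ∃ φ, fw.1 = g * φ}

/-- localisation of the filtered ring at `Z = ζ^2` -/
noncomputable def FZ {σ : Type} (G : Set (MvPolynomial σ ℝ × ℕ)) {L : Type} [Field L] [Algebra (MvPolynomial σ ℝ) L] (ζ : MvPolynomial σ ℝ) (E : ℕ)
    (hE : 2 * ζ.totalDegree ≤ E) : Filt L where
  B := fun r => 
    { carrier := {a | ∃ f : MvPolynomial σ ℝ, f.totalDegree ≤ r * E ∧ algebraMap _ L f = algebraMap _ L ζ ^ (2 * r) * a}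
      zero_mem' := ⟨0, by simp, by simp⟩
      add_mem' := by
        rintro a b ⟨f, hf, hf'⟩ ⟨g, hg, hg'⟩
        exact ⟨f + g, (totalDegree_add _ _).trans (max_le hf hg), by rw [map_add, hf', hg', mul_add]⟩
      neg_mem' := by
        rintro a ⟨f, hf, hf'⟩
        exact ⟨-f, by rwa [totalDegree_neg], by rw [map_neg, hf', mul_neg]⟩ }
  C := fun r => 
    { carrier := {a | ∃ f : MvPolynomial σ ℝ, Cone G (r * E) f ∧ algebraMap _ L f = algebraMap _ L ζ ^ (2 * r) * a}
      zero_mem' := ⟨0, .zero _, by simp⟩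
      add_mem' := by
        rintro a b ⟨f, hf, hf'⟩ ⟨g, hg, hg'⟩
        exact ⟨f + g, .add hf hg, by rw [map_add, hf', hg', mul_add]⟩ }
  gr := 
    { mono := by
        rintro r s hrs a ⟨f, hf, hf'⟩
        obtain ⟨e, rfl⟩ := Nat.exists_eq_add_of_le hrs
        refine ⟨ζ ^ (2 * e) * f, ?_, ?_⟩
        · refine (totalDegree_mul _ _).trans ((add_le_add (totalDegree_pow _ _) hf).trans ?_)
          nlinarith
        · rw [map_mul, hf', map_pow]; ring
      one := ⟨1, by simp, by simp⟩
      mul := by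
        rintro r s a b ⟨f, hf, hf'⟩ ⟨g, hg, hg'⟩
        refine ⟨f * g, (totalDegree_mul _ _).trans ((add_le_add hf hg).trans (by rw [add_mul])), ?_⟩
        rw [map_mul, hf', hg']; ring }
  C_mono := by
    rintro r s hrs a ⟨f, hf, hf'⟩
    obtain ⟨e, rfl⟩ := Nat.exists_eq_add_of_le hrs
    refine ⟨(ζ ^ e) ^ 2 * f, .mul (.sq (totalDegree_pow _ _) le_rfl) hf ?_, ?_⟩
    · nlinarith
    · rw [map_mul, hf', map_pow, map_pow]; ring
  mul_C := by
    rintro r s a b ⟨f, hf, hf'⟩ ⟨g, hg, hg'⟩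
    refine ⟨f * g, .mul hf hg (by rw [add_mul]), ?_⟩
    rw [map_mul, hf', hg']; ring
  C_le := by
    rintro r a ⟨f, hf, hf'⟩
    exact ⟨f, hf.deg, hf'⟩
  sq_C := by
    rintro r a ⟨f, hf, hf'⟩
    refine ⟨f ^ 2, .sq hf (by rw [mul_assoc]), ?_⟩
    rw [map_pow, hf']; ring

theorem deg_mul_le {σ : Type} {a b : MvPolynomial σ ℝ} {r s t : ℕ} (ha : a.totalDegree ≤ r) (hb : b.totalDegree ≤ s) (h : r + s ≤ t) :
    (a * b).totalDegree ≤ t := (totalDegree_mul _ _).trans ((add_le_add ha hb).trans h)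

theorem deg_pow_le {σ : Type} {a : MvPolynomial σ ℝ} {r t : ℕ} (ha : a.totalDegree ≤ r) (k : ℕ) (h : k * r ≤ t) :
    (a ^ k).totalDegree ≤ t := (totalDegree_pow _ _).trans ((Nat.mul_le_mul_left k ha).trans h)

theorem deg_add_le {σ : Type} {a b : MvPolynomial σ ℝ} {t : ℕ} (ha : a.totalDegree ≤ t) (hb : b.totalDegree ≤ t) :
    (a + b).totalDegree ≤ t := (totalDegree_add _ _).trans (max_le ha hb)

theorem poly_cert_aux {n : ℕ} {L : Type} [Field L] [Algebra (MvPolynomial (Fin n) ℝ) L] [Algebra ℝ L] [IsScalarTower ℝ (MvPolynomial (Fin n) ℝ) L]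
    (hLi : Function.Injective (algebraMap (MvPolynomial (Fin n) ℝ) L)) {p g : MvPolynomial (Fin n) ℝ} (hp0 : p ≠ 0)
    {d0 R : ℕ} (hd0 : 1 ≤ d0) (hp : 2 * p.totalDegree ≤ d0) (hg : g.totalDegree ≤ d0)
    {b : MvPolynomial (Fin (n + 2)) ℝ} (hb0 : b ≠ 0) (hb : b.totalDegree ≤ R)
    (hC : Cone (Lam n ∪ {fw | ∃ i, fw = (fam p g i, d0)}) (2 * R) (-(b ^ 2))) {S : ℕ} (hS : S = 304 * (2 * R + 2 + d0) * R) :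
    ∃ J, J ≤ S ∧ Cone (GT g) (12 * d0 * S) (-(p ^ (2 * J))) := by
  classical
  obtain ⟨δ, hδ⟩ : ∃ δ, δ = p.totalDegree := ⟨_, rfl⟩
  have hpδ : p.totalDegree ≤ δ := hδ.ge
  rw [← hδ] at hp
  obtain ⟨q, hq⟩ : ∃ q : MvPolynomial (Fin n) ℝ, q = 1 + ∑ i, X i ^ 2 := ⟨_, rfl⟩
  obtain ⟨e, he⟩ : ∃ e : MvPolynomial (Fin n) ℝ, e = 1 + p ^ 2 := ⟨_, rfl⟩
  have hqd : q.totalDegree ≤ 2 := by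
    rw [hq]
    refine deg_add_le (by simp) ?_
    refine (totalDegree_finsetSum _ _).trans (Finset.sup_le fun i _ => ?_)
    exact deg_pow_le (totalDegree_X i).le 2 le_rfl
  have hed : e.totalDegree ≤ 2 * δ := by
    rw [he]; exact deg_add_le (by simp) (deg_pow_le hpδ 2 le_rfl)
  have hq0 : q ≠ 0 := by
    intro h0
    have := congrArg (eval 0) h0
    rw [hq] at this
    simp at this
  have he0 : e ≠ 0 := by
    intro h0
    have := congrArg (eval 0) h0
    rw [he, map_add, map_pow, map_one, map_zero] at this
    nlinarith [sq_nonneg (eval 0 p)]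
  obtain ⟨ζ, hζ⟩ : ∃ ζ, ζ = p * (q * e) := ⟨_, rfl⟩
  have hqed : (q * e).totalDegree ≤ 2 + 2 * δ := deg_mul_le hqd hed le_rfl
  have hζd : ζ.totalDegree ≤ 2 + 3 * δ := by
    rw [hζ]; exact deg_mul_le hpδ hqed (by omega)
  obtain ⟨E, hE⟩ : ∃ E, E = 6 + 7 * δ + g.totalDegree := ⟨_, rfl⟩
  have hζE : 2 * ζ.totalDegree ≤ E := by omega
  obtain ⟨ι, hι⟩ : ∃ ι : MvPolynomial (Fin n) ℝ →+* L, ι = algebraMap _ L := ⟨_, rfl⟩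
  have hinj : Function.Injective ι := by rw [hι]; exact hLi
  have hne : ∀ f, f ≠ 0 → ι f ≠ 0 := fun f hf h0 => hf (hinj (by rw [h0, map_zero]))
  have hsc : ∀ c : ℝ, algebraMap ℝ L c = ι (C c) := by
    intro c; rw [hι, IsScalarTower.algebraMap_apply ℝ (MvPolynomial (Fin n) ℝ) L]; rfl
  have hae : ∀ f, aeval (fun i => ι (X i)) f = ι f := by
    intro f
    induction f using MvPolynomial.induction_on with
    | C a => rw [algHom_C, hsc]
    | add p q hp hq => rw [map_add, map_add, hp, hq]
    | mul_X p i hp => rw [map_mul, map_mul, hp, aeval_X]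
  obtain ⟨F, hFd⟩ : ∃ F : Filt L, F = FZ (GT g) ζ E hζE := ⟨_, rfl⟩
  have hB : ∀ r a, a ∈ F.B r ↔ ∃ f, f.totalDegree ≤ r * E ∧ ι f = ι ζ ^ (2 * r) * a := by
    intro r a; rw [hFd, hι]; rfl
  have hCC : ∀ r a, a ∈ F.C r ↔ ∃ f, Cone (GT g) (r * E) f ∧ ι f = ι ζ ^ (2 * r) * a := by
    intro r a; rw [hFd, hι]; rfl
  have hp' := hne p hp0
  have hq' := hne q hq0
  have he' := hne e he0
  have hqi : ι q = 1 + ∑ i, ι (X i) ^ 2 := by rw [hq]; simp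
  have hei : ι e = 1 + ι p ^ 2 := by rw [he]; simp
  have hζi : ι ζ = ι p * (ι q * ι e) := by rw [hζ, map_mul, map_mul]
  have hsh : Sh F (fun i => ι (X i)) (aeval (fun i => ι (X i)) p) (aeval (fun i => ι (X i)) g) ((ι q)⁻¹) ((ι e)⁻¹) (ι q * ι e / ι p) := by
    rw [hae, hae]
    refine ⟨?_, ?_, ?_, hp', ?_, ?_, ?_, ?_, ?_, ?_, ?_, ?_, ?_⟩
    · intro c
      rw [hB]
      exact ⟨C c, by simp, by rw [hsc]; simp⟩
    · intro i
      rw [hB]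
      refine ⟨ζ ^ 2 * X i, deg_mul_le (deg_pow_le hζd 2 le_rfl) (totalDegree_X i).le (by omega), by rw [map_mul, map_pow]⟩
    · rw [hB]
      refine ⟨ζ ^ 2 * p, deg_mul_le (deg_pow_le hζd 2 le_rfl) hpδ (by omega), by rw [map_mul, map_pow]⟩
    · rw [← hqi, inv_mul_cancel₀ hq']
    · rw [← hei, inv_mul_cancel₀ he']
    · field_simp
    · rw [hB]
      refine ⟨p ^ 2 * (e * (q * e)), deg_mul_le (deg_pow_le hpδ 2 le_rfl) (deg_mul_le hed hqed le_rfl) (by omega), ?_⟩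
      rw [hζi]; simp only [map_mul, map_pow]; field_simp; ring
    · intro i
      rw [hB]
      refine ⟨p ^ 2 * (e * (q * e)) * X i, deg_mul_le (deg_mul_le (deg_pow_le hpδ 2 le_rfl) (deg_mul_le hed hqed le_rfl) le_rfl) (totalDegree_X i).le (by omega), ?_⟩
      rw [hζi]; simp only [map_mul, map_pow]; field_simp; ring
    · rw [hB]
      refine ⟨p ^ 2 * (q * (q * e)), deg_mul_le (deg_pow_le hpδ 2 le_rfl) (deg_mul_le hqd hqed le_rfl) (by omega), ?_⟩
      rw [hζi]; simp only [map_mul, map_pow]; field_simp; ring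
    · rw [hB]
      refine ⟨p ^ 2 * (q * (q * e)) * p, deg_mul_le (deg_mul_le (deg_pow_le hpδ 2 le_rfl) (deg_mul_le hqd hqed le_rfl) le_rfl) hpδ (by omega), ?_⟩
      rw [hζi]; simp only [map_mul, map_pow]; field_simp; ring
    · rw [hB]
      refine ⟨p * (q * e) ^ 3, deg_mul_le hpδ (deg_pow_le hqed 3 le_rfl) (by omega), ?_⟩
      rw [hζi]; simp only [map_mul, map_pow]; field_simp; ring
    · rw [hCC]
      have hd : (g * (-(ζ ^ 2))).totalDegree ≤ 1 * E :=
        deg_mul_le (r := g.totalDegree) (s := 4 + 6 * δ) le_rfl (by rw [totalDegree_neg]; exact deg_pow_le hζd 2 (by omega)) (by omega)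
      refine ⟨g * (-(ζ ^ 2)), .gen (w := 1 * E) ⟨_, rfl⟩ hd le_rfl, ?_⟩
      rw [map_mul, map_neg, map_pow]; ring
  obtain ⟨J, hJ, hneg⟩ := hsh.shift hd0 (by omega) hg hb0 hb hC
  rw [hae] at hneg
  obtain ⟨S0, hS0⟩ : ∃ S0, S0 = 300 * (2 * R + 2 + d0) * R := ⟨_, rfl⟩
  rw [← hS0, hCC] at hneg
  obtain ⟨f, hf, hfe⟩ := hneg
  have hfp : f = -(ζ ^ (2 * S0) * p ^ (2 * J)) := by
    apply hinj
    rw [hfe, map_neg, map_mul, map_pow, map_pow]; ring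
  have hJS : J + S0 ≤ S := by
    rw [hS, hS0]; nlinarith
  have hES : S0 * E ≤ 12 * d0 * S := by
    have : E ≤ 12 * d0 := by omega
    calc S0 * E ≤ S * (12 * d0) := Nat.mul_le_mul (by omega) this
      _ = _ := by ring
  have hδS : 2 * ((J + S0) * δ) ≤ d0 * S := by
    calc 2 * ((J + S0) * δ) = (2 * δ) * (J + S0) := by ring
      _ ≤ _ := Nat.mul_le_mul hp hJS
  -- remove the factor `(q e)^(2 S0)`
  have hU : ∀ k : ℕ, ∃ c, Cone (GT g) (2 * k * (2 + 2 * δ)) c ∧ (q * e) ^ (2 * k) = 1 + c := by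
    have hone : Cone (GT g) (2 * (2 + 2 * δ)) ((q * e) ^ 2 - 1) := by
      have c1 : Cone (GT g) (2 + 2 * δ) (∑ i : Fin n, X i ^ 2) := by
        have : ∑ i : Fin n, (X i : MvPolynomial (Fin n) ℝ) ^ 2 ∈ (MF (GT g)).C (2 + 2 * δ) :=
          sum_mem fun i _ => Cone.sq (totalDegree_X i).le (by omega)
        exact this
      have c2 : Cone (GT g) (2 * δ) (p ^ 2) := .sq hpδ le_rfl
      have c3 : Cone (GT g) (2 + 2 * δ) (q * p ^ 2) := by
        refine .mul (r := 2) (s := 2 * δ) ?_ c2 le_rfl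
        have : q ∈ (MF (GT g)).C 2 := by
          rw [hq]
          exact add_mem ((MF (GT g)).one_C 2) (sum_mem fun i _ => Cone.sq (totalDegree_X i).le (by omega))
        exact this
      have c4 : Cone (GT g) (2 + 2 * δ) (∑ i : Fin n, X i ^ 2 + q * p ^ 2) := .add c1 c3
      have c5 : Cone (GT g) (2 + 2 * δ) 1 := (MF (GT g)).one_C _
      have c6 := Cone.mul c4 (.add c4 (.add c5 c5)) (t := 2 * (2 + 2 * δ)) (by omega)
      convert c6 using 1
      rw [he]
      linear_combination ((q * (1 + p ^ 2)) + (q * p ^ 2 + ∑ i : Fin n, X i ^ 2 + 1)) * hq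
    intro k
    induction k with
    | zero => exact ⟨0, .zero _, by simp⟩
    | succ k ih =>
      obtain ⟨c, hc, hce⟩ := ih
      refine ⟨c * ((q * e) ^ 2 - 1) + (c + ((q * e) ^ 2 - 1)), .add (.mul hc hone (by nlinarith)) (.add (hc.mono (by nlinarith)) (hone.mono (by nlinarith))), ?_⟩
      rw [mul_add, pow_add, hce]; ring
  obtain ⟨c, hc, hce⟩ := hU S0
  refine ⟨J + S0, hJS, ?_⟩
  have hsq : Cone (GT g) (2 * ((J + S0) * δ)) ((p ^ (J + S0)) ^ 2) := .sq (deg_pow_le hpδ _ le_rfl) le_rfl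
  have h1 := Cone.mul hsq hc (t := 12 * d0 * S) (by
    have : 2 + 2 * δ ≤ 3 * d0 := by omega
    have h2 : 2 * S0 * (2 + 2 * δ) ≤ 2 * S * (3 * d0) := Nat.mul_le_mul (by omega) this
    nlinarith)
  have h2 := Cone.add (hf.mono hES) h1
  convert h2 using 1
  rw [hfp, hζ, mul_pow, hce]; ring

theorem poly_cert {n : ℕ} {p g : MvPolynomial (Fin n) ℝ} (hp0 : p ≠ 0)
    {d0 R : ℕ} (hd0 : 1 ≤ d0) (hp : 2 * p.totalDegree ≤ d0) (hg : g.totalDegree ≤ d0)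
    {b : MvPolynomial (Fin (n + 2)) ℝ} (hb0 : b ≠ 0) (hb : b.totalDegree ≤ R)
    (hC : Cone (Lam n ∪ {fw | ∃ i, fw = (fam p g i, d0)}) (2 * R) (-(b ^ 2))) {S : ℕ} (hS : S = 304 * (2 * R + 2 + d0) * R) :
    ∃ J, J ≤ S ∧ Cone (GT g) (12 * d0 * S) (-(p ^ (2 * J))) :=
  poly_cert_aux (L := FractionRing (MvPolynomial (Fin n) ℝ)) (IsFractionRing.injective _ _) hp0 hd0 hp hg hb0 hb hC hS

end ENS
end

section
open MvPolynomial
open scoped Polynomial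
namespace ENS

/-! Numerical estimates. -/

theorem dNext_le_aux (d : ℕ) : dNext d + 1 ≤ 145 * (d + 1) ^ 6 := by
  unfold dNext
  have e : 145 * (d + 1) ^ 6 = ((2 * d + 2) * ((4 * d + 3) * ((4 * d ^ 2 + 2 * d + 2) * (4 * d ^ 2 + 2 * d))) +
    (4 * d ^ 2 + 2 * d + 1) * (4 * d ^ 2 + 2 * d)) + 1 + (17 * d ^ 6 + 518 * d ^ 5 + 1743 * d ^ 4 + 2588 * d ^ 3
      + 2039 * d ^ 2 + 844 * d + 144) := by
    ring
  omega

theorem dNext_le_pow {d : ℕ} (hd : 8 ≤ d) : dNext d ≤ d ^ 16 := by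
  have h1 := dNext_le_aux d
  have h2 : 145 * (d + 1) ^ 6 ≤ 145 * (2 * d) ^ 6 := by gcongr; omega
  have h3 : 145 * (2 * d) ^ 6 = 9280 * d ^ 6 := by ring
  have h4 : 9280 * d ^ 6 ≤ 8 ^ 10 * d ^ 6 := by gcongr; norm_num
  have h5 : 8 ^ 10 * d ^ 6 ≤ d ^ 10 * d ^ 6 := by gcongr
  have h6 : d ^ 10 * d ^ 6 = d ^ 16 := by ring
  omega

theorem tt_ge (d N : ℕ) : d + 8 ≤ tt d N := by
  unfold tt
  have h1 : 1 ≤ (2 * N) ^ (2 * d + 2) + 1 := by omega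
  have : 8 * (d + 1) ^ 2 * 1 ≤ 8 * (d + 1) ^ 2 * ((2 * N) ^ (2 * d + 2) + 1) := by gcongr
  nlinarith

theorem tt_le {d N a : ℕ} (hd : 8 ≤ d) (hN : 3 ≤ N) (ha : 2 ≤ a) (hNa : N ≤ 2 ^ a) :
    tt d N + 1 ≤ 2 ^ (a * d ^ 2) := by
  unfold tt
  have h1 : 8 ≤ (2 * N) ^ (2 * d + 2) := by
    calc 8 ≤ 6 ^ 2 := by norm_num
      _ ≤ (2 * N) ^ 2 := by gcongr; omega
      _ ≤ _ := Nat.pow_le_pow_right (by omega) (by omega)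
  have h2 : (2 * N) ^ (2 * d + 2) ≤ (2 ^ (a + 1)) ^ (2 * d + 2) := by
    apply Nat.pow_le_pow_left; rw [pow_succ]; omega
  have h3 : (d + 1) ^ 2 ≤ (2 ^ d) ^ 2 := by
    apply Nat.pow_le_pow_left; exact Nat.lt_two_pow_self
  have h4 : 1 ≤ (d + 1) ^ 2 := Nat.one_le_pow _ _ (by omega)
  calc 8 * (d + 1) ^ 2 * ((2 * N) ^ (2 * d + 2) + 1) + 1 ≤ 16 * ((d + 1) ^ 2 * (2 * N) ^ (2 * d + 2)) := by nlinarith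
    _ ≤ 16 * ((2 ^ d) ^ 2 * (2 ^ (a + 1)) ^ (2 * d + 2)) := by gcongr
    _ = 2 ^ (4 + d * 2 + (a + 1) * (2 * d + 2)) := by
      rw [← pow_mul, ← pow_mul, pow_add 2 (4 + d * 2), pow_add 2 4]; ring
    _ ≤ _ := by
      apply Nat.pow_le_pow_right (by norm_num)
      nlinarith [Nat.mul_le_mul ha hd, Nat.mul_le_mul (Nat.le_refl (a * d)) hd]

theorem lin_le_two_pow {T : ℕ} (hT : 8 ≤ T) : 20 * T ≤ 2 ^ T := by
  induction T, hT using Nat.le_induction with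
  | base => norm_num
  | succ m hm ih => rw [pow_succ]; omega

theorem kk_le (d N : ℕ) : kk d N ≤ 2 ^ (5 * tt d N ^ 3) := by
  unfold kk
  have hT : 8 ≤ tt d N := by have := tt_ge d N; omega
  generalize tt d N = T at hT
  have h1 : Filt.cst T ≤ 2 ^ (3 * T ^ 2 + 3 * T) := by
    unfold Filt.cst
    calc 2 ^ (2 * T ^ 2) * (20 * T) ^ (T + 3) ≤ 2 ^ (2 * T ^ 2) * (2 ^ T) ^ (T + 3) := by
          gcongr; exact lin_le_two_pow hT
      _ = _ := by rw [← pow_mul, ← pow_add]; ring_nf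
  calc 2 ^ T * (2 * Filt.cst T ^ T) ≤ 2 ^ T * (2 * (2 ^ (3 * T ^ 2 + 3 * T)) ^ T) := by gcongr
    _ = 2 ^ (T + 1 + (3 * T ^ 2 + 3 * T) * T) := by rw [← pow_mul, pow_add, pow_add]; ring
    _ ≤ _ := by
      apply Nat.pow_le_pow_right (by norm_num)
      nlinarith [Nat.mul_le_mul hT hT, Nat.mul_le_mul (Nat.mul_le_mul hT hT) hT, Nat.mul_le_mul (Nat.le_refl (T*T)) hT]

theorem rr_le (d N : ℕ) : rr d N ≤ 2 ^ (5 * tt d N ^ 3) := by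
  unfold rr ww
  have hT := tt_ge d N
  have hd := dNext_le_aux d
  generalize tt d N = T at hT
  have h0 : d + 1 ≤ T := by omega
  have h1 : dNext d + 1 ≤ 145 * T ^ 6 := hd.trans (by gcongr)
  have h2 : T ≤ 2 ^ T := Nat.lt_two_pow_self.le
  calc (4 * d + 4) * ((2 * d + 2) * (T * (3 * T * dNext d + 3 * T)))
      = 24 * (d + 1) ^ 2 * (T ^ 2 * (dNext d + 1)) := by ring
    _ ≤ 24 * T ^ 2 * (T ^ 2 * (145 * T ^ 6)) := by gcongr
    _ = 3480 * T ^ 10 := by ring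
    _ ≤ 2 ^ 12 * (2 ^ T) ^ 10 := by gcongr; norm_num
    _ = 2 ^ (12 + T * 10) := by rw [← pow_mul, ← pow_add]
    _ ≤ _ := by
      apply Nat.pow_le_pow_right (by norm_num)
      have hT8 : 8 ≤ T := by omega
      nlinarith [Nat.mul_le_mul hT8 hT8, Nat.mul_le_mul (Nat.mul_le_mul hT8 hT8) hT8, Nat.mul_le_mul (Nat.le_refl (T*T)) hT8]

def fE : ℕ → ℕ
  | 0 => 0
  | k + 1 => 2 + 16 * fE k

theorem KK_le (k : ℕ) : ∀ {d N a : ℕ}, 8 ≤ d → d ≤ 2 ^ a → 3 ≤ N → N ≤ 2 ^ a →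
    KK k d N ≤ 2 ^ 2 ^ (4 * (a * d ^ fE k) + k) := by
  induction k with
  | zero =>
    intro d N a hd hda hN hNa
    have : KK 0 d N = d := rfl
    rw [this]
    refine hda.trans (Nat.pow_le_pow_right (by norm_num) ?_)
    refine Nat.lt_two_pow_self.le.trans (Nat.pow_le_pow_right (by norm_num) ?_)
    simp only [fE, pow_zero]; omega
  | succ k ih =>
    intro d N a hd hda hN hNa
    have ha : 3 ≤ a := by
      by_contra hlt
      have : 2 ^ a ≤ 2 ^ 2 := Nat.pow_le_pow_right (by norm_num) (by omega)
      omega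
    have e : KK (k + 1) d N = kk d N * max (rr d N) (KK k (dNext d) (tt d N + 1)) := rfl
    have h1 := kk_le d N
    have h2 := rr_le d N
    have h3 := tt_le hd hN (by omega : 2 ≤ a) hNa
    have h4 := tt_ge d N
    have h5 := dNext_le_pow hd
    have h6 := le_dNext d
    obtain ⟨A, hA⟩ : ∃ A, A = a * d ^ 2 := ⟨_, rfl⟩
    rw [← hA] at h3
    have hdA : dNext d ≤ 2 ^ A := by
      refine h5.trans ?_
      calc d ^ 16 ≤ (2 ^ a) ^ 16 := by gcongr
        _ = 2 ^ (a * 16) := by rw [← pow_mul]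
        _ ≤ _ := by
          apply Nat.pow_le_pow_right (by norm_num)
          rw [hA]; gcongr; nlinarith
    have h7 := ih (d := dNext d) (N := tt d N + 1) (a := A) (by omega) hdA (by omega) h3
    have hT3 : 5 * tt d N ^ 3 ≤ 2 ^ (4 * A) := by
      have hA3 : 3 ≤ A := by rw [hA]; nlinarith
      have : 5 ≤ 2 ^ A := by
        calc 5 ≤ 2 ^ 3 := by norm_num
          _ ≤ _ := Nat.pow_le_pow_right (by norm_num) hA3
      calc 5 * tt d N ^ 3 ≤ 2 ^ A * (2 ^ A) ^ 3 := by gcongr; omega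
        _ = _ := by rw [← pow_mul, ← pow_add]; ring_nf
    have hY : A ≤ A * dNext d ^ fE k := Nat.le_mul_of_pos_right _ (Nat.pow_pos (by omega))
    have hY2 : A * dNext d ^ fE k ≤ a * d ^ fE (k + 1) := by
      have : a * d ^ fE (k + 1) = A * (d ^ 16) ^ fE k := by
        rw [hA, fE, pow_add, pow_mul]; ring
      rw [this]; gcongr
    obtain ⟨Y, hYd⟩ : ∃ Y, Y = A * dNext d ^ fE k := ⟨_, rfl⟩
    rw [← hYd] at hY hY2 h7
    have hp : 2 ^ (4 * A) ≤ 2 ^ (4 * Y + k) := Nat.pow_le_pow_right (by norm_num) (by omega)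
    have hk : kk d N ≤ 2 ^ 2 ^ (4 * Y + k) :=
      h1.trans (Nat.pow_le_pow_right (by norm_num) (hT3.trans hp))
    have hr : rr d N ≤ 2 ^ 2 ^ (4 * Y + k) :=
      h2.trans (Nat.pow_le_pow_right (by norm_num) (hT3.trans hp))
    rw [e]
    calc _ ≤ 2 ^ 2 ^ (4 * Y + k) * 2 ^ 2 ^ (4 * Y + k) := Nat.mul_le_mul hk (max_le hr h7)
      _ = 2 ^ 2 ^ (4 * Y + k + 1) := by rw [← pow_add, pow_succ 2 (4 * Y + k), mul_two]
      _ ≤ _ := by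
        apply Nat.pow_le_pow_right (by norm_num)
        apply Nat.pow_le_pow_right (by norm_num)
        omega

theorem fE_le {n : ℕ} (hn : 1 ≤ n) : 6 + 3 * fE n ≤ 16 ^ n := by
  induction n, hn using Nat.le_induction with
  | base => simp [fE]
  | succ m hm ih => rw [fE, pow_succ]; have : 2 ≤ fE m := by
                      obtain ⟨k, rfl⟩ : ∃ k, m = k + 1 := ⟨m - 1, by omega⟩
                      rw [fE]; omega
                    omega

theorem num_pos {n D : ℕ} (hn : 1 ≤ n) (hD : 2 ≤ D) :
    ∃ R, KK n (D ^ 3) 3 ≤ R ∧ 1 ≤ R ∧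
      16 * D ^ 3 * (304 * (2 * R + 2 + D ^ 3) * R) ≤ 2 ^ 2 ^ D ^ 16 ^ n := by
  have hD3 : 8 ≤ D ^ 3 := by
    calc 8 = 2 ^ 3 := by norm_num
      _ ≤ _ := by gcongr
  have hself : D ^ 3 ≤ 2 ^ D ^ 3 := Nat.lt_two_pow_self.le
  have h1 := KK_le n hD3 hself (le_refl 3) (by omega)
  obtain ⟨e, he⟩ : ∃ e, e = 4 * (D ^ 3 * (D ^ 3) ^ fE n) + n := ⟨_, rfl⟩
  rw [← he] at h1
  have hf : 1 ≤ (D ^ 3) ^ fE n := Nat.one_le_pow _ _ (by omega)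
  have he1 : 4 * D ^ 3 ≤ e := by rw [he]; nlinarith
  obtain ⟨R, hR⟩ : ∃ R, R = 2 ^ 2 ^ e := ⟨_, rfl⟩
  have hRd : D ^ 3 ≤ R := by
    rw [hR]; refine hself.trans (Nat.pow_le_pow_right (by norm_num) ?_)
    refine Nat.lt_two_pow_self.le.trans (Nat.pow_le_pow_right (by norm_num) (by omega))
  have hR16 : 2 ^ 16 ≤ R := by
    rw [hR]; refine Nat.pow_le_pow_right (by norm_num) ?_
    calc 16 = 2 ^ 4 := by norm_num
      _ ≤ _ := Nat.pow_le_pow_right (by norm_num) (by omega)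
  refine ⟨R, hR ▸ h1, by omega, ?_⟩
  have hcalc : 16 * D ^ 3 * (304 * (2 * R + 2 + D ^ 3) * R) ≤ R ^ 4 := by
    calc _ ≤ 16 * R * (304 * (2 * R + R + R) * R) := by gcongr; omega
      _ = 19456 * R ^ 3 := by ring
      _ ≤ R * R ^ 3 := by gcongr; omega
      _ = _ := by ring
  refine hcalc.trans ?_
  rw [hR, ← pow_mul]
  apply Nat.pow_le_pow_right (by norm_num)
  have : 2 ^ e * 4 = 2 ^ (e + 2) := by rw [pow_add]; norm_num
  rw [this]
  apply Nat.pow_le_pow_right (by norm_num)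
  have e1 : D ^ 3 * (D ^ 3) ^ fE n = D ^ (3 + 3 * fE n) := by rw [← pow_mul, ← pow_add]
  have hnf : n ≤ fE n := by
    clear * -
    induction n with
    | zero => simp
    | succ k ih => rw [fE]; omega
  have h2 : 4 * D ^ (3 + 3 * fE n) ≤ D ^ (5 + 3 * fE n) := by
    have : D ^ (5 + 3 * fE n) = D ^ 2 * D ^ (3 + 3 * fE n) := by rw [← pow_add]; congr 1; omega
    rw [this]; gcongr; nlinarith
  have h3 : n + 2 ≤ D ^ (5 + 3 * fE n) := by
    calc n + 2 ≤ 5 + 3 * fE n := by omega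
      _ ≤ 2 ^ (5 + 3 * fE n) := Nat.lt_two_pow_self.le
      _ ≤ _ := by gcongr
  have h4 : 2 * D ^ (5 + 3 * fE n) ≤ D ^ (6 + 3 * fE n) := by
    have : D ^ (6 + 3 * fE n) = D * D ^ (5 + 3 * fE n) := by rw [← pow_succ']; congr 1; omega
    rw [this]; gcongr
  have h5 : D ^ (6 + 3 * fE n) ≤ D ^ 16 ^ n := Nat.pow_le_pow_right (by omega) (fE_le hn)
  rw [he, e1]; omega

theorem num_zero {D : ℕ} (hD : 2 ≤ D) :
      16 * D ^ 3 * (304 * (2 * D ^ 3 + 2 + D ^ 3) * D ^ 3) ≤ 2 ^ 2 ^ (2 ^ D + D) := by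
  have h1 : 2 ≤ D ^ 3 := by
    calc 2 ≤ 2 ^ 3 := by norm_num
      _ ≤ _ := by gcongr
  calc 16 * D ^ 3 * (304 * (2 * D ^ 3 + 2 + D ^ 3) * D ^ 3)
      ≤ 16 * D ^ 3 * (304 * (2 * D ^ 3 + D ^ 3 + D ^ 3) * D ^ 3) := by gcongr
    _ = 19456 * D ^ 9 := by ring
    _ ≤ 2 ^ 15 * (2 ^ D) ^ 9 := by gcongr; norm_num; exact Nat.lt_two_pow_self.le
    _ = 2 ^ (15 + D * 9) := by rw [← pow_mul, ← pow_add]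
    _ ≤ _ := by
      apply Nat.pow_le_pow_right (by norm_num)
      have h2 : ∀ m, 2 ≤ m → m + 2 ≤ 2 ^ m := by
        intro m hm
        induction m, hm using Nat.le_induction with
        | base => norm_num
        | succ k hk ih => rw [pow_succ]; omega
      have h3 := h2 D hD
      calc 15 + D * 9 ≤ 16 * (D + 2) := by omega
        _ ≤ 16 * 2 ^ D := by gcongr
        _ = 2 ^ (D + 4) := by rw [pow_add]; ring
        _ ≤ _ := Nat.pow_le_pow_right (by norm_num) (by omega)

end ENS
end

section
open MvPolynomial
open scoped Polynomial
namespace ENS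

theorem isSOS_of_fintype {σ ι : Type} [Fintype ι] {w : ℕ} (f : ι → MvPolynomial σ ℝ)
    (hf : ∀ i, (f i).totalDegree ≤ w) : IsSOS w (∑ i, f i ^ 2) := by
  refine ⟨Fintype.card ι, fun i => f ((Fintype.equivFin ι).symm i), fun i => hf _, ?_⟩
  exact ((Fintype.equivFin ι).symm.sum_comp (fun i => f i ^ 2)).symm

theorem isSOS_mono {σ : Type} {w w' : ℕ} {p : MvPolynomial σ ℝ} (hp : IsSOS w p) (h : w ≤ w') : IsSOS w' p := by
  obtain ⟨k, f, hf, e⟩ := hp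
  exact ⟨k, f, fun i => (hf i).trans h, e⟩

theorem isSOS_add {σ : Type} {w : ℕ} {p q : MvPolynomial σ ℝ} (hp : IsSOS w p) (hq : IsSOS w q) :
    IsSOS w (p + q) := by
  obtain ⟨k, f, hf, rfl⟩ := hp
  obtain ⟨k', f', hf', rfl⟩ := hq
  have := isSOS_of_fintype (w := w) (Sum.elim f f') (by rintro (i | i); exacts [hf i, hf' i])
  simpa using this

theorem isSOS_mul {σ : Type} {w w' v : ℕ} {p q : MvPolynomial σ ℝ} (hp : IsSOS w p) (hq : IsSOS w' q)
    (hv : w + w' ≤ v) : IsSOS v (p * q) := by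
  obtain ⟨k, f, hf, rfl⟩ := hp
  obtain ⟨k', f', hf', rfl⟩ := hq
  have := isSOS_of_fintype (w := v) (fun i : Fin k × Fin k' => f i.1 * f' i.2)
    (fun i => deg_mul_le (hf _) (hf' _) hv)
  rw [Fintype.sum_prod_type] at this
  rw [Finset.sum_mul_sum]
  simpa [mul_pow] using this

theorem isSOS_sq {σ : Type} {w : ℕ} {p : MvPolynomial σ ℝ} (hp : p.totalDegree ≤ w) : IsSOS w (p ^ 2) :=
  ⟨1, fun _ => p, fun _ => hp, by simp⟩

theorem isSOS_zero {σ : Type} (w : ℕ) : IsSOS w (0 : MvPolynomial σ ℝ) :=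
  ⟨0, Fin.elim0, fun i => i.elim0, by simp⟩

theorem isSOS_deg {σ : Type} {w : ℕ} {p : MvPolynomial σ ℝ} (hp : IsSOS w p) : p.totalDegree ≤ 2 * w := by
  obtain ⟨k, f, hf, rfl⟩ := hp
  refine (totalDegree_finsetSum _ _).trans (Finset.sup_le fun i _ => ?_)
  exact deg_pow_le (hf i) 2 le_rfl

theorem isSOS_eval {σ : Type} {w : ℕ} {p : MvPolynomial σ ℝ} (hp : IsSOS w p) (x : σ → ℝ) : 0 ≤ eval x p := by
  obtain ⟨k, f, hf, rfl⟩ := hp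
  rw [map_sum]
  refine Finset.sum_nonneg fun i _ => ?_
  rw [map_pow]; positivity

theorem cone_GT {n : ℕ} {g : MvPolynomial (Fin n) ℝ} {W : ℕ} {f : MvPolynomial (Fin n) ℝ} (hC : Cone (GT g) W f) :
    ∃ σ φ, IsSOS (W / 2) σ ∧ (g * φ).totalDegree ≤ W ∧ f = σ + g * φ := by
  induction hC with
  | zero s => exact ⟨0, 0, isSOS_zero _, by simp, by simp⟩
  | sq hp hs => exact ⟨_, 0, isSOS_sq (hp.trans (by omega)), by simp, by simp⟩
  | gen hf hd hws =>
    obtain ⟨φ, hφ⟩ := hf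
    simp only at hφ
    exact ⟨0, φ, isSOS_zero _, by rw [← hφ]; omega, by rw [zero_add, hφ]⟩
  | add _ _ h1 h2 =>
    obtain ⟨σ, φ, hσ, hφ, rfl⟩ := h1
    obtain ⟨σ', φ', hσ', hφ', rfl⟩ := h2
    refine ⟨σ + σ', φ + φ', isSOS_add hσ hσ', ?_, by ring⟩
    rw [mul_add]; exact deg_add_le hφ hφ'
  | @mul r s t f f' _ _ hrs h1 h2 =>
    obtain ⟨σ, φ, hσ, hφ, rfl⟩ := h1
    obtain ⟨σ', φ', hσ', hφ', rfl⟩ := h2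
    refine ⟨σ * σ', φ * σ' + σ * φ' + φ * (g * φ'), isSOS_mul hσ hσ' (by omega), ?_, by ring⟩
    have e : g * (φ * σ' + σ * φ' + φ * (g * φ')) = g * φ * σ' + σ * (g * φ') + g * φ * (g * φ') := by ring
    have h1 := isSOS_deg hσ
    have h2 := isSOS_deg hσ'
    rw [e]
    refine deg_add_le (deg_add_le ?_ ?_) ?_
    · exact deg_mul_le hφ h2 (by omega)
    · exact deg_mul_le h1 hφ' (by omega)
    · exact deg_mul_le hφ hφ' (by omega)

theorem cone_const {σ : Type} {G : Set (MvPolynomial σ ℝ × ℕ)} {c : ℝ} (hc : 0 ≤ c) (s : ℕ) : Cone G s (C c) := by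
  have : (C c : MvPolynomial σ ℝ) = C (Real.sqrt c) ^ 2 := by
    rw [← C_pow, Real.sq_sqrt hc]
  rw [this]
  exact Cone.sq (r := 0) (by simp) (by omega)

/-- The ladder: `t + ε + c t^(2^m)` is a sum of squares. -/
theorem ladder {σ : Type} {G : Set (MvPolynomial σ ℝ × ℕ)} (p : MvPolynomial σ ℝ) (m : ℕ) :
    ∀ {ε : ℝ}, 0 < ε → ∃ c : ℝ, 0 ≤ c ∧
      Cone G (2 ^ (m + 1) * p.totalDegree) (p + C ε + C c * p ^ (2 ^ (m + 1))) := by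
  induction m with
  | zero =>
    intro ε hε
    refine ⟨1 / (4 * ε), by positivity, ?_⟩
    have e : p + C ε + C (1 / (4 * ε)) * p ^ (2 ^ (0 + 1)) = C ε * (1 + C (1 / (2 * ε)) * p) ^ 2 := by
      have e1 : (C ε : MvPolynomial σ ℝ) * C (1 / (2 * ε)) = C (1 / 2) := by
        rw [← C_mul]; congr 1; field_simp
      have e2 : (C (1 / (4 * ε)) : MvPolynomial σ ℝ) = C ε * C (1 / (2 * ε)) ^ 2 := by
        rw [← C_pow, ← C_mul]; congr 1; field_simp; norm_num
      have e3 : (C (1 / 2) : MvPolynomial σ ℝ) * 2 = 1 := by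
        rw [show (2 : MvPolynomial σ ℝ) = C 2 from (map_ofNat C 2).symm, ← C_mul]; norm_num
      rw [e2]
      linear_combination (-2 * p) * e1 - p * e3
    rw [e]
    refine Cone.mul (cone_const hε.le 0) (Cone.sq (r := p.totalDegree) ?_ le_rfl) (by omega)
    exact deg_add_le (by simp) (deg_mul_le (r := 0) (totalDegree_C _).le le_rfl (by omega))
  | succ m ih =>
    intro ε hε
    obtain ⟨c, hc, h⟩ := ih (half_pos hε)
    refine ⟨c ^ 2 / (2 * ε), by positivity, ?_⟩
    have e : p + C ε + C (c ^ 2 / (2 * ε)) * p ^ (2 ^ (m + 1 + 1)) =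
        (p + C (ε / 2) + C c * p ^ (2 ^ (m + 1))) + C (ε / 2) * (1 - C (c / ε) * p ^ (2 ^ (m + 1))) ^ 2 := by
      have e1 : (C (ε / 2) : MvPolynomial σ ℝ) * C (c / ε) = C (c / 2) := by
        rw [← C_mul]; congr 1; field_simp
      have e2 : (C (c ^ 2 / (2 * ε)) : MvPolynomial σ ℝ) = C (ε / 2) * C (c / ε) ^ 2 := by
        rw [← C_pow, ← C_mul]; congr 1; field_simp
      have e3 : (C (c / 2) : MvPolynomial σ ℝ) * 2 = C c := by
        rw [show (2 : MvPolynomial σ ℝ) = C 2 from (map_ofNat C 2).symm, ← C_mul]; congr 1; ring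
      have e4 : (C (ε / 2) : MvPolynomial σ ℝ) + C (ε / 2) = C ε := by
        rw [← C_add]; congr 1; ring
      have e5 : p ^ (2 ^ (m + 1 + 1)) = (p ^ (2 ^ (m + 1))) ^ 2 := by
        rw [← pow_mul]; congr 1
      rw [e2, e5]
      linear_combination (2 * p ^ (2 ^ (m + 1))) * e1 + p ^ (2 ^ (m + 1)) * e3 - e4
    rw [e]
    have hpw : 2 ^ (m + 1 + 1) * p.totalDegree = 2 * (2 ^ (m + 1) * p.totalDegree) := by rw [pow_succ]; ring
    refine Cone.add (h.mono (by omega)) (Cone.mul (cone_const (by positivity) 0)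
      (Cone.sq (r := 2 ^ (m + 1) * p.totalDegree) ?_ hpw.ge) (by omega))
    rw [sub_eq_add_neg]
    refine deg_add_le (by simp) ?_
    rw [totalDegree_neg]
    exact deg_mul_le (r := 0) (totalDegree_C _).le (deg_pow_le le_rfl _ le_rfl) (by omega)

theorem exists_pow_between {S : ℕ} (hS : 1 ≤ S) : ∃ m, S ≤ 2 ^ m ∧ 2 ^ m ≤ 2 * S := by
  refine ⟨Nat.log 2 S + 1, (Nat.lt_pow_succ_log_self (by norm_num) S).le, ?_⟩
  rw [pow_succ]
  have := Nat.pow_log_le_self 2 (x := S) (by omega)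
  omega

/-- Main consequence: `p + ε` lies in the truncated cone. -/
theorem p_add_eps {n : ℕ} {p g : MvPolynomial (Fin n) ℝ} (hg0 : ∀ x, 0 ≤ eval x g)
    (hgp : ∀ x, eval x g = 0 → eval x p = 0) {d0 R S : ℕ} (hd0 : 2 ≤ d0)
    (hpd : 1 + 2 * p.totalDegree ≤ d0) (hgd : g.totalDegree ≤ d0)
    (hR : KK n d0 3 ≤ R) (hR1 : 1 ≤ R) (hS : S = 304 * (2 * R + 2 + d0) * R) {ε : ℝ} (hε : 0 < ε) :
    Cone (GT g) (16 * d0 * S) (p + C ε) := by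
  by_cases hp0 : p = 0
  · rw [hp0, zero_add]; exact cone_const hε.le _
  obtain ⟨b, hb0, hb, hC⟩ := certificate p g hg0 hgp hd0 hpd hgd
  obtain ⟨J, hJ, hK⟩ := poly_cert hp0 (by omega) (by omega) hgd hb0 (hb.trans hR) (hC.mono (by omega)) hS
  have hS1 : 1 ≤ S := by rw [hS]; nlinarith
  obtain ⟨m, hm1, hm2⟩ := exists_pow_between hS1
  obtain ⟨c, hc, hl⟩ := ladder (G := GT g) p m hε
  have hpm : 2 ^ (m + 1) = 2 * J + 2 * (2 ^ m - J) := by rw [pow_succ]; omega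
  have e : p + C ε = (p + C ε + C c * p ^ (2 ^ (m + 1))) + C c * ((p ^ (2 ^ m - J)) ^ 2 * (-(p ^ (2 * J)))) := by
    rw [hpm, pow_add, ← pow_mul, mul_comm (2 ^ m - J) 2]; ring
  rw [e]
  have hm3 : 2 ^ m * p.totalDegree ≤ 2 * S * d0 := Nat.mul_le_mul hm2 (by omega)
  have hm4 : 2 ^ (m + 1) * p.totalDegree ≤ 2 * S * d0 := by
    have : 2 ^ (m + 1) * p.totalDegree = 2 ^ m * (2 * p.totalDegree) := by rw [pow_succ]; ring
    rw [this]; exact Nat.mul_le_mul hm2 (by omega)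
  have hx : 16 * d0 * S = 12 * d0 * S + 2 * (2 * S * d0) := by ring
  refine Cone.add (hl.mono (by omega)) (Cone.mul (cone_const hc 0) (Cone.mul (r := 2 * (2 * S * d0)) (Cone.sq (r := 2 * S * d0) ?_ le_rfl) hK le_rfl) (by omega))
  exact deg_pow_le le_rfl _ (by
    refine le_trans (Nat.mul_le_mul_right _ (Nat.sub_le _ _)) hm3)

theorem bitNum_pos (d : ℕ) : 1 ≤ bitNum d := by
  unfold bitNum; split <;> omega

theorem numerics (n w s : ℕ) (hs : 1 ≤ s) : ∃ R, KK n ((max 2 (2 * w)) ^ 3) 3 ≤ R ∧ 1 ≤ R ∧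
    16 * (max 2 (2 * w)) ^ 3 * (304 * (2 * R + 2 + (max 2 (2 * w)) ^ 3) * R) ≤ bFun n (2 * w) s := by
  unfold bFun
  have hb := bitNum_pos (2 * w)
  have hD : 2 ≤ max 2 (2 * w) := le_max_left _ _
  generalize max 2 (2 * w) = D at *
  have hs' : 1 ≤ s ^ 2 ^ n := Nat.one_le_pow _ _ hs
  have h1 : D ^ 16 ^ n ≤ s ^ 2 ^ n * D ^ (16 ^ n * bitNum (2 * w)) := by
    refine le_trans ?_ (Nat.le_mul_of_pos_left _ hs')
    exact Nat.pow_le_pow_right (by omega) (Nat.le_mul_of_pos_right _ hb)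
  rcases Nat.eq_zero_or_pos n with hn | hn
  · subst hn
    refine ⟨D ^ 3, le_rfl, Nat.one_le_pow _ _ (by omega), (num_zero hD).trans ?_⟩
    apply Nat.pow_le_pow_right (by norm_num)
    apply Nat.pow_le_pow_right (by norm_num)
    simp only [pow_zero, pow_one] at h1 ⊢
    omega
  · obtain ⟨R, hR, hR1, h⟩ := num_pos hn hD
    refine ⟨R, hR, hR1, h.trans ?_⟩
    apply Nat.pow_le_pow_right (by norm_num)
    apply Nat.pow_le_pow_right (by norm_num)
    exact h1.trans (Nat.le_add_left _ _)

/-- Feasibility of `p + ε` for the truncated quadratic module. -/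
theorem feasible {n l : ℕ} {d w : ℕ} (hw : d ≤ 2 * w) (h : Fin l → MvPolynomial (Fin n) ℝ)
    (hdeg : ∀ j, (h j).totalDegree ≤ d) (p : MvPolynomial (Fin n) ℝ) (hp : p.totalDegree ≤ 2 * w)
    (hv : ∀ x, (∀ j, eval x (h j) = 0) → eval x p = 0) {r : ℕ}
    (hr : r = bFun n (2 * w) (l + 1) / 2 + d) {ε : ℝ} (hε : 0 < ε) :
    ∃ (σ : MvPolynomial (Fin n) ℝ) (ψ : Fin l → MvPolynomial (Fin n) ℝ),
        IsSOS r σ ∧ (∀ j, (h j * ψ j).totalDegree ≤ 2 * r) ∧ p + C ε = σ + ∑ j, h j * ψ j := by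
  obtain ⟨g, hg⟩ : ∃ g, g = ∑ j, h j ^ 2 := ⟨_, rfl⟩
  have hgS : IsSOS d g := ⟨l, h, hdeg, hg⟩
  have hgev : ∀ x, eval x g = ∑ j, (eval x (h j)) ^ 2 := fun x => by rw [hg]; simp
  have hgp : ∀ x, eval x g = 0 → eval x p = 0 := by
    intro x hx
    rw [hgev, Finset.sum_eq_zero_iff_of_nonneg (fun i _ => sq_nonneg _)] at hx
    exact hv x fun j => by simpa using hx j (Finset.mem_univ j)
  obtain ⟨R, hR, hR1, hB⟩ := numerics n w (l + 1) (by omega)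
  have hD3 : 4 * max 2 (2 * w) ≤ (max 2 (2 * w)) ^ 3 := by
    have hD : 2 ≤ max 2 (2 * w) := le_max_left _ _
    have : (max 2 (2 * w)) ^ 3 = (max 2 (2 * w)) ^ 2 * max 2 (2 * w) := by ring
    rw [this]; exact Nat.mul_le_mul_right _ (by nlinarith)
  have hm1 : 2 ≤ max 2 (2 * w) := le_max_left _ _
  have hm2 : 2 * w ≤ max 2 (2 * w) := le_max_right _ _
  have hgd := isSOS_deg hgS
  have hC := p_add_eps (isSOS_eval hgS) hgp (d0 := (max 2 (2 * w)) ^ 3) (by omega) (by omega) (by omega) hR hR1 rfl hε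
  have hbe : 2 ∣ bFun n (2 * w) (l + 1) := by
    unfold bFun; exact dvd_pow_self 2 (by positivity)
  obtain ⟨σ, φ, hσ, hφ, e⟩ := cone_GT (hC.mono hB)
  have hr2 : 2 * r = bFun n (2 * w) (l + 1) + 2 * d := by omega
  obtain ⟨φ', hφ', e'⟩ : ∃ φ', φ'.totalDegree ≤ bFun n (2 * w) (l + 1) ∧ p + C ε = σ + g * φ' := by
    by_cases hz : g = 0
    · exact ⟨0, by simp, by rw [e, hz]; simp⟩
    by_cases hz' : φ = 0
    · exact ⟨0, by simp, by rw [e, hz']⟩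
    refine ⟨φ, ?_, e⟩
    rw [totalDegree_mul_of_isDomain hz hz'] at hφ
    omega
  refine ⟨σ, fun j => h j * φ', isSOS_mono hσ (by omega), fun j => ?_, ?_⟩
  · exact deg_mul_le (hdeg j) (deg_mul_le (hdeg j) hφ' le_rfl) (by omega)
  · rw [e', hg, Finset.sum_mul]
    congr 1
    exact Finset.sum_congr rfl fun j _ => by ring

theorem le_half_bFun (n w l : ℕ) : w ≤ bFun n (2 * w) (l + 1) / 2 := by
  obtain ⟨R, -, hR1, h⟩ := numerics n w (l + 1) (by omega)
  have hm2 : 2 * w ≤ max 2 (2 * w) := le_max_right _ _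
  generalize max 2 (2 * w) = D at *
  have h1 : D ≤ D ^ 3 := Nat.le_self_pow (by norm_num) D
  have h2 : 1 ≤ 304 * (2 * R + 2 + D ^ 3) * R := by nlinarith [Nat.zero_le (D ^ 3)]
  have h3 : D ^ 3 ≤ 16 * D ^ 3 * (304 * (2 * R + 2 + D ^ 3) * R) := by nlinarith
  omega

end ENS
end

/-- **Lemma 2.23(3) (exactness of the SOS relaxation under an SOS certificate
at the optimum).** Let `h₀, h₁,…,h_l` have degree at most `d`, let
`h* = inf {h₀(x) : x ∈ V(h)} > -∞` (in `ℝ ∪ {±∞}`, with `inf ∅ = +∞`).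
If there is `q ∈ Σ²_w[x]` with `2w ≥ d` such that `h₀ - h* - q` vanishes on
`V(h)`, then with `r = b(n,2w,l+1)/2 + d` the SOS relaxation of order `r` is
exact: `ρ_r(h̄) = sup {ξ : h₀ - ξ ∈ Σ²_r[x] + I_r(h)[x]} = h*`. -/
theorem stmt_15 {n l : ℕ} (d : ℕ)
    (h₀ : MvPolynomial (Fin n) ℝ) (h : Fin l → MvPolynomial (Fin n) ℝ)
    (hdeg₀ : h₀.totalDegree ≤ d) (hdeg : ∀ j, (h j).totalDegree ≤ d)
    (V : Set (Fin n → ℝ)) (hV : V = {x | ∀ j, eval x (h j) = 0})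
    (hstar : EReal) (hstar_def : hstar = ⨅ x ∈ V, ((eval x h₀ : ℝ) : EReal))
    (hbdd : ⊥ < hstar)
    (w : ℕ) (hw : d ≤ 2 * w)
    (q : MvPolynomial (Fin n) ℝ) (hq : IsSOS w q)
    (hcert : ∀ x ∈ V, ((eval x h₀ - eval x q : ℝ) : EReal) = hstar)
    (r : ℕ) (hr : r = bFun n (2 * w) (l + 1) / 2 + d) :
    sSup {ξ : EReal | ∃ ξ' : ℝ, ξ = (ξ' : EReal) ∧
      ∃ (σ : MvPolynomial (Fin n) ℝ) (ψ : Fin l → MvPolynomial (Fin n) ℝ),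
        IsSOS r σ ∧ (∀ j, (h j * ψ j).totalDegree ≤ 2 * r) ∧
        h₀ - C ξ' = σ + ∑ j, h j * ψ j} = hstar := by
  have hfeas : ∀ z : ℝ, (z : EReal) < hstar → ∃ (σ : MvPolynomial (Fin n) ℝ)
      (ψ : Fin l → MvPolynomial (Fin n) ℝ), IsSOS r σ ∧ (∀ j, (h j * ψ j).totalDegree ≤ 2 * r) ∧
        h₀ - C z = σ + ∑ j, h j * ψ j := by
    intro z hz
    have hsub : ∀ (c : ℝ) (f : MvPolynomial (Fin n) ℝ), f.totalDegree ≤ 2 * w →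
        (f - C c).totalDegree ≤ 2 * w := fun c f hf =>
      (totalDegree_sub _ _).trans (max_le hf (by rw [totalDegree_C]; omega))
    rcases V.eq_empty_or_nonempty with hE | ⟨x₀, hx₀⟩
    · obtain ⟨σ, ψ, hσ, hψ, e⟩ := ENS.feasible hw h hdeg (h₀ - C (z + 1))
        (hsub _ _ (hdeg₀.trans hw)) (fun x hx => by
          have : x ∈ V := by rw [hV]; exact hx
          rw [hE] at this; exact this.elim) hr one_pos
      refine ⟨σ, ψ, hσ, hψ, ?_⟩
      rw [← e, C_add]; ring
    · obtain ⟨c, hc⟩ : ∃ c, c = eval x₀ h₀ - eval x₀ q := ⟨_, rfl⟩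
      have hcs : hstar = (c : EReal) := by rw [hc]; exact (hcert x₀ hx₀).symm
      have hzc : z < c := by rw [hcs] at hz; exact_mod_cast hz
      obtain ⟨σ, ψ, hσ, hψ, e⟩ := ENS.feasible hw h hdeg (h₀ - q - C c)
        (hsub _ _ ((totalDegree_sub _ _).trans (max_le (hdeg₀.trans hw) (ENS.isSOS_deg hq))))
        (fun x hx => by
          have hxV : x ∈ V := by rw [hV]; exact hx
          have := hcert x hxV
          rw [hcs] at this
          have h2 : eval x h₀ - eval x q = c := by exact_mod_cast this
          rw [map_sub, map_sub, eval_C, h2, sub_self]) hr (sub_pos.2 hzc)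
      refine ⟨σ + q, ψ, ENS.isSOS_add hσ (ENS.isSOS_mono hq ?_), hψ, ?_⟩
      · rw [hr]; exact (ENS.le_half_bFun n w l).trans (Nat.le_add_right _ _)
      · have e2 : h₀ - C z = (h₀ - q - C c + C (c - z)) + q := by rw [C_sub]; ring
        rw [e2, e]; ring
  apply le_antisymm
  · refine sSup_le ?_
    rintro ξ ⟨ξ', rfl, σ, ψ, hσ, -, e⟩
    rw [hstar_def]
    refine le_iInf₂ fun x hx => ?_
    rw [hV] at hx
    have h1 := congrArg (eval x) e
    rw [map_sub, eval_C, map_add, map_sum] at h1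
    have h2 : ∑ j, eval x (h j * ψ j) = 0 := Finset.sum_eq_zero fun j _ => by
      rw [map_mul, hx j, zero_mul]
    have h3 := ENS.isSOS_eval hσ x
    have h4 : ξ' ≤ eval x h₀ := by linarith
    exact_mod_cast h4
  · refine le_of_forall_lt fun y hy => ?_
    obtain ⟨z, hyz, hz⟩ := EReal.lt_iff_exists_real_btwn.1 hy
    exact hyz.trans_le (le_sSup ⟨z, rfl, hfeas z hz⟩)
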